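/- Let 0 < α < 1, let T > 0 and l > 0, let p ∈ C¹([0,l]) with p(x) > 0 on [0,l], let q ∈ C([0,l]) with q(x) ≥ 0 on [0,l], let φ ∈ C¹([0,l]) with φ(0) = φ(l) = 0, let h ∈ C¹([0,l]) with h(0) = h(l) = 0 and h not identically zero on [0,l], and let g : [0,T] → ℝ be such that g and g′ are absolutely continuous on [0,T], with the compatibility condition ∫_0^l φ(x) h(x) dx = g(0). Then there exists a unique function f absolutely continuous on [0,T] such that the (unique) solution u of the direct problem ∂_t^α u − (p u_x)_x + q u = f(t) h(x) on (0,T] × (0,l), u(0,x) = φ(x), u(t,0) = u(t,l) = 0 (with u continuous on [0,T] × [0,l] and ∂_t^α u, u_{xx} continuous on (0,T] × (0,l)) satisfies the overdetermination condition ∫_0^l h(x) u(t,x) dx = g(t) for all 0 ≤ t ≤ T. -/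

import Mathlib

open MeasureTheory Set

/-- The Caputo fractional derivative of order `α ∈ (0,1)` of `u` at time `t`:
`∂_t^α u(t) = (1/Γ(1−α)) ∫_0^t u'(s) (t−s)^{−α} ds`. -/
noncomputable def caputoDeriv (α : ℝ) (u : ℝ → ℝ) (t : ℝ) : ℝ :=
  (Real.Gamma (1 - α))⁻¹ * ∫ s in (0:ℝ)..t, deriv u s * (t - s) ^ (-α)

/-- A function `f` is absolutely continuous on `[a,b]` iff there is an integrable `f'`
on `[a,b]` with `f x = f a + ∫_a^x f'(t) dt` for all `x ∈ [a,b]`. -/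
def AbsContOn (f : ℝ → ℝ) (a b : ℝ) : Prop :=
  ∃ f' : ℝ → ℝ, IntegrableOn f' (Icc a b) ∧
    ∀ x ∈ Icc a b, f x = f a + ∫ t in a..x, f' t

/-- `u` is a (regular) solution of the direct problem
`∂_t^α u − (p u_x)_x + q u = F(t,x)` on `(0,T] × (0,l)` with initial datum `φ` and
homogeneous Dirichlet boundary conditions: `u` is continuous on `[0,T] × [0,l]`, the
Caputo derivative `∂_t^α u` and the second spatial derivative `u_{xx}` exist and are
continuous on `(0,T] × (0,l)`, the equation holds there, `u(0,·) = φ` on `[0,l]`, and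
`u(·,0) = u(·,l) = 0` on `[0,T]`. -/
def IsDirectSolution (α T l : ℝ) (p q : ℝ → ℝ) (F : ℝ → ℝ → ℝ) (φ : ℝ → ℝ)
    (u : ℝ → ℝ → ℝ) : Prop :=
  ContinuousOn (fun pt : ℝ × ℝ => u pt.1 pt.2) (Icc 0 T ×ˢ Icc 0 l) ∧
  (∀ t ∈ Ioc 0 T, ∀ x ∈ Ioo 0 l, DifferentiableAt ℝ (fun τ => u τ x) t) ∧
  ContinuousOn (fun pt : ℝ × ℝ => caputoDeriv α (fun τ => u τ pt.2) pt.1)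
    (Ioc 0 T ×ˢ Ioo 0 l) ∧
  (∀ t ∈ Ioc 0 T, ∀ x ∈ Ioo 0 l,
    DifferentiableAt ℝ (u t) x ∧ DifferentiableAt ℝ (deriv (u t)) x) ∧
  ContinuousOn (fun pt : ℝ × ℝ => deriv (deriv (u pt.1)) pt.2)
    (Ioc 0 T ×ˢ Ioo 0 l) ∧
  (∀ t ∈ Ioc 0 T, ∀ x ∈ Ioo 0 l,
    caputoDeriv α (fun τ => u τ x) t
      - deriv (fun y => p y * deriv (u t) y) x + q x * u t x = F t x) ∧
  (∀ x ∈ Icc 0 l, u 0 x = φ x) ∧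
  (∀ t ∈ Icc 0 T, u t 0 = 0 ∧ u t l = 0)

namespace InvSource

open Filter Topology
open intervalIntegral (integral_of_le integral_mono_on integral_congr
  integral_add_adjacent_intervals integral_mono_on_of_le_Ioo integral_mono_interval
  integral_hasDerivAt_right integral_eq_sub_of_hasDerivAt integral_comp_sub_left integral_symm
  integral_interval_sub_left)
open Real (norm_eq_abs exp exp_pos rpow_nonneg Gamma Gamma_pos_of_pos)

local notation "mulL" => ContinuousLinearMap.mul ℝ ℝ
local notation "⟪" x "," y "⟫" => inner ℝ x y

lemma intervalIntegrable_cont {f : ℝ → ℝ} {a b : ℝ} (hf : Continuous f := by fun_prop) :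
    IntervalIntegrable f volume a b := hf.intervalIntegrable a b

/-- The causal convolution `∫_0^t f(s) g(t-s) ds`. -/
noncomputable def cv (f g : ℝ → ℝ) (t : ℝ) : ℝ := ∫ s in (0:ℝ)..t, f s * g (t - s)

/-- Truncation to `(0,T]`. -/
noncomputable def tr (T : ℝ) (f : ℝ → ℝ) : ℝ → ℝ := (Ioc 0 T).indicator f

lemma tr_eq {T s : ℝ} (f : ℝ → ℝ) (h : s ∈ Ioc 0 T) : tr T f s = f s := indicator_of_mem h f

lemma integrable_tr {T : ℝ} {f : ℝ → ℝ} (hf : IntegrableOn f (Ioc 0 T)) :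
    Integrable (tr T f) := (integrable_indicator_iff measurableSet_Ioc).2 hf

lemma tr_mul_tr {T t : ℝ} (ht : t ≤ T) (f g : ℝ → ℝ) :
    (fun s => tr T f s * tr T g (t - s)) = (Ioo 0 t).indicator (fun s => f s * g (t - s)) := by
  funext s
  by_cases h : s ∈ Ioo 0 t
  · rw [indicator_of_mem h, tr_eq f ⟨h.1, by linarith [h.2]⟩,
      tr_eq g ⟨by linarith [h.2], by linarith [h.1]⟩]
  · rw [indicator_of_notMem h]
    by_cases h0 : 0 < s
    · have : tr T g (t - s) = 0 := by
        apply indicator_of_notMem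
        intro h'
        exact h ⟨h0, by linarith [h'.1]⟩
      rw [this, mul_zero]
    · have : tr T f s = 0 := by
        apply indicator_of_notMem
        intro h'
        exact h0 h'.1
      rw [this, zero_mul]

lemma conv_tr {T t : ℝ} (h0 : 0 ≤ t) (ht : t ≤ T) (f g : ℝ → ℝ) :
    convolution (tr T f) (tr T g) mulL volume t = cv f g t := by
  rw [convolution_def, cv, integral_of_le h0, integral_Ioc_eq_integral_Ioo,
    ← integral_indicator measurableSet_Ioo, ← tr_mul_tr ht]
  rfl

lemma cv_congr {f f' g g' : ℝ → ℝ} {t : ℝ} (h0 : 0 ≤ t) (hf : ∀ s ∈ Ioo 0 t, f s = f' s)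
    (hg : ∀ s ∈ Ioo 0 t, g s = g' s) : cv f g t = cv f' g' t := by
  rw [cv, cv, integral_of_le h0, integral_of_le h0,
    integral_Ioc_eq_integral_Ioo, integral_Ioc_eq_integral_Ioo]
  apply setIntegral_congr_fun measurableSet_Ioo
  intro s hs
  have h2 : t - s ∈ Ioo 0 t := ⟨by linarith [hs.2], by linarith [hs.1]⟩
  simp only [hf s hs, hg _ h2]

lemma cv_comm (f g : ℝ → ℝ) (t : ℝ) : cv f g t = cv g f t := by
  have := integral_comp_sub_left (a := 0) (b := t) (fun s => f s * g (t - s)) t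
  simp only [sub_zero, sub_self] at this
  rw [cv, ← this, cv]
  congr 1
  funext s
  rw [sub_sub_cancel, mul_comm]

lemma cv_zero (f g : ℝ → ℝ) : cv f g 0 = 0 := by simp [cv]

lemma ae_integrable_cv {T : ℝ} {f g : ℝ → ℝ} (hf : IntegrableOn f (Ioc 0 T))
    (hg : IntegrableOn g (Ioc 0 T)) :
    ∀ᵐ t, t ∈ Ioc 0 T → IntervalIntegrable (fun s => f s * g (t - s)) volume 0 t := by
  have := (integrable_tr hf).ae_convolution_exists mulL (integrable_tr hg)
  filter_upwards [this] with t ht hT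
  have h1 : Integrable (fun s => tr T f s * tr T g (t - s)) := ht
  rw [tr_mul_tr hT.2, integrable_indicator_iff measurableSet_Ioo] at h1
  rw [intervalIntegrable_iff_integrableOn_Ioo_of_le hT.1.le]
  exact h1

lemma integrableOn_cv {T : ℝ} {f g : ℝ → ℝ} (hf : IntegrableOn f (Ioc 0 T))
    (hg : IntegrableOn g (Ioc 0 T)) : IntegrableOn (cv f g) (Ioc 0 T) := by
  have := (integrable_tr hf).integrable_convolution mulL (integrable_tr hg)
  refine (this.integrableOn (s := Ioc 0 T)).congr_fun (fun t ht => ?_) measurableSet_Ioc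
  exact conv_tr ht.1.le ht.2 f g

lemma tr_conv {T t : ℝ} (h0 : 0 ≤ t) (ht : t ≤ T) (f g h : ℝ → ℝ) :
    convolution (convolution (tr T f) (tr T g) mulL volume) (tr T h)
      mulL volume t = cv (cv f g) h t := by
  have hc : ∀ s, s ≤ 0 → convolution (tr T f) (tr T g) mulL volume s = 0 := by
    intro s hs
    rw [convolution_def]
    have : ∀ r, mulL (tr T f r) (tr T g (s - r)) = 0 := by
      intro r
      rw [ContinuousLinearMap.mul_apply']
      by_cases hr : 0 < r
      · have : tr T g (s - r) = 0 := indicator_of_notMem (fun h' => by linarith [h'.1]) _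
        rw [this, mul_zero]
      · have : tr T f r = 0 := indicator_of_notMem (fun h' => hr h'.1) _
        rw [this, zero_mul]
    simp [this]
  rw [← conv_tr h0 ht, convolution_def, convolution_def]
  congr 1
  funext s
  simp only [ContinuousLinearMap.mul_apply']
  by_cases h1 : s ≤ 0
  · rw [hc s h1, zero_mul]
    have : tr T (cv f g) s = 0 := indicator_of_notMem (fun h' => by linarith [h'.1]) _
    rw [this, zero_mul]
  · by_cases h2 : s ≤ T
    · rw [conv_tr (by linarith) h2, tr_eq _ ⟨by linarith, h2⟩]
    · have : tr T h (t - s) = 0 := indicator_of_notMem (fun h' => by linarith [h'.1]) _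
      rw [this, mul_zero, mul_zero]

lemma cv_assoc_ae {T : ℝ} {f g h : ℝ → ℝ} (hf : IntegrableOn f (Ioc 0 T))
    (hg : IntegrableOn g (Ioc 0 T)) (hh : IntegrableOn h (Ioc 0 T)) :
    ∀ᵐ t, t ∈ Ioc 0 T → cv (cv f g) h t = cv f (cv g h) t := by
  have hf' := integrable_tr hf
  have hg' := integrable_tr hg
  have hh' := integrable_tr hh
  have e1 := hf'.ae_convolution_exists mulL hg'
  have e2 := hg'.norm.ae_convolution_exists mulL hh'.norm
  have e3 := hf'.norm.ae_convolution_exists mulL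
    (hg'.norm.integrable_convolution mulL hh'.norm)
  filter_upwards [e3] with t h3 ht
  have := convolution_assoc (μ := volume) (ν := volume) mulL
    mulL mulL mulL
    (fun x y z => by simp [mul_assoc]) (x₀ := t) hf'.1 hg'.1 hh'.1 e1 e2 h3
  rw [tr_conv ht.1.le ht.2] at this
  rw [this, cv_comm f, ← tr_conv ht.1.le ht.2, ← convolution_flip]
  congr 1
  ext
  simp

lemma cv_one_left (f : ℝ → ℝ) (t : ℝ) : cv (fun _ => 1) f t = ∫ s in (0:ℝ)..t, f s := by
  rw [cv_comm]; simp [cv]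

lemma cv_smul_left (c : ℝ) (f g : ℝ → ℝ) (t : ℝ) : cv (fun s => c * f s) g t = c * cv f g t := by
  rw [cv, cv, ← intervalIntegral.integral_const_mul]
  simp only [mul_assoc]

lemma cv_smul_right (c : ℝ) (f g : ℝ → ℝ) (t : ℝ) : cv f (fun s => c * g s) t = c * cv f g t := by
  rw [cv_comm, cv_smul_left, cv_comm]

/-- Integrability of the convolution integrand at time `t`. -/
def CvI (f g : ℝ → ℝ) (t : ℝ) : Prop := IntervalIntegrable (fun s => f s * g (t - s)) volume 0 t

lemma CvI.symm {f g : ℝ → ℝ} {t : ℝ} (h : CvI f g t) : CvI g f t := by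
  have := h.comp_sub_left t
  simp only [sub_zero, sub_self, sub_sub_cancel] at this
  refine this.symm.congr (fun s _ => ?_)
  ring

lemma cv_add_left {f f' g : ℝ → ℝ} {t : ℝ} (h : CvI f g t) (h' : CvI f' g t) :
    cv (fun s => f s + f' s) g t = cv f g t + cv f' g t := by
  rw [cv, cv, cv, ← intervalIntegral.integral_add h h']
  simp only [add_mul]

lemma cv_add_right {f g g' : ℝ → ℝ} {t : ℝ} (h : CvI f g t) (h' : CvI f g' t) :
    cv f (fun s => g s + g' s) t = cv f g t + cv f g' t := by
  rw [cv, cv, cv, ← intervalIntegral.integral_add h h']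
  simp only [mul_add]

lemma cv_sub_left {f f' g : ℝ → ℝ} {t : ℝ} (h : CvI f g t) (h' : CvI f' g t) :
    cv (fun s => f s - f' s) g t = cv f g t - cv f' g t := by
  rw [cv, cv, cv, ← intervalIntegral.integral_sub h h']
  simp only [sub_mul]

lemma cv_sub_right {f g g' : ℝ → ℝ} {t : ℝ} (h : CvI f g t) (h' : CvI f g' t) :
    cv f (fun s => g s - g' s) t = cv f g t - cv f g' t := by
  rw [cv, cv, cv, ← intervalIntegral.integral_sub h h']
  simp only [mul_sub]

lemma abs_cv_le_conv {T t : ℝ} (h0 : 0 ≤ t) (ht : t ≤ T) (f g : ℝ → ℝ) :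
    |cv f g t| ≤ convolution (fun s => ‖tr T f s‖) (fun s => ‖tr T g s‖)
      mulL volume t := by
  rw [← conv_tr h0 ht, convolution_def, convolution_def, ← norm_eq_abs]
  refine (norm_integral_le_integral_norm _).trans (le_of_eq ?_)
  simp

lemma young {T : ℝ} {f g : ℝ → ℝ} (hf : IntegrableOn f (Ioc 0 T))
    (hg : IntegrableOn g (Ioc 0 T)) :
    ∫ t in Ioc 0 T, |cv f g t| ≤ (∫ t in Ioc 0 T, |f t|) * ∫ t in Ioc 0 T, |g t| := by
  have hf' := (integrable_tr hf).norm
  have hg' := (integrable_tr hg).norm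
  have hc := hf'.integrable_convolution mulL hg'
  have h1 : ∫ t in Ioc 0 T, |cv f g t| ≤ ∫ t in Ioc 0 T,
      convolution (fun s => ‖tr T f s‖) (fun s => ‖tr T g s‖)
        mulL volume t := by
    apply setIntegral_mono_on (integrableOn_cv hf hg).abs hc.integrableOn measurableSet_Ioc
    intro t ht
    exact abs_cv_le_conv ht.1.le ht.2 f g
  have h2 : ∀ f : ℝ → ℝ, ∫ t, ‖tr T f t‖ = ∫ t in Ioc 0 T, |f t| := by
    intro f
    rw [← integral_indicator measurableSet_Ioc]
    congr 1
    funext t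
    rw [tr, norm_indicator_eq_indicator_norm]
    rfl
  refine h1.trans ((setIntegral_le_integral hc (ae_of_all _ (fun t => ?_))).trans (le_of_eq ?_))
  · rw [convolution_def]
    apply integral_nonneg
    intro s
    exact mul_nonneg (norm_nonneg _) (norm_nonneg _)
  · rw [integral_convolution _ hf' hg', h2, h2]
    rfl

lemma exp_cv (β : ℝ) (f g : ℝ → ℝ) (t : ℝ) :
    exp (-β * t) * cv f g t
      = cv (fun s => exp (-β * s) * f s) (fun s => exp (-β * s) * g s) t := by
  rw [cv, cv, ← intervalIntegral.integral_const_mul]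
  congr 1
  funext s
  have : exp (-β * t) = exp (-β * s) * exp (-β * (t - s)) := by
    rw [← Real.exp_add]; congr 1; ring
  rw [this]; ring

lemma integrableOn_exp_mul {T : ℝ} (β : ℝ) {f : ℝ → ℝ} (hf : IntegrableOn f (Ioc 0 T)) :
    IntegrableOn (fun s => exp (-β * s) * f s) (Ioc 0 T) := by
  have h := (integrableOn_Icc_iff_integrableOn_Ioc).2 hf
  exact (h.continuousOn_mul (Continuous.continuousOn (by fun_prop)) isCompact_Icc).mono_set
    Ioc_subset_Icc_self

lemma exists_weight {T : ℝ} {f : ℝ → ℝ} (hf : IntegrableOn f (Ioc 0 T)) :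
    ∃ β : ℝ, ∫ s in Ioc 0 T, |exp (-β * s) * f s| < 1 / 2 := by
  have h : Tendsto (fun n : ℕ => ∫ s in Ioc 0 T, |exp (-(n:ℝ) * s) * f s|) atTop
      (𝓝 (∫ s in Ioc 0 T, (0:ℝ))) := by
    apply tendsto_integral_of_dominated_convergence (fun s => |f s|)
    · intro n
      exact (integrableOn_exp_mul n hf).abs.1
    · exact hf.abs
    · intro n
      filter_upwards [ae_restrict_mem measurableSet_Ioc] with s hs
      rw [norm_eq_abs, abs_abs, abs_mul, Real.abs_exp]
      have : exp (-(n:ℝ) * s) ≤ 1 := by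
        rw [Real.exp_le_one_iff]
        have := mul_nonneg (Nat.cast_nonneg (α := ℝ) n) hs.1.le
        linarith
      exact mul_le_of_le_one_left (abs_nonneg _) this
    · filter_upwards [ae_restrict_mem measurableSet_Ioc] with s hs
      have h1 : Tendsto (fun n : ℕ => exp (-(n:ℝ) * s)) atTop (𝓝 0) := by
        apply Real.tendsto_exp_atBot.comp
        have : Tendsto (fun n : ℕ => (n:ℝ) * s) atTop atTop :=
          tendsto_natCast_atTop_atTop.atTop_mul_const hs.1
        simp only [neg_mul]
        exact tendsto_neg_atTop_atBot.comp this
      have := (h1.mul_const (f s)).abs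
      simpa using this
  simp only [integral_zero] at h
  obtain ⟨n, hn⟩ := (h.eventually (gt_mem_nhds (by norm_num : (0:ℝ) < 1 / 2))).exists
  exact ⟨n, hn⟩

/-- Uniqueness for the homogeneous Volterra equation with integrable kernel. -/
lemma volterra_unique {T : ℝ} {κ F : ℝ → ℝ} (hκ : IntegrableOn κ (Ioc 0 T))
    (hF : IntegrableOn F (Ioc 0 T)) (h : ∀ᵐ t, t ∈ Ioc 0 T → F t = cv κ F t) :
    ∀ᵐ t, t ∈ Ioc 0 T → F t = 0 := by
  obtain ⟨β, hβ⟩ := exists_weight hκ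
  have h1 : ∫ t in Ioc 0 T, |exp (-β * t) * F t|
      = ∫ t in Ioc 0 T, |cv (fun s => exp (-β * s) * κ s)
        (fun s => exp (-β * s) * F s) t| := by
    apply setIntegral_congr_ae measurableSet_Ioc
    filter_upwards [h] with t ht htT
    rw [← exp_cv, ← ht htT]
  have h2 := young (integrableOn_exp_mul β hκ) (integrableOn_exp_mul β hF)
  rw [← h1] at h2
  have h3 : 0 ≤ ∫ t in Ioc 0 T, |exp (-β * t) * F t| :=
    integral_nonneg (fun _ => abs_nonneg _)
  have h4 : ∫ t in Ioc 0 T, |exp (-β * t) * F t| = 0 := by nlinarith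
  rw [integral_eq_zero_iff_of_nonneg (fun _ => abs_nonneg _) (integrableOn_exp_mul β hF).abs] at h4
  have h5 := (ae_restrict_iff' measurableSet_Ioc).1 h4
  filter_upwards [h5] with t ht htT
  have := ht htT
  simp only [Pi.zero_apply, abs_eq_zero, mul_eq_zero, Real.exp_ne_zero, false_or] at this
  exact this

/-- `L¹ * (bounded continuous)` is continuous up to `0`. -/
lemma continuousOn_cv_bdd {T C : ℝ} {f g : ℝ → ℝ} (hf : IntegrableOn f (Ioc 0 T))
    (hg : ContinuousOn g (Ioc 0 T)) (hC : ∀ t ∈ Ioc 0 T, |g t| ≤ C) :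
    ContinuousOn (cv f g) (Icc 0 T) := by
  have hrep : ∀ t ∈ Icc 0 T, cv f g t
      = ∫ s in Ioc 0 T, f s * tr T g (t - s) := by
    intro t ht
    rw [← conv_tr ht.1 ht.2, convolution_def, ← integral_indicator measurableSet_Ioc]
    congr 1
    funext s
    rw [ContinuousLinearMap.mul_apply', tr, indicator_mul_left (Ioc 0 T) f (fun s => tr T g (t - s))]
  have hgm : AEStronglyMeasurable (tr T g) volume := by
    rw [tr, aestronglyMeasurable_indicator_iff measurableSet_Ioc]
    exact hg.aestronglyMeasurable measurableSet_Ioc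
  have hb : ∀ s, |tr T g s| ≤ |C| := by
    intro s
    by_cases h : s ∈ Ioc 0 T
    · rw [tr_eq g h]; exact (hC s h).trans (le_abs_self C)
    · rw [tr, indicator_of_notMem h]; simp
  apply ContinuousOn.congr _ hrep
  intro t ht
  apply continuousWithinAt_of_dominated (bound := fun s => |f s| * |C|)
  · refine Eventually.of_forall (fun r => ?_)
    refine hf.1.mul ?_
    exact (hgm.comp_quasiMeasurePreserving
      (Measure.measurePreserving_sub_left volume r).quasiMeasurePreserving).restrict
  · refine Eventually.of_forall (fun r => ae_of_all _ (fun s => ?_))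
    rw [norm_mul]
    exact mul_le_mul_of_nonneg_left (hb _) (abs_nonneg _)
  · exact hf.abs.mul_const _
  · have hne : ∀ᵐ s : ℝ, s ≠ t := by
      simp [ae_iff, measure_singleton]
    filter_upwards [ae_restrict_of_ae hne, ae_restrict_mem measurableSet_Ioc] with s hs hsT
    apply ContinuousWithinAt.mul continuousWithinAt_const
    rcases lt_or_gt_of_ne hs with h | h
    · have hmem : t - s ∈ Ioc 0 T := ⟨by linarith, by linarith [ht.2, hsT.1]⟩
      have hev : ∀ᶠ r in 𝓝[Icc 0 T] t, r - s ∈ Ioc 0 T := by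
        have : ∀ᶠ r in 𝓝 t, s < r := lt_mem_nhds h
        filter_upwards [mem_nhdsWithin_of_mem_nhds this, self_mem_nhdsWithin] with r hr hr2
        exact ⟨by linarith, by linarith [hr2.2, hsT.1]⟩
      have h1 : ContinuousWithinAt (fun r => g (r - s)) (Icc 0 T) t := by
        have h2 : Tendsto (fun r => r - s) (𝓝[Icc 0 T] t) (𝓝[Ioc 0 T] (t - s)) := by
          apply tendsto_nhdsWithin_of_tendsto_nhds_of_eventually_within _ _ hev
          exact (Continuous.tendsto (by fun_prop) t).mono_left nhdsWithin_le_nhds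
        exact (hg _ hmem).tendsto.comp h2
      refine h1.congr_of_eventuallyEq ?_ (tr_eq g hmem)
      filter_upwards [hev] with r hr
      exact tr_eq g hr
    · have hev : ∀ᶠ r in 𝓝[Icc 0 T] t, tr T g (r - s) = 0 := by
        have : ∀ᶠ r in 𝓝 t, r < s := gt_mem_nhds h
        filter_upwards [mem_nhdsWithin_of_mem_nhds this] with r hr
        exact indicator_of_notMem (fun h' => by linarith [h'.1]) _
      have h0 : tr T g (t - s) = 0 := indicator_of_notMem (fun h' => by linarith [h'.1]) _
      exact (continuousWithinAt_const (b := (0:ℝ))).congr_of_eventuallyEq hev h0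

lemma cvI_bdd {T C t : ℝ} {f g : ℝ → ℝ} (hf : IntegrableOn f (Ioc 0 T))
    (hg : ContinuousOn g (Ioc 0 T)) (hC : ∀ t ∈ Ioc 0 T, |g t| ≤ C) (ht : t ∈ Icc 0 T) :
    CvI f g t := by
  rw [CvI, intervalIntegrable_iff_integrableOn_Ioo_of_le ht.1]
  refine Integrable.mul_bdd (c := C) (hf.mono_set (fun s hs => ⟨hs.1, by linarith [hs.2, ht.2]⟩)) ?_ ?_
  · apply ContinuousOn.aestronglyMeasurable _ measurableSet_Ioo
    apply hg.comp (Continuous.continuousOn (by fun_prop))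
    intro s hs
    exact ⟨by linarith [hs.2], by linarith [hs.1, ht.2]⟩
  · filter_upwards [ae_restrict_mem measurableSet_Ioo] with s hs
    exact hC _ ⟨by linarith [hs.2], by linarith [hs.1, ht.2]⟩

lemma abs_cv_le {C t : ℝ} {f g : ℝ → ℝ} (h0 : 0 ≤ t) (hf : IntegrableOn f (Ioc 0 t))
    (hC : ∀ s ∈ Ioo 0 t, |g s| ≤ C) : |cv f g t| ≤ (∫ s in Ioc 0 t, |f s|) * C := by
  rw [cv, ← norm_eq_abs, integral_of_le h0, integral_Ioc_eq_integral_Ioo,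
    integral_Ioc_eq_integral_Ioo, ← integral_mul_const]
  refine norm_integral_le_of_norm_le ((hf.mono_set Ioo_subset_Ioc_self).abs.mul_const _) ?_
  filter_upwards [ae_restrict_mem measurableSet_Ioo] with s hs
  rw [norm_mul]
  exact mul_le_mul_of_nonneg_left (hC _ ⟨by linarith [hs.2], by linarith [hs.1]⟩) (abs_nonneg _)

/-- Functions continuous on `(0,∞)` and integrable near `0`. -/
structure KC (f : ℝ → ℝ) : Prop where
  cont : ContinuousOn f (Ioi 0)
  int : ∀ T, IntegrableOn f (Ioc 0 T)

lemma KC.of_bound {f : ℝ → ℝ} (hf : ContinuousOn f (Ioi 0)) {δ : ℝ} (hδ : 0 < δ) {b : ℝ → ℝ}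
    (hb : IntegrableOn b (Ioc 0 δ)) (h : ∀ t ∈ Ioc 0 δ, |f t| ≤ b t) : KC f := by
  refine ⟨hf, fun T => ?_⟩
  have h1 : IntegrableOn f (Ioc 0 δ) := by
    refine Integrable.mono' hb ((hf.mono Ioc_subset_Ioi_self).aestronglyMeasurable measurableSet_Ioc) ?_
    filter_upwards [ae_restrict_mem measurableSet_Ioc] with t ht using h t ht
  have h2 : IntegrableOn f (Icc δ T) :=
    (hf.mono (fun t ht => lt_of_lt_of_le hδ ht.1)).integrableOn_Icc
  refine (h1.union h2).mono_set ?_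
  intro t ht
  rcases le_or_gt t δ with h | h
  · exact Or.inl ⟨ht.1, h⟩
  · exact Or.inr ⟨h.le, ht.2⟩

lemma KC.of_cont {f : ℝ → ℝ} (hf : Continuous f) : KC f :=
  ⟨hf.continuousOn, fun _ => hf.integrableOn_Ioc⟩

lemma KC.of_bdd {f : ℝ → ℝ} (hf : ContinuousOn f (Ioi 0)) {C : ℝ}
    (h : ∀ t ∈ Ioc (0:ℝ) 1, |f t| ≤ C) : KC f :=
  KC.of_bound hf one_pos (b := fun _ => C) (by simp) h

lemma KC.add {f g : ℝ → ℝ} (hf : KC f) (hg : KC g) : KC (fun t => f t + g t) :=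
  ⟨hf.cont.add hg.cont, fun T => (hf.int T).add (hg.int T)⟩
lemma KC.sub {f g : ℝ → ℝ} (hf : KC f) (hg : KC g) : KC (fun t => f t - g t) :=
  ⟨hf.cont.sub hg.cont, fun T => (hf.int T).sub (hg.int T)⟩
lemma KC.smul {f : ℝ → ℝ} (c : ℝ) (hf : KC f) : KC (fun t => c * f t) :=
  ⟨continuousOn_const.mul hf.cont, fun T => (hf.int T).const_mul c⟩

lemma KC.intervalIntegrable {f : ℝ → ℝ} (hf : KC f) {t : ℝ} (ht : 0 ≤ t) :
    IntervalIntegrable f volume 0 t := by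
  rw [intervalIntegrable_iff_integrableOn_Ioc_of_le ht]; exact hf.int t

lemma KC.cvI_half {f g : ℝ → ℝ} (hf : KC f) (hg : KC g) {t : ℝ} (ht : 0 < t) :
    IntervalIntegrable (fun s => f s * g (t - s)) volume 0 (t / 2) := by
  have h2 : 0 ≤ t / 2 := by linarith
  apply (hf.intervalIntegrable h2).mul_continuousOn
  rw [uIcc_of_le h2]
  apply hg.cont.comp (Continuous.continuousOn (by fun_prop))
  intro s hs
  have := hs.2
  simp only [mem_Ioi]; linarith

lemma KC.cvI {f g : ℝ → ℝ} (hf : KC f) (hg : KC g) {t : ℝ} (ht : 0 < t) : CvI f g t := by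
  have h1 := hf.cvI_half hg ht
  have h2 := (hg.cvI_half hf ht).comp_sub_left t
  simp only [sub_zero, sub_sub_cancel] at h2
  rw [show t - t / 2 = t / 2 by ring] at h2
  refine h1.trans (h2.symm.congr (fun s _ => ?_))
  ring

lemma KC.cv_split {f g : ℝ → ℝ} (hf : KC f) (hg : KC g) {t : ℝ} (ht : 0 < t) :
    cv f g t = (∫ s in (0:ℝ)..(t / 2), f s * g (t - s)) + ∫ s in (0:ℝ)..(t / 2), g s * f (t - s) := by
  have h := hf.cvI hg ht
  rw [cv, ← integral_add_adjacent_intervals (b := t / 2) (hf.cvI_half hg ht)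
    (h.mono_set ?_)]
  · congr 1
    have := integral_comp_sub_left (a := 0) (b := t / 2) (fun s => f s * g (t - s)) t
    rw [sub_zero, show t - t / 2 = t / 2 by ring] at this
    rw [← this]
    simp only [sub_sub_cancel, mul_comm]
  · rw [uIcc_of_le (by linarith), uIcc_of_le (by linarith)]
    exact Icc_subset_Icc (by linarith) le_rfl

lemma KC.half_cont {f g : ℝ → ℝ} (hf : KC f) (hg : KC g) :
    ContinuousOn (fun t => ∫ s in (0:ℝ)..(t / 2), f s * g (t - s)) (Ioi 0) := by
  intro t0 ht0
  have ht0 : 0 < t0 := ht0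
  apply ContinuousAt.continuousWithinAt
  obtain ⟨C, hC⟩ := (isCompact_Icc (a := t0 / 4) (b := 2 * t0)).exists_bound_of_continuousOn
    (hg.cont.mono (fun s hs => by have := hs.1; simp only [mem_Ioi]; linarith))
  have hev : ∀ᶠ t in 𝓝 t0, t ∈ Ioo (t0 / 2) (2 * t0) :=
    Ioo_mem_nhds (by linarith) (by linarith)
  have key : ContinuousAt (fun t => ∫ s in Ioc 0 t0,
      (Iic (t / 2)).indicator (fun s => f s * g (t - s)) s) t0 := by
    apply continuousAt_of_dominated (bound := fun s => |f s| * C)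
    · filter_upwards [hev] with t ht
      have h1 : IntegrableOn (fun s => f s * g (t - s)) (Ioc 0 (t / 2)) :=
        (intervalIntegrable_iff_integrableOn_Ioc_of_le (by linarith [ht.1])).1
          (hf.cvI_half hg (by linarith [ht.1]))
      rw [aestronglyMeasurable_indicator_iff measurableSet_Iic,
        Measure.restrict_restrict measurableSet_Iic]
      refine (h1.mono_set ?_).1
      intro s hs
      exact ⟨hs.2.1, hs.1⟩
    · filter_upwards [hev] with t ht
      filter_upwards [ae_restrict_mem measurableSet_Ioc] with s hs
      by_cases h : s ∈ Iic (t / 2)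
      · rw [indicator_of_mem h, norm_mul]
        have h' : s ≤ t / 2 := h
        exact mul_le_mul_of_nonneg_left
          (hC _ ⟨by linarith [ht.1], by linarith [hs.1, ht.2]⟩) (abs_nonneg _)
      · rw [indicator_of_notMem h, norm_zero]
        have := (norm_nonneg _).trans (hC (t0 / 2) ⟨by linarith, by linarith⟩)
        positivity
    · exact (hf.int t0).abs.mul_const _
    · have hne : ∀ᵐ s : ℝ, s ≠ t0 / 2 := by simp [ae_iff, measure_singleton]
      filter_upwards [ae_restrict_of_ae hne, ae_restrict_mem measurableSet_Ioc] with s hs hsT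
      rcases lt_or_gt_of_ne hs with h | h
      · have e : ∀ᶠ t in 𝓝 t0, (Iic (t / 2)).indicator (fun s => f s * g (t - s)) s
            = f s * g (t - s) := by
          filter_upwards [lt_mem_nhds (show 2 * s < t0 by linarith)] with t ht
          exact indicator_of_mem (by simp only [mem_Iic]; linarith) _
        refine ContinuousAt.congr ?_ (e.mono (fun _ h => h.symm))
        apply ContinuousAt.mul continuousAt_const
        have : ContinuousAt g (t0 - s) := hg.cont.continuousAt (Ioi_mem_nhds (by linarith))
        exact ContinuousAt.comp (f := fun t => t - s) this (by fun_prop)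
      · have e : ∀ᶠ t in 𝓝 t0, (Iic (t / 2)).indicator (fun s => f s * g (t - s)) s = 0 := by
          filter_upwards [gt_mem_nhds (show t0 < 2 * s by linarith)] with t ht
          exact indicator_of_notMem (by simp only [mem_Iic]; linarith) _
        exact continuousAt_const.congr (e.mono (fun _ h => h.symm))
  refine key.congr ?_
  filter_upwards [hev] with t ht
  rw [integral_of_le (by linarith [ht.1]), integral_indicator measurableSet_Iic,
    Measure.restrict_restrict measurableSet_Iic]
  congr 2
  ext s
  simp only [mem_inter_iff, mem_Iic, mem_Ioc]
  constructor
  · rintro ⟨h1, h2, h3⟩; exact ⟨h2, h1⟩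
  · rintro ⟨h1, h2⟩; exact ⟨h2, h1, by linarith [ht.2]⟩

lemma KC.cv {f g : ℝ → ℝ} (hf : KC f) (hg : KC g) : KC (cv f g) := by
  refine ⟨?_, fun T => integrableOn_cv (hf.int T) (hg.int T)⟩
  exact ((hf.half_cont hg).add (hg.half_cont hf)).congr (fun t ht => hf.cv_split hg ht)

lemma eq_of_ae_of_cont {T : ℝ} {F G : ℝ → ℝ} (hF : ContinuousOn F (Ioc 0 T))
    (hG : ContinuousOn G (Ioc 0 T)) (h : ∀ᵐ t, t ∈ Ioc 0 T → F t = G t) :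
    ∀ t ∈ Ioc 0 T, F t = G t := by
  intro t ht
  exact Measure.eqOn_Ioc_of_ae_eq volume ((ae_restrict_iff' measurableSet_Ioc).2 h) hF hG ht

lemma KC.assoc {f g h : ℝ → ℝ} (hf : KC f) (hg : KC g) (hh : KC h) {t : ℝ} (ht : 0 < t) :
    InvSource.cv (InvSource.cv f g) h t = InvSource.cv f (InvSource.cv g h) t :=
  eq_of_ae_of_cont (T := t) (((hf.cv hg).cv hh).cont.mono Ioc_subset_Ioi_self)
    ((hf.cv (hg.cv hh)).cont.mono Ioc_subset_Ioi_self)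
    (cv_assoc_ae (hf.int t) (hg.int t) (hh.int t)) t ⟨ht, le_rfl⟩

/-- The Riemann–Liouville kernel `t^(a-1)/Γ(a)`. -/
noncomputable def rl (a : ℝ) (t : ℝ) : ℝ := t ^ (a - 1) / Gamma a

lemma rl_pos {a t : ℝ} (ha : 0 < a) (ht : 0 < t) : 0 < rl a t :=
  div_pos (Real.rpow_pos_of_pos ht _) (Gamma_pos_of_pos ha)

lemma rl_nonneg {a t : ℝ} (ha : 0 < a) (ht : 0 ≤ t) : 0 ≤ rl a t :=
  div_nonneg (rpow_nonneg ht _) (Gamma_pos_of_pos ha).le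

lemma rl_one (t : ℝ) : rl 1 t = 1 := by simp [rl]

lemma kc_rpow {a : ℝ} (ha : 0 < a) : KC (fun t => t ^ (a - 1)) := by
  refine ⟨?_, fun T => ?_⟩
  · intro t ht
    exact (Real.continuousAt_rpow_const t _ (Or.inl (ne_of_gt ht))).continuousWithinAt
  · rcases le_or_gt 0 T with h | h
    · exact (intervalIntegrable_iff_integrableOn_Ioc_of_le h).1
        (intervalIntegral.intervalIntegrable_rpow' (by linarith))
    · simp [Ioc_eq_empty (not_lt.2 h.le)]

lemma kc_rl {a : ℝ} (ha : 0 < a) : KC (rl a) := by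
  have := (kc_rpow ha).smul (Gamma a)⁻¹
  refine ⟨this.cont.congr (fun t _ => ?_), fun T => (this.int T).congr_fun (fun t _ => ?_) measurableSet_Ioc⟩
  · simp [rl, div_eq_inv_mul]
  · simp [rl, div_eq_inv_mul]

lemma cv_rl {a b t : ℝ} (ha : 0 < a) (hb : 0 < b) (ht : 0 < t) :
    cv (rl a) (rl b) t = rl (a + b) t := by
  have h1 := Complex.betaIntegral_scaled a b ht
  rw [Complex.betaIntegral_eq_Gamma_mul_div _ _ (by simpa) (by simpa)] at h1
  have h2 : (∫ x in (0:ℝ)..t, (x:ℂ) ^ ((a:ℂ) - 1) * ((t:ℂ) - x) ^ ((b:ℂ) - 1))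
      = ((∫ x in (0:ℝ)..t, x ^ (a - 1) * (t - x) ^ (b - 1) : ℝ) : ℂ) := by
    rw [← intervalIntegral.integral_ofReal]
    apply integral_congr
    intro x hx
    rw [uIcc_of_le ht.le] at hx
    simp only
    rw [Complex.ofReal_mul, Complex.ofReal_cpow hx.1, Complex.ofReal_cpow (by linarith [hx.2])]
    push_cast
    rfl
  rw [h2, ← Complex.ofReal_add, Complex.Gamma_ofReal, Complex.Gamma_ofReal, Complex.Gamma_ofReal,
    ← Complex.ofReal_mul, ← Complex.ofReal_div] at h1
  have h3 : ((t:ℂ)) ^ (((a + b : ℝ) : ℂ) - 1) = ((t ^ (a + b - 1) : ℝ) : ℂ) := by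
    rw [Complex.ofReal_cpow ht.le]; push_cast; rfl
  rw [h3, ← Complex.ofReal_mul, Complex.ofReal_inj] at h1
  have ga := (Gamma_pos_of_pos ha).ne'
  have gb := (Gamma_pos_of_pos hb).ne'
  have : cv (rl a) (rl b) t
      = (Gamma a * Gamma b)⁻¹ * ∫ x in (0:ℝ)..t, x ^ (a - 1) * (t - x) ^ (b - 1) := by
    rw [cv, ← intervalIntegral.integral_const_mul]
    congr 1
    funext s
    simp only [rl]
    field_simp
  rw [this, h1, rl]
  field_simp

lemma cv_rl_compl {α t : ℝ} (h0 : 0 < α) (h1 : α < 1) (ht : 0 < t) :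
    cv (rl (1 - α)) (rl α) t = 1 := by
  rw [cv_rl (by linarith) h0 ht, sub_add_cancel, rl_one]

lemma cv_one_rl {a t : ℝ} (ha : 0 < a) (ht : 0 < t) :
    cv (fun _ => 1) (rl a) t = rl (a + 1) t := by
  have := cv_rl one_pos ha ht
  rw [add_comm, ← this]
  exact cv_congr ht.le (fun s _ => (rl_one s).symm) (fun _ _ => rfl)

lemma kc_one : KC (fun _ => 1) := KC.of_cont continuous_const

lemma kc_exp_mul {f : ℝ → ℝ} (β : ℝ) (hf : KC f) : KC (fun t => exp (-β * t) * f t) :=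
  ⟨(Continuous.continuousOn (by fun_prop)).mul hf.cont, fun T => integrableOn_exp_mul β (hf.int T)⟩

lemma integral_exp_rpow_le {α β T : ℝ} (h0 : 0 < α) (hβ : 0 < β) (hT : 0 ≤ T) :
    ∫ s in (0:ℝ)..T, exp (-β * s) * s ^ (α - 1) ≤ (1 / β) ^ α * Gamma α := by
  rw [← Real.integral_rpow_mul_exp_neg_mul_Ioi h0 hβ, integral_of_le hT]
  have hi : IntegrableOn (fun s : ℝ => s ^ (α - 1) * exp (-(β * s))) (Ioi 0) := by
    by_contra h
    have h1 := Real.integral_rpow_mul_exp_neg_mul_Ioi h0 hβ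
    rw [integral_undef h] at h1
    have := mul_pos (Real.rpow_pos_of_pos (one_div_pos.2 hβ) α) (Gamma_pos_of_pos h0)
    linarith
  have : ∀ s : ℝ, exp (-β * s) * s ^ (α - 1) = s ^ (α - 1) * exp (-(β * s)) := by
    intro s; rw [mul_comm, neg_mul]
  simp only [this]
  apply setIntegral_mono_set hi _ (LE.le.eventuallyLE Ioc_subset_Ioi_self)
  filter_upwards [ae_restrict_mem measurableSet_Ioi] with s hs
  exact mul_nonneg (rpow_nonneg (le_of_lt hs) _) (exp_pos _).le

lemma weighted_kernel_bound {α β t : ℝ} (h0 : 0 < α) (h1 : α < 1) (hβ : 0 < β) (ht : 0 < t) :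
    cv (fun s => s ^ (α - 1)) (fun s => s ^ (α - 1) * exp (β * s)) t
      ≤ (4 * (1 / β) ^ α * Gamma α) * (t ^ (α - 1) * exp (β * t)) := by
  have hp := kc_rpow h0
  have hpe := kc_exp_mul β hp
  have hG := Gamma_pos_of_pos h0
  have hB := Real.rpow_pos_of_pos (one_div_pos.2 hβ) α
  have e1 : cv (fun s => s ^ (α - 1)) (fun s => s ^ (α - 1) * exp (β * s)) t
      = exp (β * t) * cv (fun s => exp (-β * s) * s ^ (α - 1)) (fun s => s ^ (α - 1)) t := by
    have := exp_cv β (fun s => s ^ (α - 1)) (fun s => s ^ (α - 1) * exp (β * s)) t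
    have h2 : (fun s => exp (-β * s) * (s ^ (α - 1) * exp (β * s))) =
        (fun s : ℝ => s ^ (α - 1)) := by
      funext s
      rw [mul_comm, mul_assoc, ← Real.exp_add]
      simp
    rw [h2] at this
    rw [← this, ← mul_assoc, ← Real.exp_add]
    simp
  rw [e1, hpe.cv_split hp ht]
  have ht2 : 0 < t / 2 := by linarith
  have h2t : (t / 2) ^ (α - 1) ≤ 2 * t ^ (α - 1) := by
    rw [Real.div_rpow ht.le (by norm_num), div_eq_mul_inv, ← Real.rpow_neg (by norm_num), mul_comm]
    apply mul_le_mul_of_nonneg_right _ (rpow_nonneg ht.le _)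
    calc (2:ℝ) ^ (-(α - 1)) ≤ 2 ^ (1:ℝ) :=
          Real.rpow_le_rpow_of_exponent_le (by norm_num) (by linarith)
      _ = 2 := Real.rpow_one 2
  have hI := integral_exp_rpow_le h0 hβ ht2.le
  have hint := (hpe.intervalIntegrable ht2.le)
  have key : ∀ s ∈ Ioc 0 (t / 2), (t - s) ^ (α - 1) ≤ (t / 2) ^ (α - 1) := by
    intro s hs
    exact Real.rpow_le_rpow_of_nonpos ht2 (by linarith [hs.2]) (by linarith)
  have b1 : ∫ s in (0:ℝ)..(t / 2), exp (-β * s) * s ^ (α - 1) * (t - s) ^ (α - 1)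
      ≤ (1 / β) ^ α * Gamma α * (2 * t ^ (α - 1)) := by
    calc _ ≤ ∫ s in (0:ℝ)..(t / 2), exp (-β * s) * s ^ (α - 1) * (2 * t ^ (α - 1)) := by
          apply integral_mono_on_of_le_Ioo ht2.le (hpe.cvI_half hp ht)
            (hint.mul_const _)
          intro s hs
          apply mul_le_mul_of_nonneg_left ((key s ⟨hs.1, hs.2.le⟩).trans h2t)
          exact mul_nonneg (exp_pos _).le (rpow_nonneg hs.1.le _)
      _ ≤ _ := by
          rw [intervalIntegral.integral_mul_const]
          exact mul_le_mul_of_nonneg_right hI (by have := rpow_nonneg ht.le (α - 1); linarith)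
  have b2 : ∫ s in (0:ℝ)..(t / 2), s ^ (α - 1) * (exp (-β * (t - s)) * (t - s) ^ (α - 1))
      ≤ (1 / β) ^ α * Gamma α * (2 * t ^ (α - 1)) := by
    calc _ ≤ ∫ s in (0:ℝ)..(t / 2), exp (-β * s) * s ^ (α - 1) * (2 * t ^ (α - 1)) := by
          apply integral_mono_on_of_le_Ioo ht2.le (hp.cvI_half hpe ht)
            (hint.mul_const _)
          intro s hs
          have i1 : exp (-β * (t - s)) ≤ exp (-β * s) := by
            apply Real.exp_le_exp.2
            nlinarith [hs.2]
          have i2 := (key s ⟨hs.1, hs.2.le⟩).trans h2t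
          have i3 := rpow_nonneg (show 0 ≤ t - s by linarith [hs.2]) (α - 1)
          have i4 := mul_le_mul i1 i2 i3 (exp_pos _).le
          calc _ ≤ s ^ (α - 1) * (exp (-β * s) * (2 * t ^ (α - 1))) :=
                mul_le_mul_of_nonneg_left i4 (rpow_nonneg hs.1.le _)
            _ = _ := by ring
      _ ≤ _ := by
          rw [intervalIntegral.integral_mul_const]
          exact mul_le_mul_of_nonneg_right hI (by have := rpow_nonneg ht.le (α - 1); linarith)
  calc _ ≤ exp (β * t) * ((1 / β) ^ α * Gamma α * (2 * t ^ (α - 1))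
        + (1 / β) ^ α * Gamma α * (2 * t ^ (α - 1))) :=
        mul_le_mul_of_nonneg_left (add_le_add b1 b2) (exp_pos _).le
    _ = _ := by ring

lemma abs_cv_mono {f g f' g' : ℝ → ℝ} {t : ℝ} (ht : 0 < t) (hi : CvI f' g' t)
    (hf : ∀ s ∈ Ioo 0 t, |f s| ≤ f' s) (hg : ∀ s ∈ Ioo 0 t, |g s| ≤ g' s) :
    |cv f g t| ≤ cv f' g' t := by
  rw [CvI, intervalIntegrable_iff_integrableOn_Ioo_of_le ht.le] at hi
  rw [cv, cv, integral_of_le ht.le, integral_of_le ht.le,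
    integral_Ioc_eq_integral_Ioo, integral_Ioc_eq_integral_Ioo, ← norm_eq_abs]
  apply norm_integral_le_of_norm_le hi
  filter_upwards [ae_restrict_mem measurableSet_Ioo] with s hs
  rw [norm_mul]
  exact mul_le_mul (hf s hs) (hg _ ⟨by linarith [hs.2], by linarith [hs.1]⟩) (norm_nonneg _)
    ((abs_nonneg _).trans (hf s hs))

lemma kc_of_rpow_exp_bound {α β C : ℝ} (h0 : 0 < α) {f : ℝ → ℝ} (hf : ContinuousOn f (Ioi 0))
    (h : ∀ t, 0 < t → |f t| ≤ C * (t ^ (α - 1) * exp (β * t))) : KC f := by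
  have : KC (fun t => t ^ (α - 1) * exp (β * t)) := by
    have := kc_exp_mul (-β) (kc_rpow h0)
    simpa [mul_comm] using this
  exact KC.of_bound hf one_pos ((this.smul C).int 1) (fun t ht => h t ht.1)

lemma exists_beta {α C : ℝ} (h0 : 0 < α) :
    ∃ β : ℝ, 0 < β ∧ C * (4 * (1 / β) ^ α * Gamma α) ≤ 1 / 2 := by
  have h1 : Tendsto (fun β : ℝ => (1 / β) ^ α) atTop (𝓝 0) := by
    have := (tendsto_inv_atTop_zero (𝕜 := ℝ)).rpow_const (Or.inr h0.le) (p := α)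
    rw [Real.zero_rpow h0.ne'] at this
    simpa using this
  have h2 : Tendsto (fun β : ℝ => C * (4 * (1 / β) ^ α * Gamma α)) atTop (𝓝 0) := by
    have := ((h1.const_mul 4).mul_const (Gamma α)).const_mul C
    simpa using this
  obtain ⟨β, hβ1, hβ2⟩ := ((h2.eventually (gt_mem_nhds (by norm_num : (0:ℝ) < 1 / 2))).and
    (eventually_gt_atTop 0)).exists
  exact ⟨β, hβ2, hβ1.le⟩

open scoped BoundedContinuousFunction

/-- Existence for a weakly singular Volterra equation. -/
lemma volterra_exists {α C : ℝ} (h0 : 0 < α) (h1 : α < 1) {κ F : ℝ → ℝ}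
    (hκ : ContinuousOn κ (Ioi 0)) (hF : ContinuousOn F (Ioi 0))
    (bκ : ∀ t, 0 < t → |κ t| ≤ C * t ^ (α - 1)) (bF : ∀ t, 0 < t → |F t| ≤ C * t ^ (α - 1)) :
    ∃ y : ℝ → ℝ, KC y ∧ (∃ β D : ℝ, ∀ t, 0 < t → |y t| ≤ D * (t ^ (α - 1) * exp (β * t))) ∧
      ∀ t, 0 < t → y t = F t + cv κ y t := by
  have hC : 0 ≤ C := by
    have := (abs_nonneg _).trans (bκ 1 one_pos)
    simpa using this
  obtain ⟨β, hβ, hθ⟩ := exists_beta (α := α) (C := C) h0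
  set w : ℝ → ℝ := fun t => t ^ (α - 1) * exp (β * t) with hw
  have w_pos : ∀ t, 0 < t → 0 < w t := fun t ht => mul_pos (Real.rpow_pos_of_pos ht _) (exp_pos _)
  have w_kc : KC w := by
    have := kc_exp_mul (-β) (kc_rpow h0)
    simpa [mul_comm, hw] using this
  have κ_kc : KC κ := KC.of_bound hκ one_pos (((kc_rpow h0).smul C).int 1) (fun t ht => bκ t ht.1)
  set ext : (Ioi (0:ℝ) →ᵇ ℝ) → ℝ → ℝ := fun v t => if h : 0 < t then w t * v ⟨t, h⟩ else 0 with hext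
  have ext_eq : ∀ v t (h : 0 < t), ext v t = w t * v ⟨t, h⟩ := fun v t h => by simp [hext, h]
  have ext_bd : ∀ v t, 0 < t → |ext v t| ≤ ‖v‖ * w t := by
    intro v t h
    rw [ext_eq v t h, abs_mul, abs_of_pos (w_pos t h), mul_comm]
    exact mul_le_mul_of_nonneg_right (v.norm_coe_le_norm _) (w_pos t h).le
  have ext_kc : ∀ v, KC (ext v) := by
    intro v
    apply kc_of_rpow_exp_bound h0 (β := β) (C := ‖v‖) _ (ext_bd v)
    rw [continuousOn_iff_continuous_domRestrict]
    have : (Ioi (0:ℝ)).domRestrict (ext v) = fun t : Ioi (0:ℝ) => w t * v t := by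
      funext t
      exact ext_eq v t t.2
    rw [this]
    exact (continuousOn_iff_continuous_domRestrict.1 w_kc.cont).mul v.continuous
  have cvb : ∀ (y : ℝ → ℝ) (M : ℝ) (t : ℝ), 0 < t → (∀ s, 0 < s → |y s| ≤ M * w s) →
      |cv κ y t| ≤ 1 / 2 * (M * w t) := by
    intro y M t ht hy
    have hM : 0 ≤ M := by
      have := (abs_nonneg _).trans (hy 1 one_pos)
      exact nonneg_of_mul_nonneg_left this (w_pos 1 one_pos)
    have hMw := mul_nonneg hM (w_pos t ht).le
    have hi : CvI (fun s => C * s ^ (α - 1)) (fun s => M * w s) t :=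
      ((kc_rpow h0).smul C).cvI (w_kc.smul M) ht
    refine (abs_cv_mono ht hi (fun s hs => bκ s hs.1) fun s hs => hy s hs.1).trans ?_
    rw [cv_smul_left, cv_smul_right]
    have := weighted_kernel_bound h0 h1 hβ ht
    calc C * (M * cv (fun s => s ^ (α - 1)) w t)
        ≤ C * (M * ((4 * (1 / β) ^ α * Gamma α) * w t)) := by gcongr
      _ = (C * (4 * (1 / β) ^ α * Gamma α)) * (M * w t) := by ring
      _ ≤ _ := mul_le_mul_of_nonneg_right hθ hMw
  have wF : ∀ t, 0 < t → |F t| ≤ C * w t := by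
    intro t ht
    refine (bF t ht).trans (mul_le_mul_of_nonneg_left ?_ hC)
    apply le_mul_of_one_le_right (rpow_nonneg ht.le _)
    exact Real.one_le_exp (by positivity)
  let Φ : (Ioi (0:ℝ) →ᵇ ℝ) → (Ioi (0:ℝ) →ᵇ ℝ) := fun v =>
    BoundedContinuousFunction.ofNormedAddCommGroup
      (fun t : Ioi (0:ℝ) => (F t + cv κ (ext v) t) / w t)
      (by
        have h1 := continuousOn_iff_continuous_domRestrict.1 hF
        have h2 := continuousOn_iff_continuous_domRestrict.1 (κ_kc.cv (ext_kc v)).cont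
        have h3 := continuousOn_iff_continuous_domRestrict.1 w_kc.cont
        exact (h1.add h2).div h3 (fun t => (w_pos t t.2).ne'))
      (C + 1 / 2 * ‖v‖)
      (by
        intro t
        have a1 := wF t t.2
        have a2 := cvb (ext v) ‖v‖ t t.2 (ext_bd v)
        have hw := w_pos t t.2
        rw [norm_div, norm_eq_abs, norm_eq_abs, abs_of_pos hw, div_le_iff₀ hw]
        calc _ ≤ _ := abs_add_le _ _
          _ ≤ _ := add_le_add a1 a2
          _ = _ := by ring)
  have Φ_contr : ContractingWith (1 / 2) Φ := by
    refine ⟨by rw [← NNReal.coe_lt_coe]; norm_num, LipschitzWith.of_dist_le_mul (fun v v' => ?_)⟩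
    rw [BoundedContinuousFunction.dist_le (by positivity)]
    intro t
    have ht : 0 < (t:ℝ) := t.2
    have hw := w_pos t ht
    have e : Φ v t - Φ v' t = cv κ (fun s => ext v s - ext v' s) t / w t := by
      rw [cv_sub_right (κ_kc.cvI (ext_kc v) ht) (κ_kc.cvI (ext_kc v') ht)]
      change (F t + cv κ (ext v) t) / w t - (F t + cv κ (ext v') t) / w t = _
      ring
    rw [Real.dist_eq, e, abs_div, abs_of_pos hw, div_le_iff₀ hw]
    refine (cvb _ (dist v v') t ht (fun s hs => ?_)).trans (le_of_eq ?_)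
    · rw [ext_eq v s hs, ext_eq v' s hs, ← mul_sub, abs_mul, abs_of_pos (w_pos s hs), mul_comm]
      apply mul_le_mul_of_nonneg_right _ (w_pos s hs).le
      rw [← Real.dist_eq]
      exact BoundedContinuousFunction.dist_coe_le_dist _
    · push_cast; ring
  obtain ⟨v, hv, -⟩ := Φ_contr.exists_fixedPoint 0 (edist_ne_top _ _)
  refine ⟨ext v, ext_kc v, ⟨β, ‖v‖, ext_bd v⟩, fun t ht => ?_⟩
  have : Φ v ⟨t, ht⟩ = v ⟨t, ht⟩ := by rw [hv]
  have h2 : Φ v ⟨t, ht⟩ = (F t + cv κ (ext v) t) / w t := rfl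
  rw [ext_eq v t ht, ← this, h2, mul_div_cancel₀ _ (w_pos t ht).ne']

/-- `P` is the relaxation kernel `t^(α-1) E_{α,α}(-lam t^α)`, characterized by its Volterra
equation. -/
structure IsRelax (α lam : ℝ) (P : ℝ → ℝ) : Prop where
  kc : KC P
  bound : ∃ β D : ℝ, ∀ t, 0 < t → |P t| ≤ D * (t ^ (α - 1) * exp (β * t))
  eq : ∀ t, 0 < t → P t = rl α t - lam * cv (rl α) P t

lemma exists_isRelax {α lam : ℝ} (h0 : 0 < α) (h1 : α < 1) : ∃ P, IsRelax α lam P := by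
  have hG := Gamma_pos_of_pos h0
  obtain ⟨y, hy, hb, he⟩ := volterra_exists (C := (1 + |lam|) / Gamma α) h0 h1
    (κ := fun t => -lam * rl α t) (F := rl α)
    ((kc_rl h0).smul (-lam)).cont (kc_rl h0).cont
    (by
      intro t ht
      rw [abs_mul, abs_neg, abs_of_pos (rl_pos h0 ht), rl, mul_div_assoc', div_mul_eq_mul_div]
      gcongr
      · linarith [abs_nonneg lam])
    (by
      intro t ht
      rw [abs_of_pos (rl_pos h0 ht), rl, div_mul_eq_mul_div]
      gcongr
      apply le_mul_of_one_le_left (rpow_nonneg ht.le _)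
      linarith [abs_nonneg lam])
  refine ⟨y, hy, hb, fun t ht => ?_⟩
  have := he t ht
  rw [cv_smul_left] at this
  linarith

lemma cv_nonneg {f g : ℝ → ℝ} {t : ℝ} (ht : 0 ≤ t) (hf : ∀ s ∈ Ioo 0 t, 0 ≤ f s)
    (hg : ∀ s ∈ Ioo 0 t, 0 ≤ g s) : 0 ≤ cv f g t := by
  rw [cv, integral_of_le ht, integral_Ioc_eq_integral_Ioo]
  apply setIntegral_nonneg measurableSet_Ioo
  intro s hs
  exact mul_nonneg (hf s hs) (hg _ ⟨by linarith [hs.2], by linarith [hs.1]⟩)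

namespace IsRelax

variable {α lam : ℝ} {P : ℝ → ℝ}

lemma eventually_pos (h0 : 0 < α) (hP : IsRelax α lam P) :
    ∀ᶠ t in 𝓝[>] (0:ℝ), 0 < P t := by
  obtain ⟨β, D, hD⟩ := hP.bound
  have hG := Gamma_pos_of_pos h0
  have hG2 := Gamma_pos_of_pos (show 0 < α + α by linarith)
  have hD0 : 0 ≤ D := by
    have := (abs_nonneg _).trans (hD 1 one_pos)
    simp only [Real.one_rpow, mul_one, one_mul] at this
    exact nonneg_of_mul_nonneg_left this (exp_pos _)
  set D' := D * exp |β| * Gamma α with hD'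
  have hD'0 : 0 ≤ D' := by positivity
  have lim : Tendsto (fun t : ℝ => |lam| * D' * Gamma α / Gamma (α + α) * t ^ α) (𝓝[>] 0) (𝓝 0) := by
    have h1 : Tendsto (fun t : ℝ => t ^ α) (𝓝 0) (𝓝 (0 ^ α)) :=
      (Real.continuousAt_rpow_const 0 α (Or.inr h0.le)).tendsto
    rw [Real.zero_rpow h0.ne'] at h1
    have := (h1.mono_left (nhdsWithin_le_nhds (s := Ioi 0))).const_mul
      (|lam| * D' * Gamma α / Gamma (α + α))
    simpa using this
  have h01 : ∀ᶠ t in 𝓝[>] (0:ℝ), t < 1 := mem_nhdsWithin_of_mem_nhds (gt_mem_nhds one_pos)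
  filter_upwards [lim.eventually (gt_mem_nhds one_pos), h01, self_mem_nhdsWithin] with t h2 ht1 ht
  have ht : 0 < t := ht
  have b : |cv (rl α) P t| ≤ D' * rl (α + α) t := by
    rw [← cv_rl h0 h0 ht, ← cv_smul_right]
    apply abs_cv_mono ht ((kc_rl h0).cvI ((kc_rl h0).smul D') ht)
    · intro s hs
      rw [abs_of_pos (rl_pos h0 hs.1)]
    · intro s hs
      refine (hD s hs.1).trans ?_
      rw [hD', rl]
      have : exp (β * s) ≤ exp |β| := by
        apply Real.exp_le_exp.2
        calc β * s ≤ |β| * 1 := mul_le_mul (le_abs_self β) (by linarith [hs.2]) hs.1.le (abs_nonneg β)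
          _ = |β| := mul_one _
      have h3 := rpow_nonneg hs.1.le (α - 1)
      calc D * (s ^ (α - 1) * exp (β * s)) ≤ D * (s ^ (α - 1) * exp |β|) := by gcongr
        _ = _ := by field_simp
  rw [hP.eq t ht]
  have b2 : |lam * cv (rl α) P t| ≤ |lam| * (D' * rl (α + α) t) := by
    rw [abs_mul]; exact mul_le_mul_of_nonneg_left b (abs_nonneg _)
  have e : |lam| * (D' * rl (α + α) t)
      = (|lam| * D' * Gamma α / Gamma (α + α) * t ^ α) * rl α t := by
    rw [rl, rl, show α + α - 1 = α + (α - 1) by ring, Real.rpow_add ht]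
    field_simp
  have := rl_pos h0 ht
  have := le_abs_self (lam * cv (rl α) P t)
  nlinarith

lemma pos_or (h0 : 0 < α) (h1 : α < 1) (hl : 0 ≤ lam) (hP : IsRelax α lam P) {t : ℝ} (ht : 0 < t) :
    0 < P t := by
  by_contra hneg
  rw [not_lt] at hneg
  obtain ⟨δ, hδ, hδP⟩ := mem_nhdsGT_iff_exists_Ioo_subset.1 (hP.eventually_pos h0)
  have hδ : 0 < δ := hδ
  have htδ : δ ≤ t := by
    by_contra h
    exact absurd (hδP ⟨ht, not_le.1 h⟩) (not_lt.2 hneg)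
  have hcl : IsClosed (Icc δ t ∩ P ⁻¹' Iic 0) :=
    (hP.kc.cont.mono (fun s hs => lt_of_lt_of_le hδ hs.1)).preimage_isClosed_of_isClosed
      isClosed_Icc isClosed_Iic
  have hne : (Icc δ t ∩ P ⁻¹' Iic 0).Nonempty := ⟨t, ⟨htδ, le_rfl⟩, hneg⟩
  have hbdd : BddBelow (Icc δ t ∩ P ⁻¹' Iic 0) := ⟨δ, fun s hs => hs.1.1⟩
  set t0 := sInf (Icc δ t ∩ P ⁻¹' Iic 0) with ht0def
  have hmem := hcl.csInf_mem hne hbdd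
  rw [← ht0def] at hmem
  have ht0 : 0 < t0 := lt_of_lt_of_le hδ hmem.1.1
  have hPt0 : P t0 ≤ 0 := hmem.2
  have hpos : ∀ s, 0 < s → s < t0 → 0 < P s := by
    intro s hs hst
    by_contra h
    rcases lt_or_ge s δ with h' | h'
    · exact h (hδP ⟨hs, h'⟩)
    · have : t0 ≤ s := csInf_le hbdd ⟨⟨h', by linarith [hmem.1.2]⟩, not_lt.1 h⟩
      linarith
  have hg := kc_rl h0
  -- the comparison inequality
  have cmp : ∀ t1, 0 < t1 → t1 < t0 → rl α t0 / rl α t1 * P t1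
      ≤ lam * ∫ s in t1..t0, rl α (t0 - s) * P s := by
    intro t1 ht1 ht10
    have hI : CvI P (rl α) t0 := hP.kc.cvI hg ht0
    have hI1 : IntervalIntegrable (fun s => P s * rl α (t0 - s)) volume 0 t1 :=
      hI.mono_set (by rw [uIcc_of_le ht1.le, uIcc_of_le ht0.le]; exact Icc_subset_Icc le_rfl ht10.le)
    have hI2 : IntervalIntegrable (fun s => P s * rl α (t0 - s)) volume t1 t0 :=
      hI.mono_set (by rw [uIcc_of_le ht10.le, uIcc_of_le ht0.le]; exact Icc_subset_Icc ht1.le le_rfl)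
    have hsplit := integral_add_adjacent_intervals hI1 hI2
    have hle : ∫ s in (0:ℝ)..t1, P s * rl α (t0 - s) ≤ rl α t0 / rl α t1 * cv P (rl α) t1 := by
      rw [cv, ← intervalIntegral.integral_const_mul]
      apply integral_mono_on_of_le_Ioo ht1.le hI1
        (((hP.kc.cvI hg ht1)).const_mul _)
      intro s hs
      have hps := hpos s hs.1 (by linarith [hs.2])
      have hk : rl α (t0 - s) ≤ rl α t0 / rl α t1 * rl α (t1 - s) := by
        rw [div_mul_eq_mul_div, le_div_iff₀ (rl_pos h0 ht1)]
        simp only [rl]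
        rw [div_mul_div_comm, div_mul_div_comm]
        have hG := Gamma_pos_of_pos h0
        refine div_le_div_of_nonneg_right ?_ (by positivity)
        rw [← Real.mul_rpow (by linarith [hs.2]) ht1.le, ← Real.mul_rpow ht0.le (by linarith [hs.2])]
        apply Real.rpow_le_rpow_of_nonpos
        · exact mul_pos ht0 (by linarith [hs.2])
        · nlinarith [hs.1, hs.2]
        · linarith
      calc P s * rl α (t0 - s) ≤ P s * (rl α t0 / rl α t1 * rl α (t1 - s)) :=
            mul_le_mul_of_nonneg_left hk hps.le
        _ = _ := by ring
    have e0 := hP.eq t0 ht0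
    have e1 := hP.eq t1 ht1
    rw [cv_comm] at e0 e1
    have hc : cv P (rl α) t0 = (∫ s in (0:ℝ)..t1, P s * rl α (t0 - s))
      + ∫ s in t1..t0, P s * rl α (t0 - s) := hsplit.symm
    have hcomm : ∫ s in t1..t0, rl α (t0 - s) * P s = ∫ s in t1..t0, P s * rl α (t0 - s) := by
      simp only [mul_comm]
    rw [hcomm]
    have h3 := mul_le_mul_of_nonneg_left hle hl
    have h4 : rl α t0 / rl α t1 * P t1 = rl α t0 - lam * (rl α t0 / rl α t1 * cv P (rl α) t1) := by
      rw [e1]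
      have := (rl_pos h0 ht1).ne'
      field_simp
    rw [h4]
    rw [hc] at e0
    linarith
  -- choose a short interval before `t0`
  have lim : Tendsto (fun r => lam * rl (α + 1) (t0 - r)) (𝓝[<] t0) (𝓝 0) := by
    have h1 : Tendsto (fun t : ℝ => t ^ α) (𝓝 0) (𝓝 (0 ^ α)) :=
      (Real.continuousAt_rpow_const 0 α (Or.inr h0.le)).tendsto
    rw [Real.zero_rpow h0.ne'] at h1
    have h2 : Tendsto (fun r => t0 - r) (𝓝[<] t0) (𝓝 0) := by
      have : Tendsto (fun r => t0 - r) (𝓝 t0) (𝓝 (t0 - t0)) :=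
        (Continuous.tendsto (by fun_prop) t0)
      rw [sub_self] at this
      exact this.mono_left nhdsWithin_le_nhds
    have := ((h1.comp h2).div_const (Gamma (α + 1))).const_mul lam
    simpa [rl] using this
  have hnear : ∀ᶠ r in 𝓝[<] t0, t0 / 2 < r := mem_nhdsWithin_of_mem_nhds (lt_mem_nhds (by linarith))
  obtain ⟨t1, ⟨hsm, ht1h⟩, ht1⟩ := ((lim.eventually (gt_mem_nhds (by norm_num : (0:ℝ) < 1 / 2))).and
    hnear |>.and self_mem_nhdsWithin).exists
  have ht1 : t1 < t0 := ht1
  have ht1p : 0 < t1 := by linarith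
  obtain ⟨m, hm, hmax⟩ := (isCompact_Icc (a := t1) (b := t0)).exists_isMaxOn ⟨t1, le_rfl, ht1.le⟩
    (hP.kc.cont.mono (fun s hs => lt_of_lt_of_le ht1p hs.1))
  have hPm : 0 < P m := lt_of_lt_of_le (hpos t1 ht1p ht1) (hmax ⟨le_rfl, ht1.le⟩)
  have hmt : m < t0 := by
    rcases lt_or_eq_of_le hm.2 with h | h
    · exact h
    · rw [h] at hPm; linarith
  have hmp : 0 < m := by linarith [hm.1]
  have h5 := cmp m hmp hmt
  have h6 : ∫ s in m..t0, rl α (t0 - s) * P s ≤ rl (α + 1) (t0 - m) * P m := by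
    have hrl : IntervalIntegrable (fun s => rl α (t0 - s)) volume m t0 := by
      have := (hg.intervalIntegrable (show 0 ≤ t0 - m by linarith)).comp_sub_left t0
      simp only [sub_zero, sub_sub_cancel] at this
      exact this.symm
    calc ∫ s in m..t0, rl α (t0 - s) * P s ≤ ∫ s in m..t0, rl α (t0 - s) * P m := by
          apply integral_mono_on_of_le_Ioo hmt.le _ (hrl.mul_const _)
          · intro s hs
            exact mul_le_mul_of_nonneg_left (hmax ⟨by linarith [hs.1, hm.1], hs.2.le⟩)
              (rl_pos h0 (by linarith [hs.2])).le
          · apply hrl.mul_continuousOn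
            rw [uIcc_of_le hmt.le]
            exact hP.kc.cont.mono (fun s hs => lt_of_lt_of_le hmp hs.1)
      _ = _ := by
          rw [intervalIntegral.integral_mul_const,
            integral_comp_sub_left (fun s => rl α s) t0, sub_self,
            ← cv_one_left, cv_one_rl h0 (by linarith)]
  have h7 : rl (α + 1) (t0 - m) ≤ rl (α + 1) (t0 - t1) := by
    simp only [rl, add_sub_cancel_right]
    have hG := Gamma_pos_of_pos (show 0 < α + 1 by linarith)
    gcongr
    exact hm.1
  have h8 : (1:ℝ) / 2 ≤ rl α t0 / rl α m := by
    rw [div_le_div_iff₀ two_pos (rl_pos h0 hmp)]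
    simp only [rl]
    have hG := Gamma_pos_of_pos h0
    rw [one_mul, div_mul_eq_mul_div]
    gcongr
    have : m ^ (α - 1) ≤ (t0 / 2) ^ (α - 1) :=
      Real.rpow_le_rpow_of_nonpos (by linarith) (by linarith [hm.1]) (by linarith)
    refine this.trans ?_
    rw [Real.div_rpow ht0.le (by norm_num), div_eq_mul_inv, ← Real.rpow_neg (by norm_num)]
    apply mul_le_mul_of_nonneg_left _ (rpow_nonneg ht0.le _)
    calc (2:ℝ) ^ (-(α - 1)) ≤ 2 ^ (1:ℝ) :=
          Real.rpow_le_rpow_of_exponent_le (by norm_num) (by linarith)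
      _ = 2 := Real.rpow_one 2
  have h9 := mul_le_mul_of_nonneg_right h8 hPm.le
  have h10 := mul_le_mul_of_nonneg_left h6 hl
  have h11 := mul_le_mul_of_nonneg_left (mul_le_mul_of_nonneg_right h7 hPm.le) hl
  have h12 := mul_lt_mul_of_pos_right hsm hPm
  nlinarith

lemma le_rl (h0 : 0 < α) (h1 : α < 1) (hl : 0 ≤ lam) (hP : IsRelax α lam P) {t : ℝ} (ht : 0 < t) :
    P t ≤ rl α t := by
  rw [hP.eq t ht]
  have := cv_nonneg (f := rl α) (g := P) ht.le (fun s hs => (rl_pos h0 hs.1).le)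
    (fun s hs => (hP.pos_or h0 h1 hl hs.1).le)
  nlinarith

end IsRelax

/-- The relaxation function `E_α(-lam t^α)` attached to the kernel `P`. -/
noncomputable def relaxS (lam : ℝ) (P : ℝ → ℝ) (t : ℝ) : ℝ := 1 - lam * ∫ s in (0:ℝ)..t, P s

lemma relaxS_zero (lam : ℝ) (P : ℝ → ℝ) : relaxS lam P 0 = 1 := by simp [relaxS]

lemma KC.hasDerivAt_integral {f : ℝ → ℝ} (hf : KC f) {t : ℝ} (ht : 0 < t) :
    HasDerivAt (fun t => ∫ s in (0:ℝ)..t, f s) (f t) t :=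
  integral_hasDerivAt_right (hf.intervalIntegrable ht.le)
    (hf.cont.stronglyMeasurableAtFilter isOpen_Ioi t ht) (hf.cont.continuousAt (Ioi_mem_nhds ht))

lemma continuousOn_integral_Icc {T : ℝ} {f : ℝ → ℝ} (hf : IntegrableOn f (Ioc 0 T)) :
    ContinuousOn (fun t => ∫ s in (0:ℝ)..t, f s) (Icc 0 T) := by
  rcases lt_or_ge T 0 with h | h
  · simp [Icc_eq_empty (not_le.2 h)]
  · have := intervalIntegral.continuousOn_primitive_interval (a := 0) (b := T) (f := f)
      (μ := volume) (by rwa [uIcc_of_le h, integrableOn_Icc_iff_integrableOn_Ioc])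
    rwa [uIcc_of_le h] at this

lemma KC.continuousOn_integral {f : ℝ → ℝ} (hf : KC f) :
    ContinuousOn (fun t => ∫ s in (0:ℝ)..t, f s) (Ici 0) := by
  intro t ht
  have := continuousOn_integral_Icc (hf.int (t + 1)) t ⟨ht, by linarith⟩
  apply this.mono_of_mem_nhdsWithin
  rw [mem_nhdsWithin]
  exact ⟨Iio (t + 1), isOpen_Iio, by simp, fun s hs => ⟨hs.2, le_of_lt hs.1⟩⟩

namespace IsRelax

variable {α lam : ℝ} {P : ℝ → ℝ}

lemma hasDerivAt_S (hP : IsRelax α lam P) {t : ℝ} (ht : 0 < t) :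
    HasDerivAt (relaxS lam P) (-(lam * P t)) t := by
  exact ((hP.kc.hasDerivAt_integral ht).const_mul lam).const_sub 1

lemma continuousOn_S (hP : IsRelax α lam P) : ContinuousOn (relaxS lam P) (Ici 0) :=
  continuousOn_const.sub (continuousOn_const.mul hP.kc.continuousOn_integral)

lemma cv_k (h0 : 0 < α) (h1 : α < 1) (hP : IsRelax α lam P) {t : ℝ} (ht : 0 < t) :
    cv (rl (1 - α)) P t = relaxS lam P t := by
  have hk := kc_rl (show 0 < 1 - α by linarith)
  have hg := kc_rl h0
  have e : cv (rl (1 - α)) P t = cv (rl (1 - α)) (fun s => rl α s - lam * cv (rl α) P s) t :=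
    cv_congr ht.le (fun _ _ => rfl) (fun s hs => hP.eq s hs.1)
  rw [e, cv_sub_right (hk.cvI hg ht) (hk.cvI ((hg.cv hP.kc).smul lam) ht), cv_rl_compl h0 h1 ht,
    cv_smul_right, ← hk.assoc hg hP.kc ht, relaxS, ← cv_one_left,
    cv_congr ht.le (fun s hs => cv_rl_compl h0 h1 hs.1) (fun _ _ => rfl)]

lemma S_nonneg (h0 : 0 < α) (h1 : α < 1) (hl : 0 ≤ lam) (hP : IsRelax α lam P) {t : ℝ}
    (ht : 0 ≤ t) : 0 ≤ relaxS lam P t := by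
  rcases ht.eq_or_lt with rfl | ht
  · simp [relaxS]
  · rw [← hP.cv_k h0 h1 ht]
    exact cv_nonneg ht.le (fun s hs => (rl_pos (by linarith) hs.1).le)
      (fun s hs => (hP.pos_or h0 h1 hl hs.1).le)

lemma antitoneOn_S (h0 : 0 < α) (h1 : α < 1) (hl : 0 ≤ lam) (hP : IsRelax α lam P) :
    AntitoneOn (relaxS lam P) (Ici 0) := by
  apply antitoneOn_of_deriv_nonpos (convex_Ici 0) hP.continuousOn_S
  · intro x hx
    rw [interior_Ici] at hx
    exact (hP.hasDerivAt_S hx).differentiableAt.differentiableWithinAt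
  · intro x hx
    rw [interior_Ici] at hx
    rw [(hP.hasDerivAt_S hx).deriv]
    have := mul_nonneg hl (hP.pos_or h0 h1 hl hx).le
    linarith

lemma S_le_one (h0 : 0 < α) (h1 : α < 1) (hl : 0 ≤ lam) (hP : IsRelax α lam P) {t : ℝ}
    (ht : 0 ≤ t) : relaxS lam P t ≤ 1 := by
  have := hP.antitoneOn_S h0 h1 hl (mem_Ici.2 le_rfl) (mem_Ici.2 ht) ht
  rwa [relaxS_zero] at this

lemma kc_S (h0 : 0 < α) (h1 : α < 1) (hl : 0 ≤ lam) (hP : IsRelax α lam P) :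
    KC (relaxS lam P) :=
  KC.of_bdd (C := 1) (hP.continuousOn_S.mono Ioi_subset_Ici_self) (fun t ht => by
    rw [abs_of_nonneg (hP.S_nonneg h0 h1 hl ht.1.le)]
    exact hP.S_le_one h0 h1 hl ht.1.le)

lemma cv_g_S (h0 : 0 < α) (h1 : α < 1) (hP : IsRelax α lam P) {t : ℝ} (ht : 0 < t) :
    cv (rl α) (relaxS lam P) t = ∫ s in (0:ℝ)..t, P s := by
  have hk := kc_rl (show 0 < 1 - α by linarith)
  have hg := kc_rl h0
  rw [cv_congr ht.le (fun _ _ => rfl) (fun s hs => (hP.cv_k h0 h1 hs.1).symm),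
    ← hg.assoc hk hP.kc ht, ← cv_one_left]
  exact cv_congr ht.le (fun s hs => by rw [cv_comm]; exact cv_rl_compl h0 h1 hs.1) (fun _ _ => rfl)

lemma S_add (h0 : 0 < α) (h1 : α < 1) (hP : IsRelax α lam P) {t : ℝ} (ht : 0 < t) :
    relaxS lam P t + lam * cv (rl α) (relaxS lam P) t = 1 := by
  rw [hP.cv_g_S h0 h1 ht, relaxS]; ring

lemma lam_mul_S_le (h0 : 0 < α) (h1 : α < 1) (hl : 0 ≤ lam) (hP : IsRelax α lam P) {t : ℝ}
    (ht : 0 < t) : lam * (t ^ α * relaxS lam P t) ≤ Gamma (α + 1) := by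
  have hg := kc_rl h0
  have hG := Gamma_pos_of_pos (show 0 < α + 1 by linarith)
  have h : relaxS lam P t * rl (α + 1) t ≤ cv (rl α) (relaxS lam P) t := by
    rw [← cv_one_rl h0 ht, ← cv_smul_left, cv_comm, cv, cv]
    apply integral_mono_on_of_le_Ioo ht.le
      (hg.cvI (kc_one.smul (relaxS lam P t)) ht) (hg.cvI (hP.kc_S h0 h1 hl) ht)
    intro s hs
    apply mul_le_mul_of_nonneg_left _ (rl_pos h0 hs.1).le
    rw [mul_one]
    exact hP.antitoneOn_S h0 h1 hl (mem_Ici.2 (by linarith [hs.2])) (mem_Ici.2 ht.le)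
      (by linarith [hs.1])
  have h2 := hP.S_add h0 h1 ht
  have h3 := hP.S_nonneg h0 h1 hl ht.le
  have h4 := mul_le_mul_of_nonneg_left h hl
  have h5 : lam * (relaxS lam P t * rl (α + 1) t) ≤ 1 := by linarith
  rw [rl, add_sub_cancel_right, ← mul_div_assoc, ← mul_div_assoc, div_le_one hG] at h5
  linarith

/-- Variation of constants. -/
lemma solve (h0 : 0 < α) (hP : IsRelax α lam P) {T : ℝ} {Y Z : ℝ → ℝ}
    (hY : IntegrableOn Y (Ioc 0 T)) (hZ : IntegrableOn Z (Ioc 0 T))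
    (h : ∀ᵐ t, t ∈ Ioc 0 T → Y t + lam * cv (rl α) Y t = cv (rl α) Z t) :
    ∀ᵐ t, t ∈ Ioc 0 T → Y t = cv P Z t := by
  have hg := kc_rl h0
  have hPZ := integrableOn_cv (hP.kc.int T) hZ
  have key : ∀ᵐ t, t ∈ Ioc 0 T → (Y t - cv P Z t)
      = cv (fun s => -lam * rl α s) (fun s => Y s - cv P Z s) t := by
    filter_upwards [h, ae_integrable_cv (hg.int T) hY, ae_integrable_cv (hg.int T) hPZ,
      cv_assoc_ae (hg.int T) (hP.kc.int T) hZ, ae_integrable_cv (hg.int T) hZ,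
      ae_integrable_cv ((hg.cv hP.kc).int T) hZ] with t e i1 i2 e2 i3 i4 ht
    rw [cv_smul_left, cv_sub_right (i1 ht) (i2 ht), ← e2 ht]
    have e3 : cv P Z t = cv (rl α) Z t - lam * cv (cv (rl α) P) Z t := by
      rw [← cv_smul_left, ← cv_sub_left (i3 ht)]
      · exact cv_congr ht.1.le (fun s hs => hP.eq s hs.1) (fun _ _ => rfl)
      · have := (i4 ht).const_mul lam
        simpa only [CvI, mul_assoc] using this
    have := e ht
    rw [e3]
    linarith
  filter_upwards [volterra_unique ((hg.smul (-lam)).int T) (hY.sub hPZ) key] with t e ht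
  have := e ht
  simp only [Pi.sub_apply] at this
  linarith

lemma lam_mul_P_le (h0 : 0 < α) (h1 : α < 1) (hl : 0 ≤ lam) (hP : IsRelax α lam P) {t : ℝ}
    (ht : 0 < t) : lam * (t * P t) ≤ α := by
  have hg := kc_rl h0
  have hS := hP.kc_S h0 h1 hl
  have hR : KC (fun t => t * P t) := by
    refine KC.of_bound (continuousOn_id.mul hP.kc.cont) one_pos (b := fun t => |P t|)
      (hP.kc.int 1).abs (fun t ht => ?_)
    rw [abs_mul, abs_of_pos ht.1]
    exact mul_le_of_le_one_left (abs_nonneg _) ht.2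
  have hZ : KC (fun t => α * relaxS lam P t) := hS.smul α
  have e : ∀ s, 0 < s → s * P s + lam * cv (rl α) (fun t => t * P t) s
      = cv (rl α) (fun t => α * relaxS lam P t) s := by
    intro s hs
    have hsg : KC (fun t => α * rl (α + 1) t) := (kc_rl (by linarith)).smul α
    have a1 : s * cv (rl α) P s
        = cv (fun t => α * rl (α + 1) t) P s + cv (rl α) (fun t => t * P t) s := by
      have : ∀ r, 0 < r → α * rl (α + 1) r = r * rl α r := by
        intro r hr
        simp only [rl]
        rw [Real.Gamma_add_one h0.ne', add_sub_cancel_right,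
          show r ^ α = r * r ^ (α - 1) by
            rw [← Real.rpow_one_add' hr.le (by linarith)]; congr 1; ring]
        field_simp
      rw [cv, cv, cv, ← intervalIntegral.integral_const_mul,
        ← intervalIntegral.integral_add (hsg.cvI hP.kc hs) (hg.cvI hR hs),
        integral_of_le hs.le, integral_of_le hs.le]
      apply setIntegral_congr_fun measurableSet_Ioc
      intro r hr
      simp only [this r hr.1]
      ring
    have a2 : cv (fun t => α * rl (α + 1) t) P s
        = α * cv (fun _ => 1) (cv (rl α) P) s := by
      rw [← kc_one.assoc hg hP.kc hs, cv_smul_left]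
      congr 1
      exact cv_congr hs.le (fun r hr => (cv_one_rl h0 hr.1).symm) (fun _ _ => rfl)
    have a3 : s * rl α s = α * cv (fun _ => 1) (rl α) s := by
      rw [cv_one_rl h0 hs, rl, rl, Real.Gamma_add_one h0.ne', add_sub_cancel_right,
          show s ^ α = s * s ^ (α - 1) by
            rw [← Real.rpow_one_add' hs.le (by linarith)]; congr 1; ring]
      field_simp
    rw [cv_smul_right, hP.cv_g_S h0 h1 hs, ← cv_one_left,
      cv_congr hs.le (fun _ _ => rfl) (fun r hr => hP.eq r hr.1),
      cv_sub_right (kc_one.cvI hg hs) (kc_one.cvI ((hg.cv hP.kc).smul lam) hs), cv_smul_right]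
    conv_lhs => rw [hP.eq s hs]
    linear_combination a3 - lam * a1 - lam * a2
  have key := eq_of_ae_of_cont (T := t) (hR.cont.mono fun s hs => hs.1)
    ((hP.kc.cv hZ).cont.mono fun s hs => hs.1)
    (hP.solve h0 (hR.int t) (hZ.int t) (Eventually.of_forall fun s hs => e s hs.1)) t ⟨ht, le_rfl⟩
  rw [key, cv_smul_right]
  have b : cv P (relaxS lam P) t ≤ ∫ s in (0:ℝ)..t, P s := by
    rw [← cv_one_left, cv_comm _ P]
    apply integral_mono_on_of_le_Ioo ht.le (hP.kc.cvI hS ht)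
      (hP.kc.cvI kc_one ht)
    intro s hs
    exact mul_le_mul_of_nonneg_left (hP.S_le_one h0 h1 hl (by linarith [hs.2]))
      (hP.pos_or h0 h1 hl hs.1).le
  have c := hP.S_nonneg h0 h1 hl ht.le
  rw [relaxS] at c
  have d := mul_le_mul_of_nonneg_left b hl
  nlinarith

end IsRelax

section CompactOperator

variable {M : Type*} [NormedAddCommGroup M] [InnerProductSpace ℝ M]

/-- The frame operator `∫ e_x ⊗ e_x dx` of a continuous curve. -/
noncomputable def frameOp [CompleteSpace M] (e : ℝ → M) (l : ℝ) : M →L[ℝ] M :=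
  ∫ x in (0:ℝ)..l, InnerProductSpace.rankOne ℝ (e x) (e x)

lemma isCompactOperator_rankOne (x y : M) :
    IsCompactOperator (InnerProductSpace.rankOne ℝ x y : M →L[ℝ] M) := by
  rw [InnerProductSpace.rankOne_def']
  have : IsCompactOperator (innerSL ℝ y : M →L[ℝ] ℝ) := by
    have h : IsCompactOperator (id : ℝ → ℝ) := isCompactOperator_id_iff_finiteDimensional (𝕜 := ℝ) |>.2 inferInstance
    exact h.comp_clm (innerSL ℝ y)
  exact this.clm_comp (ContinuousLinearMap.toSpanSingleton ℝ x)

lemma continuous_rankOne {e : ℝ → M} (he : Continuous e) :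
    Continuous fun x => (InnerProductSpace.rankOne ℝ (e x) (e x) : M →L[ℝ] M) := by
  have h1 : Continuous fun x => (InnerProductSpace.rankOne ℝ (e x) : M →L⋆[ℝ] M →L[ℝ] M) :=
    (InnerProductSpace.rankOne ℝ).continuous.comp he
  exact h1.clm_apply he

variable [CompleteSpace M]

lemma isCompactOperator_frameOp {e : ℝ → M} (he : Continuous e) (l : ℝ) :
    IsCompactOperator (frameOp e l) := by
  set 𝒦 := compactOperator (RingHom.id ℝ) M M with h𝒦
  have : IsClosed (𝒦 : Set (M →L[ℝ] M)) := isClosed_setOfPred_isCompactOperator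
  have : CompleteSpace 𝒦 := IsClosed.completeSpace_coe
  let E : ℝ → 𝒦 := fun x => ⟨InnerProductSpace.rankOne ℝ (e x) (e x), isCompactOperator_rankOne _ _⟩
  have hE : Continuous E := (continuous_rankOne he).subtype_mk _
  have h := ContinuousLinearMap.intervalIntegral_comp_comm (𝕜 := ℝ) (E := 𝒦) (F := M →L[ℝ] M)
    𝒦.subtypeₗᵢ.toContinuousLinearMap (hE.intervalIntegrable (μ := volume) 0 l)
  have h2 : frameOp e l = 𝒦.subtypeₗᵢ.toContinuousLinearMap (∫ x in (0:ℝ)..l, E x) := h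
  rw [h2]
  exact (∫ x in (0:ℝ)..l, E x).2

lemma inner_frameOp {e : ℝ → M} (he : Continuous e) (l : ℝ) (v w : M) :
    ⟪frameOp e l v, w⟫ = ∫ x in (0:ℝ)..l, ⟪e x, v⟫ * ⟪e x, w⟫ := by
  have h1 := ((innerSL ℝ w).comp (ContinuousLinearMap.apply ℝ M v)).intervalIntegral_comp_comm
    ((continuous_rankOne he).intervalIntegrable (μ := volume) 0 l)
  simp only [ContinuousLinearMap.comp_apply, ContinuousLinearMap.apply_apply,
    innerSL_apply_apply, InnerProductSpace.rankOne_apply, inner_smul_right] at h1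
  rw [real_inner_comm, frameOp, ← h1]
  simp only [real_inner_comm]

lemma isSymmetric_frameOp {e : ℝ → M} (he : Continuous e) (l : ℝ) :
    (frameOp e l : M →ₗ[ℝ] M).IsSymmetric := by
  intro v w
  rw [ContinuousLinearMap.coe_coe, inner_frameOp he, real_inner_comm, inner_frameOp he]
  simp only [mul_comm]

end CompactOperator

lemma exists_eigenbasis {M : Type} [NormedAddCommGroup M] [InnerProductSpace ℝ M] [CompleteSpace M]
    {T : M →L[ℝ] M} (hT : IsCompactOperator T) (hs : (T : M →ₗ[ℝ] M).IsSymmetric) :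
    ∃ (ι : Type) (w : HilbertBasis ι ℝ M) (μ : ι → ℝ), ∀ i, T (w i) = μ i • w i := by
  let V : ℝ → Submodule ℝ M := fun μ => Module.End.eigenspace (T : Module.End ℝ M) μ
  have hV : OrthogonalFamily ℝ (fun μ => V μ) fun μ => (V μ).subtypeₗᵢ :=
    hs.orthogonalFamily_eigenspaces
  have : ∀ μ, CompleteSpace (V μ) := by
    intro μ
    have : IsClosed (V μ : Set M) := by
      have : (V μ : Set M) = {x | T x = μ • x} := by
        ext x; simp [V]
      rw [this]
      exact isClosed_eq T.continuous (continuous_const_smul μ)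
    exact this.completeSpace_coe
  choose s b hb using fun μ => exists_hilbertBasis ℝ (V μ)
  have ho : Orthonormal ℝ (fun a : Σ μ, s μ => ((b a.1 a.2 : V a.1) : M)) :=
    hV.orthonormal_sigma_orthonormal (fun μ => (b μ).orthonormal)
  have hsp : (Submodule.span ℝ (range fun a : Σ μ, s μ => ((b a.1 a.2 : V a.1) : M)))ᗮ = ⊥ := by
    rw [eq_bot_iff, ← ContinuousLinearMap.orthogonalComplement_iSup_eigenspaces_eq_bot hT hs]
    intro x hx
    rw [← Submodule.iInf_orthogonal, Submodule.mem_iInf]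
    intro μ
    rw [Submodule.mem_orthogonal]
    intro y hy
    have h0 := (b μ).hasSum_repr ⟨y, hy⟩
    have h1 := ((innerSL ℝ x).comp (V μ).subtypeL).hasSum h0
    simp only [ContinuousLinearMap.comp_apply, map_smul, innerSL_apply_apply,
      Submodule.subtypeL_apply, smul_eq_mul] at h1
    have h2 : ∀ i, ⟪x, ((b μ i : V μ) : M)⟫ = 0 := by
      intro i
      exact Submodule.inner_left_of_mem_orthogonal (Submodule.subset_span (mem_range_self (⟨μ, i⟩ : Σ μ, s μ))) hx
    simp only [h2, mul_zero] at h1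
    rw [real_inner_comm]
    exact h1.unique hasSum_zero
  refine ⟨_, HilbertBasis.mkOfOrthogonalEqBot ho hsp, fun a => a.1, fun a => ?_⟩
  rw [HilbertBasis.coe_mkOfOrthogonalEqBot]
  exact Module.End.mem_eigenspace_iff.1 (b a.1 a.2).2

/-- `-(p U')' + q U = ζ` on `(0,l)`, with flux `D = p U'`. -/
def Ell (p q : ℝ → ℝ) (l : ℝ) (U ζ : ℝ → ℝ) : Prop :=
  ∃ D : ℝ → ℝ, ∀ x ∈ Ioo 0 l, HasDerivAt U (D x / p x) x ∧ HasDerivAt D (q x * U x - ζ x) x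

/-- The square integrable functions on `(0,l]`. -/
abbrev L2space (l : ℝ) : Type := Lp ℝ 2 (volume.restrict (Ioc (0:ℝ) l))

lemma memLp_of_continuousOn {l : ℝ} {f : ℝ → ℝ} (hf : ContinuousOn f (Icc 0 l)) :
    MemLp f 2 (volume.restrict (Ioc (0:ℝ) l)) := by
  obtain ⟨C, hC⟩ := isCompact_Icc.exists_bound_of_continuousOn hf
  refine MemLp.of_bound ((hf.mono Ioc_subset_Icc_self).aestronglyMeasurable measurableSet_Ioc) C ?_
  filter_upwards [ae_restrict_mem measurableSet_Ioc] with x hx using hC x (Ioc_subset_Icc_self hx)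

lemma inner_toLp {l : ℝ} {f : ℝ → ℝ} (hf : MemLp f 2 (volume.restrict (Ioc (0:ℝ) l)))
    (a : L2space l) : ⟪hf.toLp f, a⟫ = ∫ x in Ioc 0 l, f x * a x := by
  rw [L2.inner_def]
  apply integral_congr_ae
  filter_upwards [hf.coeFn_toLp] with x hx
  rw [hx, real_inner_eq_re_inner, mul_comm]
  simp

lemma inner_toLp_toLp {l : ℝ} {f g : ℝ → ℝ} (hf : MemLp f 2 (volume.restrict (Ioc (0:ℝ) l)))
    (hg : MemLp g 2 (volume.restrict (Ioc (0:ℝ) l))) :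
    ⟪hf.toLp f, hg.toLp g⟫ = ∫ x in Ioc 0 l, f x * g x := by
  rw [inner_toLp]
  apply integral_congr_ae
  filter_upwards [hg.coeFn_toLp] with x hx
  rw [hx]

section

variable {p q : ℝ → ℝ} {l : ℝ}

/-- Projection of the line to `[0,l]`. -/
noncomputable def clamp (l x : ℝ) : ℝ := max 0 (min x l)

lemma continuous_clamp (l : ℝ) : Continuous (clamp l) := by unfold clamp; fun_prop

lemma clamp_eq {x : ℝ} (hx : x ∈ Icc 0 l) : clamp l x = x := by
  rw [clamp, min_eq_left hx.2, max_eq_right hx.1]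

lemma clamp_mem (hl : 0 ≤ l) (x : ℝ) : clamp l x ∈ Icc 0 l :=
  ⟨le_max_left _ _, max_le hl (min_le_right _ _)⟩

lemma continuous_inv_sqrt (hp : Continuous p) (hp0 : ∀ x, 0 < p x) :
    Continuous fun x => (√(p x))⁻¹ :=
  (Real.continuous_sqrt.comp hp).inv₀ fun x => (Real.sqrt_pos.2 (hp0 x)).ne'

/-- Coefficients of the elliptic operator, extended to the whole line. -/
structure Coef (p q : ℝ → ℝ) : Prop where
  pc : Continuous p
  p0 : ∀ x, 0 < p x
  qc : Continuous q
  q0 : ∀ x, 0 ≤ q x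

lemma memLp_ev (h : Coef p q) (l x : ℝ) :
    MemLp ((Ioc 0 (clamp l x)).indicator fun x => (√(p x))⁻¹) 2
      (volume.restrict (Ioc (0:ℝ) l)) :=
  (memLp_of_continuousOn (continuous_inv_sqrt h.pc h.p0).continuousOn).indicator measurableSet_Ioc

/-- Evaluation vectors: `⟪ev x, a⟫ = ∫_0^x a/√p`. -/
noncomputable def ev (h : Coef p q) (l x : ℝ) : L2space l := (memLp_ev h l x).toLp _

lemma inner_ev (h : Coef p q) {x : ℝ} (hx : x ∈ Icc 0 l) (a : L2space l) :
    ⟪ev h l x, a⟫ = ∫ s in (0:ℝ)..x, (√(p s))⁻¹ * a s := by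
  rw [ev, inner_toLp, clamp_eq hx, integral_of_le hx.1]
  simp_rw [← indicator_mul_left]
  rw [setIntegral_indicator measurableSet_Ioc, Ioc_inter_Ioc]
  simp [hx.2]

lemma inner_ev_toLp (h : Coef p q) {x : ℝ} (hx : x ∈ Icc 0 l) {f : ℝ → ℝ}
    (hf : MemLp f 2 (volume.restrict (Ioc (0:ℝ) l))) :
    ⟪ev h l x, hf.toLp f⟫ = ∫ s in (0:ℝ)..x, (√(p s))⁻¹ * f s := by
  rw [ev, inner_toLp_toLp, clamp_eq hx, integral_of_le hx.1]
  simp_rw [← indicator_mul_left]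
  rw [setIntegral_indicator measurableSet_Ioc, Ioc_inter_Ioc]
  simp [hx.2]

lemma inner_ev_ev (h : Coef p q) (hl : 0 ≤ l) (x y : ℝ) :
    ⟪ev h l x, ev h l y⟫ = ∫ s in (0:ℝ)..(min (clamp l x) (clamp l y)), (p s)⁻¹ := by
  have hx := clamp_mem hl x
  have hy := clamp_mem hl y
  rw [ev, ev, inner_toLp_toLp, integral_of_le (le_min hx.1 hy.1)]
  simp_rw [← inter_indicator_mul]
  rw [setIntegral_indicator (measurableSet_Ioc.inter measurableSet_Ioc), Ioc_inter_Ioc, Ioc_inter_Ioc]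
  have : min l (min (clamp l x) (clamp l y)) = min (clamp l x) (clamp l y) :=
    min_eq_right ((min_le_left _ _).trans hx.2)
  simp only [max_self, this]
  apply setIntegral_congr_fun measurableSet_Ioc
  intro s _
  simp only
  rw [← mul_inv, Real.mul_self_sqrt (h.p0 s).le]

lemma Coef.inv_cont (h : Coef p q) : Continuous fun s => (p s)⁻¹ := h.pc.inv₀ fun x => (h.p0 x).ne'

lemma Coef.continuous_primitive (h : Coef p q) : Continuous fun z => ∫ s in (0:ℝ)..z, (p s)⁻¹ :=
  intervalIntegral.continuous_primitive (fun a b => h.inv_cont.intervalIntegrable a b) 0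

lemma continuous_ev (h : Coef p q) (hl : 0 ≤ l) : Continuous (ev h l) := by
  rw [continuous_iff_continuousAt]
  intro x
  rw [ContinuousAt, tendsto_iff_norm_sub_tendsto_zero]
  set G : ℝ → ℝ := fun z => ∫ s in (0:ℝ)..z, (p s)⁻¹
  have hG : Continuous G := h.continuous_primitive
  have e : ∀ y, ‖ev h l y - ev h l x‖ = √(G (min (clamp l y) (clamp l y))
      - 2 * G (min (clamp l y) (clamp l x)) + G (min (clamp l x) (clamp l x))) := by
    intro y
    rw [← Real.sqrt_sq (norm_nonneg (ev h l y - ev h l x)), norm_sub_sq_real,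
      ← real_inner_self_eq_norm_sq, ← real_inner_self_eq_norm_sq, inner_ev_ev h hl,
      inner_ev_ev h hl, inner_ev_ev h hl]
  simp_rw [e]
  have hc := continuous_clamp l
  have : Continuous fun y => √(G (min (clamp l y) (clamp l y))
      - 2 * G (min (clamp l y) (clamp l x)) + G (min (clamp l x) (clamp l x))) := by fun_prop
  convert this.tendsto x using 2
  simp
  ring_nf
  simp

lemma ev_zero (h : Coef p q) (hl : 0 ≤ l) : ev h l 0 = 0 := by
  rw [← inner_self_eq_zero (𝕜 := ℝ), inner_ev_ev h hl, clamp_eq ⟨le_rfl, hl⟩]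
  simp

lemma memLp_mulSqrt (h : Coef p q) (hl : 0 ≤ l) (a : L2space l) :
    MemLp (fun x => √(q x) * ⟪ev h l x, a⟫) 2 (volume.restrict (Ioc (0:ℝ) l)) :=
  memLp_of_continuousOn ((Real.continuous_sqrt.comp h.qc).mul
    ((continuous_ev h hl).inner continuous_const)).continuousOn

/-- The operator `a ↦ √q ∫_0^x a/√p`. -/
noncomputable def potOp (h : Coef p q) (hl : 0 ≤ l) : L2space l →ₗ[ℝ] L2space l where
  toFun a := (memLp_mulSqrt h hl a).toLp _
  map_add' a b := by
    rw [← MemLp.toLp_add]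
    congr 1
    ext x
    simp [inner_add_right, mul_add]
  map_smul' c a := by
    rw [RingHom.id_apply, ← MemLp.toLp_const_smul]
    congr 1
    ext x
    simp [inner_smul_right]
    ring

lemma inner_potOp (h : Coef p q) (hl : 0 ≤ l) (a b : L2space l) :
    ⟪potOp h hl a, potOp h hl b⟫ = ∫ x in (0:ℝ)..l, q x * ⟪ev h l x, a⟫ * ⟪ev h l x, b⟫ := by
  rw [integral_of_le hl]
  refine (inner_toLp_toLp (memLp_mulSqrt h hl a) (memLp_mulSqrt h hl b)).trans (setIntegral_congr_fun measurableSet_Ioc fun x _ => ?_)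
  have := Real.mul_self_sqrt (h.q0 x)
  linear_combination (⟪ev h l x, a⟫ * ⟪ev h l x, b⟫) * this

lemma exists_potOp_bound (h : Coef p q) (hl : 0 ≤ l) :
    ∃ C, ∀ a, ‖potOp h hl a‖ ≤ C * ‖a‖ := by
  have hc : Continuous fun x => q x * ‖ev h l x‖ ^ 2 := h.qc.mul ((continuous_ev h hl).norm.pow 2)
  set I := ∫ x in (0:ℝ)..l, q x * ‖ev h l x‖ ^ 2
  have hI : 0 ≤ I := intervalIntegral.integral_nonneg hl fun x _ => mul_nonneg (h.q0 x) (sq_nonneg _)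
  refine ⟨√I, fun a => ?_⟩
  refine abs_le_of_sq_le_sq' ?_ (by positivity) |>.2
  rw [mul_pow, Real.sq_sqrt hI, ← real_inner_self_eq_norm_sq, inner_potOp,
    ← intervalIntegral.integral_mul_const]
  have hev := continuous_ev h hl
  have hq := h.qc
  apply integral_mono_on hl
  · exact intervalIntegrable_cont
  · exact (hc.mul continuous_const).intervalIntegrable _ _
  · intro x _
    have h1 := abs_real_inner_le_norm (ev h l x) a
    have h2 : ⟪ev h l x, a⟫ ^ 2 ≤ (‖ev h l x‖ * ‖a‖) ^ 2 := sq_le_sq' (by linarith [neg_abs_le ⟪ev h l x, a⟫]) (by linarith [le_abs_self ⟪ev h l x, a⟫])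
    have h3 := mul_le_mul_of_nonneg_left h2 (h.q0 x)
    linarith

/-- `potOp` as a continuous operator. -/
noncomputable def potL (h : Coef p q) (hl : 0 ≤ l) : L2space l →L[ℝ] L2space l :=
  (potOp h hl).mkContinuousOfExistsBound (exists_potOp_bound h hl)

/-- The energy space: pairs `(√p U', √q U)` with `U` vanishing at the end points. -/
noncomputable def energySpace (h : Coef p q) (hl : 0 ≤ l) :
    Submodule ℝ (WithLp 2 (L2space l × L2space l)) :=
  ((innerSL ℝ (ev h l l)).comp (WithLp.fstL 2 ℝ (L2space l) (L2space l))).ker ⊓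
    (WithLp.sndL 2 ℝ (L2space l) (L2space l)
      - (potL h hl).comp (WithLp.fstL 2 ℝ (L2space l) (L2space l))).ker

lemma mem_energySpace (h : Coef p q) (hl : 0 ≤ l) {w : WithLp 2 (L2space l × L2space l)} :
    w ∈ energySpace h hl ↔ ⟪ev h l l, w.fst⟫ = 0 ∧ w.snd = potOp h hl w.fst := by
  simp [energySpace, potL, sub_eq_zero]

instance (h : Coef p q) (hl : 0 ≤ l) : CompleteSpace (energySpace h hl) :=
  ((ContinuousLinearMap.isClosed_ker _).inter (ContinuousLinearMap.isClosed_ker _)).completeSpace_coe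

/-- The element of the energy space with first component `a`. -/
noncomputable def mkEnergy (h : Coef p q) (hl : 0 ≤ l) (a : L2space l) (ha : ⟪ev h l l, a⟫ = 0) :
    energySpace h hl :=
  ⟨WithLp.toLp 2 (a, potOp h hl a), (mem_energySpace h hl).2 ⟨ha, rfl⟩⟩

/-- Evaluation vectors in the energy space. -/
noncomputable def evE (h : Coef p q) (hl : 0 ≤ l) (x : ℝ) : energySpace h hl :=
  (energySpace h hl).orthogonalProjectionOnto (WithLp.toLp 2 (ev h l x, 0))

lemma inner_evE (h : Coef p q) (hl : 0 ≤ l) (x : ℝ) (w : energySpace h hl) :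
    ⟪evE h hl x, w⟫ = ⟪ev h l x, w.1.fst⟫ := by
  rw [evE, Submodule.inner_orthogonalProjectionOnto_eq_of_mem_right, WithLp.prod_inner_apply]
  simp

lemma continuous_evE (h : Coef p q) (hl : 0 ≤ l) : Continuous (evE h hl) := by
  have := continuous_ev h hl
  unfold evE
  fun_prop

lemma evE_zero (h : Coef p q) (hl : 0 ≤ l) : evE h hl 0 = 0 := by
  rw [← inner_self_eq_zero (𝕜 := ℝ), inner_evE h hl, ev_zero h hl, inner_zero_left]

lemma eq_zero_of_forall_inner_evE (h : Coef p q) (hl : 0 ≤ l) {w : energySpace h hl}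
    (hw : ∀ x ∈ Icc 0 l, ⟪evE h hl x, w⟫ = 0) : w = 0 := by
  have h1 : ∀ x ∈ Icc 0 l, ∫ s in (0:ℝ)..x, (√(p s))⁻¹ * w.1.fst s = 0 := by
    intro x hx
    rw [← inner_ev h hx, ← inner_evE h hl]
    exact hw x hx
  have hint : IntegrableOn (fun s => (√(p s))⁻¹ * w.1.fst s) (Ioc 0 l) :=
    MemLp.integrable_mul (p := 2) (q := 2)
      (memLp_of_continuousOn (continuous_inv_sqrt h.pc h.p0).continuousOn) (Lp.memLp _)
  have h2 : ∀ᵐ s, s ∈ Ioo 0 l → (√(p s))⁻¹ * w.1.fst s = 0 := by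
    have hI : IntervalIntegrable (fun s => (√(p s))⁻¹ * w.1.fst s) volume 0 l := by
      rwa [intervalIntegrable_iff_integrableOn_Ioc_of_le hl]
    filter_upwards [hI.ae_hasDerivAt_integral] with s hs hs1
    have hs2 := hs (by rw [uIcc_of_le hl]; exact Ioo_subset_Icc_self hs1) 0
      (by rw [uIcc_of_le hl]; exact ⟨le_rfl, hl⟩)
    have : (fun x => ∫ s in (0:ℝ)..x, (√(p s))⁻¹ * w.1.fst s) =ᶠ[𝓝 s] fun _ => 0 := by
      filter_upwards [Ioo_mem_nhds hs1.1 hs1.2] with x hx using h1 x (Ioo_subset_Icc_self hx)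
    exact hs2.unique ((hasDerivAt_const s (0:ℝ)).congr_of_eventuallyEq this)
  have h3 : w.1.fst = 0 := by
    apply Lp.ext
    have h2' := (ae_restrict_iff' measurableSet_Ioo).2 h2
    rw [Measure.restrict_congr_set Ioo_ae_eq_Ioc] at h2'
    filter_upwards [h2', Lp.coeFn_zero ℝ 2 (volume.restrict (Ioc 0 l))] with s hs h0
    rw [h0]
    exact (mul_eq_zero.1 hs).resolve_left (inv_ne_zero (Real.sqrt_pos.2 (h.p0 s)).ne')
  have h4 := ((mem_energySpace h hl).1 w.2).2
  rw [h3, map_zero] at h4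
  apply Subtype.ext
  exact (WithLp.ofLp_injective 2) (Prod.ext h3 h4)

lemma ell_of_inner (h : Coef p q) (hl : 0 ≤ l) (m w : energySpace h hl)
    (hmw : ∀ m', ⟪w, m'⟫ = ∫ x in (0:ℝ)..l, ⟪evE h hl x, m⟫ * ⟪evE h hl x, m'⟫) :
    Ell p q l (fun x => ⟪evE h hl x, w⟫) (fun x => ⟪evE h hl x, m⟫) := by
  have hev := continuous_ev h hl
  have hevE := continuous_evE h hl
  have hq := h.qc
  set ξ : ℝ → ℝ := fun x => ⟪evE h hl x, m⟫ - q x * ⟪evE h hl x, w⟫ with hξ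
  have hξc : Continuous ξ := by fun_prop
  set v : L2space l := ∫ x in (0:ℝ)..l, ξ x • ev h l x with hv
  have hvi : ∀ b, ⟪v, b⟫ = ∫ x in (0:ℝ)..l, ξ x * ⟪ev h l x, b⟫ := by
    intro b
    have := (innerSL ℝ b).intervalIntegral_comp_comm
      (show IntervalIntegrable (fun x => ξ x • ev h l x) volume 0 l from
        (hξc.smul hev).intervalIntegrable 0 l)
    simp only [innerSL_apply_apply, inner_smul_right] at this
    rw [real_inner_comm, hv, ← this]
    simp only [real_inner_comm]
  set a := w.1.fst with ha
  have horth : ∀ b : L2space l, ⟪ev h l l, b⟫ = 0 → ⟪a - v, b⟫ = 0 := by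
    intro b hb
    have h1 := hmw (mkEnergy h hl b hb)
    rw [Submodule.coe_inner, WithLp.prod_inner_apply] at h1
    have h2 : w.1.snd = potOp h hl a := ((mem_energySpace h hl).1 w.2).2
    have h3 : ⟪a, b⟫ + ⟪potOp h hl a, potOp h hl b⟫
        = ∫ x in (0:ℝ)..l, ⟪evE h hl x, m⟫ * ⟪ev h l x, b⟫ := by
      rw [← h2]
      simp only [inner_evE h hl _ (mkEnergy h hl b hb)] at h1
      exact h1
    rw [inner_potOp] at h3
    rw [inner_sub_left, hvi, sub_eq_zero, eq_sub_of_add_eq h3,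
      ← intervalIntegral.integral_sub intervalIntegrable_cont
        intervalIntegrable_cont]
    apply integral_congr
    intro x _
    simp only [hξ, inner_evE h hl x w]
    ring
  obtain ⟨c, hc⟩ : ∃ c : ℝ, a = v + c • ev h l l := by
    set N := ⟪ev h l l, ev h l l⟫ with hN
    refine ⟨⟪ev h l l, a - v⟫ / N, ?_⟩
    set c := ⟪ev h l l, a - v⟫ / N
    set b := a - v - c • ev h l l with hb
    have h1 : ⟪ev h l l, b⟫ = 0 := by
      rw [hb, inner_sub_right, inner_smul_right]
      by_cases hN0 : N = 0
      · rw [inner_self_eq_zero.1 hN0]; simp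
      · simp only [c]
        rw [← hN]
        field_simp
        ring
    have h2 : ⟪b, b⟫ = 0 := by
      rw [show ⟪b, b⟫ = ⟪a - v - c • ev h l l, b⟫ from rfl, inner_sub_left, horth b h1,
        inner_smul_left, h1]
      simp
    have h3 := inner_self_eq_zero.1 h2
    rw [hb, sub_eq_zero] at h3
    rw [← h3]; abel
  set G : ℝ → ℝ := fun z => ∫ s in (0:ℝ)..z, (p s)⁻¹ with hG
  have hGc : Continuous G := h.continuous_primitive
  set Θ : ℝ → ℝ := fun z => ∫ s in z..l, ξ s with hΘ
  have hU : ∀ y ∈ Icc 0 l, ⟪evE h hl y, w⟫ = (∫ x in (0:ℝ)..y, ξ x * G x) + G y * Θ y + c * G y := by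
    intro y hy
    rw [inner_evE, ← ha, hc, inner_add_right, real_inner_comm, hvi, inner_smul_right,
      inner_ev_ev h hl, clamp_eq hy, clamp_eq ⟨hl, le_rfl⟩, min_eq_left hy.2]
    congr 1
    have hcl := continuous_clamp l
    rw [← integral_add_adjacent_intervals (b := y)
      intervalIntegrable_cont
      intervalIntegrable_cont, hΘ,
      ← intervalIntegral.integral_const_mul]
    congr 1
    · apply integral_congr
      intro x hx
      rw [uIcc_of_le hy.1] at hx
      simp only [inner_ev_ev h hl]
      rw [clamp_eq hy, clamp_eq ⟨hx.1, hx.2.trans hy.2⟩, min_eq_left hx.2]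
    · apply integral_congr
      intro x hx
      rw [uIcc_of_le hy.2] at hx
      simp only [inner_ev_ev h hl]
      rw [clamp_eq hy, clamp_eq ⟨hy.1.trans hx.1, hx.2⟩, min_eq_right hx.1, mul_comm]
  refine ⟨fun y => Θ y + c, fun y hy => ?_⟩
  have dG : HasDerivAt G (p y)⁻¹ y :=
    integral_hasDerivAt_right (h.inv_cont.intervalIntegrable _ _)
      h.inv_cont.stronglyMeasurable.stronglyMeasurableAtFilter h.inv_cont.continuousAt
  have dΘ : HasDerivAt Θ (-ξ y) y :=
    intervalIntegral.integral_hasDerivAt_left (hξc.intervalIntegrable _ _)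
      hξc.stronglyMeasurable.stronglyMeasurableAtFilter hξc.continuousAt
  have dI : HasDerivAt (fun y => ∫ x in (0:ℝ)..y, ξ x * G x) (ξ y * G y) y :=
    integral_hasDerivAt_right ((hξc.mul hGc).intervalIntegrable _ _)
      (hξc.mul hGc).stronglyMeasurable.stronglyMeasurableAtFilter (hξc.mul hGc).continuousAt
  constructor
  · have h1 := (dI.add (dG.mul dΘ)).add (dG.const_mul c)
    refine (h1.congr_of_eventuallyEq ?_).congr_deriv ?_
    · filter_upwards [Ioo_mem_nhds hy.1 hy.2] with z hz
      exact hU z (Ioo_subset_Icc_self hz)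
    · have := (h.p0 y).ne'
      field_simp
      ring
  · refine (dΘ.add_const c).congr_deriv ?_
    simp only [hξ]
    ring

lemma exists_energy_rep (h : Coef p q) (hl : 0 ≤ l) {φ : ℝ → ℝ}
    (hd : ∀ x ∈ Icc 0 l, DifferentiableAt ℝ φ x) (hc : ContinuousOn (deriv φ) (Icc 0 l))
    (h0 : φ 0 = 0) (hφl : φ l = 0) :
    ∃ m : energySpace h hl, ∀ x ∈ Icc 0 l, ⟪evE h hl x, m⟫ = φ x := by
  have hm : MemLp (fun x => √(p x) * deriv φ x) 2 (volume.restrict (Ioc (0:ℝ) l)) :=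
    memLp_of_continuousOn ((Real.continuous_sqrt.comp h.pc).continuousOn.mul hc)
  have key : ∀ x ∈ Icc 0 l, ⟪ev h l x, hm.toLp _⟫ = φ x := by
    intro x hx
    rw [inner_ev_toLp h hx]
    have : ∀ s, (√(p s))⁻¹ * (√(p s) * deriv φ s) = deriv φ s := by
      intro s
      have := (Real.sqrt_pos.2 (h.p0 s)).ne'
      field_simp
    simp only [this]
    rw [intervalIntegral.integral_deriv_eq_sub, h0, sub_zero]
    · intro s hs
      rw [uIcc_of_le hx.1] at hs
      exact hd s ⟨hs.1, hs.2.trans hx.2⟩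
    · apply ContinuousOn.intervalIntegrable
      rw [uIcc_of_le hx.1]
      exact hc.mono (Icc_subset_Icc_right hx.2)
  refine ⟨mkEnergy h hl _ ((key l ⟨hl, le_rfl⟩).trans hφl), fun x hx => ?_⟩
  rw [inner_evE]
  exact key x hx

lemma evE_right (h : Coef p q) (hl : 0 ≤ l) : evE h hl l = 0 := by
  rw [← inner_self_eq_zero (𝕜 := ℝ), inner_evE h hl]
  exact ((mem_energySpace h hl).1 (evE h hl l).2).1

end

/-- Spectral data of the elliptic operator with Dirichlet conditions: `e x` represents the
evaluation at `x` and `B` the inverse operator, diagonal in the basis `w`. -/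
structure Spec {M ι : Type} [NormedAddCommGroup M] [InnerProductSpace ℝ M]
    (p q : ℝ → ℝ) (l : ℝ) (e : ℝ → M) (B : M →L[ℝ] M) (w : HilbertBasis ι ℝ M)
    (mu : ι → ℝ) : Prop where
  countable : Countable ι
  cont : Continuous e
  left : e 0 = 0
  right : e l = 0
  inner_B : ∀ m n, ⟪B m, n⟫ = ∫ x in (0:ℝ)..l, ⟪e x, m⟫ * ⟪e x, n⟫
  mu_pos : ∀ i, 0 < mu i
  B_w : ∀ i, B (w i) = mu i • w i
  ell : ∀ m, Ell p q l (fun x => ⟪e x, B m⟫) (fun x => ⟪e x, m⟫)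

lemma countable_of_eigen {M ι : Type} [NormedAddCommGroup M] [InnerProductSpace ℝ M]
    {l : ℝ} (hl : 0 ≤ l) {e : ℝ → M} (he : Continuous e) {w : ι → M} (hw : Orthonormal ℝ w)
    (hpos : ∀ i, 0 < ∫ x in (0:ℝ)..l, ⟪e x, w i⟫ * ⟪e x, w i⟫) : Countable ι := by
  have hs : Summable fun i => ∫ x in (0:ℝ)..l, ⟪e x, w i⟫ * ⟪e x, w i⟫ := by
    refine summable_of_sum_le (c := ∫ x in (0:ℝ)..l, ‖e x‖ ^ 2) (fun i => (hpos i).le) fun s => ?_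
    rw [← intervalIntegral.integral_finsetSum fun i _ =>
      intervalIntegrable_cont]
    refine integral_mono_on hl
      intervalIntegrable_cont
      intervalIntegrable_cont fun x _ => ?_
    refine (Finset.sum_congr rfl fun i _ => ?_).trans_le (hw.sum_inner_products_le (e x) (s := s))
    rw [real_inner_comm, norm_eq_abs, sq_abs, sq]
  have := hs.countable_support
  rw [Function.support_eq_univ fun i => (hpos i).ne'] at this
  exact countable_univ_iff.1 this

lemma exists_spec {p q : ℝ → ℝ} (h : Coef p q) {l : ℝ} (hl : 0 < l) :
    ∃ (ι : Type) (w : HilbertBasis ι ℝ (energySpace h hl.le)) (mu : ι → ℝ),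
      Spec p q l (evE h hl.le) (frameOp (evE h hl.le) l) w mu := by
  have he := continuous_evE h hl.le
  set e := evE h hl.le
  obtain ⟨ι, w, mu, hmu⟩ := exists_eigenbasis (isCompactOperator_frameOp he l)
    (isSymmetric_frameOp he l)
  have hval : ∀ i, ∫ x in (0:ℝ)..l, ⟪e x, w i⟫ * ⟪e x, w i⟫ = mu i := by
    intro i
    rw [← inner_frameOp he, hmu, inner_smul_left, real_inner_self_eq_norm_sq, w.orthonormal.1 i]
    simp
  have hpos : ∀ i, 0 < mu i := by
    intro i
    have h0 : 0 ≤ mu i := by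
      rw [← hval]
      exact intervalIntegral.integral_nonneg hl.le fun x _ => mul_self_nonneg _
    refine h0.lt_of_ne fun hc => w.orthonormal.ne_zero i ?_
    apply eq_zero_of_forall_inner_evE h hl.le
    have h1 := hval i
    rw [← hc] at h1
    by_contra! hne
    obtain ⟨x, hx, hxne⟩ := hne
    have : 0 < ∫ x in (0:ℝ)..l, ⟪e x, w i⟫ * ⟪e x, w i⟫ :=
      intervalIntegral.integral_pos hl (Continuous.continuousOn (by fun_prop))
        (fun y _ => mul_self_nonneg _) ⟨x, hx, mul_self_pos.2 hxne⟩
    linarith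
  refine ⟨ι, w, mu, countable_of_eigen hl.le he w.orthonormal fun i => by rw [hval]; exact hpos i,
    he, evE_zero h hl.le, evE_right h hl.le, inner_frameOp he l, hpos, hmu, fun m => ?_⟩
  exact ell_of_inner h hl.le m _ (inner_frameOp he l m)

section

variable {ι : Type}

lemma cv_tsum_of_bound [Countable ι] {a : ι → ℝ} {K : ℝ → ℝ} {f : ι → ℝ → ℝ} {t C : ℝ}
    (ht : 0 ≤ t) (ha : Summable fun i => |a i|) (hi : ∀ i, CvI K (f i) t)
    (hC : ∀ i, ∫ s in Ioc 0 t, |K s * f i (t - s)| ≤ C) :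
    cv K (fun s => ∑' i, a i * f i s) t = ∑' i, a i * cv K (f i) t := by
  have hi' : ∀ i, IntegrableOn (fun s => K s * f i (t - s)) (Ioc 0 t) := fun i => by
    have := hi i
    rwa [CvI, intervalIntegrable_iff_integrableOn_Ioc_of_le ht] at this
  simp only [cv, integral_of_le ht]
  have h := integral_tsum_of_summable_integral_norm (μ := volume.restrict (Ioc 0 t))
    (F := fun i s => a i * (K s * f i (t - s))) (fun i => (hi' i).const_mul _) ?_
  · simp_rw [integral_const_mul] at h
    rw [h]
    congr 1
    ext s
    rw [← tsum_mul_left]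
    congr 1
    ext i
    ring
  · refine Summable.of_nonneg_of_le (fun i => integral_nonneg fun s => norm_nonneg _) (fun i => ?_)
      (ha.mul_right C)
    simp_rw [norm_eq_abs, abs_mul (a i), integral_const_mul]
    exact mul_le_mul_of_nonneg_left (hC i) (abs_nonneg _)

/-- Families of kernels, uniformly bounded away from `0` and in `L¹(0,T)`. -/
structure Fam (f : ι → ℝ → ℝ) : Prop where
  cont : ∀ i, ContinuousOn (f i) (Ioi 0)
  int : ∀ i T, IntegrableOn (f i) (Ioc 0 T)
  bd : ∀ ε, 0 < ε → ∃ C, ∀ i t, ε ≤ t → |f i t| ≤ C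
  L1 : ∀ T, ∃ C, ∀ i, ∫ s in Ioc 0 T, |f i s| ≤ C

lemma Fam.kc {f : ι → ℝ → ℝ} (hf : Fam f) (i : ι) : KC (f i) := ⟨hf.cont i, hf.int i⟩

lemma Fam.kc_tsum [Countable ι] {f : ι → ℝ → ℝ} (hf : Fam f) {a : ι → ℝ}
    (ha : Summable fun i => |a i|) : KC (fun t => ∑' i, a i * f i t) := by
  constructor
  · intro t ht
    obtain ⟨C, hC⟩ := hf.bd (t / 2) (half_pos ht)
    have h1 : ContinuousOn (fun t => ∑' i, a i * f i t) (Ioi (t / 2)) := by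
      refine continuousOn_tsum (u := fun i => |a i| * C) (fun i => ?_) (ha.mul_right C)
        fun i s hs => ?_
      · exact continuousOn_const.mul ((hf.cont i).mono (Ioi_subset_Ioi (half_pos ht).le))
      · rw [norm_eq_abs, abs_mul]
        exact mul_le_mul_of_nonneg_left (hC i s (le_of_lt hs)) (abs_nonneg _)
    exact (h1.continuousAt (Ioi_mem_nhds (half_lt_self ht))).continuousWithinAt
  · intro T
    obtain ⟨C, hC⟩ := hf.L1 T
    have h1 : ∀ i, Integrable (fun s => a i * f i s) (volume.restrict (Ioc 0 T)) :=
      fun i => (hf.int i T).const_mul _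
    have h2 : Summable fun i => ∫ s in Ioc 0 T, ‖a i * f i s‖ := by
      refine Summable.of_nonneg_of_le (fun i => integral_nonneg fun s => norm_nonneg _)
        (fun i => ?_) (ha.mul_right C)
      simp_rw [norm_eq_abs, abs_mul (a i), integral_const_mul]
      exact mul_le_mul_of_nonneg_left (hC i) (abs_nonneg _)
    refine ⟨?_, ?_⟩
    · have h3 : AEMeasurable (fun s => ∑' i, a i * f i s) (volume.restrict (Ioc 0 T)) :=
        AEMeasurable.tsum fun i => (h1 i).aestronglyMeasurable.aemeasurable
      exact h3.aestronglyMeasurable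
    · have h3 : ∫⁻ s in Ioc 0 T, ∑' i, ‖a i * f i s‖ₑ < ⊤ := by
        rw [lintegral_tsum fun i => (h1 i).aestronglyMeasurable.enorm]
        have h4 : ∀ i, ∫⁻ s in Ioc 0 T, ‖a i * f i s‖ₑ
            = ENNReal.ofReal (∫ s in Ioc 0 T, ‖a i * f i s‖) := fun i =>
          (ofReal_integral_norm_eq_lintegral_enorm (h1 i)).symm
        simp_rw [h4]
        exact (ENNReal.ofReal_tsum_of_nonneg (fun i => integral_nonneg fun s => norm_nonneg _) h2
          ▸ ENNReal.ofReal_lt_top)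
      refine lt_of_le_of_lt (lintegral_mono fun s => ?_) h3
      exact enorm_tsum_le_tsum_enorm

lemma Fam.cv_tsum [Countable ι] {f : ι → ℝ → ℝ} (hf : Fam f) {a : ι → ℝ}
    (ha : Summable fun i => |a i|) {K : ℝ → ℝ} (hK : KC K) {t : ℝ} (ht : 0 < t) :
    cv K (fun s => ∑' i, a i * f i s) t = ∑' i, a i * cv K (f i) t := by
  obtain ⟨C, hC⟩ := hf.bd (t / 2) (half_pos ht)
  obtain ⟨C1, hC1⟩ := hf.L1 t
  obtain ⟨C2, hC2⟩ := (isCompact_Icc (a := t / 2) (b := t)).exists_bound_of_continuousOn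
    (hK.cont.mono fun s hs => (half_pos ht).trans_le hs.1)
  have hC2' : 0 ≤ C2 := (norm_nonneg _).trans (hC2 t ⟨(half_lt_self ht).le, le_rfl⟩)
  have e : ∀ i, ∫ s in Ioc 0 t, |f i (t - s)| = ∫ s in Ioc 0 t, |f i s| := by
    intro i
    rw [← integral_of_le ht.le, ← integral_of_le ht.le,
      integral_comp_sub_left (fun s => |f i s|)]
    simp
  have hr : ∀ i, IntegrableOn (fun s => |f i (t - s)|) (Ioc 0 t) := by
    intro i
    have := ((hf.kc i).intervalIntegrable ht.le).abs.comp_sub_left t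
    simp only [sub_zero, sub_self] at this
    exact (intervalIntegrable_iff_integrableOn_Ioc_of_le ht.le).1 this.symm
  refine cv_tsum_of_bound (C := (∫ s in Ioc 0 t, C * |K s|) + C2 * C1) ht.le ha
    (fun i => hK.cvI (hf.kc i) ht) fun i => ?_
  have h1 : ∫ s in Ioc 0 t, |K s * f i (t - s)|
      ≤ ∫ s in Ioc 0 t, (C * |K s| + C2 * |f i (t - s)|) := by
    refine setIntegral_mono_on ?_ (((hK.int t).abs.const_mul C).add ((hr i).const_mul C2))
      measurableSet_Ioc fun s hs => ?_
    · have := hK.cvI (hf.kc i) ht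
      rw [CvI, intervalIntegrable_iff_integrableOn_Ioc_of_le ht.le] at this
      exact this.abs
    · rw [abs_mul]
      have hC0 : 0 ≤ C := (abs_nonneg _).trans (hC i t (half_lt_self ht).le)
      rcases le_total s (t / 2) with h | h
      · have := mul_le_mul_of_nonneg_left (hC i (t - s) (by linarith)) (abs_nonneg (K s))
        nlinarith [abs_nonneg (f i (t - s)), mul_nonneg hC2' (abs_nonneg (f i (t - s)))]
      · have := mul_le_mul_of_nonneg_right (hC2 s ⟨h, hs.2⟩) (abs_nonneg (f i (t - s)))
        rw [norm_eq_abs] at this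
        nlinarith [mul_nonneg hC0 (abs_nonneg (K s))]
  refine h1.trans ?_
  rw [integral_add ((hK.int t).abs.const_mul C) ((hr i).const_mul C2), integral_const_mul C2, e]
  gcongr
  exact hC1 i

lemma Fam.of_dom {f : ι → ℝ → ℝ} {C b : ℝ} (hb : 0 < b) (hb1 : b ≤ 1)
    (hc : ∀ i, ContinuousOn (f i) (Ioi 0)) (hC : 0 ≤ C)
    (h : ∀ i t, 0 < t → |f i t| ≤ C * t ^ (b - 1)) : Fam f := by
  have hk := (kc_rpow hb).smul C
  have hi : ∀ i T, IntegrableOn (f i) (Ioc 0 T) := by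
    intro i T
    refine Integrable.mono' (hk.int T)
      (((hc i).mono Ioc_subset_Ioi_self).aestronglyMeasurable measurableSet_Ioc) ?_
    filter_upwards [ae_restrict_mem measurableSet_Ioc] with t ht using h i t ht.1
  refine ⟨hc, hi, fun ε hε => ⟨C * ε ^ (b - 1), fun i t ht => ?_⟩,
    fun T => ⟨∫ s in Ioc 0 T, C * s ^ (b - 1), fun i => ?_⟩⟩
  · refine (h i t (hε.trans_le ht)).trans (mul_le_mul_of_nonneg_left ?_ hC)
    exact Real.rpow_le_rpow_of_nonpos hε ht (by linarith)
  · exact setIntegral_mono_on (hi i T).abs (hk.int T) measurableSet_Ioc fun s hs => h i s hs.1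

/-- Families of relaxation functions. -/
structure Relax (α : ℝ) (lam : ι → ℝ) (P : ι → ℝ → ℝ) : Prop where
  h0 : 0 < α
  h1 : α < 1
  lam_nonneg : ∀ i, 0 ≤ lam i
  relax : ∀ i, IsRelax α (lam i) (P i)

namespace Relax

variable {α : ℝ} {lam : ι → ℝ} {P : ι → ℝ → ℝ}

lemma famP (h : Relax α lam P) : Fam P := by
  refine Fam.of_dom (C := (Gamma α)⁻¹) h.h0 h.h1.le (fun i => (h.relax i).kc.cont)
    (inv_nonneg.2 (Gamma_pos_of_pos h.h0).le) fun i t ht => ?_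
  rw [abs_of_pos ((h.relax i).pos_or h.h0 h.h1 (h.lam_nonneg i) ht)]
  refine ((h.relax i).le_rl h.h0 h.h1 (h.lam_nonneg i) ht).trans_eq ?_
  rw [rl, div_eq_inv_mul]

lemma abs_S_le (h : Relax α lam P) (i : ι) {t : ℝ} (ht : 0 ≤ t) : |relaxS (lam i) (P i) t| ≤ 1 := by
  rw [abs_of_nonneg ((h.relax i).S_nonneg h.h0 h.h1 (h.lam_nonneg i) ht)]
  exact (h.relax i).S_le_one h.h0 h.h1 (h.lam_nonneg i) ht

lemma lamS_le (h : Relax α lam P) (i : ι) {t : ℝ} (ht : 0 < t) :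
    |lam i * relaxS (lam i) (P i) t| ≤ Gamma (α + 1) * t ^ (-α) := by
  rw [abs_of_nonneg (mul_nonneg (h.lam_nonneg i)
    ((h.relax i).S_nonneg h.h0 h.h1 (h.lam_nonneg i) ht.le)), Real.rpow_neg ht.le,
    ← div_eq_mul_inv, le_div_iff₀ (Real.rpow_pos_of_pos ht α)]
  have := (h.relax i).lam_mul_S_le h.h0 h.h1 (h.lam_nonneg i) ht
  linarith

lemma integral_lamP (_ : Relax α lam P) (i : ι) (t : ℝ) :
    ∫ s in (0:ℝ)..t, lam i * P i s = 1 - relaxS (lam i) (P i) t := by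
  rw [intervalIntegral.integral_const_mul, relaxS]
  ring

lemma famN (h : Relax α lam P) : Fam fun i t => lam i * P i t := by
  have hpos : ∀ i t, 0 < t → 0 ≤ lam i * P i t := fun i t ht =>
    mul_nonneg (h.lam_nonneg i) ((h.relax i).pos_or h.h0 h.h1 (h.lam_nonneg i) ht).le
  refine ⟨fun i => continuousOn_const.mul (h.relax i).kc.cont,
    fun i T => ((h.relax i).kc.int T).const_mul _, fun ε hε => ⟨α / ε, fun i t ht => ?_⟩,
    fun T => ⟨1, fun i => ?_⟩⟩
  · have ht0 := hε.trans_le ht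
    rw [abs_of_nonneg (hpos i t ht0), le_div_iff₀ hε]
    have h1 := (h.relax i).lam_mul_P_le h.h0 h.h1 (h.lam_nonneg i) ht0
    have h2 := mul_le_mul_of_nonneg_right ht (hpos i t ht0)
    linarith
  · rcases le_or_gt T 0 with hT | hT
    · simp [Ioc_eq_empty_of_le hT]
    · rw [setIntegral_congr_fun measurableSet_Ioc fun s hs => abs_of_nonneg (hpos i s hs.1),
        ← integral_of_le hT.le, h.integral_lamP]
      linarith [(h.relax i).S_nonneg h.h0 h.h1 (h.lam_nonneg i) hT.le]

end Relax

end

/-- Local integrability on `(0,∞)` up to `0`. -/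
def LI (f : ℝ → ℝ) : Prop := ∀ T, IntegrableOn f (Ioc 0 T)

/-- Continuity on `[0,∞)`. -/
def BC (f : ℝ → ℝ) : Prop := ContinuousOn f (Ici 0)

lemma KC.li {f : ℝ → ℝ} (hf : KC f) : LI f := hf.int

lemma BC.exists_bound {f : ℝ → ℝ} (hf : BC f) (T : ℝ) : ∃ C, ∀ t ∈ Icc 0 T, |f t| ≤ C :=
  isCompact_Icc.exists_bound_of_continuousOn (hf.mono Icc_subset_Ici_self)

lemma BC.kc {f : ℝ → ℝ} (hf : BC f) : KC f := by
  obtain ⟨C, hC⟩ := hf.exists_bound 1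
  exact KC.of_bdd (hf.mono Ioi_subset_Ici_self) fun t ht => hC t ⟨ht.1.le, ht.2⟩

lemma bc_of_Icc {f : ℝ → ℝ} (h : ∀ T, 0 < T → ContinuousOn f (Icc 0 T)) : BC f := by
  intro t ht
  have h1 := h (t + 1) (by linarith [mem_Ici.1 ht]) t ⟨ht, by linarith⟩
  refine h1.mono_of_mem_nhdsWithin ?_
  filter_upwards [self_mem_nhdsWithin, mem_nhdsWithin_of_mem_nhds (Iio_mem_nhds (lt_add_one t))]
    with s hs hs1 using ⟨hs, le_of_lt hs1⟩

lemma LI.cv_bc {f g : ℝ → ℝ} (hf : LI f) (hg : BC g) : BC (cv f g) := by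
  refine bc_of_Icc fun T _ => ?_
  obtain ⟨C, hC⟩ := hg.exists_bound T
  exact continuousOn_cv_bdd (hf T) (hg.mono fun s hs => hs.1.le)
    fun s hs => hC s (Ioc_subset_Icc_self hs)

lemma LI.cvI {f g : ℝ → ℝ} (hf : LI f) (hg : BC g) {t : ℝ} (ht : 0 ≤ t) : CvI f g t := by
  obtain ⟨C, hC⟩ := hg.exists_bound t
  exact cvI_bdd (hf t) (hg.mono fun s hs => hs.1.le)
    (fun s hs => hC s (Ioc_subset_Icc_self hs)) ⟨ht, le_rfl⟩

lemma LI.cv {f g : ℝ → ℝ} (hf : LI f) (hg : LI g) : LI (cv f g) :=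
  fun T => integrableOn_cv (hf T) (hg T)

lemma LI.add {f g : ℝ → ℝ} (hf : LI f) (hg : LI g) : LI fun t => f t + g t :=
  fun T => (hf T).add (hg T)

lemma LI.smul {f : ℝ → ℝ} (c : ℝ) (hf : LI f) : LI fun t => c * f t :=
  fun T => (hf T).const_mul c

lemma LI.assoc {f g h : ℝ → ℝ} (hf : LI f) (hg : LI g) (hh : BC h) {t : ℝ} (ht : 0 ≤ t) :
    InvSource.cv (InvSource.cv f g) h t = InvSource.cv f (InvSource.cv g h) t := by
  rcases ht.eq_or_lt with rfl | ht
  · rw [cv_zero, cv_zero]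
  · exact eq_of_ae_of_cont (((hf.cv hg).cv_bc hh).mono fun s hs => hs.1.le)
      ((hf.cv_bc (hg.cv_bc hh)).mono fun s hs => hs.1.le)
      (cv_assoc_ae (hf t) (hg t) (hh.kc.int t)) t ⟨ht, le_rfl⟩

lemma LI.bc_integral {f : ℝ → ℝ} (hf : LI f) : BC fun t => ∫ s in (0:ℝ)..t, f s :=
  bc_of_Icc fun T _ => continuousOn_integral_Icc (hf T)

lemma bc_const (c : ℝ) : BC fun _ => c := continuousOn_const

lemma LI.intervalIntegrable {f : ℝ → ℝ} (hf : LI f) {t : ℝ} (ht : 0 ≤ t) :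
    IntervalIntegrable f volume 0 t :=
  (intervalIntegrable_iff_integrableOn_Ioc_of_le ht).2 (hf t)

/-- The continuous function with derivative `fp` and initial value `f0`. -/
noncomputable def prim (f0 : ℝ) (fp : ℝ → ℝ) (t : ℝ) : ℝ := f0 + ∫ s in (0:ℝ)..t, fp s

section

variable {ι : Type}

/-- Response of a mode to the source `prim f0 fp`. -/
noncomputable def resp (P : ι → ℝ → ℝ) (f0 : ℝ) (fp : ℝ → ℝ) (i : ι) (t : ℝ) : ℝ :=
  f0 * (∫ s in (0:ℝ)..t, P i s) + cv fp (fun t => ∫ s in (0:ℝ)..t, P i s) t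

/-- Caputo derivative of `resp`. -/
noncomputable def respC (lam : ι → ℝ) (P : ι → ℝ → ℝ) (f0 : ℝ) (fp : ℝ → ℝ) (i : ι) (t : ℝ) : ℝ :=
  f0 * relaxS (lam i) (P i) t + cv fp (relaxS (lam i) (P i)) t

namespace Relax

variable {α : ℝ} {lam : ι → ℝ} {P : ι → ℝ → ℝ}

lemma bc_S (h : Relax α lam P) (i : ι) : BC (relaxS (lam i) (P i)) := (h.relax i).continuousOn_S

lemma bc_R (h : Relax α lam P) (i : ι) : BC fun t => ∫ s in (0:ℝ)..t, P i s :=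
  (h.relax i).kc.li.bc_integral

lemma lam_resp (h : Relax α lam P) {f0 : ℝ} {fp : ℝ → ℝ} (hf : LI fp) (i : ι) {t : ℝ}
    (ht : 0 ≤ t) : lam i * resp P f0 fp i t = prim f0 fp t - respC lam P f0 fp i t := by
  have e : ∀ t, lam i * (∫ s in (0:ℝ)..t, P i s) = 1 - relaxS (lam i) (P i) t := fun t => by
    rw [relaxS]; ring
  rw [resp, mul_add, mul_left_comm, e, ← cv_smul_right]
  simp only [e]
  rw [cv_sub_right (hf.cvI (bc_const 1) ht) (hf.cvI (h.bc_S i) ht), cv_comm, cv_one_left, prim,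
    respC]
  ring

lemma abs_R_le (h : Relax α lam P) (i : ι) {s t : ℝ} (hs : 0 ≤ s) (hst : s ≤ t) :
    |∫ r in (0:ℝ)..s, P i r| ≤ ∫ r in (0:ℝ)..t, rl α r := by
  have hp : ∀ r, 0 < r → 0 ≤ P i r := fun r hr =>
    ((h.relax i).pos_or h.h0 h.h1 (h.lam_nonneg i) hr).le
  rw [abs_of_nonneg]
  · refine (integral_mono_on_of_le_Ioo hs
      ((h.relax i).kc.intervalIntegrable hs) ((kc_rl h.h0).intervalIntegrable hs)
      fun r hr => (h.relax i).le_rl h.h0 h.h1 (h.lam_nonneg i) hr.1).trans ?_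
    rw [integral_of_le hs, integral_of_le (hs.trans hst)]
    refine setIntegral_mono_set ((kc_rl h.h0).int t) ?_ (Ioc_subset_Ioc_right hst).eventuallyLE
    filter_upwards [ae_restrict_mem measurableSet_Ioc] with r hr using rl_nonneg h.h0 hr.1.le
  · rw [integral_of_le hs]
    exact setIntegral_nonneg measurableSet_Ioc fun r hr => hp r hr.1

lemma exists_bound_resp (h : Relax α lam P) (f0 : ℝ) {fp : ℝ → ℝ} (hf : LI fp) (T : ℝ) :
    ∃ C, ∀ i, ∀ t ∈ Icc 0 T, |resp P f0 fp i t| ≤ C := by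
  refine ⟨|f0| * (∫ r in (0:ℝ)..T, rl α r) + (∫ s in Ioc 0 T, |fp s|) * ∫ r in (0:ℝ)..T, rl α r,
    fun i t ht => ?_⟩
  have h1 : 0 ≤ ∫ r in (0:ℝ)..T, rl α r := (abs_nonneg _).trans (h.abs_R_le i ht.1 ht.2)
  refine (abs_add_le _ _).trans (add_le_add ?_ ?_)
  · rw [abs_mul]
    exact mul_le_mul_of_nonneg_left (h.abs_R_le i ht.1 ht.2) (abs_nonneg _)
  · refine (abs_cv_le ht.1 (hf t) fun s hs => h.abs_R_le i hs.1.le (hs.2.le.trans ht.2)).trans ?_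
    refine mul_le_mul_of_nonneg_right ?_ h1
    exact setIntegral_mono_set (hf T).abs (Eventually.of_forall fun s => abs_nonneg _)
      (Ioc_subset_Ioc_right ht.2).eventuallyLE

lemma exists_bound_respC (h : Relax α lam P) (f0 : ℝ) {fp : ℝ → ℝ} (hf : LI fp) (T : ℝ) :
    ∃ C, ∀ i, ∀ t ∈ Icc 0 T, |respC lam P f0 fp i t| ≤ C := by
  refine ⟨|f0| + (∫ s in Ioc 0 T, |fp s|), fun i t ht => ?_⟩
  refine (abs_add_le _ _).trans (add_le_add ?_ ?_)
  · rw [abs_mul]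
    exact mul_le_of_le_one_right (abs_nonneg _) (h.abs_S_le i ht.1)
  · refine (abs_cv_le ht.1 (hf t) fun s hs => h.abs_S_le i hs.1.le).trans ?_
    rw [mul_one]
    exact setIntegral_mono_set (hf T).abs (Eventually.of_forall fun s => abs_nonneg _)
      (Ioc_subset_Ioc_right ht.2).eventuallyLE

lemma summable_S (h : Relax α lam P) {a : ι → ℝ} (ha : Summable fun i => |a i|) {t : ℝ}
    (ht : 0 ≤ t) : Summable fun i => a i * relaxS (lam i) (P i) t := by
  refine Summable.of_norm_bounded ha fun i => ?_
  rw [norm_eq_abs, abs_mul]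
  exact mul_le_of_le_one_right (abs_nonneg _) (h.abs_S_le i ht)

variable [Countable ι]

lemma cv_tsum_bdd {a : ι → ℝ} (ha : Summable fun i => |a i|) {K : ℝ → ℝ} (hK : LI K)
    {f : ι → ℝ → ℝ} (hf : ∀ i, BC (f i)) {C t : ℝ} (ht : 0 ≤ t)
    (hC : ∀ i, ∀ s ∈ Icc 0 t, |f i s| ≤ C) :
    cv K (fun s => ∑' i, a i * f i s) t = ∑' i, a i * cv K (f i) t := by
  refine cv_tsum_of_bound (C := (∫ s in Ioc 0 t, |K s|) * C) ht ha (fun i => hK.cvI (hf i) ht)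
    fun i => ?_
  rw [← integral_mul_const]
  have := hK.cvI (hf i) ht
  rw [CvI, intervalIntegrable_iff_integrableOn_Ioc_of_le ht] at this
  refine setIntegral_mono_on this.abs ((hK t).abs.mul_const C) measurableSet_Ioc fun s hs => ?_
  rw [abs_mul]
  exact mul_le_mul_of_nonneg_left (hC i _ ⟨by linarith [hs.2], by linarith [hs.1]⟩) (abs_nonneg _)

lemma integral_tsum_P (h : Relax α lam P) {a : ι → ℝ} (ha : Summable fun i => |a i|) {t : ℝ}
    (ht : 0 ≤ t) : ∫ s in (0:ℝ)..t, ∑' i, a i * P i s = ∑' i, a i * ∫ s in (0:ℝ)..t, P i s := by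
  rcases ht.eq_or_lt with rfl | ht
  · simp
  · rw [← cv_one_left, h.famP.cv_tsum ha kc_one ht]
    simp only [cv_one_left]

lemma integral_tsum_N (h : Relax α lam P) {a : ι → ℝ} (ha : Summable fun i => |a i|) {t : ℝ}
    (ht : 0 ≤ t) : ∫ s in (0:ℝ)..t, ∑' i, a i * (lam i * P i s)
      = ∑' i, a i - ∑' i, a i * relaxS (lam i) (P i) t := by
  rcases ht.eq_or_lt with rfl | ht
  · simp [relaxS_zero]
  · rw [← cv_one_left, h.famN.cv_tsum ha kc_one ht, ← ha.of_abs.tsum_sub (h.summable_S ha ht.le)]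
    simp only [cv_one_left, h.integral_lamP]
    congr 1
    ext i
    ring

lemma bc_tsum_S (h : Relax α lam P) {a : ι → ℝ} (ha : Summable fun i => |a i|) :
    BC fun t => ∑' i, a i * relaxS (lam i) (P i) t := by
  have h1 : BC fun t => ∑' i, a i - ∫ s in (0:ℝ)..t, ∑' i, a i * (lam i * P i s) :=
    (bc_const (∑' i, a i)).sub (h.famN.kc_tsum ha).li.bc_integral
  refine ContinuousOn.congr h1 fun t ht => ?_
  rw [h.integral_tsum_N ha ht]
  ring

lemma cv_k_tsum_P (h : Relax α lam P) {a : ι → ℝ} (ha : Summable fun i => |a i|) {t : ℝ}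
    (ht : 0 < t) : cv (rl (1 - α)) (fun s => ∑' i, a i * P i s) t
      = ∑' i, a i * relaxS (lam i) (P i) t := by
  rw [h.famP.cv_tsum ha (kc_rl (by linarith [h.h1])) ht]
  congr 1
  ext i
  rw [(h.relax i).cv_k h.h0 h.h1 ht]

lemma cv_k_tsum_N (h : Relax α lam P) {a : ι → ℝ} (ha : Summable fun i => |a i|) {t : ℝ}
    (ht : 0 < t) : cv (rl (1 - α)) (fun s => ∑' i, a i * (lam i * P i s)) t
      = ∑' i, a i * (lam i * relaxS (lam i) (P i) t) := by
  rw [h.famN.cv_tsum ha (kc_rl (by linarith [h.h1])) ht]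
  congr 1
  ext i
  rw [cv_smul_right, (h.relax i).cv_k h.h0 h.h1 ht]

lemma tsum_resp (h : Relax α lam P) {a : ι → ℝ} (ha : Summable fun i => |a i|) (f0 : ℝ)
    {fp : ℝ → ℝ} (hf : LI fp) {t : ℝ} (ht : 0 ≤ t) :
    ∑' i, a i * resp P f0 fp i t = f0 * (∫ s in (0:ℝ)..t, ∑' i, a i * P i s)
      + cv fp (fun t => ∫ s in (0:ℝ)..t, ∑' i, a i * P i s) t := by
  have e : cv fp (fun t => ∫ s in (0:ℝ)..t, ∑' i, a i * P i s) t
      = cv fp (fun t => ∑' i, a i * ∫ s in (0:ℝ)..t, P i s) t :=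
    cv_congr ht (fun _ _ => rfl) fun s hs => h.integral_tsum_P ha hs.1.le
  rw [e, cv_tsum_bdd ha hf h.bc_R ht (fun i s hs => h.abs_R_le i hs.1 hs.2),
    h.integral_tsum_P ha ht, ← tsum_mul_left, ← Summable.tsum_add]
  · congr 1
    ext i
    rw [resp]
    ring
  · refine Summable.of_norm_bounded (ha.mul_right (|f0| * ∫ r in (0:ℝ)..t, rl α r)) fun i => ?_
    rw [norm_eq_abs, abs_mul, abs_mul, mul_left_comm]
    exact mul_le_mul_of_nonneg_left (mul_le_mul_of_nonneg_left
      (h.abs_R_le i ht le_rfl) (abs_nonneg _)) (abs_nonneg _)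
  · refine Summable.of_norm_bounded (ha.mul_right ((∫ s in Ioc 0 t, |fp s|) *
      ∫ r in (0:ℝ)..t, rl α r)) fun i => ?_
    rw [norm_eq_abs, abs_mul]
    exact mul_le_mul_of_nonneg_left (abs_cv_le ht (hf t) fun s hs =>
      h.abs_R_le i hs.1.le hs.2.le) (abs_nonneg _)

lemma tsum_respC (h : Relax α lam P) {a : ι → ℝ} (ha : Summable fun i => |a i|) (f0 : ℝ)
    {fp : ℝ → ℝ} (hf : LI fp) {t : ℝ} (ht : 0 ≤ t) :
    ∑' i, a i * respC lam P f0 fp i t = f0 * (∑' i, a i * relaxS (lam i) (P i) t)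
      + cv fp (fun t => ∑' i, a i * relaxS (lam i) (P i) t) t := by
  rw [cv_tsum_bdd ha hf h.bc_S ht (fun i s hs => h.abs_S_le i hs.1), ← tsum_mul_left,
    ← Summable.tsum_add]
  · congr 1
    ext i
    rw [respC]
    ring
  · exact (h.summable_S ha ht).mul_left f0
  · refine Summable.of_norm_bounded (ha.mul_right (∫ s in Ioc 0 t, |fp s|)) fun i => ?_
    rw [norm_eq_abs, abs_mul]
    refine mul_le_mul_of_nonneg_left ?_ (abs_nonneg _)
    have := abs_cv_le (C := 1) ht (hf t) fun s hs => h.abs_S_le i hs.1.le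
    rwa [mul_one] at this

end Relax

/-- Time derivative of a sum of modes. -/
noncomputable def modeDeriv (lam : ι → ℝ) (P : ι → ℝ → ℝ) (a c : ι → ℝ) (f0 : ℝ) (b y : ℝ → ℝ)
    (t : ℝ) : ℝ :=
  f0 * (∑' i, c i * P i t) - (∑' i, a i * (lam i * P i t))
    + (cv b (fun t => ∑' i, c i * relaxS (lam i) (P i) t) t + cv y (fun t => ∑' i, c i * P i t) t)

namespace Relax

variable {α : ℝ} {lam : ι → ℝ} {P : ι → ℝ → ℝ} [Countable ι]
  {a c : ι → ℝ} {f0 : ℝ} {b y : ℝ → ℝ}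

lemma kc_modeDeriv (h : Relax α lam P) (ha : Summable fun i => |a i|)
    (hc : Summable fun i => |c i|) (hb : LI b) (hy : KC y) : KC (modeDeriv lam P a c f0 b y) :=
  (((h.famP.kc_tsum hc).smul f0).sub (h.famN.kc_tsum ha)).add
    ((hb.cv_bc (h.bc_tsum_S hc)).kc.add (hy.cv (h.famP.kc_tsum hc)))

lemma modes_eq (h : Relax α lam P) (ha : Summable fun i => |a i|)
    (hc : Summable fun i => |c i|) (hb : LI b) (hy : KC y) {t : ℝ} (ht : 0 ≤ t) :
    (∑' i, a i * relaxS (lam i) (P i) t)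
      + ∑' i, c i * resp P f0 (fun t => cv (rl (1 - α)) b t + y t) i t
      = ∑' i, a i + ∫ s in (0:ℝ)..t, modeDeriv lam P a c f0 b y s := by
  have hk : KC (rl (1 - α)) := kc_rl (by linarith [h.h1])
  have hkb := hk.li.cv hb
  have hPc := h.famP.kc_tsum hc
  have hS := h.bc_tsum_S hc
  rw [h.tsum_resp hc f0 (hkb.add hy.li) ht]
  unfold modeDeriv
  rw [intervalIntegral.integral_add, intervalIntegral.integral_sub, intervalIntegral.integral_add,
    intervalIntegral.integral_const_mul, h.integral_tsum_N ha ht,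
    cv_add_left (hkb.cvI hPc.li.bc_integral ht) (hy.li.cvI hPc.li.bc_integral ht)]
  rotate_left
  · exact (hb.cv hS.kc.li).intervalIntegrable ht
  · exact (hy.cv hPc).intervalIntegrable ht
  · exact ((hPc).smul f0).intervalIntegrable ht
  · exact (h.famN.kc_tsum ha).intervalIntegrable ht
  · exact (((h.famP.kc_tsum hc).smul f0).sub (h.famN.kc_tsum ha)).intervalIntegrable ht
  · exact ((hb.cv_bc (h.bc_tsum_S hc)).kc.add (hy.cv (h.famP.kc_tsum hc))).intervalIntegrable ht
  rcases ht.eq_or_lt with rfl | ht0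
  · simp [cv_zero]
  set Pc : ℝ → ℝ := fun t => ∑' i, c i * P i t
  set Sc : ℝ → ℝ := fun t => ∑' i, c i * relaxS (lam i) (P i) t
  have e1 : cv y (fun t => ∫ s in (0:ℝ)..t, Pc s) t = ∫ s in (0:ℝ)..t, cv y Pc s := by
    rw [← cv_one_left]
    simp_rw [← cv_one_left]
    rw [cv_comm (fun _ => 1) (cv y Pc), hy.assoc hPc kc_one ht0]
    exact cv_congr ht (fun _ _ => rfl) fun s _ => cv_comm _ _ _
  have e2 : cv (cv (rl (1 - α)) b) (fun t => ∫ s in (0:ℝ)..t, Pc s) t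
      = ∫ s in (0:ℝ)..t, cv b Sc s := by
    rw [← cv_one_left, cv_comm (fun _ => 1) (cv b Sc), hb.assoc hS.kc.li (bc_const 1) ht,
      cv_congr (f := cv (rl (1 - α)) b) (f' := cv b (rl (1 - α))) ht (fun s _ => cv_comm _ _ _)
        (fun _ _ => rfl), hb.assoc hk.li hPc.li.bc_integral ht]
    refine cv_congr ht (fun _ _ => rfl) fun s hs => ?_
    simp_rw [← cv_one_left]
    rw [cv_congr (g := cv (fun _ => 1) Pc) (g' := cv Pc (fun _ => 1)) hs.1.le (fun _ _ => rfl)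
      (fun r _ => cv_comm _ _ _), ← hk.assoc hPc kc_one hs.1]
    exact cv_congr hs.1.le (fun r hr => h.cv_k_tsum_P hc hr.1) fun _ _ => rfl
  rw [e1, e2]
  ring

lemma cv_k_modeDeriv (h : Relax α lam P) (ha : Summable fun i => |a i|)
    (hc : Summable fun i => |c i|) (hb : LI b) (hy : KC y) {t : ℝ} (ht : 0 < t) :
    cv (rl (1 - α)) (modeDeriv lam P a c f0 b y) t
      = (∑' i, c i * respC lam P f0 (fun t => cv (rl (1 - α)) b t + y t) i t)
        - ∑' i, a i * (lam i * relaxS (lam i) (P i) t) := by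
  have hk : KC (rl (1 - α)) := kc_rl (by linarith [h.h1])
  have hkb := hk.li.cv hb
  have hPc := h.famP.kc_tsum hc
  have hS := h.bc_tsum_S hc
  have hN := h.famN.kc_tsum ha
  rw [h.tsum_respC hc f0 (hkb.add hy.li) ht.le]
  unfold modeDeriv
  rw [cv_add_right (hk.cvI ((hPc.smul f0).sub hN) ht)
      (hk.cvI ((hb.cv_bc hS).kc.add (hy.cv hPc)) ht),
    cv_sub_right (hk.cvI (hPc.smul f0) ht) (hk.cvI hN ht), cv_smul_right,
    cv_add_right (hk.cvI (hb.cv_bc hS).kc ht) (hk.cvI (hy.cv hPc) ht),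
    h.cv_k_tsum_N ha ht, h.cv_k_tsum_P hc ht,
    cv_add_left (hkb.cvI hS ht.le) (hy.li.cvI hS ht.le), hk.li.assoc hb hS ht.le]
  have e : cv (rl (1 - α)) (cv y fun t => ∑' i, c i * P i t) t
      = cv y (fun t => ∑' i, c i * relaxS (lam i) (P i) t) t := by
    rw [cv_comm, hy.assoc hPc hk ht]
    refine cv_congr ht.le (fun _ _ => rfl) fun s hs => ?_
    rw [cv_comm, h.cv_k_tsum_P hc hs.1]
  rw [e]
  ring

end Relax

end

/-- The inhomogeneous Volterra equation with kernel of type `t ^ (α - 1)`. -/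
lemma volterra_exists_kc {α C : ℝ} (h0 : 0 < α) (h1 : α < 1) {κ Z : ℝ → ℝ} (hκ : KC κ)
    (bκ : ∀ t, 0 < t → |κ t| ≤ C * t ^ (α - 1)) (hZ : KC Z) :
    ∃ y, KC y ∧ ∀ t, 0 < t → y t = Z t + cv κ y t := by
  obtain ⟨r, hr, -, hre⟩ := volterra_exists h0 h1 hκ.cont hκ.cont bκ bκ
  refine ⟨fun t => Z t + cv r Z t, hZ.add (hr.cv hZ), fun t ht => ?_⟩
  rw [cv_add_right (hκ.cvI hZ ht) (hκ.cvI (hr.cv hZ) ht), ← hκ.assoc hr hZ ht,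
    ← cv_add_left (hκ.cvI hZ ht) ((hκ.cv hr).cvI hZ ht)]
  change _ + cv r Z t = _ + _
  rw [cv_congr ht.le (fun s hs => hre s hs.1) fun _ _ => rfl]

lemma cv_one_right (f : ℝ → ℝ) (t : ℝ) : cv f (fun _ => 1) t = ∫ s in (0:ℝ)..t, f s := by
  rw [cv_comm, cv_one_left]

/-- A convolution may be integrated in its second factor. -/
lemma KC.integral_cv {f g : ℝ → ℝ} (hf : KC f) (hg : KC g) {t : ℝ} (ht : 0 ≤ t) :
    ∫ s in (0:ℝ)..t, InvSource.cv f g s = InvSource.cv f (fun t => ∫ s in (0:ℝ)..t, g s) t := by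
  rcases ht.eq_or_lt with rfl | ht
  · simp [cv_zero]
  rw [← cv_one_right, hf.assoc hg kc_one ht]
  exact cv_congr ht.le (fun _ _ => rfl) fun s _ => cv_one_right _ _

lemma LI.integral_cv {f g : ℝ → ℝ} (hf : LI f) (hg : LI g) {t : ℝ} (ht : 0 ≤ t) :
    ∫ s in (0:ℝ)..t, InvSource.cv f g s = InvSource.cv f (fun t => ∫ s in (0:ℝ)..t, g s) t := by
  rw [← cv_one_right, hf.assoc hg (bc_const 1) ht]
  exact cv_congr ht (fun _ _ => rfl) fun s _ => cv_one_right _ _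

lemma integral_eq_of_cv_k_eq {α : ℝ} (h0 : 0 < α) (h1 : α < 1) {A B : ℝ → ℝ} (hA : KC A)
    (hB : KC B) {t : ℝ} (ht : 0 ≤ t)
    (h : ∀ s, 0 < s → cv (rl (1 - α)) A s = cv (rl (1 - α)) B s) :
    ∫ s in (0:ℝ)..t, A s = ∫ s in (0:ℝ)..t, B s := by
  rcases ht.eq_or_lt with rfl | ht
  · simp
  have hk : KC (rl (1 - α)) := kc_rl (by linarith)
  have hg : KC (rl α) := kc_rl h0
  have key : ∀ F, KC F → ∫ s in (0:ℝ)..t, F s = cv (rl α) (cv (rl (1 - α)) F) t := by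
    intro F hF
    rw [← hg.assoc hk hF ht, ← cv_one_left]
    refine cv_congr ht.le (fun s hs => ?_) fun _ _ => rfl
    rw [cv_comm, cv_rl_compl h0 h1 hs.1]
  rw [key A hA, key B hB]
  exact cv_congr ht.le (fun _ _ => rfl) fun s hs => h s hs.1

namespace Relax

variable {ι : Type} {α : ℝ} {lam : ι → ℝ} {P : ι → ℝ → ℝ}

lemma abs_P_le (h : Relax α lam P) (i : ι) {t : ℝ} (ht : 0 < t) : |P i t| ≤ rl α t := by
  rw [abs_of_pos ((h.relax i).pos_or h.h0 h.h1 (h.lam_nonneg i) ht)]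
  exact (h.relax i).le_rl h.h0 h.h1 (h.lam_nonneg i) ht

lemma abs_tsum_P_le (h : Relax α lam P) {d : ι → ℝ} (hd : Summable fun i => |d i|) {t : ℝ}
    (ht : 0 < t) : |∑' i, d i * P i t| ≤ (∑' i, |d i|) * rl α t := by
  rw [← tsum_mul_right]
  rw [← norm_eq_abs]
  refine tsum_of_norm_bounded (hd.mul_right (rl α t)).hasSum fun i => ?_
  rw [norm_eq_abs, abs_mul]
  exact mul_le_mul_of_nonneg_left (h.abs_P_le i ht) (abs_nonneg _)

variable [Countable ι]

/-- Solution of the inverse problem at the level of modes. -/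
lemma exists_source (h : Relax α lam P) {a m : ι → ℝ} (ha : Summable fun i => |a i|)
    (hm : Summable fun i => |m i|) (hla : Summable fun i => |lam i * a i|)
    (hlm : Summable fun i => |lam i * m i|) (hN : ∑' i, m i ≠ 0) {b : ℝ → ℝ} (hb : LI b) (γ : ℝ) :
    ∃ f0 y, KC y ∧ ∀ t, 0 ≤ t → (∑' i, a i * relaxS (lam i) (P i) t)
      + ∑' i, m i * resp P f0 (fun t => cv (rl (1 - α)) b t + y t) i t
      = ∑' i, a i + ∫ s in (0:ℝ)..t, (γ + (∑' i, m i) * ∫ r in (0:ℝ)..s, b r) := by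
  set N : ℝ := ∑' i, m i
  have hk : KC (rl (1 - α)) := kc_rl (by linarith [h.h1])
  have hkb := hk.li.cv hb
  set Pd : ℝ → ℝ := fun t => ∑' i, (lam i * m i) * P i t
  have hPd : KC Pd := h.famP.kc_tsum hlm
  set Sd : ℝ → ℝ := fun t => ∑' i, (lam i * m i) * relaxS (lam i) (P i) t
  have hSd : BC Sd := h.bc_tsum_S hlm
  set Ne : ℝ → ℝ := fun t => ∑' i, (lam i * a i) * (lam i * P i t)
  have hNe : KC Ne := h.famN.kc_tsum hla
  set Se : ℝ → ℝ := fun t => ∑' i, (lam i * a i) * relaxS (lam i) (P i) t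
  set Sm : ℝ → ℝ := fun t => ∑' i, m i * relaxS (lam i) (P i) t
  have hSm : BC Sm := h.bc_tsum_S hm
  set f0 : ℝ := (∑' i, lam i * a i) / N
  have hf0 : f0 * N = ∑' i, lam i * a i := div_mul_cancel₀ _ hN
  set Y : ℝ → ℝ := fun t => γ * rl (1 - α) t - Ne t + (f0 * Pd t + cv b Sd t)
  have hY : KC Y := ((hk.smul γ).sub hNe).add ((hPd.smul f0).add (hb.cv_bc hSd).kc)
  obtain ⟨y, hy, hye⟩ := volterra_exists_kc (C := |N⁻¹| * ((∑' i, |lam i * m i|) / Gamma α))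
    h.h0 h.h1 (hPd.smul N⁻¹) (fun t ht => by
      rw [abs_mul, mul_assoc]
      refine mul_le_mul_of_nonneg_left ((h.abs_tsum_P_le hlm ht).trans (le_of_eq ?_))
        (abs_nonneg _)
      rw [rl]
      ring) (hY.smul N⁻¹)
  have hyN : ∀ t, 0 < t → N * y t = Y t + cv Pd y t := by
    intro t ht
    rw [hye t ht, cv_smul_left]
    field_simp
  refine ⟨f0, y, hy, fun t ht => ?_⟩
  rw [h.modes_eq ha hm hb hy ht]
  congr 1
  have hBi : KC fun s => γ + N * ∫ r in (0:ℝ)..s, b r :=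
    (bc_const γ).kc.add (hb.bc_integral.kc.smul N)
  refine integral_eq_of_cv_k_eq h.h0 h.h1 (h.kc_modeDeriv ha hm hb hy) hBi ht fun s hs => ?_
  have hSmN : ∀ s, 0 ≤ s → Sm s = N - ∫ r in (0:ℝ)..s, Pd r := by
    intro s hs
    have := h.integral_tsum_N hm hs
    have e : ∀ r, ∑' i, m i * (lam i * P i r) = Pd r := fun r => by
      simp only [Pd]
      congr 1
      ext i
      ring
    simp only [e] at this
    rw [this]
    ring
  have e1 : ∀ {F : ℝ → ℝ}, LI F → cv F Sm s
      = N * (∫ r in (0:ℝ)..s, F r) - cv F (fun t => ∫ r in (0:ℝ)..t, Pd r) s := by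
    intro F hF
    rw [cv_congr (g' := fun r => N - ∫ r in (0:ℝ)..r, Pd r) hs.le (fun _ _ => rfl)
      fun r hr => hSmN r hr.1.le,
      cv_sub_right (hF.cvI (bc_const N) hs.le) (hF.cvI hPd.li.bc_integral hs.le)]
    congr 1
    rw [← cv_one_right, ← cv_smul_right]
    simp
  have hYint : N * ∫ r in (0:ℝ)..s, y r = γ * (∫ r in (0:ℝ)..s, rl (1 - α) r)
      - ((∑' i, lam i * a i) - Se s) + (f0 * (∫ r in (0:ℝ)..s, Pd r)
        + ∫ r in (0:ℝ)..s, cv b Sd r) + ∫ r in (0:ℝ)..s, cv Pd y r := by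
    rw [← intervalIntegral.integral_const_mul, ← h.integral_tsum_N hla hs.le,
      ← intervalIntegral.integral_const_mul, ← intervalIntegral.integral_const_mul,
      ← intervalIntegral.integral_sub, ← intervalIntegral.integral_add,
      ← intervalIntegral.integral_add, ← intervalIntegral.integral_add]
    · exact intervalIntegral.integral_congr_ae (ae_of_all _ fun r hr => by
        rw [uIoc_of_le hs.le] at hr
        exact hyN r hr.1)
    · exact hY.intervalIntegrable hs.le
    · exact (hPd.cv hy).intervalIntegrable hs.le
    · exact ((hk.smul γ).sub hNe).intervalIntegrable hs.le
    · exact ((hPd.smul f0).add (hb.cv_bc hSd).kc).intervalIntegrable hs.le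
    · exact (hPd.smul f0).intervalIntegrable hs.le
    · exact (hb.cv_bc hSd).kc.intervalIntegrable hs.le
    · exact (hk.smul γ).intervalIntegrable hs.le
    · exact hNe.intervalIntegrable hs.le
  rw [h.cv_k_modeDeriv ha hm hb hy hs, h.tsum_respC hm f0 (hkb.add hy.li) hs.le]
  change f0 * Sm s + cv (fun t => cv (rl (1 - α)) b t + y t) Sm s - _ = _
  have eSe : ∑' i, a i * (lam i * relaxS (lam i) (P i) s) = Se s := by
    simp only [Se]
    congr 1
    ext i
    ring
  have ePdy : ∫ r in (0:ℝ)..s, cv Pd y r = cv y (fun t => ∫ r in (0:ℝ)..t, Pd r) s := by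
    rw [← hy.integral_cv hPd hs.le]
    simp_rw [cv_comm Pd y]
  have ekb : cv (cv (rl (1 - α)) b) (fun t => ∫ r in (0:ℝ)..t, Pd r) s
      = ∫ r in (0:ℝ)..s, cv b Sd r := by
    rw [cv_congr (f := cv (rl (1 - α)) b) (f' := cv b (rl (1 - α))) hs.le
        (fun s _ => cv_comm _ _ _) (fun _ _ => rfl), hb.assoc hk.li hPd.li.bc_integral hs.le,
      hb.integral_cv hSd.kc.li hs.le]
    refine cv_congr hs.le (fun _ _ => rfl) fun r hr => ?_
    rw [← hk.integral_cv hPd hr.1.le]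
    refine intervalIntegral.integral_congr_ae (ae_of_all _ fun v hv => ?_)
    rw [uIoc_of_le hr.1.le] at hv
    exact h.cv_k_tsum_P hlm hv.1
  have hNb : BC fun s => N * ∫ r in (0:ℝ)..s, b r := continuousOn_const.mul hb.bc_integral
  rw [cv_add_left (hkb.cvI hSm hs.le) (hy.li.cvI hSm hs.le), e1 hkb, e1 hy.li, eSe, hSmN s hs.le,
    cv_add_right (hk.li.cvI (bc_const γ) hs.le) (hk.li.cvI hNb hs.le), cv_smul_right]
  have ek1 : cv (rl (1 - α)) (fun _ => γ) s = γ * ∫ r in (0:ℝ)..s, rl (1 - α) r := by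
    rw [← cv_one_right, ← cv_smul_right]
    simp
  rw [ek1, ← hk.li.integral_cv hb hs.le, ekb]
  linear_combination hYint + hf0 + ePdy

end Relax

lemma continuousOn_primitive_Icc {X : Type*} [TopologicalSpace X] {A : Set X} {c d x0 : ℝ}
    {f : X → ℝ → ℝ} (hf : ContinuousOn (fun z : X × ℝ => f z.1 z.2) (A ×ˢ Icc c d))
    (hx0 : x0 ∈ Icc c d) :
    ContinuousOn (fun z : X × ℝ => ∫ r in x0..z.2, f z.1 r) (A ×ˢ Icc c d) := by
  have hcd : c ≤ d := hx0.1.trans hx0.2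
  have h1 : Continuous (Function.uncurry fun (s : A) (r : ℝ) => f s (projIcc c d hcd r)) := by
    refine hf.comp_continuous (f := fun y : A × ℝ => ((y.1 : X), (projIcc c d hcd y.2 : ℝ)))
      (by fun_prop) fun y => ⟨y.1.2, (projIcc c d hcd y.2).2⟩
  have h2 := intervalIntegral.continuous_parametric_primitive_of_continuous (μ := volume)
    (a₀ := x0) h1
  rw [continuousOn_iff_continuous_domRestrict]
  have h3 : Continuous fun z : (A ×ˢ Icc c d : Set (X × ℝ)) =>
      ((⟨z.1.1, z.2.1⟩ : A), z.1.2) := by fun_prop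
  refine (h2.comp h3).congr fun z => ?_
  refine integral_congr fun r hr => ?_
  have hr' : r ∈ Icc c d := by
    rcases le_total x0 z.1.2 with h | h
    · rw [uIcc_of_le h] at hr
      exact ⟨hx0.1.trans hr.1, hr.2.trans z.2.2.2⟩
    · rw [uIcc_of_ge h] at hr
      exact ⟨z.2.2.1.trans hr.1, hr.2.trans hx0.2⟩
  simp [projIcc_of_mem hcd hr']

lemma continuousOn_primitive_Ioo {X : Type*} [TopologicalSpace X] {A : Set X} {a b x0 : ℝ}
    {f : X → ℝ → ℝ} (hf : ContinuousOn (fun z : X × ℝ => f z.1 z.2) (A ×ˢ Ioo a b))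
    (hx0 : x0 ∈ Ioo a b) :
    ContinuousOn (fun z : X × ℝ => ∫ r in x0..z.2, f z.1 r) (A ×ˢ Ioo a b) := by
  rintro ⟨s, x⟩ ⟨hs, hx⟩
  obtain ⟨c, hc1, hc2⟩ := exists_between (lt_min hx0.1 hx.1)
  obtain ⟨d, hd1, hd2⟩ := exists_between (max_lt hx0.2 hx.2)
  have hsub : Icc c d ⊆ Ioo a b := fun r hr => ⟨hc1.trans_le hr.1, hr.2.trans_lt hd2⟩
  have := continuousOn_primitive_Icc (hf.mono (prod_mono_right hsub))
    ⟨(hc2.trans_le (min_le_left _ _)).le, ((le_max_left _ _).trans_lt hd1).le⟩ (s, x)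
    ⟨hs, (hc2.trans_le (min_le_right _ _)).le, ((le_max_right _ _).trans_lt hd1).le⟩
  refine this.mono_of_mem_nhdsWithin ?_
  have : A ×ˢ Icc c d = A ×ˢ univ ∩ univ ×ˢ Icc c d := by
    rw [prod_inter_prod]; simp
  rw [this]
  refine inter_mem (mem_of_superset self_mem_nhdsWithin fun z hz => ⟨hz.1, trivial⟩) ?_
  refine mem_nhdsWithin_of_mem_nhds (prod_mem_nhds univ_mem (Icc_mem_nhds ?_ ?_))
  · exact hc2.trans_le (min_le_right _ _)
  · exact (le_max_right _ _).trans_lt hd1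

variable {p q : ℝ → ℝ} {l : ℝ}

namespace Ell

variable {U V ζ ξ : ℝ → ℝ}

lemma hasDerivAt (h : Ell p q l U ζ) {x : ℝ} (hx : x ∈ Ioo 0 l) : HasDerivAt U (deriv U x) x := by
  obtain ⟨D, hD⟩ := h
  exact (hD x hx).1.differentiableAt.hasDerivAt

lemma flux (h : Ell p q l U ζ) (hp : ∀ x, 0 < p x) {x : ℝ} (hx : x ∈ Ioo 0 l) :
    HasDerivAt (fun y => p y * deriv U y) (q x * U x - ζ x) x := by
  obtain ⟨D, hD⟩ := h
  refine (hD x hx).2.congr_of_eventuallyEq ?_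
  filter_upwards [Ioo_mem_nhds hx.1 hx.2] with y hy
  rw [(hD y hy).1.deriv, mul_div_cancel₀ _ (hp y).ne']

lemma intro (h1 : ∀ x ∈ Ioo 0 l, DifferentiableAt ℝ U x) (hp : ∀ x, 0 < p x)
    (h2 : ∀ x ∈ Ioo 0 l, HasDerivAt (fun y => p y * deriv U y) (q x * U x - ζ x) x) :
    Ell p q l U ζ :=
  ⟨fun y => p y * deriv U y, fun x hx => ⟨by
    rw [mul_div_cancel_left₀ _ (hp x).ne']
    exact (h1 x hx).hasDerivAt, h2 x hx⟩⟩

lemma continuousOn (h : Ell p q l U ζ) : ContinuousOn U (Ioo 0 l) :=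
  fun _ hx => (h.hasDerivAt hx).continuousAt.continuousWithinAt

lemma congr (h : Ell p q l U ζ) (hV : ∀ x ∈ Ioo 0 l, V x = U x) (hξ : ∀ x ∈ Ioo 0 l, ξ x = ζ x) :
    Ell p q l V ξ := by
  obtain ⟨D, hD⟩ := h
  refine ⟨D, fun x hx => ⟨(hD x hx).1.congr_of_eventuallyEq ?_, ?_⟩⟩
  · filter_upwards [Ioo_mem_nhds hx.1 hx.2] with y hy using hV y hy
  · rw [hV x hx, hξ x hx]
    exact (hD x hx).2

lemma add (h : Ell p q l U ζ) (h' : Ell p q l V ξ) :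
    Ell p q l (fun x => U x + V x) fun x => ζ x + ξ x := by
  obtain ⟨D, hD⟩ := h
  obtain ⟨E, hE⟩ := h'
  refine ⟨fun x => D x + E x, fun x hx => ⟨?_, ?_⟩⟩
  · convert! (hD x hx).1.add (hE x hx).1 using 1
    ring
  · convert! (hD x hx).2.add (hE x hx).2 using 1
    ring

lemma smul (c : ℝ) (h : Ell p q l U ζ) : Ell p q l (fun x => c * U x) fun x => c * ζ x := by
  obtain ⟨D, hD⟩ := h
  refine ⟨fun x => c * D x, fun x hx => ⟨?_, ?_⟩⟩
  · convert! (hD x hx).1.const_mul c using 1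
    ring
  · convert! (hD x hx).2.const_mul c using 1
    ring

lemma sub (h : Ell p q l U ζ) (h' : Ell p q l V ξ) :
    Ell p q l (fun x => U x - V x) fun x => ζ x - ξ x := by
  refine (h.add (h'.smul (-1))).congr (fun x _ => ?_) fun x _ => ?_ <;> ring

/-- A primitive of `1 / p`. -/
noncomputable def scale (p : ℝ → ℝ) (x : ℝ) : ℝ := ∫ s in (0:ℝ)..x, (p s)⁻¹

lemma hasDerivAt_scale (hc : Coef p q) (x : ℝ) : HasDerivAt (scale p) (p x)⁻¹ x :=
  integral_hasDerivAt_right (hc.inv_cont.intervalIntegrable _ _)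
    (hc.inv_cont.stronglyMeasurableAtFilter _ _) hc.inv_cont.continuousAt

lemma continuous_scale (hc : Coef p q) : Continuous (scale p) :=
  continuous_iff_continuousAt.2 fun x => (hasDerivAt_scale hc x).continuousAt

lemma strictMono_scale (hc : Coef p q) : StrictMono (scale p) :=
  strictMono_of_deriv_pos fun x => by
    rw [(hasDerivAt_scale hc x).deriv]
    exact inv_pos.2 (hc.p0 x)

lemma uIcc_sub {x0 x : ℝ} (h0 : x0 ∈ Ioo 0 l) (hx : x ∈ Ioo 0 l) : uIcc x0 x ⊆ Ioo 0 l :=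
  (ordConnected_Ioo (a := (0:ℝ)) (b := l)).uIcc_subset h0 hx

lemma formula (h : Ell p q l U ζ) (hc : Coef p q) (hζ : ContinuousOn ζ (Ioo 0 l)) {x0 x : ℝ}
    (h0 : x0 ∈ Ioo 0 l) (hx : x ∈ Ioo 0 l) :
    U x - U x0 = p x0 * deriv U x0 * (scale p x - scale p x0)
      + ∫ r in x0..x, (scale p x - scale p r) * (q r * U r - ζ r) := by
  have hsub := uIcc_sub h0 hx
  have h1 : ∀ r ∈ uIcc x0 x, HasDerivAt
      (fun r => U r + (scale p x - scale p r) * (p r * deriv U r))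
      ((scale p x - scale p r) * (q r * U r - ζ r)) r := by
    intro r hr
    have := (h.hasDerivAt (hsub hr)).add
      (((hasDerivAt_scale hc r).const_sub (scale p x)).mul (h.flux hc.p0 (hsub hr)))
    convert! this using 1
    field_simp [(hc.p0 r).ne']
    ring
  have h2 := integral_eq_sub_of_hasDerivAt h1
    (ContinuousOn.intervalIntegrable (by
      have := hc.qc
      have := continuous_scale hc
      have := h.continuousOn.mono hsub
      have := hζ.mono hsub
      fun_prop))
  rw [h2]
  ring

lemma of_formula (hc : Coef p q) (hU : ContinuousOn U (Ioo 0 l)) (hζ : ContinuousOn ζ (Ioo 0 l))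
    {x0 d : ℝ} (h0 : x0 ∈ Ioo 0 l)
    (h : ∀ x ∈ Ioo 0 l, U x - U x0 = d * (scale p x - scale p x0)
      + ∫ r in x0..x, (scale p x - scale p r) * (q r * U r - ζ r)) : Ell p q l U ζ := by
  have hqc := hc.qc
  have hf : ContinuousOn (fun r => q r * U r - ζ r) (Ioo 0 l) := by fun_prop
  have hsc := continuous_scale hc
  have hd : ∀ F : ℝ → ℝ, ContinuousOn F (Ioo 0 l) → ∀ x ∈ Ioo 0 l,
      HasDerivAt (fun x => ∫ r in x0..x, F r) (F x) x := by
    intro F hF x hx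
    have hn := Ioo_mem_nhds hx.1 hx.2
    exact integral_hasDerivAt_right
      ((hF.mono (uIcc_sub h0 hx)).intervalIntegrable)
      (hF.stronglyMeasurableAtFilter isOpen_Ioo x hx) (hF.continuousAt hn)
  refine ⟨fun x => d + ∫ r in x0..x, (q r * U r - ζ r), fun x hx => ⟨?_, ?_⟩⟩
  · have hG : ∀ y ∈ Ioo 0 l, U y = U x0 + (d * (scale p y - scale p x0)
        + (scale p y * (∫ r in x0..y, (q r * U r - ζ r))
          - ∫ r in x0..y, scale p r * (q r * U r - ζ r))) := by
      intro y hy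
      have hs := uIcc_sub h0 hy
      rw [← intervalIntegral.integral_const_mul, ← intervalIntegral.integral_sub]
      · have := h y hy
        simp only [sub_mul] at this
        linear_combination this
      · exact ((hf.mono hs).intervalIntegrable).const_mul _
      · exact ((hsc.continuousOn.mul hf).mono hs).intervalIntegrable
    have h1 := ((((hasDerivAt_scale hc x).sub_const (scale p x0)).const_mul d).add
      (((hasDerivAt_scale hc x).mul (hd _ hf x hx)).sub
        (hd _ (hsc.continuousOn.mul hf) x hx))).const_add (U x0)
    refine (h1.congr_deriv ?_).congr_of_eventuallyEq ?_
    · simp only [div_eq_mul_inv, Pi.mul_apply]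
      ring
    · filter_upwards [Ioo_mem_nhds hx.1 hx.2] with y hy
      exact hG y hy
  · exact (hd _ hf x hx).const_add d

section Param

variable {X : Type*} [TopologicalSpace X] {A : Set X} {U ζ : X → ℝ → ℝ}

lemma continuousOn_left {f : X → ℝ → ℝ} {B : Set ℝ}
    (h : ContinuousOn (fun z : X × ℝ => f z.1 z.2) (A ×ˢ B)) {s : X} (hs : s ∈ A) :
    ContinuousOn (f s) B :=
  h.comp (f := fun x : ℝ => (s, x)) (by fun_prop) fun x hx => ⟨hs, hx⟩

lemma continuousOn_right {f : X → ℝ → ℝ} {B : Set ℝ}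
    (h : ContinuousOn (fun z : X × ℝ => f z.1 z.2) (A ×ˢ B)) {x : ℝ} (hx : x ∈ B) :
    ContinuousOn (fun s => f s x) A :=
  h.comp (f := fun s : X => (s, x)) (by fun_prop) fun s hs => ⟨hs, hx⟩

lemma continuousOn_slope (hc : Coef p q) {x0 x1 : ℝ} (h0 : x0 ∈ Ioo 0 l) (h1 : x1 ∈ Ioo 0 l)
    (hU : ContinuousOn (fun z : X × ℝ => U z.1 z.2) (A ×ˢ Ioo 0 l))
    (hζ : ContinuousOn (fun z : X × ℝ => ζ z.1 z.2) (A ×ˢ Ioo 0 l)) :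
    ContinuousOn (fun s => (U s x1 - U s x0
      - ∫ r in x0..x1, (scale p x1 - scale p r) * (q r * U s r - ζ s r))
        / (scale p x1 - scale p x0)) A := by
  have hqc := hc.qc
  have hsc := continuous_scale hc
  refine ContinuousOn.div_const (((continuousOn_right hU h1).sub (continuousOn_right hU h0)).sub ?_)
    _
  refine continuousOn_right
    (f := fun s x => ∫ r in x0..x, (scale p x1 - scale p r) * (q r * U s r - ζ s r)) ?_ h1
  exact continuousOn_primitive_Ioo
    (f := fun s r => (scale p x1 - scale p r) * (q r * U s r - ζ s r)) (by fun_prop) h0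

/-- The flux of a continuous family of solutions is continuous. -/
lemma continuousOn_flux (hc : Coef p q) (h : ∀ s ∈ A, Ell p q l (U s) (ζ s))
    (hU : ContinuousOn (fun z : X × ℝ => U z.1 z.2) (A ×ˢ Ioo 0 l))
    (hζ : ContinuousOn (fun z : X × ℝ => ζ z.1 z.2) (A ×ˢ Ioo 0 l)) :
    ContinuousOn (fun z : X × ℝ => p z.2 * deriv (U z.1) z.2) (A ×ˢ Ioo 0 l) := by
  rcases le_or_gt l 0 with hl | hl
  · simp [Ioo_eq_empty (not_lt.2 hl)]
  have hqc := hc.qc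
  have h0 : l / 3 ∈ Ioo 0 l := ⟨by linarith, by linarith⟩
  have h1 : l / 2 ∈ Ioo 0 l := ⟨by linarith, by linarith⟩
  have hne : scale p (l / 2) - scale p (l / 3) ≠ 0 :=
    (sub_pos.2 (strictMono_scale hc (by linarith))).ne'
  have hf : ContinuousOn (fun z : X × ℝ => q z.2 * U z.1 z.2 - ζ z.1 z.2) (A ×ˢ Ioo 0 l) := by
    fun_prop
  have k1 := (continuousOn_slope hc h0 h1 hU hζ).comp (f := fun z : X × ℝ => z.1)
    (s := A ×ˢ Ioo 0 l) (by fun_prop) fun z hz => hz.1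
  refine (k1.add (continuousOn_primitive_Ioo (f := fun s r => q r * U s r - ζ s r) hf h0)).congr ?_
  rintro ⟨s, x⟩ ⟨hs, hx⟩
  have hsub := uIcc_sub h0 hx
  have e1 := (h s hs).formula hc (continuousOn_left hζ hs) h0 h1
  have e2 := integral_eq_sub_of_hasDerivAt
    (fun r hr => (h s hs).flux hc.p0 (hsub hr))
    (((continuousOn_left (f := fun s r => q r * U s r - ζ s r) hf hs).mono
      hsub).intervalIntegrable)
  simp only [Pi.add_apply, Function.comp_apply]
  rw [e2, e1]
  field_simp
  ring

lemma continuousOn_deriv (hc : Coef p q) (h : ∀ s ∈ A, Ell p q l (U s) (ζ s))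
    (hU : ContinuousOn (fun z : X × ℝ => U z.1 z.2) (A ×ˢ Ioo 0 l))
    (hζ : ContinuousOn (fun z : X × ℝ => ζ z.1 z.2) (A ×ˢ Ioo 0 l)) :
    ContinuousOn (fun z : X × ℝ => deriv (U z.1) z.2) (A ×ˢ Ioo 0 l) := by
  have hpc := hc.pc
  refine ((continuousOn_flux hc h hU hζ).div (g := fun z : X × ℝ => p z.2) (by fun_prop)
    fun z _ => (hc.p0 z.2).ne').congr fun z _ => ?_
  simp only [Pi.div_apply]
  rw [mul_div_cancel_left₀ _ (hc.p0 z.2).ne']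

/-- Solutions are stable under continuous passage to the closure of the parameter set. -/
lemma of_closure (hc : Coef p q) (h : ∀ s ∈ A, Ell p q l (U s) (ζ s)) {s₀ : X}
    (hs₀ : s₀ ∈ closure A)
    (hU : ContinuousOn (fun z : X × ℝ => U z.1 z.2) (insert s₀ A ×ˢ Ioo 0 l))
    (hζ : ContinuousOn (fun z : X × ℝ => ζ z.1 z.2) (insert s₀ A ×ˢ Ioo 0 l)) :
    Ell p q l (U s₀) (ζ s₀) := by
  rcases le_or_gt l 0 with hl | hl
  · exact ⟨0, by simp [Ioo_eq_empty (not_lt.2 hl)]⟩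
  have hqc := hc.qc
  have hsc := continuous_scale hc
  have h0 : l / 3 ∈ Ioo 0 l := ⟨by linarith, by linarith⟩
  have h1 : l / 2 ∈ Ioo 0 l := ⟨by linarith, by linarith⟩
  have hne : scale p (l / 2) - scale p (l / 3) ≠ 0 :=
    (sub_pos.2 (strictMono_scale hc (by linarith))).ne'
  have hm : s₀ ∈ insert s₀ A := mem_insert _ _
  have hsl := continuousOn_slope hc h0 h1 hU hζ
  refine of_formula hc (continuousOn_left hU hm) (continuousOn_left hζ hm) h0
    (d := (U s₀ (l / 2) - U s₀ (l / 3)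
      - ∫ r in (l / 3)..(l / 2), (scale p (l / 2) - scale p r) * (q r * U s₀ r - ζ s₀ r))
        / (scale p (l / 2) - scale p (l / 3))) fun x hx => ?_
  have hint : ContinuousOn
      (fun s => ∫ r in (l / 3)..x, (scale p x - scale p r) * (q r * U s r - ζ s r))
      (insert s₀ A) :=
    continuousOn_right
      (f := fun s y => ∫ r in (l / 3)..y, (scale p x - scale p r) * (q r * U s r - ζ s r))
      (continuousOn_primitive_Ioo
        (f := fun s r => (scale p x - scale p r) * (q r * U s r - ζ s r)) (by fun_prop) h0) hx
  have hL := (continuousOn_right hU hx).sub (continuousOn_right hU h0) s₀ hm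
  have hR := (hsl.mul_const (scale p x - scale p (l / 3))).add hint s₀ hm
  have hne' : (𝓝[A] s₀).NeBot := mem_closure_iff_nhdsWithin_neBot.1 hs₀
  refine tendsto_nhds_unique (hL.mono_left (nhdsWithin_mono _ (subset_insert _ _)))
    ((hR.mono_left (nhdsWithin_mono _ (subset_insert _ _))).congr' ?_)
  filter_upwards [self_mem_nhdsWithin] with s hs
  have hζs := continuousOn_left hζ (mem_insert_of_mem s₀ hs)
  have e1 := (h s hs).formula hc hζs h0 h1
  have e2 := (h s hs).formula hc hζs h0 hx
  simp only [Pi.add_apply, Pi.sub_apply]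
  rw [e1, e2]
  field_simp
  ring

end Param

/-- Weighted integration of a continuous family of solutions. -/
lemma integral (hc : Coef p q) {a b : ℝ} (hab : a ≤ b) {w : ℝ → ℝ} (hw : ContinuousOn w (Icc a b))
    {U ζ : ℝ → ℝ → ℝ} (h : ∀ s ∈ Icc a b, Ell p q l (U s) (ζ s))
    (hU : ContinuousOn (fun z : ℝ × ℝ => U z.1 z.2) (Icc a b ×ˢ Ioo 0 l))
    (hζ : ContinuousOn (fun z : ℝ × ℝ => ζ z.1 z.2) (Icc a b ×ˢ Ioo 0 l)) :
    Ell p q l (fun x => ∫ s in a..b, w s * U s x) (fun x => ∫ s in a..b, w s * ζ s x) := by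
  have hqc := hc.qc
  have hcw : ContinuousOn (fun z : ℝ × ℝ => w z.1) (Icc a b ×ˢ Ioo 0 l) :=
    hw.comp (by fun_prop) fun z hz => hz.1
  have key : ∀ F F' : ℝ → ℝ → ℝ,
      ContinuousOn (fun z : ℝ × ℝ => F z.1 z.2) (Icc a b ×ˢ Ioo 0 l) →
      ContinuousOn (fun z : ℝ × ℝ => F' z.1 z.2) (Icc a b ×ˢ Ioo 0 l) →
      (∀ s ∈ Icc a b, ∀ x ∈ Ioo 0 l, HasDerivAt (F s) (F' s x) x) → ∀ x ∈ Ioo 0 l,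
      HasDerivAt (fun x => ∫ s in a..b, w s * F s x) (∫ s in a..b, w s * F' s x) x := by
    intro F F' hF hF' hd x hx
    obtain ⟨c, hc1, hc2⟩ := exists_between hx.1
    obtain ⟨d, hd1, hd2⟩ := exists_between hx.2
    have hsub : Icc c d ⊆ Ioo 0 l := fun r hr => ⟨hc1.trans_le hr.1, hr.2.trans_lt hd2⟩
    have hwF' : ContinuousOn (fun z : ℝ × ℝ => w z.1 * F' z.1 z.2) (Icc a b ×ˢ Ioo 0 l) :=
      hcw.mul hF'
    have hwF : ContinuousOn (fun z : ℝ × ℝ => w z.1 * F z.1 z.2) (Icc a b ×ˢ Ioo 0 l) :=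
      hcw.mul hF
    obtain ⟨C, hC⟩ := (isCompact_Icc.prod isCompact_Icc).exists_bound_of_continuousOn
      (hwF'.mono (prod_mono_right hsub))
    have hI : uIoc a b ⊆ Icc a b := by
      rw [uIoc_of_le hab]
      exact Ioc_subset_Icc_self
    refine (intervalIntegral.hasDerivAt_integral_of_dominated_loc_of_deriv_le
      (F := fun x s => w s * F s x) (F' := fun x s => w s * F' s x) (bound := fun _ => C)
      (s := Icc c d) (Icc_mem_nhds hc2 hd1) ?_ ?_ ?_ ?_ ?_ ?_).2
    · filter_upwards [Icc_mem_nhds hc2 hd1] with y hy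
      exact ((continuousOn_right (f := fun s x => w s * F s x) hwF (hsub hy)).mono
        hI).aestronglyMeasurable measurableSet_uIoc
    · exact (continuousOn_right (f := fun s x => w s * F s x) hwF
        hx).intervalIntegrable_of_Icc hab
    · exact ((continuousOn_right (f := fun s x => w s * F' s x) hwF' hx).mono
        hI).aestronglyMeasurable measurableSet_uIoc
    · exact ae_of_all _ fun s hs y hy => hC (s, y) ⟨hI hs, hy⟩
    · exact intervalIntegrable_const
    · exact ae_of_all _ fun s hs y hy => (hd s (hI hs) y (hsub hy)).const_mul _
  have hD := continuousOn_flux hc h hU hζ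
  have hpc := hc.pc
  refine ⟨fun x => ∫ s in a..b, w s * (p x * deriv (U s) x), fun x hx => ⟨?_, ?_⟩⟩
  · have := key U (fun s x => deriv (U s) x) hU (continuousOn_deriv hc h hU hζ)
      (fun s hs x hx => (h s hs).hasDerivAt hx) x hx
    convert! this using 1
    rw [← intervalIntegral.integral_div]
    congr 1
    ext s
    field_simp [(hc.p0 x).ne']
  · have := key (fun s x => p x * deriv (U s) x) (fun s x => q x * U s x - ζ s x) hD
      (by fun_prop) (fun s hs x hx => (h s hs).flux hc.p0 hx) x hx
    convert! this using 1
    rw [← intervalIntegral.integral_const_mul, ← intervalIntegral.integral_sub]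
    · congr 1
      ext s
      ring
    · exact ((continuousOn_right (f := fun s x => w s * U s x) (hcw.mul hU)
        hx).intervalIntegrable_of_Icc hab).const_mul _
    · exact (continuousOn_right (f := fun s x => w s * ζ s x) (hcw.mul hζ)
        hx).intervalIntegrable_of_Icc hab

end Ell

/-- Uniqueness for the homogeneous Dirichlet problem on an interval. -/
lemma eq_zero_of_ell (hc : Coef p q) {a b : ℝ} {w D : ℝ → ℝ}
    (hw : ContinuousOn w (Icc a b)) (ha : w a = 0) (hb : w b = 0)
    (h : ∀ x ∈ Ioo a b, HasDerivAt w (D x / p x) x ∧ HasDerivAt D (q x * w x) x) :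
    ∀ x ∈ Icc a b, w x = 0 := by
  have hmono : ∀ x ∈ Ioo a b, ∀ y ∈ Ioo a b, x ≤ y → w x * D x ≤ w y * D y := by
    have hd : ∀ x ∈ Ioo a b, HasDerivAt (fun x => w x * D x) (D x ^ 2 / p x + q x * w x ^ 2) x := by
      intro x hx
      refine ((h x hx).1.mul (h x hx).2).congr_deriv ?_
      ring
    have := monotoneOn_of_deriv_nonneg (convex_Ioo a b)
      (fun x hx => (hd x hx).continuousAt.continuousWithinAt)
      (fun x hx => (hd x (interior_subset hx)).differentiableAt.differentiableWithinAt)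
      fun x hx => by
        rw [(hd x (interior_subset hx)).deriv]
        have := hc.p0 x
        have := hc.q0 x
        positivity
    exact fun x hx y hy hxy => this hx hy hxy
  have hsq : ∀ x ∈ Ioo a b, HasDerivAt (fun x => w x ^ 2) (2 * (w x * D x) / p x) x := by
    intro x hx
    refine ((h x hx).1.pow 2).congr_deriv ?_
    simp
    ring
  have hzero : ∀ x ∈ Ioo a b, w x * D x = 0 := by
    intro x hx
    by_contra hne
    have hwx : w x ≠ 0 := left_ne_zero_of_mul hne
    have hpos : 0 < w x ^ 2 := by positivity
    rcases lt_or_gt_of_ne hne with hlt | hgt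
    · have hsub : Icc a x ⊆ Icc a b := Icc_subset_Icc_right hx.2.le
      have := antitoneOn_of_deriv_nonpos (convex_Icc a x) ((hw.mono hsub).pow 2)
        (fun y hy => by
          rw [interior_Icc] at hy
          exact (hsq y ⟨hy.1, hy.2.trans hx.2⟩).differentiableAt.differentiableWithinAt)
        fun y hy => by
          rw [interior_Icc] at hy
          have hy' : y ∈ Ioo a b := ⟨hy.1, hy.2.trans hx.2⟩
          have h3 := (hsq y hy').deriv
          change deriv (fun x => w x ^ 2) y ≤ 0
          rw [h3]
          have := hmono y hy' x hx hy.2.le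
          exact div_nonpos_of_nonpos_of_nonneg (by linarith) (hc.p0 y).le
      have h2 := this ⟨le_rfl, hx.1.le⟩ ⟨hx.1.le, le_rfl⟩ hx.1.le
      simp only [Pi.pow_apply, ha] at h2
      nlinarith
    · have hsub : Icc x b ⊆ Icc a b := Icc_subset_Icc_left hx.1.le
      have := monotoneOn_of_deriv_nonneg (convex_Icc x b) ((hw.mono hsub).pow 2)
        (fun y hy => by
          rw [interior_Icc] at hy
          exact (hsq y ⟨hx.1.trans hy.1, hy.2⟩).differentiableAt.differentiableWithinAt)
        fun y hy => by
          rw [interior_Icc] at hy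
          have hy' : y ∈ Ioo a b := ⟨hx.1.trans hy.1, hy.2⟩
          have h3 := (hsq y hy').deriv
          change 0 ≤ deriv (fun x => w x ^ 2) y
          rw [h3]
          have := hmono x hx y hy' hy.1.le
          exact div_nonneg (by linarith) (hc.p0 y).le
      have h2 := this ⟨le_rfl, hx.2.le⟩ ⟨hx.2.le, le_rfl⟩ hx.2.le
      simp only [Pi.pow_apply, hb] at h2
      nlinarith
  intro x hx
  have h2 : w x ^ 2 = w a ^ 2 := by
    rcases hx.1.eq_or_lt with rfl | hax
    · rfl
    have hsub : Icc a x ⊆ Icc a b := Icc_subset_Icc_right hx.2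
    obtain ⟨y, hy, he⟩ := exists_hasDerivAt_eq_slope (fun x => w x ^ 2)
      (fun x => 2 * (w x * D x) / p x) hax ((hw.mono hsub).pow 2)
      fun y hy => hsq y ⟨hy.1, hy.2.trans_le hx.2⟩
    rw [hzero y ⟨hy.1, hy.2.trans_le hx.2⟩] at he
    simp only [mul_zero, zero_div] at he
    have := (div_eq_zero_iff.1 he.symm).resolve_right (sub_pos.2 hax).ne'
    linarith
  rw [ha] at h2
  exact pow_eq_zero_iff (two_ne_zero) |>.1 (by rw [h2]; ring)

section Curve

variable {M ι : Type} [NormedAddCommGroup M] [InnerProductSpace ℝ M]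

lemma summable_abs_inner (w : HilbertBasis ι ℝ M) (a b : M) :
    Summable fun i => |⟪w i, a⟫ * ⟪w i, b⟫| := by
  refine (w.summable_inner_mul_inner a b).abs.congr fun i => ?_
  rw [real_inner_comm]

lemma tsum_inner (w : HilbertBasis ι ℝ M) (a b : M) :
    ∑' i, ⟪w i, a⟫ * ⟪w i, b⟫ = ⟪a, b⟫ := by
  rw [← w.tsum_inner_mul_inner a b]
  refine tsum_congr fun i => ?_
  rw [real_inner_comm]

lemma eq_of_inner_basis (w : HilbertBasis ι ℝ M) {a b : M} (h : ∀ i, ⟪w i, a⟫ = ⟪w i, b⟫) :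
    a = b := by
  refine w.repr.injective (lp.ext (funext fun i => ?_))
  rw [w.repr_apply_apply, w.repr_apply_apply, h]

lemma exists_multiplier (w : HilbertBasis ι ℝ M) (v : M) {σ : ι → ℝ} {C : ℝ}
    (hC : ∀ i, |σ i| ≤ C) : ∃ m : M, ∀ i, ⟪w i, m⟫ = σ i * ⟪w i, v⟫ := by
  have hm : Memℓp (fun i => σ i * ⟪w i, v⟫) 2 := by
    have h2 := (lp.memℓp (w.repr v)).const_mul C
    refine memℓp_gen ?_
    have h3 := h2.summable (by norm_num)
    refine Summable.of_nonneg_of_le (fun i => by positivity) (fun i => ?_) h3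
    refine Real.rpow_le_rpow (norm_nonneg _) ?_ (by norm_num)
    rw [w.repr_apply_apply, norm_mul, norm_mul]
    exact mul_le_mul_of_nonneg_right ((hC i).trans (le_abs_self C)) (norm_nonneg _)
  refine ⟨w.repr.symm ⟨_, hm⟩, fun i => ?_⟩
  rw [← w.repr_apply_apply, LinearIsometryEquiv.apply_symm_apply]

lemma exists_curve (w : HilbertBasis ι ℝ M) (v : M) {σ : ι → ℝ → ℝ} {A : Set ℝ}
    (hσ : ∀ i, ContinuousOn (σ i) A)
    (hC : ∀ t ∈ A, ∃ C, ∀ᶠ s in 𝓝[A] t, ∀ i, |σ i s| ≤ C) :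
    ∃ m : ℝ → M, ContinuousOn m A ∧ ∀ t ∈ A, ∀ i, ⟪w i, m t⟫ = σ i t * ⟪w i, v⟫ := by
  have hex : ∀ t, ∃ m : M, t ∈ A → ∀ i, ⟪w i, m⟫ = σ i t * ⟪w i, v⟫ := by
    intro t
    by_cases ht : t ∈ A
    · obtain ⟨C, h⟩ := hC t ht
      obtain ⟨m, hm⟩ := exists_multiplier w v (h.self_of_nhdsWithin ht)
      exact ⟨m, fun _ => hm⟩
    · exact ⟨0, fun h => absurd h ht⟩
  choose m hm using hex
  refine ⟨m, fun t ht => ?_, hm⟩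
  obtain ⟨C, h⟩ := hC t ht
  have hsq : Tendsto (fun s => ‖m s - m t‖ ^ 2) (𝓝[A] t) (𝓝 0) := by
    have key : Tendsto (fun s => ∑' i, ((σ i s - σ i t) * ⟪w i, v⟫) ^ 2) (𝓝[A] t)
        (𝓝 (∑' _ : ι, (0:ℝ))) := by
      refine tendsto_tsum_of_dominated_convergence
        (bound := fun i => (2 * C) ^ 2 * |⟪w i, v⟫ * ⟪w i, v⟫|)
        ((summable_abs_inner w v v).mul_left _) (fun i => ?_) ?_
      · have h1 : Tendsto (fun s => ((σ i s - σ i t) * ⟪w i, v⟫) ^ 2) (𝓝[A] t)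
            (𝓝 (((σ i t - σ i t) * ⟪w i, v⟫) ^ 2)) :=
          (((hσ i t ht).sub tendsto_const_nhds).mul tendsto_const_nhds).pow 2
        simpa using h1
      · filter_upwards [h] with s hs i
        rw [norm_eq_abs, abs_pow, abs_mul, mul_pow, abs_mul, ← sq]
        have h1 := hs i
        have h2 := h.self_of_nhdsWithin ht i
        have h3 := abs_sub (σ i s) (σ i t)
        gcongr
        linarith
    rw [tsum_zero] at key
    refine key.congr' ?_
    filter_upwards [self_mem_nhdsWithin] with s hs
    rw [← real_inner_self_eq_norm_sq, ← tsum_inner w]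
    refine tsum_congr fun i => ?_
    rw [inner_sub_right, hm s hs, hm t ht]
    ring
  have h0 : Tendsto (fun s => ‖m s - m t‖) (𝓝[A] t) (𝓝 0) := by
    have := hsq.sqrt
    simpa using this
  exact tendsto_iff_norm_sub_tendsto_zero.2 h0

end Curve

namespace Spec

variable {M ι : Type} [NormedAddCommGroup M] [InnerProductSpace ℝ M]
  {p q : ℝ → ℝ} {l : ℝ} {e : ℝ → M} {B : M →L[ℝ] M} {w : HilbertBasis ι ℝ M} {mu : ι → ℝ}

lemma inner_B_basis (S : Spec p q l e B w mu) (m : M) (i : ι) :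
    ⟪w i, B m⟫ = mu i * ⟪w i, m⟫ := by
  rw [real_inner_comm, S.inner_B]
  simp_rw [mul_comm (inner ℝ (e _) m)]
  rw [← S.inner_B, S.B_w, inner_smul_left]
  simp

lemma exists_relax (S : Spec p q l e B w mu) {α : ℝ} (h0 : 0 < α) (h1 : α < 1) :
    ∃ P, Relax α (fun i => (mu i)⁻¹) P := by
  choose P hP using fun i => exists_isRelax (lam := (mu i)⁻¹) h0 h1
  exact ⟨P, h0, h1, fun i => (inv_pos.2 (S.mu_pos i)).le, hP⟩

/-- Solution of the inverse problem in the energy space. -/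
lemma exists_solution (S : Spec p q l e B w mu) {α : ℝ} (h0 : 0 < α) (h1 : α < 1) (φ h : M)
    (hN : ⟪B h, h⟫ ≠ 0) {b : ℝ → ℝ} (hb : LI b) (γ : ℝ) :
    ∃ (f0 : ℝ) (fp : ℝ → ℝ) (u c : ℝ → M) (d : ℝ → ℝ → ℝ), LI fp ∧
      ContinuousOn u (Ici 0) ∧ ContinuousOn c (Ioi 0) ∧ u 0 = φ ∧
      (∀ t, 0 < t → u t = B (prim f0 fp t • h - c t)) ∧
      (∀ x, KC (d x)) ∧
      (∀ x t, 0 ≤ t → ⟪e x, u t⟫ = ⟪e x, φ⟫ + ∫ s in (0:ℝ)..t, d x s) ∧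
      (∀ x t, 0 < t → cv (rl (1 - α)) (d x) t = ⟪e x, c t⟫) ∧
      ∀ t, 0 ≤ t → ⟪B h, u t⟫
        = ⟪B h, φ⟫ + ∫ s in (0:ℝ)..t, (γ + ⟪B h, h⟫ * ∫ r in (0:ℝ)..s, b r) := by
  have := S.countable
  obtain ⟨P, hP⟩ := S.exists_relax h0 h1
  set lam : ι → ℝ := fun i => (mu i)⁻¹ with hlam
  have hml : ∀ i, mu i * lam i = 1 := fun i => mul_inv_cancel₀ (S.mu_pos i).ne'
  have hlm : ∀ i, lam i * mu i = 1 := fun i => inv_mul_cancel₀ (S.mu_pos i).ne'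
  have hBs : ∀ a b : M, Summable fun i => |mu i * ⟪w i, a⟫ * ⟪w i, b⟫| := fun a b =>
    (summable_abs_inner w (B a) b).congr fun i => by rw [S.inner_B_basis]
  have hBt : ∀ a b : M, ∑' i, mu i * ⟪w i, a⟫ * ⟪w i, b⟫ = ⟪B a, b⟫ := fun a b => by
    rw [← tsum_inner w]
    exact tsum_congr fun i => by rw [S.inner_B_basis]
  have hLs : ∀ a b : M, Summable fun i => |lam i * (mu i * ⟪w i, a⟫ * ⟪w i, b⟫)| := fun a b =>
    (summable_abs_inner w a b).congr fun i => by
      rw [← mul_assoc, ← mul_assoc, hlm, one_mul]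
  obtain ⟨f0, y, hy, hfy⟩ := hP.exists_source (hBs h φ) (hBs h h) (hLs h φ) (hLs h h)
    (by rwa [hBt]) hb γ
  rw [hBt, hBt] at hfy
  set fp : ℝ → ℝ := fun t => cv (rl (1 - α)) b t + y t with hfp_def
  have hk : LI (rl (1 - α)) := (kc_rl (by linarith)).li
  have hfp : LI fp := (hk.cv hb).add hy.li
  have hev : ∀ t : ℝ, ∀ᶠ s in 𝓝[Ici 0] t, s ∈ Icc 0 (t + 1) := fun t => by
    filter_upwards [self_mem_nhdsWithin, mem_nhdsWithin_of_mem_nhds (Iio_mem_nhds (lt_add_one t))]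
      with s h1 h2 using ⟨h1, (mem_Iio.1 h2).le⟩
  have bR := hP.bc_R
  have bS := hP.bc_S
  have bresp : ∀ i, BC (resp P f0 fp i) := fun i =>
    (continuousOn_const.mul (bR i)).add (hfp.cv_bc (bR i))
  have brespC : ∀ i, BC (respC lam P f0 fp i) := fun i =>
    (continuousOn_const.mul (bS i)).add (hfp.cv_bc (bS i))
  obtain ⟨u1, cu1, hu1⟩ := exists_curve w φ (σ := fun i => relaxS (lam i) (P i)) (A := Ici 0) bS
    fun t _ => ⟨1, (hev t).mono fun s hs i => hP.abs_S_le i hs.1⟩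
  obtain ⟨u2, cu2, hu2⟩ := exists_curve w h (σ := resp P f0 fp) (A := Ici 0) bresp fun t _ => by
    obtain ⟨C, hC⟩ := hP.exists_bound_resp f0 hfp (t + 1)
    exact ⟨C, (hev t).mono fun s hs i => hC i s hs⟩
  obtain ⟨c2, cc2, hc2⟩ := exists_curve w h (σ := respC lam P f0 fp) (A := Ici 0) brespC
    fun t _ => by
      obtain ⟨C, hC⟩ := hP.exists_bound_respC f0 hfp (t + 1)
      exact ⟨C, (hev t).mono fun s hs i => hC i s hs⟩
  obtain ⟨c1, cc1, hc1⟩ := exists_curve w φ (σ := fun i t => lam i * relaxS (lam i) (P i) t)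
    (A := Ioi 0) (fun i => continuousOn_const.mul ((bS i).mono Ioi_subset_Ici_self)) fun t ht => by
      refine ⟨Gamma (α + 1) * t ^ (-α) + 1, ?_⟩
      have hc : ContinuousAt (fun s : ℝ => Gamma (α + 1) * s ^ (-α)) t :=
        continuousAt_const.mul (Real.continuousAt_rpow_const _ _ (Or.inl (ne_of_gt ht)))
      filter_upwards [self_mem_nhdsWithin,
        mem_nhdsWithin_of_mem_nhds (hc.eventually (gt_mem_nhds (lt_add_one _)))] with s hs h2 i
      exact (hP.lamS_le i hs).trans h2.le
  have ha : ∀ x, Summable fun i => |⟪w i, φ⟫ * ⟪w i, e x⟫| := fun x => summable_abs_inner w _ _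
  have hc : ∀ x, Summable fun i => |⟪w i, h⟫ * ⟪w i, e x⟫| := fun x => summable_abs_inner w _ _
  have hsum : ∀ {m v : M} {σ : ι → ℝ}, (∀ i, ⟪w i, m⟫ = σ i * ⟪w i, v⟫) → ∀ z,
      ⟪z, m⟫ = ∑' i, ⟪w i, v⟫ * ⟪w i, z⟫ * σ i := fun {m v σ} hm z => by
    rw [← tsum_inner w]
    exact tsum_congr fun i => by rw [hm]; ring
  refine ⟨f0, fp, fun t => u1 t + u2 t, fun t => c2 t - c1 t,
    fun x => modeDeriv lam P (fun i => ⟪w i, φ⟫ * ⟪w i, e x⟫) (fun i => ⟪w i, h⟫ * ⟪w i, e x⟫)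
      f0 b y, hfp, cu1.add cu2, (cc2.mono Ioi_subset_Ici_self).sub cc1, ?_, fun t ht => ?_,
    fun x => hP.kc_modeDeriv (ha x) (hc x) hb hy, fun x t ht => ?_, fun x t ht => ?_,
    fun t ht => ?_⟩
  · refine eq_of_inner_basis w fun i => ?_
    rw [inner_add_right, hu1 0 self_mem_Ici, hu2 0 self_mem_Ici]
    simp [resp, cv, relaxS_zero]
  · refine eq_of_inner_basis w fun i => ?_
    rw [S.inner_B_basis, inner_add_right, hu1 t (mem_Ici.2 ht.le), hu2 t (mem_Ici.2 ht.le),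
      inner_sub_right, inner_sub_right, inner_smul_right, hc1 t ht, hc2 t (mem_Ici.2 ht.le)]
    have e1 := hP.lam_resp (f0 := f0) hfp i ht.le
    have e2 : resp P f0 fp i t = mu i * (prim f0 fp t - respC lam P f0 fp i t) := by
      rw [← e1, ← mul_assoc, hml, one_mul]
    rw [e2]
    linear_combination (-(relaxS (lam i) (P i) t * inner ℝ (w i) φ)) * hml i
  · rw [inner_add_right, hsum (hu1 t ht), hsum (hu2 t ht),
      hP.modes_eq (ha x) (hc x) hb hy ht, tsum_inner, real_inner_comm]
  · rw [hP.cv_k_modeDeriv (ha x) (hc x) hb hy ht, inner_sub_right,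
      hsum (hc2 t (mem_Ici.2 ht.le)), hsum (hc1 t ht)]
  · rw [← hfy t ht, inner_add_right, hsum (hu1 t ht), hsum (hu2 t ht)]
    congr 1
    · exact tsum_congr fun i => by rw [S.inner_B_basis]; ring
    · exact tsum_congr fun i => by rw [S.inner_B_basis]; ring

end Spec

lemma coef_clamp {p q : ℝ → ℝ} {l : ℝ} (hl : 0 ≤ l) (hp : ContinuousOn p (Icc 0 l))
    (hp0 : ∀ x ∈ Icc 0 l, 0 < p x) (hq : ContinuousOn q (Icc 0 l))
    (hq0 : ∀ x ∈ Icc 0 l, 0 ≤ q x) :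
    Coef (fun x => p (clamp l x)) (fun x => q (clamp l x)) where
  pc := hp.comp_continuous (continuous_clamp l) (clamp_mem hl)
  p0 x := hp0 _ (clamp_mem hl x)
  qc := hq.comp_continuous (continuous_clamp l) (clamp_mem hl)
  q0 x := hq0 _ (clamp_mem hl x)

section Clamp

variable {p q : ℝ → ℝ} {l : ℝ}

lemma clamp_eventuallyEq (p : ℝ → ℝ) {x : ℝ} (hx : x ∈ Ioo 0 l) :
    (fun y => p (clamp l y)) =ᶠ[𝓝 x] p := by
  filter_upwards [Ioo_mem_nhds hx.1 hx.2] with y hy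
  rw [clamp_eq (Ioo_subset_Icc_self hy)]

lemma Ell.hasDerivAt_flux_clamp {U ζ : ℝ → ℝ}
    (h : Ell (fun x => p (clamp l x)) (fun x => q (clamp l x)) l U ζ)
    (hp0 : ∀ x ∈ Icc 0 l, 0 < p x) {x : ℝ} (hx : x ∈ Ioo 0 l) :
    HasDerivAt (fun y => p y * deriv U y) (q x * U x - ζ x) x := by
  have hl : 0 ≤ l := (hx.1.trans hx.2).le
  have := h.flux (fun x => hp0 _ (clamp_mem hl x)) hx
  simp only [clamp_eq (Ioo_subset_Icc_self hx)] at this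
  refine this.congr_of_eventuallyEq ?_
  filter_upwards [clamp_eventuallyEq p hx] with y hy
  rw [hy]

lemma Ell.hasDerivAt_deriv_clamp {U ζ : ℝ → ℝ}
    (h : Ell (fun x => p (clamp l x)) (fun x => q (clamp l x)) l U ζ)
    (hp0 : ∀ x ∈ Icc 0 l, 0 < p x) (hpd : ∀ x ∈ Icc 0 l, DifferentiableAt ℝ p x) {x : ℝ}
    (hx : x ∈ Ioo 0 l) :
    HasDerivAt (deriv U) ((q x * U x - ζ x - deriv p x * deriv U x) / p x) x := by
  have hx' := Ioo_subset_Icc_self hx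
  have hpx := (hp0 x hx').ne'
  have := (h.hasDerivAt_flux_clamp hp0 hx).div (hpd x hx').hasDerivAt hpx
  refine (this.congr_of_eventuallyEq ?_).congr_deriv ?_
  · filter_upwards [Ioo_mem_nhds hx.1 hx.2] with y hy
    have hpy := (hp0 y (Ioo_subset_Icc_self hy)).ne'
    simp only [Pi.div_apply]
    field_simp
  · field_simp

lemma ell_clamp_of_deriv {U ζ : ℝ → ℝ} (hp0 : ∀ x ∈ Icc 0 l, 0 < p x)
    (hpd : ∀ x ∈ Icc 0 l, DifferentiableAt ℝ p x)
    (h1 : ∀ x ∈ Ioo 0 l, DifferentiableAt ℝ U x ∧ DifferentiableAt ℝ (deriv U) x)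
    (h2 : ∀ x ∈ Ioo 0 l, deriv (fun y => p y * deriv U y) x = q x * U x - ζ x) :
    Ell (fun x => p (clamp l x)) (fun x => q (clamp l x)) l U ζ := by
  rcases le_or_gt l 0 with hl | hl
  · exact ⟨0, by simp [Ioo_eq_empty (not_lt.2 hl)]⟩
  refine Ell.intro (fun x hx => (h1 x hx).1) (fun x => hp0 _ (clamp_mem hl.le x)) fun x hx => ?_
  simp only [clamp_eq (Ioo_subset_Icc_self hx)]
  have := ((hpd x (Ioo_subset_Icc_self hx)).mul (h1 x hx).2).hasDerivAt
  rw [show deriv (p * deriv U) x = _ from h2 x hx] at this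
  refine this.congr_of_eventuallyEq ?_
  filter_upwards [clamp_eventuallyEq p hx] with y hy
  rw [hy, Pi.mul_apply]

end Clamp

lemma caputoDeriv_eq_cv {α : ℝ} {v d : ℝ → ℝ} {t : ℝ} (ht : 0 ≤ t)
    (h : ∀ s ∈ Ioo 0 t, deriv v s = d s) : caputoDeriv α v t = cv (rl (1 - α)) d t := by
  rw [cv_comm, caputoDeriv, ← intervalIntegral.integral_const_mul]
  refine intervalIntegral.integral_congr_ae ?_
  rw [uIoc_of_le ht]
  filter_upwards [compl_mem_ae_iff.2 (measure_singleton t)] with s hs hst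
  rw [h s ⟨hst.1, hst.2.lt_of_ne hs⟩, rl]
  rw [show 1 - α - 1 = -α by ring]
  ring

section Rep

variable {E ι : Type} [NormedAddCommGroup E] [InnerProductSpace ℝ E] {p q h : ℝ → ℝ} {l : ℝ}
  {e : ℝ → E} {B : E →L[ℝ] E} {w : HilbertBasis ι ℝ E} {mu : ι → ℝ} {m : E}

lemma Spec.inner_B_rep (S : Spec p q l e B w mu) (hl : 0 ≤ l)
    (hm : ∀ x ∈ Icc 0 l, ⟪e x, m⟫ = h x) (n : E) :
    ⟪B m, n⟫ = ∫ x in (0:ℝ)..l, h x * ⟪e x, n⟫ := by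
  rw [S.inner_B]
  refine integral_congr fun x hx => ?_
  rw [uIcc_of_le hl] at hx
  simp only [hm x hx]

lemma Spec.inner_B_pos (S : Spec p q l e B w mu) (hl : 0 < l) (hh : ContinuousOn h (Icc 0 l))
    (hne : ∃ x ∈ Icc 0 l, h x ≠ 0) (hm : ∀ x ∈ Icc 0 l, ⟪e x, m⟫ = h x) : 0 < ⟪B m, m⟫ := by
  have h1 : ∫ x in (0:ℝ)..l, h x * ⟪e x, m⟫ = ∫ x in (0:ℝ)..l, h x ^ 2 :=
    integral_congr fun x hx => by
      rw [uIcc_of_le hl.le] at hx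
      simp only [hm x hx, sq]
  rw [S.inner_B_rep hl.le hm, h1]
  obtain ⟨x0, hx0, hx⟩ := hne
  exact intervalIntegral.integral_pos hl (hh.pow 2) (fun x _ => sq_nonneg _)
    ⟨x0, hx0, by positivity⟩

end Rep

/-- Existence for the inverse problem, in terms of representatives `φ'` and `h'` of the initial
value and of the spatial factor of the source. -/
lemma Spec.exists_inverse_solution {E ι : Type} [NormedAddCommGroup E] [InnerProductSpace ℝ E]
    [CompleteSpace E] {α T l : ℝ} (hα0 : 0 < α) (hα1 : α < 1) (hl : 0 < l) {p q φ h g : ℝ → ℝ}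
    {e : ℝ → E} {B : E →L[ℝ] E} {w : HilbertBasis ι ℝ E} {mu : ι → ℝ} {φ' h' : E}
    (hC : Coef (fun x => p (clamp l x)) (fun x => q (clamp l x)))
    (S : Spec (fun x => p (clamp l x)) (fun x => q (clamp l x)) l e B w mu)
    (hp_diff : ∀ x ∈ Icc 0 l, DifferentiableAt ℝ p x)
    (hp_cont : ContinuousOn (deriv p) (Icc 0 l)) (hp_pos : ∀ x ∈ Icc 0 l, 0 < p x)
    (hpc : ContinuousOn p (Icc 0 l)) (hq_cont : ContinuousOn q (Icc 0 l))
    (hhc : ContinuousOn h (Icc 0 l)) (hφ' : ∀ x ∈ Icc 0 l, ⟪e x, φ'⟫ = φ x)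
    (hh' : ∀ x ∈ Icc 0 l, ⟪e x, h'⟫ = h x) (hN : 0 < ⟪B h', h'⟫)
    (hg : ∃ g₁ : ℝ → ℝ, (∀ x ∈ Icc 0 T, g x = g 0 + ∫ t in (0:ℝ)..x, g₁ t) ∧
      AbsContOn g₁ 0 T)
    (hcompat : ∫ x in (0:ℝ)..l, φ x * h x = g 0) :
    ∃ f : ℝ → ℝ, AbsContOn f 0 T ∧
      ∃ u : ℝ → ℝ → ℝ, IsDirectSolution α T l p q (fun t x => f t * h x) φ u ∧
        ∀ t ∈ Icc 0 T, (∫ x in (0:ℝ)..l, h x * u t x) = g t := by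
  have hBint := S.inner_B_rep hl.le hh'
  set N := ⟪B h', h'⟫ with hNdef
  obtain ⟨g₁, hg1, g₂, hg2, hg12⟩ := hg
  have hb : LI ((Ioc 0 T).indicator fun t => g₂ t / N) := fun T' =>
    (IntegrableOn.integrable_indicator ((hg2.mono_set Ioc_subset_Icc_self).div_const N)
      measurableSet_Ioc).integrableOn
  obtain ⟨f0, fp, û, ĉ, d, hfp, cû, cĉ, hû0, hûB, hd, hûd, hcd, hover⟩ :=
    S.exists_solution hα0 hα1 φ' h' hN.ne' hb (g₁ 0)
  have hder : ∀ x t, 0 < t → HasDerivAt (fun τ => ⟪e x, û τ⟫) (d x t) t := fun x t ht => by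
    have h1 := ((hd x).hasDerivAt_integral ht).const_add ⟪e x, φ'⟫
    refine h1.congr_of_eventuallyEq ?_
    filter_upwards [Ioi_mem_nhds ht] with s hs using hûd x s (le_of_lt hs)
  have hcap : ∀ x t, 0 < t → caputoDeriv α (fun τ => ⟪e x, û τ⟫) t = ⟪e x, ĉ t⟫ :=
    fun x t ht => by
      rw [caputoDeriv_eq_cv ht.le fun s hs => (hder x s hs.1).deriv, hcd x t ht]
  have he : Continuous e := S.cont
  have hell : ∀ t, 0 < t → Ell (fun x => p (clamp l x)) (fun x => q (clamp l x)) l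
      (fun x => ⟪e x, û t⟫) (fun x => prim f0 fp t * h x - ⟪e x, ĉ t⟫) := fun t ht => by
    rw [hûB t ht]
    refine (S.ell _).congr (fun x _ => rfl) fun x hx => ?_
    rw [inner_sub_right, inner_smul_right, hh' x (Ioo_subset_Icc_self hx)]
  have hfc : BC (prim f0 fp) := continuousOn_const.add hfp.bc_integral
  refine ⟨prim f0 fp, ⟨fp, ?_, fun t _ => by simp [prim]⟩, fun t x => ⟪e x, û t⟫,
    ⟨?_, ?_, ?_, ?_, ?_, ?_, ?_, ?_⟩, ?_⟩
  · exact (integrableOn_Icc_iff_integrableOn_Ioc (by simp)).2 (hfp T)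
  · refine (he.comp_continuousOn continuousOn_snd).inner
      (cû.comp (f := fun z : ℝ × ℝ => z.1) continuousOn_fst fun z hz => hz.1.1)
  · exact fun t ht x _ => (hder x t ht.1).differentiableAt
  · refine ContinuousOn.congr (f := fun z : ℝ × ℝ => ⟪e z.2, ĉ z.1⟫) ?_
      fun z hz => hcap z.2 z.1 hz.1.1
    exact (he.comp_continuousOn continuousOn_snd).inner
      (cĉ.comp (f := fun z : ℝ × ℝ => z.1) continuousOn_fst fun z hz => hz.1.1)
  · intro t ht x hx
    exact ⟨((hell t ht.1).hasDerivAt hx).differentiableAt,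
      ((hell t ht.1).hasDerivAt_deriv_clamp hp_pos hp_diff hx).differentiableAt⟩
  · have c1 : ContinuousOn (fun z : ℝ × ℝ => ⟪e z.2, û z.1⟫) (Ioc 0 T ×ˢ Ioo 0 l) :=
      (he.comp_continuousOn continuousOn_snd).inner
        (cû.comp (f := fun z : ℝ × ℝ => z.1) continuousOn_fst fun z hz => hz.1.1.le)
    have c2 : ContinuousOn (fun z : ℝ × ℝ => ⟪e z.2, ĉ z.1⟫) (Ioc 0 T ×ˢ Ioo 0 l) :=
      (he.comp_continuousOn continuousOn_snd).inner
        (cĉ.comp (f := fun z : ℝ × ℝ => z.1) continuousOn_fst fun z hz => hz.1.1)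
    have hm : MapsTo (fun z : ℝ × ℝ => z.2) (Ioc 0 T ×ˢ Ioo 0 l) (Icc 0 l) :=
      fun z hz => Ioo_subset_Icc_self hz.2
    have c3 : ContinuousOn (fun z : ℝ × ℝ => h z.2) (Ioc 0 T ×ˢ Ioo 0 l) :=
      hhc.comp continuousOn_snd hm
    have c4 : ContinuousOn (fun z : ℝ × ℝ => prim f0 fp z.1) (Ioc 0 T ×ˢ Ioo 0 l) :=
      hfc.comp continuousOn_fst fun z hz => hz.1.1.le
    have c5 : ContinuousOn (fun z : ℝ × ℝ => q z.2) (Ioc 0 T ×ˢ Ioo 0 l) :=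
      hq_cont.comp continuousOn_snd hm
    have c6 : ContinuousOn (fun z : ℝ × ℝ => p z.2) (Ioc 0 T ×ˢ Ioo 0 l) :=
      hpc.comp continuousOn_snd hm
    have c7 : ContinuousOn (fun z : ℝ × ℝ => deriv p z.2) (Ioc 0 T ×ˢ Ioo 0 l) :=
      hp_cont.comp continuousOn_snd hm
    have c8 := Ell.continuousOn_deriv (U := fun t x => ⟪e x, û t⟫)
      (ζ := fun t x => prim f0 fp t * h x - ⟪e x, ĉ t⟫) hC
      (fun t (ht : t ∈ Ioc 0 T) => hell t ht.1) c1 ((c4.mul c3).sub c2)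
    exact ((((c5.mul c1).sub ((c4.mul c3).sub c2)).sub (c7.mul c8)).div c6
      fun z hz => (hp_pos _ (hm hz)).ne').congr fun z hz =>
        ((hell z.1 hz.1.1).hasDerivAt_deriv_clamp hp_pos hp_diff hz.2).deriv
  · intro t ht x hx
    have h1 := ((hell t ht.1).hasDerivAt_flux_clamp hp_pos hx).deriv
    simp only
    rw [hcap x t ht.1, h1]
    ring
  · intro x hx
    simp only
    rw [hû0, hφ' x hx]
  · intro t _
    simp only
    rw [S.left, S.right]
    simp
  · intro t ht
    rw [← hBint, hover t ht.1, hg1 t ht, hBint, ← hcompat]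
    congr 1
    · refine integral_congr fun x hx => ?_
      rw [uIcc_of_le hl.le] at hx
      simp only [hφ' x hx, mul_comm]
    · refine integral_congr fun s hs => ?_
      rw [uIcc_of_le ht.1] at hs
      have hsT : s ∈ Icc 0 T := ⟨hs.1, hs.2.trans ht.2⟩
      rw [hg12 s hsT, ← intervalIntegral.integral_const_mul]
      congr 1
      rw [integral_of_le hs.1, integral_of_le hs.1]
      refine setIntegral_congr_fun measurableSet_Ioc fun r hr => ?_
      have hrT : r ∈ Ioc 0 T := ⟨hr.1, hr.2.trans hsT.2⟩
      rw [indicator_of_mem hrT]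
      exact mul_div_cancel₀ _ hN.ne'

section Approx

variable {α lam : ℝ} {P g : ℝ → ℝ}

lemma IsRelax.abs_integral_mul_le (h0 : 0 < α) (h1 : α < 1) (hl : 0 ≤ lam)
    (hP : IsRelax α lam P) {a b M : ℝ} (ha : 0 ≤ a) (hab : a ≤ b) {φ : ℝ → ℝ}
    (hM : ∀ s ∈ Ioo a b, |φ s| ≤ M) :
    |lam * ∫ s in a..b, P s * φ s| ≤ M * (lam * ∫ s in a..b, P s) := by
  have hi : IntervalIntegrable P volume a b := (hP.kc.intervalIntegrable ha).symm.trans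
    (hP.kc.intervalIntegrable (ha.trans hab))
  rw [abs_mul, abs_of_nonneg hl, mul_left_comm]
  apply mul_le_mul_of_nonneg_left _ hl
  rw [← intervalIntegral.integral_const_mul, ← norm_eq_abs]
  apply intervalIntegral.norm_integral_le_of_norm_le hab _ (hi.const_mul M)
  filter_upwards [Countable.ae_notMem (countable_singleton b) volume] with s hs hs'
  have hs2 : s ∈ Ioo a b := ⟨hs'.1, lt_of_le_of_ne hs'.2 hs⟩
  have := hP.pos_or h0 h1 hl (ha.trans_lt hs'.1)
  rw [norm_eq_abs, abs_mul, abs_of_pos this, mul_comm]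
  exact mul_le_mul_of_nonneg_right (hM s hs2) this.le

lemma IsRelax.mass_eq (hP : IsRelax α lam P) {a b : ℝ} (ha : 0 ≤ a) (hab : a ≤ b) :
    lam * ∫ s in a..b, P s = relaxS lam P a - relaxS lam P b := by
  rw [← integral_interval_sub_left
    (hP.kc.intervalIntegrable (ha.trans hab)) (hP.kc.intervalIntegrable ha), relaxS, relaxS]
  ring

lemma IsRelax.abs_tail_le (h0 : 0 < α) (h1 : α < 1) (hl : 0 ≤ lam)
    (hP : IsRelax α lam P) (hg : KC g) {t δ : ℝ} (hδ : 0 ≤ δ) (hδt : 2 * δ ≤ t) (ht : 0 < t) :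
    |lam * ∫ s in (t - δ)..t, P s * g (t - s)| ≤ 2 * α / t * ∫ s in (0:ℝ)..δ, |g s| := by
  have hi := (hg.intervalIntegrable hδ).abs
  have hii : IntervalIntegrable (fun s => |g (t - s)|) volume (t - δ) t := by
    have := (hi.comp_sub_left t).symm
    simpa using this
  have e : ∫ s in (0:ℝ)..δ, |g s| = ∫ s in (t - δ)..t, |g (t - s)| := by
    rw [integral_comp_sub_left (fun s => |g s|)]; simp
  rw [e, ← intervalIntegral.integral_const_mul, ← intervalIntegral.integral_const_mul,
    ← norm_eq_abs]
  apply intervalIntegral.norm_integral_le_of_norm_le (by linarith) _ (hii.const_mul _)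
  refine Eventually.of_forall fun s hs => ?_
  have hs0 : 0 < s := by linarith [hs.1]
  have hp := hP.pos_or h0 h1 hl hs0
  rw [norm_eq_abs, ← mul_assoc, abs_mul, abs_of_nonneg (mul_nonneg hl hp.le)]
  apply mul_le_mul_of_nonneg_right _ (abs_nonneg _)
  have := hP.lam_mul_P_le h0 h1 hl hs0
  rw [le_div_iff₀ ht]
  have h2 : lam * P s * t ≤ lam * P s * (2 * s) :=
    mul_le_mul_of_nonneg_left (by linarith [hs.1]) (mul_nonneg hl hp.le)
  linarith

lemma KC.split3 {f : ℝ → ℝ} (hf : KC f) (hg : KC g) {t a b : ℝ} (ht : 0 < t) (ha : 0 ≤ a)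
    (hab : a ≤ b) (hb : b ≤ t) :
    InvSource.cv f g t = (∫ s in (0:ℝ)..a, f s * g (t - s)) + (∫ s in a..b, f s * g (t - s))
      + ∫ s in b..t, f s * g (t - s) := by
  have h := hf.cvI hg ht
  have m : ∀ x, 0 ≤ x → x ≤ t → IntervalIntegrable (fun s => f s * g (t - s)) volume 0 x :=
    fun x h0 h1 => h.mono_set (by rw [uIcc_of_le h0, uIcc_of_le ht.le]; exact Icc_subset_Icc_right h1)
  rw [integral_add_adjacent_intervals (m a ha (hab.trans hb))
    ((m a ha (hab.trans hb)).symm.trans (m b (ha.trans hab) hb)),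
    integral_add_adjacent_intervals (m b (ha.trans hab) hb)
    ((m b (ha.trans hab) hb).symm.trans h)]
  rfl

variable {Q : ℕ → ℝ → ℝ}

lemma abs_cv_relax_le (h0 : 0 < α) (h1 : α < 1) (hQ : ∀ n : ℕ, IsRelax α n (Q n)) (hg : KC g)
    {ε τ : ℝ} (hε : 0 < ε) : ∃ C, ∀ n : ℕ, ∀ t ∈ Icc ε τ, |(n:ℝ) * cv (Q n) g t| ≤ C := by
  obtain ⟨K, hK⟩ := isCompact_Icc.exists_bound_of_continuousOn
    (hg.cont.mono (fun t ht => lt_of_lt_of_le (half_pos hε) ht.1 : Icc (ε / 2) τ ⊆ Ioi 0))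
  refine ⟨max K 0 + 2 * α / ε * ∫ s in (0:ℝ)..(ε / 2), |g s|, fun n t ht => ?_⟩
  have htp : 0 < t := hε.trans_le ht.1
  have hn : (0:ℝ) ≤ n := n.cast_nonneg
  rw [(hQ n).kc.split3 hg htp le_rfl (by linarith [ht.1] : 0 ≤ t - ε / 2) (by linarith)]
  simp only [intervalIntegral.integral_same, zero_add, mul_add]
  refine (abs_add_le _ _).trans (add_le_add ?_ ?_)
  · refine ((hQ n).abs_integral_mul_le h0 h1 hn le_rfl (by linarith [ht.1]) (M := max K 0)
      fun s hs => ?_).trans ?_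
    · exact (hK _ ⟨by linarith [hs.2], by linarith [hs.1, ht.2]⟩).trans (le_max_left _ _)
    · rw [(hQ n).mass_eq le_rfl (by linarith [ht.1]), relaxS_zero]
      have := (hQ n).S_nonneg h0 h1 hn (t := t - ε / 2) (by linarith [ht.1])
      exact mul_le_of_le_one_right (le_max_right _ _) (by linarith)
  · refine ((hQ n).abs_tail_le h0 h1 hn hg (by linarith) (by linarith [ht.1]) htp).trans ?_
    apply mul_le_mul_of_nonneg_right
    · exact div_le_div_of_nonneg_left (by positivity) hε ht.1
    · exact intervalIntegral.integral_nonneg (by linarith) fun s _ => abs_nonneg _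

lemma tendsto_relaxS (h0 : 0 < α) (h1 : α < 1) (hQ : ∀ n : ℕ, IsRelax α n (Q n)) {t : ℝ}
    (ht : 0 < t) : Tendsto (fun n : ℕ => relaxS n (Q n) t) atTop (𝓝 0) := by
  have h : Tendsto (fun n : ℕ => Gamma (α + 1) / t ^ α / (n : ℝ)) atTop (𝓝 0) :=
    tendsto_const_div_atTop_nhds_zero_nat _
  refine squeeze_zero' (Eventually.of_forall fun n => (hQ n).S_nonneg h0 h1 n.cast_nonneg ht.le)
    ?_ h
  filter_upwards [eventually_gt_atTop 0] with n hn
  have := (hQ n).lam_mul_S_le h0 h1 n.cast_nonneg ht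
  have hp := Real.rpow_pos_of_pos ht α
  have hn' : (0:ℝ) < n := by exact_mod_cast hn
  rw [div_div, le_div_iff₀ (by positivity)]
  linarith

/-- The kernels `n P_n` form an approximate identity. -/
lemma tendsto_cv_relax (h0 : 0 < α) (h1 : α < 1) (hQ : ∀ n : ℕ, IsRelax α n (Q n)) (hg : KC g)
    {t : ℝ} (ht : 0 < t) : Tendsto (fun n : ℕ => (n:ℝ) * cv (Q n) g t) atTop (𝓝 (g t)) := by
  rw [Metric.tendsto_atTop]
  intro η hη
  have hprim : Tendsto (fun δ => 2 * α / t * ∫ s in (0:ℝ)..δ, |g s|) (𝓝[>] 0) (𝓝 0) := by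
    have hk : KC fun s => |g s| := ⟨hg.cont.abs, fun T => (hg.int T).abs⟩
    have := (hk.continuousOn_integral 0 (mem_Ici.2 le_rfl)).tendsto.mono_left
      (nhdsWithin_mono 0 Ioi_subset_Ici_self)
    simpa using this.const_mul (2 * α / t)
  obtain ⟨δ', hδ'1, hδ'0, hδ't⟩ := ((hprim.eventually (gt_mem_nhds (show (0:ℝ) < η / 4 by linarith))).and
    (Ioo_mem_nhdsGT (half_pos ht))).exists
  have hcont : ContinuousAt g t := hg.cont.continuousAt (Ioi_mem_nhds ht)
  obtain ⟨δ, hδ, hδ2⟩ := Metric.continuousAt_iff.1 hcont (η / 4) (by linarith)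
  set d := min (δ / 2) (t / 2) with hd
  have hd0 : 0 < d := lt_min (by linarith) (by linarith)
  have hdt : d ≤ t / 2 := min_le_right _ _
  have hdδ : d < δ := (min_le_left _ _).trans_lt (by linarith)
  obtain ⟨K, hK⟩ := isCompact_Icc.exists_bound_of_continuousOn
    (hg.cont.mono (fun s hs => hδ'0.trans_le hs.1 : Icc δ' t ⊆ Ioi 0))
  have hK0 : 0 ≤ K := (norm_nonneg _).trans (hK t ⟨by linarith, le_rfl⟩)
  have hS := ((tendsto_relaxS h0 h1 hQ hd0).const_mul (K + |g t| + 1)).eventually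
    (gt_mem_nhds (show (K + |g t| + 1) * 0 < η / 4 by linarith))
  obtain ⟨N, hN⟩ := eventually_atTop.1 hS
  refine ⟨N, fun n hn => ?_⟩
  have hn0 : (0:ℝ) ≤ n := n.cast_nonneg
  have hSn := hN n hn
  have hSd := (hQ n).S_nonneg h0 h1 hn0 hd0.le
  have hSt := (hQ n).S_nonneg h0 h1 hn0 (t := t - δ') (by linarith)
  have e1 := (hQ n).mass_eq (a := 0) (b := d) le_rfl hd0.le
  have e2 := (hQ n).mass_eq (a := d) (b := t - δ') hd0.le (by linarith)
  rw [relaxS_zero] at e1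
  have b1 := (hQ n).abs_integral_mul_le h0 h1 hn0 le_rfl hd0.le (φ := fun s => g (t - s) - g t)
    (M := η / 4) (fun s hs => (hδ2 (by
      rw [Real.dist_eq, sub_sub_cancel_left, abs_neg, abs_of_pos hs.1]; linarith [hs.2])).le)
  have b2 := (hQ n).abs_integral_mul_le h0 h1 hn0 hd0.le (by linarith : d ≤ t - δ')
    (φ := fun s => g (t - s))
    (M := K) (fun s hs => hK _ ⟨by linarith [hs.2], by linarith [hs.1]⟩)
  have b3 := (hQ n).abs_tail_le h0 h1 hn0 hg hδ'0.le (by linarith) ht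
  have hi1 : IntervalIntegrable (fun s => Q n s * g (t - s)) volume 0 d :=
    ((hQ n).kc.cvI hg ht).mono_set (by
      rw [uIcc_of_le hd0.le, uIcc_of_le ht.le]; exact Icc_subset_Icc_right (by linarith))
  have e3 : ∫ s in (0:ℝ)..d, Q n s * (g (t - s) - g t)
      = (∫ s in (0:ℝ)..d, Q n s * g (t - s)) - (∫ s in (0:ℝ)..d, Q n s) * g t := by
    rw [← intervalIntegral.integral_mul_const, ← intervalIntegral.integral_sub hi1
      (((hQ n).kc.intervalIntegrable hd0.le).mul_const _)]
    simp only [mul_sub]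
  rw [e3] at b1
  rw [e1] at b1
  rw [e2] at b2
  rw [Real.dist_eq, (hQ n).kc.split3 hg ht hd0.le (by linarith : d ≤ t - δ') (by linarith)]
  set A := ∫ s in (0:ℝ)..d, Q n s * g (t - s)
  set B := ∫ s in d..(t - δ'), Q n s * g (t - s)
  set D := ∫ s in (t - δ')..t, Q n s * g (t - s)
  set S := relaxS (n:ℝ) (Q n) d
  have e4 : (n:ℝ) * (A + B + D) - g t
      = n * (A - (∫ s in (0:ℝ)..d, Q n s) * g t) + n * B + n * D - S * g t := by
    linear_combination g t * e1
  rw [e4]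
  have c1 : |S * g t| = S * |g t| := by rw [abs_mul, abs_of_nonneg hSd]
  have c2 : K * (S - relaxS (n:ℝ) (Q n) (t - δ')) ≤ K * S :=
    mul_le_mul_of_nonneg_left (by linarith) hK0
  have c3 : η / 4 * (1 - S) ≤ η / 4 := by nlinarith
  refine (abs_sub _ _).trans_lt ?_
  have c4 := abs_add_three ((n:ℝ) * (A - (∫ s in (0:ℝ)..d, Q n s) * g t)) (n * B) (n * D)
  nlinarith

end Approx

/-- Convexity inequality for the Caputo derivative, in integrated form: no derivative of `y` is
used, only that `k * y` is the primitive of `D`. -/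
lemma integral_mul_ge_of_convex {α τ ε : ℝ} (h0 : 0 < α) (h1 : α < 1) {y D β j : ℝ → ℝ}
    (hy : Continuous y) (hD : KC D) (hyD : ∀ t ∈ Icc 0 τ, cv (rl (1 - α)) y t = ∫ s in (0:ℝ)..t, D s)
    (hβ : Continuous β) (hj : Continuous j) (hβj : ∀ a b, j a - j b ≤ β a * (a - b)) (hj0 : j 0 = 0)
    (hε : 0 < ε) (hετ : ε ≤ τ) :
    cv (rl (1 - α)) (fun s => j (y s)) τ - cv (rl (1 - α)) (fun s => j (y s)) ε
      ≤ ∫ t in ε..τ, β (y t) * D t := by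
  have hk := kc_rl (show 0 < 1 - α by linarith)
  have hr := kc_rl h0
  have hyk : KC y := KC.of_cont hy
  have hJk : KC (fun s => j (y s)) := KC.of_cont (hj.comp hy)
  have hτ : 0 < τ := hε.trans_le hετ
  have hyr : ∀ t ∈ Ioo 0 τ, y t = cv (rl α) D t := by
    have e : ∀ t ∈ Ioc 0 τ, ∫ s in (0:ℝ)..t, y s = ∫ s in (0:ℝ)..t, cv (rl α) D s := by
      intro t ht
      rw [← cv_one_left, ← cv_one_left, ← kc_one.assoc hr hD ht.1]
      calc cv (fun _ => 1) y t = cv (cv (rl α) (rl (1 - α))) y t :=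
            cv_congr ht.1.le (fun s hs => by rw [cv_comm, cv_rl_compl h0 h1 hs.1]) fun _ _ => rfl
        _ = cv (rl α) (cv (rl (1 - α)) y) t := hr.assoc hk hyk ht.1
        _ = cv (rl α) (cv (fun _ => 1) D) t := cv_congr ht.1.le (fun _ _ => rfl) fun s hs => by
            rw [hyD s ⟨hs.1.le, hs.2.le.trans ht.2⟩, cv_one_left]
        _ = cv (cv (rl α) (fun _ => 1)) D t := (hr.assoc kc_one hD ht.1).symm
        _ = cv (cv (fun _ => 1) (rl α)) D t :=
            cv_congr ht.1.le (fun s _ => cv_comm _ _ s) fun _ _ => rfl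
    intro t ht
    have d1 := hyk.hasDerivAt_integral ht.1
    have d2 := (hr.cv hD).hasDerivAt_integral ht.1
    refine d1.unique (d2.congr_of_eventuallyEq ?_)
    filter_upwards [Ioo_mem_nhds ht.1 ht.2] with s hs
    exact e s ⟨hs.1, hs.2.le⟩
  choose Q hQ using fun n : ℕ => exists_isRelax (lam := (n:ℝ)) h0 h1
  have hyQ : ∀ n : ℕ, ∀ t ∈ Ioo 0 τ, cv (Q n) D t = y t - n * cv (Q n) y t := by
    intro n t ht
    rw [cv_congr ht.1.le (fun s hs => (hQ n).eq s hs.1) (fun _ _ => rfl),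
      cv_sub_left (hr.cvI hD ht.1) (((hr.cv (hQ n).kc).smul n).cvI hD ht.1), cv_smul_left,
      ← hyr t ht, cv_congr ht.1.le (fun s _ => cv_comm _ _ s) (fun _ _ => rfl),
      (hQ n).kc.assoc hr hD ht.1]
    congr 2
    exact cv_congr ht.1.le (fun _ _ => rfl) fun s hs => (hyr s ⟨hs.1, hs.2.trans ht.2⟩).symm
  have pt : ∀ n : ℕ, ∀ t ∈ Ioo 0 τ,
      j (y t) - n * cv (Q n) (fun s => j (y s)) t ≤ β (y t) * cv (Q n) D t := by
    intro n t ht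
    rw [hyQ n t ht]
    have hn : (0:ℝ) ≤ n := n.cast_nonneg
    have i1 := (hQ n).kc.cvI hyk ht.1
    have i2 := (hQ n).kc.cvI hJk ht.1
    have hm : β (y t) * cv (Q n) y t - cv (Q n) (fun s => j (y s)) t
        ≤ (∫ s in (0:ℝ)..t, Q n s) * (β (y t) * y t - j (y t)) := by
      rw [cv, cv, ← intervalIntegral.integral_const_mul,
        ← intervalIntegral.integral_sub (IntervalIntegrable.const_mul i1 _) i2,
        ← intervalIntegral.integral_mul_const]
      apply integral_mono_on_of_le_Ioo ht.1.le
        ((IntervalIntegrable.const_mul i1 _).sub i2)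
        (((hQ n).kc.intervalIntegrable ht.1.le).mul_const _)
      intro s hs
      have := hβj (y t) (y (t - s))
      have hp := (hQ n).pos_or h0 h1 hn hs.1
      nlinarith
    have hS := (hQ n).S_nonneg h0 h1 hn ht.1.le
    rw [relaxS] at hS
    have hc := hβj (y t) 0
    rw [hj0] at hc
    have := mul_le_mul_of_nonneg_left hm hn
    nlinarith
  have hJint : ∀ n : ℕ, ∀ t, 0 < t →
      ∫ s in (0:ℝ)..t, (j (y s) - n * cv (Q n) (fun s => j (y s)) s)
        = cv (Q n) (cv (rl (1 - α)) fun s => j (y s)) t := by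
    intro n t ht
    have hn : (0:ℝ) ≤ n := n.cast_nonneg
    rw [← (hQ n).kc.assoc hk hJk ht, cv_congr ht.le (fun s hs => by
      rw [cv_comm, (hQ n).cv_k h0 h1 hs.1]) (fun _ _ => rfl),
      intervalIntegral.integral_sub (hJk.intervalIntegrable ht.le)
        ((((hQ n).kc.cv hJk).smul n).intervalIntegrable ht.le),
      intervalIntegral.integral_const_mul, ← cv_one_left, ← cv_one_left,
      ← kc_one.assoc (hQ n).kc hJk ht, ← cv_smul_left,
      ← cv_sub_left (kc_one.cvI hJk ht) (((kc_one.cv (hQ n).kc).smul n).cvI hJk ht)]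
    exact cv_congr ht.le (fun s _ => by rw [relaxS, cv_one_left]) fun _ _ => rfl
  have hint : ∀ {f : ℝ → ℝ}, KC f → IntervalIntegrable f volume ε τ := fun hf =>
    (hf.intervalIntegrable hε.le).symm.trans (hf.intervalIntegrable hτ.le)
  have hβint : ∀ {f : ℝ → ℝ}, KC f → IntervalIntegrable (fun t => β (y t) * f t) volume ε τ :=
    fun hf => (hint hf).continuousOn_mul (hβ.comp hy).continuousOn
  have ineq : ∀ n : ℕ, (n:ℝ) * cv (Q n) (cv (rl (1 - α)) fun s => j (y s)) τ
      - (n:ℝ) * cv (Q n) (cv (rl (1 - α)) fun s => j (y s)) ε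
      ≤ ∫ t in ε..τ, β (y t) * (n * cv (Q n) D t) := by
    intro n
    have hK : KC fun s => j (y s) - n * cv (Q n) (fun s => j (y s)) s :=
      hJk.sub (((hQ n).kc.cv hJk).smul n)
    rw [← hJint n τ hτ, ← hJint n ε hε, ← mul_sub, integral_interval_sub_left
      (hK.intervalIntegrable hτ.le) (hK.intervalIntegrable hε.le),
      ← intervalIntegral.integral_const_mul]
    apply integral_mono_on_of_le_Ioo hετ (hint (hK.smul n))
      (hβint (((hQ n).kc.cv hD).smul n))
    intro t ht
    have := mul_le_mul_of_nonneg_left (pt n t ⟨hε.trans ht.1, ht.2⟩) (Nat.cast_nonneg (α := ℝ) n)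
    linarith
  refine le_of_tendsto_of_tendsto' ((tendsto_cv_relax h0 h1 hQ (hk.cv hJk) hτ).sub
    (tendsto_cv_relax h0 h1 hQ (hk.cv hJk) hε)) ?_ ineq
  obtain ⟨C, hC⟩ := abs_cv_relax_le h0 h1 hQ hD hε (τ := τ)
  apply intervalIntegral.tendsto_integral_filter_of_dominated_convergence (fun t => |β (y t)| * C)
  · exact Eventually.of_forall fun n => by
      rw [uIoc_of_le hετ]
      exact (hβint (((hQ n).kc.cv hD).smul n)).1.aestronglyMeasurable
  · refine Eventually.of_forall fun n => Eventually.of_forall fun t ht => ?_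
    rw [uIoc_of_le hετ] at ht
    rw [norm_eq_abs, abs_mul]
    exact mul_le_mul_of_nonneg_left (hC n t ⟨ht.1.le, ht.2⟩) (abs_nonneg _)
  · exact intervalIntegrable_cont
  · refine Eventually.of_forall fun t ht => ?_
    rw [uIoc_of_le hετ] at ht
    exact (tendsto_cv_relax h0 h1 hQ hD (hε.trans ht.1)).const_mul _

section Cut

variable {α T : ℝ} {v c : ℝ → ℝ}

lemma integrableOn_of_cv_ne_zero (h1 : α < 1) {d : ℝ → ℝ} {s : ℝ} (hs : 0 < s)
    (h : cv (rl (1 - α)) d s ≠ 0) (h0 : 0 < α) : IntegrableOn d (Ioc 0 s) := by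
  have hi : IntervalIntegrable (fun r => rl (1 - α) r * d (s - r)) volume 0 s := by
    by_contra hc
    exact h (intervalIntegral.integral_undef hc)
  have hG := Gamma_pos_of_pos (show 0 < 1 - α by linarith)
  have h2 := hi.continuousOn_mul (f := fun r => rl (1 - α) r * d (s - r))
    (g := fun r => Gamma (1 - α) * r ^ α)
    (Continuous.continuousOn (continuous_const.mul (Real.continuous_rpow_const h0.le)))
  have h3 : IntervalIntegrable (fun r => d (s - r)) volume 0 s := by
    refine h2.congr fun r hr => ?_
    rw [uIoc_of_le hs.le] at hr
    have : r ^ α * r ^ (-α) = 1 := by rw [← Real.rpow_add hr.1]; simp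
    simp only [rl, show 1 - α - 1 = -α by ring]
    field_simp
    linear_combination d (s - r) * this
  have h4 := (h3.comp_sub_left s).symm
  simp only [sub_zero, sub_self, sub_sub_cancel] at h4
  exact (intervalIntegrable_iff_integrableOn_Ioc_of_le hs.le).1 h4

/-- If the derivative is integrable up to time `s`, the Caputo derivative is the derivative of the
fractional integral of order `1 - α`. -/
lemma caputo_of_integrable (h1 : α < 1) (hv : ContinuousOn v (Icc 0 T))
    (hd : ∀ t ∈ Ioo 0 T, DifferentiableAt ℝ v t)
    (hcap : ∀ t ∈ Ioc 0 T, c t = cv (rl (1 - α)) (deriv v) t) {s : ℝ} (hsT : s ≤ T)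
    (hi : IntegrableOn (deriv v) (Ioc 0 s)) :
    IntegrableOn c (Ioc 0 s) ∧ ∀ t ∈ Icc 0 s,
      v t - v 0 = (∫ r in (0:ℝ)..t, deriv v r) ∧
      cv (rl (1 - α)) (fun r => v r - v 0) t = ∫ r in (0:ℝ)..t, c r := by
  have hk := kc_rl (show 0 < 1 - α by linarith)
  set d := (Ioc 0 s).indicator (deriv v) with hdd
  have hdL : LI d := fun S => ((integrable_indicator_iff measurableSet_Ioc).2 hi).integrableOn
  have hdv : ∀ r ∈ Ioc 0 s, deriv v r = d r := fun r hr => (indicator_of_mem hr _).symm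
  have e1 : ∀ r ∈ Ioc 0 s, c r = cv (rl (1 - α)) d r := by
    intro r hr
    rw [hcap r ⟨hr.1, hr.2.trans hsT⟩]
    exact cv_congr hr.1.le (fun _ _ => rfl) fun σ hσ => hdv σ ⟨hσ.1, hσ.2.le.trans hr.2⟩
  have ev : ∀ t ∈ Icc 0 s, v t - v 0 = (∫ r in (0:ℝ)..t, deriv v r) := by
    intro t ht
    refine (intervalIntegral.integral_eq_sub_of_hasDerivAt_of_le ht.1
      (hv.mono (Icc_subset_Icc_right (ht.2.trans hsT)))
      (fun r hr => (hd r ⟨hr.1, hr.2.trans_le (ht.2.trans hsT)⟩).hasDerivAt) ?_).symm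
    exact (intervalIntegrable_iff_integrableOn_Ioc_of_le ht.1).2
      (hi.mono_set (Ioc_subset_Ioc_right ht.2))
  have ed : ∀ t ∈ Icc 0 s, ∫ r in (0:ℝ)..t, deriv v r = ∫ r in (0:ℝ)..t, d r := by
    intro t ht
    rw [integral_of_le ht.1, integral_of_le ht.1]
    exact setIntegral_congr_fun measurableSet_Ioc fun r hr => hdv r ⟨hr.1, hr.2.trans ht.2⟩
  refine ⟨(integrableOn_cv (hk.int s) (hdL s)).congr_fun (fun r hr => (e1 r hr).symm)
    measurableSet_Ioc, fun t ht => ⟨ev t ht, ?_⟩⟩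
  rw [integral_of_le ht.1, setIntegral_congr_fun measurableSet_Ioc
    (fun r hr => e1 r ⟨hr.1, hr.2.trans ht.2⟩), ← integral_of_le ht.1,
    hk.li.integral_cv hdL ht.1]
  refine cv_congr ht.1 (fun _ _ => rfl) fun r hr => ?_
  have hr' : r ∈ Icc 0 s := ⟨hr.1.le, hr.2.le.trans ht.2⟩
  rw [ev r hr', ed r hr']

/-- The Caputo derivative is regular up to some time and vanishes afterwards. -/
lemma exists_cut (h0 : 0 < α) (h1 : α < 1) (hT : 0 < T) (hv : ContinuousOn v (Icc 0 T))
    (hd : ∀ t ∈ Ioo 0 T, DifferentiableAt ℝ v t) (hc : ContinuousOn c (Ioc 0 T))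
    (hcap : ∀ t ∈ Ioc 0 T, c t = cv (rl (1 - α)) (deriv v) t) :
    IntegrableOn c (Ioc 0 T) ∧ ∃ τ ∈ Icc 0 T,
      (∀ t ∈ Icc 0 τ, cv (rl (1 - α)) (fun s => v s - v 0) t = ∫ s in (0:ℝ)..t, c s) ∧
      ∀ t ∈ Ioc τ T, c t = 0 := by
  have hreg : ∀ s ∈ Ioc 0 T, c s ≠ 0 → IntegrableOn c (Ioc 0 s) ∧ ∀ t ∈ Icc 0 s,
      (v t - v 0 = ∫ r in (0:ℝ)..t, deriv v r) ∧
        cv (rl (1 - α)) (fun r => v r - v 0) t = ∫ r in (0:ℝ)..t, c r := fun s hs hne =>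
    caputo_of_integrable h1 hv hd hcap hs.2 (integrableOn_of_cv_ne_zero h1 hs.1
      (by rwa [← hcap s hs]) h0)
  by_cases hz : ∀ t ∈ Ioc 0 T, c t = 0
  · refine ⟨integrableOn_zero.congr_fun (fun t ht => (hz t ht).symm) measurableSet_Ioc, 0,
      ⟨le_rfl, hT.le⟩, fun t ht => ?_, fun t ht => hz t ht⟩
    obtain rfl : t = 0 := le_antisymm ht.2 ht.1
    simp [cv_zero]
  push Not at hz
  obtain ⟨s0, hs0, hne0⟩ := hz
  have hci : IntegrableOn c (Ioc 0 T) := by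
    rw [← Ioc_union_Ioc_eq_Ioc hs0.1.le hs0.2]
    refine (hreg s0 hs0 hne0).1.union ?_
    exact ((hc.mono fun r hr => ⟨hs0.1.trans_le hr.1, hr.2⟩).integrableOn_Icc).mono_set
      Ioc_subset_Icc_self
  set Z := {t | t ∈ Ioc 0 T ∧ c t ≠ 0} with hZ
  have hZb : BddAbove Z := ⟨T, fun t ht => ht.1.2⟩
  have hle : s0 ≤ sSup Z := le_csSup hZb ⟨hs0, hne0⟩
  refine ⟨hci, sSup Z, ⟨hs0.1.le.trans hle, csSup_le ⟨s0, hs0, hne0⟩ fun t ht => ht.1.2⟩, ?_, ?_⟩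
  · have hpos : 0 < sSup Z := hs0.1.trans_le hle
    have hsT : sSup Z ≤ T := csSup_le ⟨s0, hs0, hne0⟩ fun t ht => ht.1.2
    have hlt : ∀ t ∈ Ioo 0 (sSup Z), cv (rl (1 - α)) (fun s => v s - v 0) t
        = ∫ s in (0:ℝ)..t, c s := by
      intro t ht
      obtain ⟨s, hs, hts⟩ := exists_lt_of_lt_csSup (s := Z) ⟨s0, hs0, hne0⟩ ht.2
      have hmem : t ∈ Icc 0 s := ⟨ht.1.le, hts.le⟩
      exact ((hreg s hs.1 hs.2).2 t hmem).2
    obtain ⟨C, hC⟩ := isCompact_Icc.exists_bound_of_continuousOn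
      (hv.sub (continuousOn_const (c := v 0)))
    have hk := kc_rl (show 0 < 1 - α by linarith)
    have c1 : ContinuousOn (cv (rl (1 - α)) fun s => v s - v 0) (Icc 0 T) :=
      continuousOn_cv_bdd (hk.int T) ((hv.sub continuousOn_const).mono Ioc_subset_Icc_self)
        fun s hs => hC s (Ioc_subset_Icc_self hs)
    have c2 := continuousOn_integral_Icc hci
    have hcl : closure (Ioo 0 (sSup Z)) = Icc 0 (sSup Z) := closure_Ioo hpos.ne
    have hsub : Icc 0 (sSup Z) ⊆ Icc 0 T := Icc_subset_Icc_right hsT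
    intro t ht
    exact EqOn.of_subset_closure (fun r hr => hlt r hr) (c1.mono hsub) (c2.mono hsub)
      Ioo_subset_Icc_self hcl.ge ht
  · intro t ht
    by_contra hne
    exact absurd (le_csSup hZb ⟨⟨(hs0.1.trans_le hle).trans ht.1, ht.2⟩, hne⟩) (not_le.2 ht.1)

end Cut

section Weight

variable {α κ : ℝ} {f g : ℝ → ℝ} {t : ℝ}

/-- The exponential probability density with rate `κ`. -/
noncomputable def expo (κ t : ℝ) : ℝ := κ * exp (-κ * t)

lemma continuous_expo (κ : ℝ) : Continuous (expo κ) := by unfold expo; fun_prop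

lemma kc_expo (κ : ℝ) : KC (expo κ) := KC.of_cont (continuous_expo κ)

lemma expo_nonneg (hκ : 0 ≤ κ) (t : ℝ) : 0 ≤ expo κ t := mul_nonneg hκ (exp_pos _).le

lemma integral_expo (κ t : ℝ) : ∫ s in (0:ℝ)..t, expo κ s = 1 - exp (-κ * t) := by
  rw [integral_eq_sub_of_hasDerivAt (f := fun s => -exp (-κ * s))]
  · simp; ring
  · intro s _
    have := ((hasDerivAt_id s).const_mul (-κ)).exp.neg
    refine this.congr_deriv ?_
    simp [expo]; ring
  · exact (continuous_expo κ).intervalIntegrable _ _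

lemma KC.id_mul (hf : KC f) : KC fun t => t * f t :=
  ⟨continuousOn_id.mul hf.cont, fun T => by
    rcases le_or_gt T 0 with h | h
    · simp [Ioc_eq_empty (not_lt.2 h)]
    · exact (intervalIntegrable_iff_integrableOn_Ioc_of_le h.le).1
        ((hf.intervalIntegrable h.le).continuousOn_mul continuousOn_id)⟩

lemma cv_id_mul (h1 : CvI f g t) (h2 : CvI (fun s => s * f s) g t) :
    cv f (fun s => s * g s) t = t * cv f g t - cv (fun s => s * f s) g t := by
  rw [cv, cv, cv, ← intervalIntegral.integral_const_mul,
    ← intervalIntegral.integral_sub (h1.const_mul t) h2]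
  congr 1
  funext s
  ring

lemma KC.expo_sub (hg : KC g) (ht : 0 < t) :
    κ * (InvSource.cv (fun _ => 1) g t
      - InvSource.cv (expo κ) (InvSource.cv (fun _ => 1) g) t) = InvSource.cv (expo κ) g t := by
  rw [← (kc_expo κ).assoc kc_one hg ht]
  have h : InvSource.cv (InvSource.cv (expo κ) fun _ => 1) g t
      = InvSource.cv (fun s => 1 - exp (-κ * s)) g t :=
    cv_congr ht.le (fun s _ => by rw [cv_one_right, integral_expo]) fun _ _ => rfl
  have he : KC fun s => exp (-κ * s) := KC.of_cont (by fun_prop)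
  rw [h, cv_sub_left (kc_one.cvI hg ht) (he.cvI hg ht), sub_sub_cancel, ← cv_smul_left]
  rfl

/-- The operator applied to the data when `u` is replaced by the averaged time difference of
`t u + α ∫ u`. -/
noncomputable def avg (κ α : ℝ) (g : ℝ → ℝ) (t : ℝ) : ℝ :=
  κ * (t * g t - cv (expo κ) (fun s => s * g s) t) + α * cv (expo κ) g t

/-- The averaged time difference of `t v`. -/
noncomputable def tdiff (κ : ℝ) (v : ℝ → ℝ) (t : ℝ) : ℝ :=
  κ * (t * v t - cv (expo κ) (fun s => s * v s) t)

lemma KC.tdiff (hg : KC g) : KC (tdiff κ g) :=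
  (hg.id_mul.sub ((kc_expo κ).cv hg.id_mul)).smul κ

lemma KC.avg (hg : KC g) : KC (avg κ α g) := hg.tdiff.add (((kc_expo κ).cv hg).smul α)

lemma kc_id : KC fun t => t := KC.of_cont continuous_id

lemma cv_one_one (t : ℝ) : cv (fun _ => 1) (fun _ => 1) t = t := by simp [cv_one_left]

variable {c v : ℝ → ℝ} {τ : ℝ}

lemma cv_id_eq (hg : KC g) (ht : 0 < t) :
    cv (fun s => s) g t = cv (fun _ => 1) (cv (fun _ => 1) g) t := by
  rw [← kc_one.assoc kc_one hg ht]
  exact cv_congr ht.le (fun s _ => (cv_one_one s).symm) fun _ _ => rfl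

lemma cv_one_id_mul (hg : KC g) (ht : 0 < t) :
    cv (fun _ => 1) (fun s => s * g s) t
      = t * cv (fun _ => 1) g t - cv (fun _ => 1) (cv (fun _ => 1) g) t := by
  have h := kc_one.id_mul
  simp only [mul_one] at h
  rw [cv_id_mul (kc_one.cvI hg ht) (by simpa using h.cvI hg ht), ← cv_id_eq hg ht]
  simp

/-- The fractional integral of `t v`. -/
lemma cv_rl_id_mul (h1 : α < 1) (hv : Continuous v) (hc : KC c)
    (hcut : ∀ t ∈ Icc 0 τ, cv (rl (1 - α)) (fun s => v s - v 0) t = ∫ s in (0:ℝ)..t, c s)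
    (ht : t ∈ Ioc 0 τ) :
    cv (rl (1 - α)) (fun s => s * v s) t = cv (fun _ => 1)
      (fun s => s * c s + α * cv (fun _ => 1) c s + v 0 * cv (fun _ => 1) (rl (1 - α)) s) t := by
  have ha : 0 < 1 - α := by linarith
  have hk := kc_rl ha
  set y : ℝ → ℝ := fun s => v s - v 0 with hy
  have hyK : KC y := KC.of_cont (by fun_prop)
  have hpos := ht.1
  have e1 : cv (rl (1 - α)) (fun s => s * v s) t
      = cv (rl (1 - α)) (fun s => s * y s) t + v 0 * cv (rl (1 - α)) (fun s => s) t := by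
    rw [← cv_smul_right, ← cv_add_right (hk.cvI hyK.id_mul hpos)
      (hk.cvI (kc_id.smul _) hpos)]
    refine cv_congr hpos.le (fun _ _ => rfl) fun s _ => ?_
    simp only [hy]; ring
  have e2 : cv (fun s => s * rl (1 - α) s) y t
      = (1 - α) * cv (fun _ => 1) (cv (fun _ => 1) c) t := by
    have : cv (fun s => s * rl (1 - α) s) y t
        = cv (fun s => (1 - α) * cv (fun _ => 1) (rl (1 - α)) s) y t := by
      refine cv_congr hpos.le (fun s hs => ?_) fun _ _ => rfl
      rw [cv_one_rl ha hs.1, rl, rl, Real.Gamma_add_one ha.ne']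
      have hG := (Gamma_pos_of_pos ha).ne'
      have hs' : s ^ (1 - α + 1 - 1) = s * s ^ (1 - α - 1) := by
        rw [show (1 - α + 1 - 1) = 1 + (1 - α - 1) by ring, Real.rpow_add hs.1, Real.rpow_one]
      rw [hs']
      field_simp
    rw [this, cv_smul_left, kc_one.assoc hk hyK hpos]
    congr 1
    refine cv_congr hpos.le (fun _ _ => rfl) fun s hs => ?_
    rw [hcut s ⟨hs.1.le, hs.2.le.trans ht.2⟩, cv_one_left]
  have e3 := hcut t ⟨hpos.le, ht.2⟩
  rw [e1, cv_id_mul (hk.cvI hyK hpos) (hk.id_mul.cvI hyK hpos), e2, e3,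
    cv_comm (rl (1 - α)) (fun s => s), cv_id_eq hk hpos]
  have hD1 := hc.id_mul
  have hD2 := (kc_one.cv hc).smul α
  have hD3 := (kc_one.cv hk).smul (v 0)
  rw [cv_add_right (kc_one.cvI (hD1.add hD2) hpos) (kc_one.cvI hD3 hpos),
    cv_add_right (kc_one.cvI hD1 hpos) (kc_one.cvI hD2 hpos), cv_smul_right, cv_smul_right,
    cv_one_id_mul hc hpos, ← cv_one_left]
  ring

lemma cv_rl_tdiff (h1 : α < 1) (hv : Continuous v) (hc : KC c)
    (hcut : ∀ t ∈ Icc 0 τ, cv (rl (1 - α)) (fun s => v s - v 0) t = ∫ s in (0:ℝ)..t, c s)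
    (ht : t ∈ Ioc 0 τ) :
    cv (rl (1 - α)) (tdiff κ v) t = cv (expo κ)
      (fun s => s * c s + α * cv (fun _ => 1) c s + v 0 * cv (fun _ => 1) (rl (1 - α)) s) t := by
  have ha : 0 < 1 - α := by linarith
  have hk := kc_rl ha
  have hpos := ht.1
  have hvK : KC fun s => s * v s := (KC.of_cont hv).id_mul
  have hE := kc_expo κ
  have hD := (hc.id_mul.add ((kc_one.cv hc).smul α)).add ((kc_one.cv hk).smul (v 0))
  rw [← hD.expo_sub hpos, ← cv_rl_id_mul h1 hv hc hcut ht]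
  have : cv (rl (1 - α)) (tdiff κ v) t = κ * (cv (rl (1 - α)) (fun s => s * v s) t
      - cv (rl (1 - α)) (cv (expo κ) fun s => s * v s) t) := by
    rw [← cv_sub_right (hk.cvI hvK hpos) (hk.cvI (hE.cv hvK) hpos), ← cv_smul_right]
    rfl
  rw [this, ← hk.assoc hE hvK hpos]
  have e : cv (cv (rl (1 - α)) (expo κ)) (fun s => s * v s) t
      = cv (expo κ) (cv (rl (1 - α)) fun s => s * v s) t := by
    rw [← hE.assoc hk hvK hpos]
    exact cv_congr hpos.le (fun s _ => cv_comm _ _ _) fun _ _ => rfl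
  rw [e]
  congr 2
  exact cv_congr hpos.le (fun _ _ => rfl) fun s hs =>
    cv_rl_id_mul h1 hv hc hcut ⟨hs.1, hs.2.le.trans ht.2⟩

lemma integral_avg (h1 : α < 1) (hc : KC c) (d : ℝ) (ht : 0 < t) :
    ∫ s in (0:ℝ)..t, (avg κ α c s + d * cv (expo κ) (rl (1 - α)) s) = cv (expo κ)
      (fun s => s * c s + α * cv (fun _ => 1) c s + d * cv (fun _ => 1) (rl (1 - α)) s) t := by
  have ha : 0 < 1 - α := by linarith
  have hk := kc_rl ha
  have hE := kc_expo κ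
  have hD1 := hc.id_mul
  have hD2 := (kc_one.cv hc).smul α
  have hD3 := (kc_one.cv hk).smul d
  have sw : ∀ {g : ℝ → ℝ}, KC g → cv (fun _ => 1) (cv (expo κ) g) t
      = cv (expo κ) (cv (fun _ => 1) g) t := fun {g} hg => by
    rw [← kc_one.assoc hE hg ht, ← hE.assoc kc_one hg ht]
    exact cv_congr ht.le (fun s _ => cv_comm _ _ _) fun _ _ => rfl
  rw [cv_add_right (hE.cvI (hD1.add hD2) ht) (hE.cvI hD3 ht),
    cv_add_right (hE.cvI hD1 ht) (hE.cvI hD2 ht), cv_smul_right, cv_smul_right, ← sw hc, ← sw hk,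
    ← hD1.expo_sub ht, ← sw hD1, ← cv_one_left, cv_add_right (kc_one.cvI hc.avg ht)
    (kc_one.cvI ((hE.cv hk).smul d) ht), cv_smul_right]
  congr 1
  have : avg κ α c = fun s => κ * (s * c s - cv (expo κ) (fun s => s * c s) s)
    + α * cv (expo κ) c s := rfl
  rw [this, cv_add_right (kc_one.cvI ((hD1.sub (hE.cv hD1)).smul κ) ht)
    (kc_one.cvI ((hE.cv hc).smul α) ht), cv_smul_right, cv_smul_right,
    cv_sub_right (kc_one.cvI hD1 ht) (kc_one.cvI (hE.cv hD1) ht)]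

end Weight

section Lower

variable {α κ T τ ε M : ℝ} {c v β j : ℝ → ℝ}

/-- The integral of the kernel of the Caputo derivative. -/
noncomputable def kint (α t : ℝ) : ℝ := ∫ s in (0:ℝ)..t, rl (1 - α) s

lemma kint_nonneg (h1 : α < 1) (h : 0 ≤ T) : 0 ≤ kint α T :=
  intervalIntegral.integral_nonneg h fun s hs => rl_nonneg (by linarith) hs.1

lemma kint_mono (h1 : α < 1) {s t : ℝ} (hs : 0 ≤ s) (hst : s ≤ t) : kint α s ≤ kint α t := by
  have hk := kc_rl (show 0 < 1 - α by linarith)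
  refine integral_mono_interval le_rfl hs hst ?_
    (hk.intervalIntegrable (hs.trans hst))
  exact (ae_restrict_mem measurableSet_Ioc).mono fun r hr => rl_nonneg (by linarith) hr.1.le

lemma abs_cv_rl_le (h1 : α < 1) {g : ℝ → ℝ} {C t : ℝ} (ht : 0 ≤ t)
    (hg : ∀ s ∈ Ioo 0 t, |g s| ≤ C) : |cv (rl (1 - α)) g t| ≤ kint α t * C := by
  have hk := kc_rl (show 0 < 1 - α by linarith)
  refine (abs_cv_le ht (hk.int t) hg).trans_eq ?_
  rw [kint, integral_of_le ht]
  congr 1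
  exact setIntegral_congr_fun measurableSet_Ioc fun s hs => abs_of_nonneg
    (rl_nonneg (by linarith) hs.1.le)

/-- Lower bound for the Caputo derivative tested with a monotone function of the solution. -/
lemma integral_mul_caputo_ge (h0 : 0 < α) (h1 : α < 1) (hv : Continuous v) (hc : KC c)
    (hτ : τ ∈ Icc 0 T)
    (hcut : ∀ t ∈ Icc 0 τ, cv (rl (1 - α)) (fun s => v s - v 0) t = ∫ s in (0:ℝ)..t, c s)
    (hz : ∀ t ∈ Ioc τ T, c t = 0) (hβ : Continuous β) (hj : Continuous j)
    (hβj : ∀ a b, j a - j b ≤ β a * (a - b)) {J : ℝ} (hJ : ∀ t, |j (v t)| ≤ J)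
    (hε : 0 < ε) (hεT : ε ≤ T) : -(4 * J * kint α T) ≤ ∫ t in ε..T, β (v t) * c t := by
  have hJ0 : 0 ≤ J := (abs_nonneg _).trans (hJ 0)
  have hK := kint_nonneg h1 (hε.le.trans hεT)
  rcases lt_or_ge τ ε with h | h
  · rw [intervalIntegral.integral_congr_ae (g := fun _ => 0)]
    · simp only [intervalIntegral.integral_zero]
      have := mul_nonneg hJ0 hK
      linarith
    · refine Eventually.of_forall fun t ht => ?_
      rw [uIoc_of_le hεT] at ht
      rw [hz t ⟨h.trans ht.1, ht.2⟩, mul_zero]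
  · have key := integral_mul_ge_of_convex h0 h1 (y := fun s => v s - v 0) (by fun_prop) hc hcut
      (β := fun y => β (y + v 0)) (by fun_prop) (j := fun y => j (y + v 0) - j (v 0))
      (by fun_prop) (fun a b => by have := hβj (a + v 0) (b + v 0); simp at this ⊢; linarith)
      (by simp) hε h
    simp only [sub_add_cancel] at key
    have hb : ∀ t, 0 ≤ t → t ≤ T →
        |cv (rl (1 - α)) ((fun y => j (y + v 0) - j (v 0)) ∘ fun s => v s - v 0) t|
          ≤ 2 * J * kint α T := by
      intro t ht htT
      refine (abs_cv_rl_le h1 ht (C := 2 * J) fun s _ => ?_).trans ?_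
      · simp only [Function.comp, sub_add_cancel]
        have := abs_sub (j (v s)) (j (v 0))
        have := hJ s
        have := hJ 0
        linarith
      · have := kint_mono h1 ht htT
        nlinarith
    have e1 := abs_le.1 (hb τ hτ.1 hτ.2)
    have e2 := abs_le.1 (hb ε hε.le hεT)
    have hi : ∀ a b, 0 < a → a ≤ b → IntervalIntegrable (fun t => β (v t) * c t) volume a b :=
      fun a b ha hab => ContinuousOn.intervalIntegrable (by
        rw [uIcc_of_le hab]
        exact (hβ.comp hv).continuousOn.mul (hc.cont.mono fun s hs => ha.trans_le hs.1))
    rw [← integral_add_adjacent_intervals (hi ε τ hε h)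
      (hi τ T (hε.trans_le h) hτ.2)]
    have : ∫ t in τ..T, β (v t) * c t = 0 := by
      rw [intervalIntegral.integral_congr_ae (g := fun _ => 0)]
      · simp
      · refine Eventually.of_forall fun t ht => ?_
        rw [uIoc_of_le hτ.2] at ht
        rw [hz t ht, mul_zero]
    rw [this]
    simp only [Function.comp_def, sub_add_cancel] at e1 e2 key
    linarith [e1.1, e2.2]

lemma continuous_cv_expo {g : ℝ → ℝ} (hg : Continuous g) : Continuous (cv (expo κ) g) := by
  have : cv (expo κ) g = fun t => exp (-κ * t) *
      ∫ s in (0:ℝ)..t, κ * exp (κ * s) * g s := by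
    funext t
    rw [cv_comm, cv, ← intervalIntegral.integral_const_mul]
    congr 1
    funext s
    rw [expo, show -κ * (t - s) = -κ * t + κ * s by ring, Real.exp_add]
    ring
  rw [this]
  exact (by fun_prop : Continuous fun t => exp (-κ * t)).mul
    (intervalIntegral.continuous_primitive (fun a b => Continuous.intervalIntegrable
      (by fun_prop) a b) 0)

lemma continuous_tdiff (hv : Continuous v) : Continuous (tdiff κ v) :=
  continuous_const.mul ((continuous_id.mul hv).sub (continuous_cv_expo (continuous_id.mul hv)))

lemma cv_expo_tail {g : ℝ → ℝ} (hg : KC g) (hτ : 0 ≤ τ) (hz : ∀ t ∈ Ioc τ T, g t = 0) {t : ℝ}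
    (ht : t ∈ Icc τ T) : cv (expo κ) g t = exp (-κ * (t - τ)) * cv (expo κ) g τ := by
  have h0 : 0 ≤ t := hτ.trans ht.1
  have hi : ∀ a b, 0 ≤ a → a ≤ b →
      IntervalIntegrable (fun s => g s * expo κ (t - s)) volume a b := by
    intro a b ha hab
    refine IntervalIntegrable.mul_continuousOn ?_
      ((continuous_expo κ).comp (by fun_prop)).continuousOn
    exact (hg.intervalIntegrable (ha.trans hab)).mono_set (by
      rw [uIcc_of_le hab, uIcc_of_le (ha.trans hab)]; exact Icc_subset_Icc_left ha)
  rw [cv_comm, cv, ← integral_add_adjacent_intervals (hi 0 τ le_rfl hτ)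
    (hi τ t hτ ht.1)]
  have : ∫ s in τ..t, g s * expo κ (t - s) = 0 := by
    rw [intervalIntegral.integral_congr_ae (g := fun _ => 0)]
    · simp
    · refine Eventually.of_forall fun s hs => ?_
      rw [uIoc_of_le ht.1] at hs
      rw [hz s ⟨hs.1, hs.2.trans ht.2⟩, zero_mul]
  rw [this, add_zero, cv_comm, cv, ← intervalIntegral.integral_const_mul]
  congr 1
  funext s
  rw [expo, expo, show -κ * (t - s) = -κ * (t - τ) + -κ * (τ - s) by ring, Real.exp_add]
  ring

lemma abs_integral_le_kint (h1 : α < 1) (hc : KC c) (hM : ∀ t, |v t| ≤ M) (hτ : τ ∈ Icc 0 T)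
    (hcut : ∀ t ∈ Icc 0 τ, cv (rl (1 - α)) (fun s => v s - v 0) t = ∫ s in (0:ℝ)..t, c s)
    (hz : ∀ t ∈ Ioc τ T, c t = 0) {t : ℝ} (ht : t ∈ Icc 0 T) :
    |∫ s in (0:ℝ)..t, c s| ≤ 2 * M * kint α t := by
  have hM0 : 0 ≤ M := (abs_nonneg _).trans (hM 0)
  have main : ∀ t ∈ Icc 0 τ, |∫ s in (0:ℝ)..t, c s| ≤ 2 * M * kint α t := by
    intro t ht
    rw [← hcut t ht]
    refine (abs_cv_rl_le h1 ht.1 (C := 2 * M) fun s _ => ?_).trans_eq (mul_comm _ _)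
    have := abs_sub (v s) (v 0)
    have := hM s
    have := hM 0
    linarith
  rcases le_or_gt t τ with h | h
  · exact main t ⟨ht.1, h⟩
  · have hi := hc.intervalIntegrable ht.1
    rw [← integral_add_adjacent_intervals (hc.intervalIntegrable hτ.1)
      (hi.mono_set (by rw [uIcc_of_le h.le, uIcc_of_le ht.1]; exact Icc_subset_Icc_left hτ.1)),
      intervalIntegral.integral_congr_ae (a := τ) (b := t) (g := fun _ => 0)]
    · simp only [intervalIntegral.integral_zero, add_zero]
      refine (main τ ⟨hτ.1, le_rfl⟩).trans ?_
      exact mul_le_mul_of_nonneg_left (kint_mono h1 hτ.1 h.le) (by linarith)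
    · refine Eventually.of_forall fun s hs => ?_
      rw [uIoc_of_le h.le] at hs
      exact hz s ⟨hs.1, hs.2.trans ht.2⟩

lemma integral_expo_cv_rl_le (h1 : α < 1) (hκ : 0 < κ) (hT : 0 ≤ T) :
    ∫ s in (0:ℝ)..T, cv (expo κ) (rl (1 - α)) s ≤ kint α T := by
  have hk := kc_rl (show 0 < 1 - α by linarith)
  rw [(kc_expo κ).integral_cv hk hT]
  have h := abs_cv_le hT ((kc_expo κ).int T) (g := kint α) (C := kint α T) fun s hs => by
    rw [abs_of_nonneg (kint_nonneg h1 hs.1.le)]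
    exact kint_mono h1 hs.1.le hs.2.le
  refine (le_abs_self _).trans (h.trans ?_)
  have e : ∫ s in Ioc 0 T, |expo κ s| = 1 - exp (-κ * T) := by
    rw [← integral_expo, integral_of_le hT]
    exact setIntegral_congr_fun measurableSet_Ioc fun s _ => abs_of_nonneg (expo_nonneg hκ.le s)
  rw [e]
  have := kint_nonneg h1 hT
  have := exp_pos (-κ * T)
  nlinarith

lemma abs_tail_avg_le (h0 : 0 < α) (h1 : α < 1) (hκ : 0 < κ) (hv : Continuous v) (hc : KC c)
    (hM : ∀ t, |v t| ≤ M) (hτ : τ ∈ Icc 0 T)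
    (hcut : ∀ t ∈ Icc 0 τ, cv (rl (1 - α)) (fun s => v s - v 0) t = ∫ s in (0:ℝ)..t, c s)
    (hz : ∀ t ∈ Ioc τ T, c t = 0) (hβ1 : ∀ y, |β y| ≤ 1) {σ : ℝ}
    (hσ : σ ∈ Icc τ T) :
    |∫ t in σ..T, β (tdiff κ v t) * avg κ α c t|
      ≤ |cv (rl (1 - α)) (tdiff κ v) τ| + 3 * M * kint α T := by
  have ha : 0 < 1 - α := by linarith
  have hk := kc_rl ha
  have hE := kc_expo κ
  have hM0 : 0 ≤ M := (abs_nonneg _).trans (hM 0)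
  have hT : 0 ≤ T := hτ.1.trans hτ.2
  have hK := kint_nonneg h1 hT
  set P := avg κ α c τ - κ * (τ * c τ) with hP
  have hP' : P = -(κ * cv (expo κ) (fun s => s * c s) τ) + α * cv (expo κ) c τ := by
    simp only [hP, avg]; ring
  have e : ∀ t ∈ Ioc τ T, avg κ α c t = exp (-κ * (t - τ)) * P := by
    intro t ht
    have ht' : t ∈ Icc τ T := ⟨ht.1.le, ht.2⟩
    rw [hP', avg, hz t ht, cv_expo_tail hc hτ.1 hz ht', cv_expo_tail hc.id_mul hτ.1
      (fun s hs => by rw [hz s hs, mul_zero]) ht']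
    ring
  have b1 : |∫ t in σ..T, β (tdiff κ v t) * avg κ α c t|
      ≤ ∫ t in σ..T, exp (-κ * (t - τ)) * |P| := by
    rw [← norm_eq_abs]
    refine intervalIntegral.norm_integral_le_of_norm_le hσ.2 (ae_of_all _ fun t ht => ?_)
      intervalIntegrable_cont
    rw [e t ⟨hσ.1.trans_lt ht.1, ht.2⟩, norm_mul, norm_mul, norm_eq_abs, norm_eq_abs,
      norm_eq_abs, abs_of_pos (exp_pos _)]
    have := mul_le_mul_of_nonneg_right (hβ1 (tdiff κ v t))
      (mul_nonneg (exp_pos (-κ * (t - τ))).le (abs_nonneg P))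
    linarith
  have b2 : κ * ∫ t in σ..T, exp (-κ * (t - τ)) * |P| ≤ |P| := by
    have : κ * ∫ t in σ..T, exp (-κ * (t - τ)) * |P|
        = (exp (-κ * (σ - τ)) - exp (-κ * (T - τ))) * |P| := by
      rw [← intervalIntegral.integral_const_mul,
        integral_eq_sub_of_hasDerivAt (f := fun t => -exp (-κ * (t - τ)) * |P|)]
      · ring
      · intro t _
        have := ((((hasDerivAt_id t).sub_const τ).const_mul (-κ)).exp.neg).mul_const |P|
        refine this.congr_deriv ?_
        simp; ring
      · exact intervalIntegrable_cont
    rw [this]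
    have e1 : exp (-κ * (σ - τ)) ≤ 1 := Real.exp_le_one_iff.2 (by nlinarith [hσ.1])
    have e2 := exp_pos (-κ * (T - τ))
    nlinarith [abs_nonneg P]
  have b3 : |P| ≤ κ * (|cv (rl (1 - α)) (tdiff κ v) τ| + 3 * M * kint α T) := by
    rcases hτ.1.eq_or_lt with h | hpos
    · have : P = 0 := by rw [hP', ← h, cv_zero, cv_zero]; simp
      rw [this, abs_zero]
      positivity
    · have hD1 := hc.id_mul
      have hD2 := (kc_one.cv hc).smul α
      have hD3 := (kc_one.cv hk).smul (v 0)
      have e1 := cv_rl_tdiff (κ := κ) h1 hv hc hcut ⟨hpos, le_rfl⟩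
      rw [cv_add_right (hE.cvI (hD1.add hD2) hpos) (hE.cvI hD3 hpos),
        cv_add_right (hE.cvI hD1 hpos) (hE.cvI hD2 hpos), cv_smul_right, cv_smul_right] at e1
      have e2 := hc.expo_sub (κ := κ) hpos
      have e3 : P = -(κ * (cv (rl (1 - α)) (tdiff κ v) τ - v 0 * cv (expo κ)
          (cv (fun _ => 1) (rl (1 - α))) τ - α * cv (fun _ => 1) c τ)) := by
        rw [hP', e1, ← e2]; ring
      have w1 := abs_integral_le_kint h1 hc hM hτ hcut hz hτ
      rw [← cv_one_left] at w1
      have w2 : |cv (expo κ) (cv (fun _ => 1) (rl (1 - α))) τ| ≤ kint α T := by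
        have h2 := integral_expo_cv_rl_le h1 hκ hτ.1
        rw [hE.integral_cv hk hτ.1] at h2
        simp only [← cv_one_left] at h2
        rw [abs_of_nonneg]
        · exact h2.trans (kint_mono h1 hτ.1 hτ.2)
        · refine cv_nonneg hτ.1 (fun s _ => expo_nonneg hκ.le s) fun s hs => ?_
          rw [cv_one_left]
          exact kint_nonneg h1 hs.1.le
      have w3 := kint_mono h1 hτ.1 hτ.2
      rw [e3, abs_neg, abs_mul, abs_of_pos hκ]
      refine mul_le_mul_of_nonneg_left ?_ hκ.le
      refine (abs_sub _ _).trans ?_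
      have := abs_sub (cv (rl (1 - α)) (tdiff κ v) τ)
        (v 0 * cv (expo κ) (cv (fun _ => 1) (rl (1 - α))) τ)
      rw [abs_mul] at this
      rw [abs_mul, abs_of_pos h0]
      have t1 : |v 0| * |cv (expo κ) (cv (fun _ => 1) (rl (1 - α))) τ| ≤ M * kint α T :=
        mul_le_mul (hM 0) w2 (abs_nonneg _) hM0
      have t2 : α * |cv (fun _ => 1) c τ| ≤ 2 * M * kint α T := by
        have : 2 * M * kint α τ ≤ 2 * M * kint α T := mul_le_mul_of_nonneg_left w3 (by linarith)
        nlinarith [abs_nonneg (cv (fun _ => 1) c τ)]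
      linarith
  refine b1.trans ?_
  exact le_of_mul_le_mul_left (b2.trans b3) hκ

/-- Lower bound, independent of the averaging parameter, for the averaged time difference of the
Caputo derivative tested with a bounded monotone function. -/
lemma integral_mul_avg_ge (h0 : 0 < α) (h1 : α < 1) (hκ : 0 < κ) (hv : Continuous v) (hc : KC c)
    (hM : ∀ t, |v t| ≤ M) (hτ : τ ∈ Icc 0 T)
    (hcut : ∀ t ∈ Icc 0 τ, cv (rl (1 - α)) (fun s => v s - v 0) t = ∫ s in (0:ℝ)..t, c s)
    (hz : ∀ t ∈ Ioc τ T, c t = 0) (hβ : Continuous β) (hj : Continuous j)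
    (hβj : ∀ a b, j a - j b ≤ β a * (a - b)) (hj0 : j 0 = 0) (hβ1 : ∀ y, |β y| ≤ 1)
    (hj1 : ∀ y, j y ≤ |y|) (hj2 : ∀ y, |y| - 3 ≤ j y) (hj3 : ∀ y, 0 ≤ j y) {B : ℝ}
    (hB : ∀ t ∈ Icc 0 T, |tdiff κ v t| ≤ B) (hε : 0 < ε) (hεT : ε ≤ T) :
    -((3 + 4 * M) * kint α T + B * kint α ε)
      ≤ ∫ t in ε..T, β (tdiff κ v t) * avg κ α c t := by
  have ha : 0 < 1 - α := by linarith
  have hk := kc_rl ha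
  have hE := kc_expo κ
  have hM0 : 0 ≤ M := (abs_nonneg _).trans (hM 0)
  have hT : 0 ≤ T := hτ.1.trans hτ.2
  have hB0 : 0 ≤ B := (abs_nonneg _).trans (hB 0 ⟨le_rfl, hT⟩)
  have hK := kint_nonneg h1 hT
  have hzc := continuous_tdiff (κ := κ) hv
  have bK : ∀ g : ℝ → ℝ, (∀ s ∈ Icc 0 T, |g s| ≤ |tdiff κ v s|) → ∀ t ∈ Icc 0 T,
      |cv (rl (1 - α)) g t| ≤ kint α t * B := fun g hg t ht =>
    abs_cv_rl_le h1 ht.1 fun s hs =>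
      (hg s ⟨hs.1.le, hs.2.le.trans ht.2⟩).trans (hB s ⟨hs.1.le, hs.2.le.trans ht.2⟩)
  rcases lt_or_ge τ ε with h | h
  · have t1 := abs_le.1 (abs_tail_avg_le h0 h1 hκ hv hc hM hτ hcut hz hβ1 ⟨h.le, hεT⟩)
    have t2 := bK _ (fun s _ => le_rfl) τ hτ
    have t3 : kint α τ * B ≤ B * kint α ε := by
      rw [mul_comm]; exact mul_le_mul_of_nonneg_left (kint_mono h1 hτ.1 h.le) hB0
    have t4 : 0 ≤ M * kint α T := mul_nonneg hM0 hK
    linarith [t1.1]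
  · have hτ0 : 0 < τ := hε.trans_le h
    have hA := hc.avg (κ := κ) (α := α)
    have hEk := hE.cv hk
    have hD := hA.add (hEk.smul (v 0))
    have key := integral_mul_ge_of_convex h0 h1 hzc hD (τ := τ) (fun t ht => by
      rcases ht.1.eq_or_lt with rfl | hpos
      · simp [cv_zero]
      · rw [integral_avg h1 hc (v 0) hpos, cv_rl_tdiff h1 hv hc hcut ⟨hpos, ht.2⟩])
      hβ hj hβj hj0 hε h
    have hi : ∀ {g : ℝ → ℝ}, KC g → ∀ a b, 0 < a → a ≤ b →
        IntervalIntegrable (fun t => β (tdiff κ v t) * g t) volume a b := fun hg a b ha hab =>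
      ContinuousOn.intervalIntegrable (by
        rw [uIcc_of_le hab]
        exact (hβ.comp hzc).continuousOn.mul (hg.cont.mono fun s hs => ha.trans_le hs.1))
    have s1 : ∫ t in ε..τ, β (tdiff κ v t) * (avg κ α c t + v 0 * cv (expo κ) (rl (1 - α)) t)
        = (∫ t in ε..τ, β (tdiff κ v t) * avg κ α c t)
          + ∫ t in ε..τ, β (tdiff κ v t) * (v 0 * cv (expo κ) (rl (1 - α)) t) := by
      rw [← intervalIntegral.integral_add (hi hA ε τ hε h) (hi (hEk.smul (v 0)) ε τ hε h)]
      simp only [mul_add]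
    have nn : ∀ t, 0 ≤ t → 0 ≤ cv (expo κ) (rl (1 - α)) t := fun t ht =>
      cv_nonneg ht (fun s _ => expo_nonneg hκ.le s) fun s hs => rl_nonneg ha hs.1.le
    have s2 : |∫ t in ε..τ, β (tdiff κ v t) * (v 0 * cv (expo κ) (rl (1 - α)) t)|
        ≤ M * kint α T := by
      rw [← norm_eq_abs]
      refine (intervalIntegral.norm_integral_le_of_norm_le (g := fun t => M * cv (expo κ)
        (rl (1 - α)) t) h (ae_of_all _ fun t ht => ?_) ?_).trans ?_
      · rw [norm_mul, norm_mul, norm_eq_abs, norm_eq_abs, norm_eq_abs,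
          abs_of_nonneg (nn t (hε.le.trans ht.1.le))]
        have n1 := nn t (hε.le.trans ht.1.le)
        have n2 := mul_le_mul_of_nonneg_right (hM 0) n1
        have n3 := mul_le_mul_of_nonneg_right (hβ1 (tdiff κ v t))
          (mul_nonneg (abs_nonneg (v 0)) n1)
        linarith
      · exact (((hEk.smul M).intervalIntegrable hτ0.le)).mono_set (by
          rw [uIcc_of_le h, uIcc_of_le hτ0.le]; exact Icc_subset_Icc_left hε.le)
      · rw [intervalIntegral.integral_const_mul]
        refine mul_le_mul_of_nonneg_left ?_ hM0
        refine le_trans ?_ (integral_expo_cv_rl_le h1 hκ hT)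
        refine integral_mono_interval hε.le h hτ.2 ?_ (hEk.intervalIntegrable hT)
        exact (ae_restrict_mem measurableSet_Ioc).mono fun r hr => nn r hr.1.le
    have s3 := abs_le.1 (abs_tail_avg_le h0 h1 hκ hv hc hM hτ hcut hz hβ1 ⟨le_rfl, hτ.2⟩)
    have s4 : |cv (rl (1 - α)) (tdiff κ v) τ| - 3 * kint α T
        ≤ cv (rl (1 - α)) (fun s => j (tdiff κ v s)) τ := by
      have u1 : |cv (rl (1 - α)) (tdiff κ v) τ| ≤ cv (rl (1 - α)) (fun s => |tdiff κ v s|) τ := by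
        rw [cv, ← norm_eq_abs, cv]
        refine intervalIntegral.norm_integral_le_of_norm_le hτ0.le (ae_of_all _ fun t ht => ?_)
          (hk.cvI (KC.of_cont hzc.abs) hτ0)
        rw [norm_mul, norm_eq_abs, norm_eq_abs, abs_of_nonneg (rl_nonneg ha ht.1.le)]
      have u2 : cv (rl (1 - α)) (fun s => |tdiff κ v s| - 3) τ
          = cv (rl (1 - α)) (fun s => |tdiff κ v s|) τ - 3 * kint α τ := by
        rw [cv_sub_right (hk.cvI (KC.of_cont hzc.abs) hτ0)
          (hk.cvI (KC.of_cont continuous_const) hτ0)]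
        congr 1
        have := cv_smul_right 3 (rl (1 - α)) (fun _ => 1) τ
        rw [cv_one_right] at this
        rw [kint]
        simpa using this
      have hjK : KC fun s => j (tdiff κ v s) := KC.of_cont (hj.comp hzc)
      have hzK : KC fun s => |tdiff κ v s| - 3 := KC.of_cont (hzc.abs.sub continuous_const)
      have u3 : 0 ≤ cv (rl (1 - α)) (fun s => j (tdiff κ v s) - (|tdiff κ v s| - 3)) τ :=
        cv_nonneg hτ0.le (fun s hs => rl_nonneg ha hs.1.le) fun s _ => by
          linarith [hj2 (tdiff κ v s)]
      rw [cv_sub_right (hk.cvI hjK hτ0) (hk.cvI hzK hτ0), u2] at u3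
      have := kint_mono h1 hτ.1 hτ.2
      linarith
    have s5 := abs_le.1 (bK (fun s => j (tdiff κ v s))
      (fun s _ => by rw [abs_of_nonneg (hj3 _)]; exact hj1 _) ε ⟨hε.le, hεT⟩)
    rw [s1] at key
    rw [← integral_add_adjacent_intervals (hi hA ε τ hε h) (hi hA τ T hτ0 hτ.2)]
    have s2' := abs_le.1 s2
    linarith [s2'.2, s3.1, s5.2]

end Lower

/-- A continuous function `u` solving the elliptic equation with source `f t * h x - c t x` at each
time, where `c` is the (possibly degenerate) Caputo derivative of `u`: for each `x` it is the
genuine Caputo derivative up to some time and vanishes afterwards. -/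
structure Cut (α T l M : ℝ) (p q h f : ℝ → ℝ) (u c : ℝ → ℝ → ℝ) : Prop where
  h0 : 0 < α
  h1 : α < 1
  hT : 0 < T
  hl : 0 < l
  coef : Coef p q
  hh : Continuous h
  hf : Continuous f
  hu : Continuous fun z : ℝ × ℝ => u z.1 z.2
  bd : ∀ t x, |u t x| ≤ M
  left : ∀ t, u t 0 = 0
  right : ∀ t, u t l = 0
  hc : ContinuousOn (fun z : ℝ × ℝ => c z.1 z.2) (Ioi 0 ×ˢ Ioo 0 l)
  kc : ∀ x ∈ Ioo 0 l, KC fun t => c t x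
  ell : ∀ t ∈ Ioc 0 T, Ell p q l (u t) fun x => f t * h x - c t x
  cut : ∀ x ∈ Ioo 0 l, ∃ τ ∈ Icc 0 T,
    (∀ t ∈ Icc 0 τ, cv (rl (1 - α)) (fun s => u s x - u 0 x) t = ∫ s in (0:ℝ)..t, c s x) ∧
    ∀ t ∈ Ioc τ T, c t x = 0

lemma tendsto_kint {α : ℝ} (h1 : α < 1) : Tendsto (kint α) (𝓝[>] 0) (𝓝 0) := by
  have hk := kc_rl (show 0 < 1 - α by linarith)
  have h := hk.continuousOn_integral 0 self_mem_Ici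
  have : Tendsto (kint α) (𝓝[Ici 0] 0) (𝓝 (kint α 0)) := h
  rw [show kint α 0 = 0 by simp [kint]] at this
  exact this.mono_left (nhdsWithin_mono _ Ioi_subset_Ici_self)

/-- A function integrable in time with uniformly small primitive near the initial time has a
jointly continuous primitive. -/
lemma continuousOn_integral_of_small {c : ℝ → ℝ → ℝ} {ω : ℝ → ℝ} {T l : ℝ}
    (hc : ContinuousOn (fun z : ℝ × ℝ => c z.1 z.2) (Ioi 0 ×ˢ Ioo 0 l))
    (hk : ∀ x ∈ Ioo 0 l, KC fun t => c t x) (hω : Tendsto ω (𝓝[>] 0) (𝓝 0))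
    (hs : ∀ x ∈ Ioo 0 l, ∀ ε ∈ Ioc 0 T, ∀ t ∈ Icc 0 ε, |∫ s in (0:ℝ)..t, c s x| ≤ ω ε)
    (hT : 0 < T) :
    ContinuousOn (fun z : ℝ × ℝ => ∫ s in (0:ℝ)..z.1, c s z.2) (Icc 0 T ×ˢ Ioo 0 l) := by
  have hu : TendstoUniformlyOn (fun ε (z : ℝ × ℝ) => ∫ s in ε..(max z.1 ε), c s z.2)
      (fun z : ℝ × ℝ => ∫ s in (0:ℝ)..z.1, c s z.2) (𝓝[>] 0) (Icc 0 T ×ˢ Ioo 0 l) := by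
    rw [Metric.tendstoUniformlyOn_iff]
    intro e he
    have h2 := hω.eventually (gt_mem_nhds he)
    filter_upwards [h2, Ioc_mem_nhdsGT hT] with ε hε1 hε2 z hz
    rw [Real.dist_eq]
    refine lt_of_le_of_lt ?_ hε1
    rcases le_total z.1 ε with h | h
    · rw [max_eq_right h, intervalIntegral.integral_same, sub_zero]
      exact hs z.2 hz.2 ε hε2 z.1 ⟨hz.1.1, h⟩
    · rw [max_eq_left h, ← integral_add_adjacent_intervals
        ((hk z.2 hz.2).intervalIntegrable hε2.1.le) (((hk z.2 hz.2).intervalIntegrable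
        (hε2.1.le.trans h)).mono_set ?_), add_sub_cancel_right]
      · exact hs z.2 hz.2 ε hε2 ε ⟨hε2.1.le, le_rfl⟩
      · rw [uIcc_of_le h, uIcc_of_le (hε2.1.le.trans h)]
        exact Icc_subset_Icc_left hε2.1.le
  refine hu.continuousOn (Filter.Eventually.frequently ?_)
  filter_upwards [Ioc_mem_nhdsGT hT] with ε hε
  have h1 : ContinuousOn (fun z : ℝ × ℝ => (fun x s => c s x) z.1 z.2) (Ioo 0 l ×ˢ Icc ε T) :=
    hc.comp (f := fun z : ℝ × ℝ => (z.2, z.1)) (by fun_prop) fun z hz =>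
      ⟨hε.1.trans_le hz.2.1, hz.1⟩
  have h2 := continuousOn_primitive_Icc (f := fun x s => c s x) h1 ⟨le_rfl, hε.2⟩
  exact h2.comp (f := fun z : ℝ × ℝ => (z.2, max z.1 ε)) (by fun_prop) fun z hz =>
    ⟨hz.2, le_max_right _ _, max_le hz.1.2 hε.2⟩

/-- The exponential average in time of a family of functions. -/
noncomputable def eav (κ : ℝ) (V : ℝ → ℝ → ℝ) (t x : ℝ) : ℝ := cv (expo κ) (fun s => V s x) t

lemma eav_eq (κ : ℝ) (V : ℝ → ℝ → ℝ) (t x : ℝ) :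
    eav κ V t x = ∫ s in (0:ℝ)..t, expo κ (t - s) * V s x := by
  rw [eav, cv_comm, cv]
  simp only [mul_comm]

lemma continuousOn_eav (κ : ℝ) {V : ℝ → ℝ → ℝ} {T l : ℝ} (hT : 0 ≤ T)
    (hV : ContinuousOn (fun z : ℝ × ℝ => V z.1 z.2) (Icc 0 T ×ˢ Ioo 0 l)) :
    ContinuousOn (fun z : ℝ × ℝ => eav κ V z.1 z.2) (Icc 0 T ×ˢ Ioo 0 l) := by
  have h1 : ContinuousOn (fun z : ℝ × ℝ => (fun x s => exp (κ * s) * V s x) z.1 z.2)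
      (Ioo 0 l ×ˢ Icc 0 T) := by
    have := hV.comp (f := fun z : ℝ × ℝ => (z.2, z.1)) (t := Icc 0 T ×ˢ Ioo 0 l)
      (s := Ioo 0 l ×ˢ Icc 0 T) (by fun_prop) fun z hz => ⟨hz.2, hz.1⟩
    exact ContinuousOn.mul (by fun_prop) this
  have h2 := (continuousOn_primitive_Icc (f := fun x s => exp (κ * s) * V s x) h1 ⟨le_rfl, hT⟩).comp
    (f := fun z : ℝ × ℝ => (z.2, z.1)) (s := Icc 0 T ×ˢ Ioo 0 l) (by fun_prop)
    fun z hz => ⟨hz.2, hz.1⟩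
  refine (ContinuousOn.mul (f := fun z : ℝ × ℝ => κ * exp (-κ * z.1)) (by fun_prop) h2).congr
    fun z _ => ?_
  rw [eav_eq]
  change _ = κ * exp (-κ * z.1) * ∫ r in (0:ℝ)..z.1, exp (κ * r) * V r z.2
  rw [← intervalIntegral.integral_const_mul]
  congr 1
  funext s
  rw [expo, show -κ * (z.1 - s) = -κ * z.1 + κ * s by ring, Real.exp_add]
  ring

lemma ell_eav {κ : ℝ} {V ζ : ℝ → ℝ → ℝ} {T l : ℝ} {p q : ℝ → ℝ} (hc : Coef p q)
    (hV : ContinuousOn (fun z : ℝ × ℝ => V z.1 z.2) (Icc 0 T ×ˢ Ioo 0 l))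
    (hζ : ContinuousOn (fun z : ℝ × ℝ => ζ z.1 z.2) (Icc 0 T ×ˢ Ioo 0 l))
    (h : ∀ t ∈ Icc 0 T, Ell p q l (V t) (ζ t)) {t : ℝ} (ht : t ∈ Icc 0 T) :
    Ell p q l (eav κ V t) (eav κ ζ t) := by
  have hsub : Icc 0 t ⊆ Icc 0 T := Icc_subset_Icc_right ht.2
  have hE := continuous_expo κ
  refine (Ell.integral hc ht.1 (w := fun s => expo κ (t - s)) (by fun_prop)
    (fun s hs => h s (hsub hs)) (hV.mono (prod_mono_left hsub))
    (hζ.mono (prod_mono_left hsub))).congr (fun x _ => eav_eq _ _ _ _) fun x _ => eav_eq _ _ _ _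

/-- The primitive in time of a family of functions. -/
noncomputable def pav (V : ℝ → ℝ → ℝ) (t x : ℝ) : ℝ := ∫ s in (0:ℝ)..t, V s x

lemma continuousOn_pav {V : ℝ → ℝ → ℝ} {T l : ℝ} (hT : 0 ≤ T)
    (hV : ContinuousOn (fun z : ℝ × ℝ => V z.1 z.2) (Icc 0 T ×ˢ Ioo 0 l)) :
    ContinuousOn (fun z : ℝ × ℝ => pav V z.1 z.2) (Icc 0 T ×ˢ Ioo 0 l) := by
  have h1 : ContinuousOn (fun z : ℝ × ℝ => (fun x s => V s x) z.1 z.2) (Ioo 0 l ×ˢ Icc 0 T) :=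
    hV.comp (f := fun z : ℝ × ℝ => (z.2, z.1)) (t := Icc 0 T ×ˢ Ioo 0 l)
      (s := Ioo 0 l ×ˢ Icc 0 T) (by fun_prop) fun z hz => ⟨hz.2, hz.1⟩
  exact (continuousOn_primitive_Icc (f := fun x s => V s x) h1 ⟨le_rfl, hT⟩).comp
    (f := fun z : ℝ × ℝ => (z.2, z.1)) (s := Icc 0 T ×ˢ Ioo 0 l) (by fun_prop)
    fun z hz => ⟨hz.2, hz.1⟩

/-- A family with values in functions integrable in time, whose primitive is jointly continuous. -/
structure Prim (T l : ℝ) (V : ℝ → ℝ → ℝ) : Prop where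
  kc : ∀ x ∈ Ioo 0 l, KC fun t => V t x
  cont : ContinuousOn (fun z : ℝ × ℝ => V z.1 z.2) (Ioc 0 T ×ˢ Ioo 0 l)
  prim : ContinuousOn (fun z : ℝ × ℝ => pav V z.1 z.2) (Icc 0 T ×ˢ Ioo 0 l)

namespace Prim

variable {T l κ : ℝ} {V W ζ : ℝ → ℝ → ℝ} {p q : ℝ → ℝ}

lemma of_cont (hT : 0 ≤ T) (h : Continuous fun z : ℝ × ℝ => V z.1 z.2) : Prim T l V :=
  ⟨fun x _ => KC.of_cont (by fun_prop), h.continuousOn, continuousOn_pav hT h.continuousOn⟩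

lemma sub (hV : Prim T l V) (hW : Prim T l W) :
    Prim T l fun t x => V t x - W t x :=
  ⟨fun x hx => (hV.kc x hx).sub (hW.kc x hx), hV.cont.sub hW.cont,
    (hV.prim.sub hW.prim).congr fun z hz => by
      simp only [pav, Pi.sub_apply]
      exact intervalIntegral.integral_sub ((hV.kc z.2 hz.2).intervalIntegrable hz.1.1)
        ((hW.kc z.2 hz.2).intervalIntegrable hz.1.1)⟩

lemma eav_eq (hV : Prim T l V) {t x : ℝ} (ht : 0 < t) (hx : x ∈ Ioo 0 l) :
    eav κ V t x = κ * (pav V t x - eav κ (pav V) t x) := by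
  have : cv (fun _ => 1) (fun s => V s x) = fun s => pav V s x := by
    funext s
    rw [cv_one_left, pav]
  rw [eav, ← (hV.kc x hx).expo_sub ht, this]
  rfl

lemma pav_id_mul (hV : Prim T l V) {t x : ℝ} (ht : 0 ≤ t) (hx : x ∈ Ioo 0 l) :
    pav (fun s y => s * V s y) t x = t * pav V t x - pav (pav V) t x := by
  rcases ht.eq_or_lt with rfl | ht
  · simp [pav]
  · have := cv_one_id_mul (hV.kc x hx) ht
    simp only [cv_one_left] at this
    exact this

lemma id_mul (hT : 0 ≤ T) (hV : Prim T l V) : Prim T l fun t x => t * V t x :=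
  ⟨fun x hx => (hV.kc x hx).id_mul, ContinuousOn.mul (by fun_prop) hV.cont, by
    have : ContinuousOn (fun z : ℝ × ℝ => z.1 * pav V z.1 z.2 - pav (pav V) z.1 z.2)
      (Icc 0 T ×ˢ Ioo 0 l) := (ContinuousOn.mul (by fun_prop) hV.prim).sub
        (continuousOn_pav hT hV.prim)
    exact this.congr fun z hz => hV.pav_id_mul hz.1.1 hz.2⟩

lemma continuousOn_eav (hT : 0 ≤ T) (hV : Prim T l V) :
    ContinuousOn (fun z : ℝ × ℝ => InvSource.eav κ V z.1 z.2) (Ioc 0 T ×ˢ Ioo 0 l) := by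
  have : ContinuousOn (fun z : ℝ × ℝ => κ * (pav V z.1 z.2 - InvSource.eav κ (pav V) z.1 z.2))
      (Ioc 0 T ×ˢ Ioo 0 l) := (continuousOn_const.mul (hV.prim.sub
        (InvSource.continuousOn_eav κ hT hV.prim))).mono (prod_mono_left Ioc_subset_Icc_self)
  exact this.congr fun z hz => hV.eav_eq hz.1.1 hz.2

lemma ell_eav (hc : Coef p q) (hV : Prim T l V) (hζ : Prim T l ζ)
    (h : ∀ t ∈ Icc 0 T, Ell p q l (pav V t) (pav ζ t)) {t : ℝ} (ht : t ∈ Ioc 0 T) :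
    Ell p q l (InvSource.eav κ V t) (InvSource.eav κ ζ t) := by
  have ht' := Ioc_subset_Icc_self ht
  exact (((h t ht').sub (InvSource.ell_eav hc hV.prim hζ.prim h ht')).smul κ).congr
    (fun x hx => hV.eav_eq ht.1 hx) fun x hx => hζ.eav_eq ht.1 hx

lemma ell_pav (hc : Coef p q) (hV : Prim T l V) (hζ : Prim T l ζ)
    (h : ∀ t ∈ Ioc 0 T, Ell p q l (V t) (ζ t)) {t : ℝ} (ht : t ∈ Icc 0 T) :
    Ell p q l (pav V t) (pav ζ t) := by
  rcases ht.1.eq_or_lt with rfl | hpos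
  · exact ⟨0, fun x _ => by
      have e : ∀ V : ℝ → ℝ → ℝ, pav V 0 = fun _ => 0 := fun V => by funext; simp [pav]
      rw [e, e]
      constructor
      · simpa using hasDerivAt_const x (0:ℝ)
      · simp⟩
  have hsub : insert 0 (Ioc 0 t) ⊆ Icc 0 T := by
    rintro s (rfl | hs)
    · exact ⟨le_rfl, ht.1.trans ht.2⟩
    · exact ⟨hs.1.le, hs.2.trans ht.2⟩
  have hcont : ∀ {V : ℝ → ℝ → ℝ}, Prim T l V → ContinuousOn
      (fun z : ℝ × ℝ => pav V t z.2 - pav V z.1 z.2) (insert 0 (Ioc 0 t) ×ˢ Ioo 0 l) := by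
    intro V hV
    refine ContinuousOn.sub ?_ (hV.prim.mono (prod_mono_left hsub))
    exact hV.prim.comp (f := fun z : ℝ × ℝ => (t, z.2)) (by fun_prop) fun z hz => ⟨ht, hz.2⟩
  have hsplit : ∀ {V : ℝ → ℝ → ℝ}, Prim T l V → ∀ s ∈ Ioc 0 t, ∀ x ∈ Ioo 0 l,
      pav V t x - pav V s x = ∫ r in s..t, 1 * V r x := by
    intro V hV s hs x hx
    simp only [one_mul, pav]
    exact integral_interval_sub_left ((hV.kc x hx).intervalIntegrable ht.1)
      ((hV.kc x hx).intervalIntegrable hs.1.le)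
  refine (Ell.of_closure hc (A := Ioc 0 t) (s₀ := (0:ℝ)) (U := fun s x => pav V t x - pav V s x)
    (ζ := fun s x => pav ζ t x - pav ζ s x) (fun s hs => ?_) ?_ (hcont hV) (hcont hζ)).congr
    (fun x _ => by simp [pav]) fun x _ => by simp [pav]
  · have hsub' : Icc s t ⊆ Ioc 0 T := fun r hr => ⟨hs.1.trans_le hr.1, hr.2.trans ht.2⟩
    exact (Ell.integral hc hs.2 (w := fun _ => 1) (by fun_prop) (fun r hr => h r (hsub' hr))
      (hV.cont.mono (prod_mono_left hsub')) (hζ.cont.mono (prod_mono_left hsub'))).congr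
      (hsplit hV s hs) (hsplit hζ s hs)
  · rw [closure_Ioc hpos.ne]
    exact ⟨le_rfl, ht.1⟩

end Prim

namespace Cut

variable {α T l M κ : ℝ} {p q h f : ℝ → ℝ} {u c : ℝ → ℝ → ℝ}

/-- The source of the elliptic equation. -/
def src (h f : ℝ → ℝ) (c : ℝ → ℝ → ℝ) (t x : ℝ) : ℝ := f t * h x - c t x

lemma M_nonneg (H : Cut α T l M p q h f u c) : 0 ≤ M := (abs_nonneg _).trans (H.bd 0 0)

lemma cont_slice (H : Cut α T l M p q h f u c) (x : ℝ) : Continuous fun t => u t x := by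
  have := H.hu
  fun_prop

lemma prim_u (H : Cut α T l M p q h f u c) : Prim T l u := Prim.of_cont H.hT.le H.hu

lemma prim_c (H : Cut α T l M p q h f u c) : Prim T l c := by
  refine ⟨H.kc, H.hc.mono (prod_mono_left Ioc_subset_Ioi_self), ?_⟩
  have hω : Tendsto (fun ε => 2 * M * kint α ε) (𝓝[>] 0) (𝓝 0) := by
    simpa using (tendsto_kint H.h1).const_mul (2 * M)
  refine continuousOn_integral_of_small H.hc H.kc hω (fun x hx ε hε t ht => ?_) H.hT
  obtain ⟨τ, hτ, hcut, hz⟩ := H.cut x hx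
  refine (abs_integral_le_kint H.h1 (H.kc x hx) (fun t => H.bd t x) hτ hcut hz
    ⟨ht.1, ht.2.trans hε.2⟩).trans ?_
  exact mul_le_mul_of_nonneg_left (kint_mono H.h1 ht.1 ht.2) (by linarith [H.M_nonneg])

lemma prim_src (H : Cut α T l M p q h f u c) : Prim T l (src h f c) := by
  have := H.hf
  have := H.hh
  exact (Prim.of_cont (V := fun t x => f t * h x) H.hT.le (by fun_prop)).sub H.prim_c

lemma ell_pav (H : Cut α T l M p q h f u c) {t : ℝ} (ht : t ∈ Icc 0 T) :
    Ell p q l (pav u t) (pav (src h f c) t) :=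
  Prim.ell_pav H.coef H.prim_u H.prim_src H.ell ht

/-- The averaged time difference of `t u`. -/
noncomputable def dif (κ : ℝ) (u : ℝ → ℝ → ℝ) (t x : ℝ) : ℝ := tdiff κ (fun s => u s x) t

lemma ell_eav (H : Cut α T l M p q h f u c) {t : ℝ} (ht : t ∈ Ioc 0 T) :
    Ell p q l (eav κ u t) (eav κ (src h f c) t) :=
  Prim.ell_eav H.coef H.prim_u H.prim_src (fun _ hs => H.ell_pav hs) ht

lemma ell_dif (H : Cut α T l M p q h f u c) {t : ℝ} (ht : t ∈ Ioc 0 T) :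
    Ell p q l (dif κ u t) (dif κ (src h f c) t) := by
  have h1 := Prim.ell_eav (κ := κ) H.coef (H.prim_u.id_mul H.hT.le) (H.prim_src.id_mul H.hT.le)
    (fun s hs => Prim.ell_pav H.coef (H.prim_u.id_mul H.hT.le) (H.prim_src.id_mul H.hT.le)
      (fun r hr => (H.ell r hr).smul r) hs) ht
  exact (((H.ell t ht).smul t).sub h1).smul κ

lemma continuousOn_eav_u (H : Cut α T l M p q h f u c) :
    ContinuousOn (fun z : ℝ × ℝ => eav κ u z.1 z.2) (Ioc 0 T ×ˢ Ioo 0 l) :=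
  H.prim_u.continuousOn_eav H.hT.le

lemma continuousOn_dif {V : ℝ → ℝ → ℝ} (hT : 0 ≤ T) (hV : Prim T l V) :
    ContinuousOn (fun z : ℝ × ℝ => dif κ V z.1 z.2) (Ioc 0 T ×ˢ Ioo 0 l) :=
  continuousOn_const.mul ((ContinuousOn.mul (by fun_prop) hV.cont).sub
    ((hV.id_mul hT).continuousOn_eav hT))

lemma continuousOn_deriv_u (H : Cut α T l M p q h f u c) :
    ContinuousOn (fun z : ℝ × ℝ => deriv (u z.1) z.2) (Ioc 0 T ×ˢ Ioo 0 l) :=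
  Ell.continuousOn_deriv H.coef (fun _ hs => H.ell _ hs) H.prim_u.cont H.prim_src.cont

lemma continuousOn_deriv_eav (H : Cut α T l M p q h f u c) :
    ContinuousOn (fun z : ℝ × ℝ => deriv (eav κ u z.1) z.2) (Ioc 0 T ×ˢ Ioo 0 l) :=
  Ell.continuousOn_deriv H.coef (fun _ hs => H.ell_eav hs) H.continuousOn_eav_u
    (H.prim_src.continuousOn_eav H.hT.le)

lemma continuousOn_deriv_dif (H : Cut α T l M p q h f u c) :
    ContinuousOn (fun z : ℝ × ℝ => deriv (dif κ u z.1) z.2) (Ioc 0 T ×ˢ Ioo 0 l) :=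
  Ell.continuousOn_deriv H.coef (fun _ hs => H.ell_dif hs) (continuousOn_dif H.hT.le H.prim_u)
    (continuousOn_dif H.hT.le H.prim_src)

end Cut

/-- The weak form of the elliptic equation with a test function vanishing at the endpoints. -/
lemma Ell.integral_test {p q V ζ : ℝ → ℝ} {l x1 x2 : ℝ} (hc : Coef p q) (hV : Ell p q l V ζ)
    (hζ : ContinuousOn ζ (Ioo 0 l)) (h1 : 0 < x1) (h12 : x1 ≤ x2) (h2 : x2 < l) {w w' : ℝ → ℝ}
    (hw : ∀ x ∈ Icc x1 x2, HasDerivAt w (w' x) x) (hw' : ContinuousOn w' (Icc x1 x2))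
    (hV' : ContinuousOn (deriv V) (Icc x1 x2)) (hw1 : w x1 = 0) (hw2 : w x2 = 0) :
    ∫ x in x1..x2, w x * ζ x
      = ∫ x in x1..x2, (q x * (w x * V x) + p x * deriv V x * w' x) := by
  have hsub : Icc x1 x2 ⊆ Ioo 0 l := fun x hx => ⟨h1.trans_le hx.1, hx.2.trans_lt h2⟩
  have hqc := hc.qc
  have hpc := hc.pc
  have hwc : ContinuousOn w (Icc x1 x2) := fun x hx => (hw x hx).continuousAt.continuousWithinAt
  have hVc := hV.continuousOn.mono hsub
  have hζc := hζ.mono hsub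
  have hi : ∀ {g : ℝ → ℝ}, ContinuousOn g (Icc x1 x2) → IntervalIntegrable g volume x1 x2 :=
    fun hg => ContinuousOn.intervalIntegrable (by rwa [uIcc_of_le h12])
  rw [← sub_eq_zero, ← intervalIntegral.integral_sub (hi (by fun_prop)) (hi (by fun_prop))]
  rw [integral_eq_sub_of_hasDerivAt
    (f := fun x => -(p x * deriv V x * w x)) (fun x hx => ?_) (hi (by fun_prop))]
  · simp [hw1, hw2]
  · rw [uIcc_of_le h12] at hx
    refine ((hV.flux hc.p0 (hsub hx)).mul (hw x hx)).neg.congr_deriv ?_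
    ring

section Rect

variable {a b c d : ℝ} {G : ℝ → ℝ → ℝ}

lemma integral_swap (hab : a ≤ b) (hcd : c ≤ d)
    (hG : ContinuousOn (fun z : ℝ × ℝ => G z.1 z.2) (Icc a b ×ˢ Icc c d)) :
    ∫ s in a..b, ∫ x in c..d, G s x = ∫ x in c..d, ∫ s in a..b, G s x := by
  simp only [integral_of_le hab, integral_of_le hcd]
  refine integral_integral_swap ?_
  rw [Measure.prod_restrict]
  exact (hG.integrableOn_compact (isCompact_Icc.prod isCompact_Icc)).mono_set
    (prod_mono Ioc_subset_Icc_self Ioc_subset_Icc_self)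

lemma continuousOn_inner (hcd : c ≤ d)
    (hG : ContinuousOn (fun z : ℝ × ℝ => G z.1 z.2) (Icc a b ×ˢ Icc c d)) :
    ContinuousOn (fun s => ∫ x in c..d, G s x) (Icc a b) :=
  (continuousOn_primitive_Icc hG ⟨le_rfl, hcd⟩).comp (f := fun s : ℝ => (s, d)) (by fun_prop)
    fun _ hs => ⟨hs, hcd, le_rfl⟩

lemma ContinuousOn.swap_rect {A B : Set ℝ}
    (hG : ContinuousOn (fun z : ℝ × ℝ => G z.1 z.2) (A ×ˢ B)) :
    ContinuousOn (fun z : ℝ × ℝ => G z.2 z.1) (B ×ˢ A) :=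
  hG.comp (f := fun z : ℝ × ℝ => (z.2, z.1)) (by fun_prop) fun _ hz => ⟨hz.2, hz.1⟩

lemma intervalIntegrable_of_cont (hab : a ≤ b) {g : ℝ → ℝ} (hg : ContinuousOn g (Icc a b)) :
    IntervalIntegrable g volume a b :=
  ContinuousOn.intervalIntegrable (by rwa [uIcc_of_le hab])

lemma integral_le_const (hab : a ≤ b) {g : ℝ → ℝ} (hg : ContinuousOn g (Icc a b)) {C : ℝ}
    (h : ∀ x ∈ Icc a b, g x ≤ C) : ∫ x in a..b, g x ≤ C * (b - a) := by
  have := integral_mono_on hab (intervalIntegrable_of_cont hab hg)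
    (intervalIntegrable_const (c := C)) h
  simpa [mul_comm] using this

end Rect

lemma exists_small {y : ℝ → ℝ → ℝ} {T l ρ a b : ℝ} (hy : Continuous fun z : ℝ × ℝ => y z.1 z.2)
    (h0 : ∀ t, y t 0 = 0) (hl : ∀ t, y t l = 0) (hρ : 0 < ρ) (ha : 0 < a) (hb : b < l) :
    ∃ x1 x2, 0 < x1 ∧ x1 ≤ a ∧ b ≤ x2 ∧ x2 < l ∧ ∀ t ∈ Icc 0 T, |y t x1| ≤ ρ ∧ |y t x2| ≤ ρ := by
  have key : ∀ x0, (∀ t, y t x0 = 0) → ∀ᶠ x in 𝓝 x0, ∀ t ∈ Icc 0 T, |y t x| ≤ ρ := by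
    intro x0 hx0
    refine isCompact_Icc.eventually_forall_of_forall_eventually fun t _ => ?_
    have hc : Continuous fun z : ℝ × ℝ => |y z.2 z.1| := by fun_prop
    have := hc.tendsto (x0, t)
    simp only [hx0, abs_zero] at this
    exact (this.eventually (gt_mem_nhds hρ)).mono fun z hz => le_of_lt hz
  obtain ⟨x1, h1, h1'⟩ := (((key 0 h0).filter_mono nhdsWithin_le_nhds).and
    (Ioc_mem_nhdsGT ha)).exists
  obtain ⟨x2, h2, h2'⟩ := (((key l hl).filter_mono nhdsWithin_le_nhds).and
    (Ico_mem_nhdsLT hb)).exists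
  exact ⟨x1, x2, h1'.1, h1'.2, h2'.1, h2'.2, fun t ht => ⟨h1 t ht, h2 t ht⟩⟩

section Trunc

variable {B : ℝ → ℝ}

/-- The primitive vanishing at zero. -/
noncomputable def pri (B : ℝ → ℝ) (y : ℝ) : ℝ := ∫ s in (0:ℝ)..y, B s

lemma hasDerivAt_pri (hB : Continuous B) (y : ℝ) : HasDerivAt (pri B) (B y) y :=
  integral_hasDerivAt_right (hB.intervalIntegrable _ _)
    (hB.stronglyMeasurableAtFilter _ _) hB.continuousAt

lemma continuous_pri (hB : Continuous B) : Continuous (pri B) :=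
  continuous_iff_continuousAt.2 fun y => (hasDerivAt_pri hB y).continuousAt

lemma pri_zero (B : ℝ → ℝ) : pri B 0 = 0 := by simp [pri]

lemma pri_sub (hB : Continuous B) (a b : ℝ) : pri B a - pri B b = ∫ s in b..a, B s :=
  integral_interval_sub_left (hB.intervalIntegrable _ _)
    (hB.intervalIntegrable _ _)

lemma monotone_pri (hB : Continuous B) (h0 : ∀ y, 0 ≤ B y) : Monotone (pri B) :=
  monotone_of_deriv_nonneg (fun y => (hasDerivAt_pri hB y).differentiableAt) fun y => by
    rw [(hasDerivAt_pri hB y).deriv]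
    exact h0 y

lemma pri_convex (hB : Continuous B) (hm : Monotone B) (a b : ℝ) :
    pri B a - pri B b ≤ B a * (a - b) := by
  rw [pri_sub hB]
  rcases le_total b a with h | h
  · have := integral_mono_on h (hB.intervalIntegrable (μ := volume) _ _)
      (intervalIntegrable_const (c := B a)) fun x hx => hm hx.2
    simpa [mul_comm] using this
  · have := integral_mono_on h (intervalIntegrable_const (c := B a))
      (hB.intervalIntegrable (μ := volume) _ _) fun x hx => hm hx.1
    rw [integral_symm]
    simp only [intervalIntegral.integral_const, smul_eq_mul] at this
    linarith

lemma abs_pri_le {C y : ℝ} (h : ∀ s, |s| ≤ |y| → |B s| ≤ C) : |pri B y| ≤ C * |y| := by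
  have := intervalIntegral.norm_integral_le_of_norm_le_const (a := 0) (b := y) (f := B) (C := C)
    fun s hs => h s (by
      rcases le_total 0 y with hy | hy
      · rw [uIoc_of_le hy] at hs
        rw [abs_of_nonneg hs.1.le, abs_of_nonneg hy]
        exact hs.2
      · rw [uIoc_of_ge hy] at hs
        rw [abs_of_nonpos hs.2, abs_of_nonpos hy]
        linarith [hs.1])
  simpa [pri] using this

lemma pri_eq_zero {ρ y : ℝ} (h : ∀ s, |s| ≤ ρ → B s = 0) (hy : |y| ≤ ρ) : pri B y = 0 := by
  have := abs_pri_le (B := B) (C := 0) (y := y) fun s hs => by rw [h s (hs.trans hy), abs_zero]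
  simpa using this

lemma pri_mul_nonneg (hB : Continuous B) (h0 : ∀ y, 0 ≤ B y) (y : ℝ) : 0 ≤ pri B y * y := by
  have hm := monotone_pri hB h0
  rcases le_total 0 y with hy | hy
  · have := hm hy
    rw [pri_zero] at this
    exact mul_nonneg this hy
  · have := hm hy
    rw [pri_zero] at this
    exact mul_nonneg_of_nonpos_of_nonpos this hy

end Trunc

namespace Cut

variable {α T l M κ : ℝ} {p q h f : ℝ → ℝ} {u c : ℝ → ℝ → ℝ}

/-- The truncated energy estimate. -/
lemma energy (H : Cut α T l M p q h f u c) {F ρ ε a b : ℝ}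
    (hF : ∀ t ∈ Icc 0 T, ∀ x ∈ Icc 0 l, |f t * h x| ≤ F) {B : ℝ → ℝ} (hB : Continuous B)
    (hB0 : ∀ y, 0 ≤ B y) (hB1 : ∀ y, B y ≤ 1) (hρ : 0 < ρ) (hBρ : ∀ y, |y| ≤ ρ → B y = 0)
    (hε : 0 < ε) (hεT : ε ≤ T) (ha : 0 < a) (hab : a ≤ b) (hb : b < l) :
    ∫ t in ε..T, ∫ x in a..b, p x * (B (u t x) * deriv (u t) x ^ 2)
      ≤ (M * F * T + 4 * M ^ 2 * kint α T) * l := by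
  obtain ⟨x1, x2, hx1, hx1a, hbx2, hx2, hsm⟩ := exists_small (T := T) H.hu H.left H.right hρ ha hb
  have h12 : x1 ≤ x2 := hx1a.trans (hab.trans hbx2)
  have hsub : Icc x1 x2 ⊆ Ioo 0 l := fun x hx => ⟨hx1.trans_le hx.1, hx.2.trans_lt hx2⟩
  have hts : Icc ε T ⊆ Ioc 0 T := fun t ht => ⟨hε.trans_le ht.1, ht.2⟩
  have hR : Icc ε T ×ˢ Icc x1 x2 ⊆ Ioc 0 T ×ˢ Ioo 0 l := prod_mono hts hsub
  have hpc := H.coef.pc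
  have hqc := H.coef.qc
  have hhc := H.hh
  have hfc := H.hf
  have huc := H.hu
  have hβ := continuous_pri hB
  have hβm := monotone_pri hB hB0
  have hM := H.M_nonneg
  have hF0 : 0 ≤ F := (abs_nonneg _).trans (hF 0 ⟨le_rfl, H.hT.le⟩ 0 ⟨le_rfl, H.hl.le⟩)
  have hK := kint_nonneg H.h1 H.hT.le
  have hdu := H.continuousOn_deriv_u.mono hR
  have hcc := H.prim_c.cont.mono hR
  have hβu : Continuous fun z : ℝ × ℝ => pri B (u z.1 z.2) := by fun_prop
  have hbd : ∀ t x, |pri B (u t x)| ≤ M := fun t x => by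
    refine (abs_pri_le (C := 1) fun s _ => ?_).trans (by linarith [H.bd t x])
    rw [abs_of_nonneg (hB0 s)]
    exact hB1 s
  have hG : ContinuousOn (fun z : ℝ × ℝ =>
      (fun t x => p x * (B (u t x) * deriv (u t) x ^ 2)) z.1 z.2) (Icc ε T ×ˢ Icc x1 x2) := by
    fun_prop
  have hW : ContinuousOn (fun z : ℝ × ℝ => (fun t x => pri B (u t x) * c t x) z.1 z.2)
      (Icc ε T ×ˢ Icc x1 x2) := by fun_prop
  have slice : ∀ {G : ℝ → ℝ → ℝ}, ContinuousOn (fun z : ℝ × ℝ => G z.1 z.2)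
      (Icc ε T ×ˢ Icc x1 x2) → ∀ t ∈ Icc ε T, ContinuousOn (G t) (Icc x1 x2) :=
    fun hG t ht => Ell.continuousOn_left hG ht
  have step : ∀ t ∈ Icc ε T, ∫ x in a..b, p x * (B (u t x) * deriv (u t) x ^ 2)
      ≤ M * F * l - ∫ x in x1..x2, pri B (u t x) * c t x := by
    intro t ht
    have ht' := hts ht
    have hGt := slice (G := fun t x => p x * (B (u t x) * deriv (u t) x ^ 2)) hG t ht
    have hWt := slice (G := fun t x => pri B (u t x) * c t x) hW t ht
    have hdt : ContinuousOn (deriv (u t)) (Icc x1 x2) :=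
      slice (G := fun t x => deriv (u t) x) hdu t ht
    have e1 : ∫ x in a..b, p x * (B (u t x) * deriv (u t) x ^ 2)
        ≤ ∫ x in x1..x2, p x * (B (u t x) * deriv (u t) x ^ 2) := by
      refine integral_mono_interval hx1a hab hbx2 (ae_of_all _ fun x => ?_)
        (intervalIntegrable_of_cont h12 hGt)
      exact mul_nonneg (H.coef.p0 x).le (mul_nonneg (hB0 _) (sq_nonneg _))
    have e2 := Ell.integral_test H.coef (H.ell t ht') (by
        exact Ell.continuousOn_left H.prim_src.cont ht') hx1 h12 hx2
      (w := fun x => pri B (u t x)) (w' := fun x => B (u t x) * deriv (u t) x)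
      (fun x hx => (hasDerivAt_pri hB _).comp x ((H.ell t ht').hasDerivAt (hsub hx)))
      (by fun_prop) hdt
      (pri_eq_zero hBρ (hsm t ⟨ht'.1.le, ht'.2⟩).1) (pri_eq_zero hBρ (hsm t ⟨ht'.1.le, ht'.2⟩).2)
    have i1 : IntervalIntegrable (fun x => pri B (u t x) * (f t * h x)) volume x1 x2 :=
      intervalIntegrable_cont
    have i2 := intervalIntegrable_of_cont h12 hWt
    have i3 : IntervalIntegrable (fun x => q x * (pri B (u t x) * u t x)) volume x1 x2 :=
      intervalIntegrable_cont
    simp only [mul_sub] at e2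
    rw [intervalIntegral.integral_sub i1 i2, intervalIntegral.integral_add i3
      (intervalIntegrable_of_cont h12 (by fun_prop))] at e2
    have e3 : 0 ≤ ∫ x in x1..x2, q x * (pri B (u t x) * u t x) :=
      intervalIntegral.integral_nonneg h12 fun x _ =>
        mul_nonneg (H.coef.q0 x) (pri_mul_nonneg hB hB0 _)
    have e4 : ∫ x in x1..x2, pri B (u t x) * (f t * h x) ≤ M * F * l := by
      refine (integral_le_const h12 (C := M * F) (by fun_prop) fun x hx => ?_).trans ?_
      · refine (le_abs_self _).trans ?_
        rw [abs_mul]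
        exact mul_le_mul (hbd t x) (hF t ⟨ht'.1.le, ht'.2⟩ x (Ioo_subset_Icc_self (hsub hx)))
          (abs_nonneg _) hM
      · exact mul_le_mul_of_nonneg_left (by linarith) (mul_nonneg hM hF0)
    have e5 : ∀ x, p x * deriv (u t) x * (B (u t x) * deriv (u t) x)
        = p x * (B (u t x) * deriv (u t) x ^ 2) := fun x => by ring
    simp only [e5] at e2
    linarith
  have hab' : Icc a b ⊆ Icc x1 x2 := Icc_subset_Icc hx1a hbx2
  have s1 := integral_mono_on hεT
    (intervalIntegrable_of_cont hεT (continuousOn_inner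
      (G := fun t x => p x * (B (u t x) * deriv (u t) x ^ 2)) hab (hG.mono (prod_mono_right hab'))))
    ((intervalIntegrable_const (c := M * F * l)).sub
      (intervalIntegrable_of_cont hεT (continuousOn_inner
      (G := fun t x => pri B (u t x) * c t x) h12 hW))) step
  rw [intervalIntegral.integral_sub intervalIntegrable_const
    (intervalIntegrable_of_cont hεT (continuousOn_inner
      (G := fun t x => pri B (u t x) * c t x) h12 hW)), integral_swap (G := fun t x => pri B (u t x) * c t x) hεT h12 hW] at s1
  have s2 : -(4 * M ^ 2 * kint α T) * (x2 - x1)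
      ≤ ∫ x in x1..x2, ∫ t in ε..T, pri B (u t x) * c t x := by
    have hcont := continuousOn_inner (G := fun x t => pri B (u t x) * c t x) hεT
      (ContinuousOn.swap_rect (G := fun t x => pri B (u t x) * c t x) hW)
    have := integral_le_const h12 hcont.neg (C := 4 * M ^ 2 * kint α T) fun x hx => ?_
    · simp only [Pi.neg_apply, intervalIntegral.integral_neg] at this
      linarith
    · obtain ⟨τ, hτ, hcut, hz⟩ := H.cut x (hsub hx)
      have := integral_mul_caputo_ge H.h0 H.h1 (H.cont_slice x) (H.kc x (hsub hx)) hτ hcut hz hβ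
        (continuous_pri hβ) (pri_convex hβ hβm) (J := M ^ 2) (fun t => ?_) hε hεT
      · simp only [Pi.neg_apply]
        linarith
      · refine (abs_pri_le (C := M) fun s hs => ?_).trans ?_
        · refine (abs_pri_le (C := 1) fun r _ => ?_).trans (by linarith [H.bd t x])
          rw [abs_of_nonneg (hB0 r)]
          exact hB1 r
        · rw [sq]
          exact mul_le_mul_of_nonneg_left (H.bd t x) hM
  simp only [intervalIntegral.integral_const, smul_eq_mul] at s1
  have s3 : 4 * M ^ 2 * kint α T * (x2 - x1) ≤ 4 * M ^ 2 * kint α T * l :=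
    mul_le_mul_of_nonneg_left (by linarith) (by positivity)
  have s4 : (T - ε) * (M * F * l) ≤ T * (M * F * l) :=
    mul_le_mul_of_nonneg_right (by linarith) (mul_nonneg (mul_nonneg hM hF0) H.hl.le)
  linarith

end Cut

section

variable {a b c η : ℝ} {w g : ℝ → ℝ}

lemma sq_integral_le (hab : a ≤ b) (hw : ContinuousOn w (Icc a b)) (hw0 : ∀ x ∈ Icc a b, 0 ≤ w x)
    (hc : 0 < c) (hwc : ∫ x in a..b, w x ≤ c) (hg : ContinuousOn g (Icc a b)) :
    (∫ x in a..b, w x * g x) ^ 2 ≤ c * ∫ x in a..b, w x * g x ^ 2 := by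
  set I := ∫ x in a..b, w x * g x with hI
  have i1 := intervalIntegrable_of_cont hab hw
  have i2 : IntervalIntegrable (fun x => w x * g x) volume a b :=
    intervalIntegrable_of_cont hab (hw.mul hg)
  have i3 : IntervalIntegrable (fun x => w x * g x ^ 2) volume a b :=
    intervalIntegrable_of_cont hab (hw.mul (hg.pow 2))
  have h0 : 0 ≤ ∫ x in a..b, w x * (c * g x - I) ^ 2 :=
    intervalIntegral.integral_nonneg hab fun x hx => mul_nonneg (hw0 x hx) (sq_nonneg _)
  have h1 : ∫ x in a..b, w x * (c * g x - I) ^ 2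
      = c ^ 2 * (∫ x in a..b, w x * g x ^ 2) - 2 * c * I * I + I ^ 2 * ∫ x in a..b, w x := by
    have : ∀ x, w x * (c * g x - I) ^ 2
        = c ^ 2 * (w x * g x ^ 2) - 2 * c * I * (w x * g x) + I ^ 2 * w x := fun x => by ring
    simp only [this]
    rw [intervalIntegral.integral_add ((i3.const_mul _).sub (i2.const_mul _)) (i1.const_mul _),
      intervalIntegral.integral_sub (i3.const_mul _) (i2.const_mul _),
      intervalIntegral.integral_const_mul, intervalIntegral.integral_const_mul,
      intervalIntegral.integral_const_mul]
  rw [h1] at h0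
  have h2 : I ^ 2 * ∫ x in a..b, w x ≤ I ^ 2 * c := mul_le_mul_of_nonneg_left hwc (sq_nonneg _)
  have h3 : 0 ≤ c * (c * (∫ x in a..b, w x * g x ^ 2) - I ^ 2) := by nlinarith
  have := nonneg_of_mul_nonneg_right h3 hc
  linarith

lemma integral_sq_diff_le {V : ℝ → ℝ} (hab : a ≤ b) (hη : 0 < η)
    (hV : ∀ x ∈ Icc a (b + η), HasDerivAt V (g x) x) (hg : ContinuousOn g (Icc a (b + η))) :
    ∫ x in a..b, (V (x + η) - V x) ^ 2 ≤ η ^ 2 * ∫ x in a..(b + η), g x ^ 2 := by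
  have hVc : ContinuousOn V (Icc a (b + η)) := fun x hx => (hV x hx).continuousAt.continuousWithinAt
  have hmap : ∀ r ∈ Icc 0 η, MapsTo (fun x => x + r) (Icc a b) (Icc a (b + η)) :=
    fun r hr x hx => ⟨by linarith [hr.1, hx.1], by linarith [hr.2, hx.2]⟩
  have hG : ContinuousOn (fun z : ℝ × ℝ => (fun x r => g (x + r) ^ 2) z.1 z.2)
      (Icc a b ×ˢ Icc 0 η) :=
    (hg.comp (f := fun z : ℝ × ℝ => z.1 + z.2) (by fun_prop) fun z hz =>
      hmap z.2 hz.2 hz.1).pow 2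
  have e1 : ∀ x ∈ Icc a b, (V (x + η) - V x) ^ 2 ≤ η * ∫ r in (0:ℝ)..η, g (x + r) ^ 2 := by
    intro x hx
    have hgx : ContinuousOn (fun r => g (x + r)) (Icc 0 η) :=
      hg.comp (by fun_prop) fun r hr => hmap r hr hx
    have : ∫ r in (0:ℝ)..η, g (x + r) = V (x + η) - V x := by
      have := integral_eq_sub_of_hasDerivAt (a := 0) (b := η)
        (f := fun r => V (x + r)) (f' := fun r => g (x + r)) (fun r hr => ?_)
        (intervalIntegrable_of_cont hη.le hgx)
      · simpa using this
      · rw [uIcc_of_le hη.le] at hr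
        exact (hV _ (hmap r hr hx)).comp_const_add x r
    have h2 := sq_integral_le hη.le (w := fun _ => 1) continuousOn_const (fun _ _ => zero_le_one) hη
      (by simp) hgx
    simpa [this] using h2
  have e2 := integral_mono_on hab (intervalIntegrable_of_cont hab
    (((hVc.comp (f := fun x => x + η) (by fun_prop) (hmap η ⟨hη.le, le_rfl⟩)).sub
      (hVc.mono (Icc_subset_Icc_right (by linarith)))).pow 2))
    (intervalIntegrable_of_cont hab ((continuousOn_inner (G := fun x r => g (x + r) ^ 2)
      hη.le hG).const_mul η)) e1
  rw [intervalIntegral.integral_const_mul, integral_swap (G := fun x r => g (x + r) ^ 2)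
    hab hη.le hG] at e2
  have e3 := integral_le_const hη.le (continuousOn_inner (G := fun r x => g (x + r) ^ 2) hab
    (ContinuousOn.swap_rect (G := fun x r => g (x + r) ^ 2) hG))
    (C := ∫ x in a..(b + η), g x ^ 2) fun r hr => by
      rw [intervalIntegral.integral_comp_add_right (fun x => g x ^ 2)]
      exact integral_mono_interval (by linarith [hr.1]) (by linarith)
        (by linarith [hr.2]) (ae_of_all _ fun x => sq_nonneg _)
        (intervalIntegrable_of_cont (by linarith) (hg.pow 2))
  have e4 := mul_le_mul_of_nonneg_left e3 hη.le
  refine (e2.trans e4).trans (le_of_eq ?_)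
  ring

/-- A continuous cut-off of the identity's derivative. -/
noncomputable def ramp (ρ y : ℝ) : ℝ := min 1 (max 0 (|y| / ρ - 1))

lemma continuous_ramp (ρ : ℝ) : Continuous (ramp ρ) := by
  unfold ramp
  fun_prop

lemma ramp_nonneg (ρ y : ℝ) : 0 ≤ ramp ρ y := le_min zero_le_one (le_max_left _ _)

lemma ramp_le_one (ρ y : ℝ) : ramp ρ y ≤ 1 := min_le_left _ _

lemma ramp_eq_zero {ρ y : ℝ} (hρ : 0 < ρ) (hy : |y| ≤ ρ) : ramp ρ y = 0 := by
  have : |y| / ρ - 1 ≤ 0 := by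
    rw [sub_nonpos, div_le_one hρ]
    exact hy
  rw [ramp, max_eq_left this, min_eq_right zero_le_one]

lemma ramp_eq_one {ρ y : ℝ} (hρ : 0 < ρ) (hy : 2 * ρ ≤ |y|) : ramp ρ y = 1 := by
  have : 1 ≤ |y| / ρ - 1 := by
    rw [le_sub_iff_add_le, le_div_iff₀ hρ]
    linarith
  rw [ramp, max_eq_right (by linarith), min_eq_left this]

lemma abs_sub_pri_ramp_le {ρ : ℝ} (hρ : 0 < ρ) (y : ℝ) : |y - pri (ramp ρ) y| ≤ 2 * ρ := by
  have hr := continuous_ramp ρ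
  have hB : Continuous fun s => 1 - ramp ρ s := by fun_prop
  have h1 : ∀ y, y - pri (ramp ρ) y = pri (fun s => 1 - ramp ρ s) y := fun y => by
    rw [pri, pri, intervalIntegral.integral_sub intervalIntegrable_const (hr.intervalIntegrable _ _)]
    simp
  have h2 : ∀ y, |y| ≤ 2 * ρ → |pri (fun s => 1 - ramp ρ s) y| ≤ 2 * ρ := fun y hy => by
    refine (abs_pri_le (C := 1) fun s _ => ?_).trans (by linarith)
    rw [abs_of_nonneg (by linarith [ramp_le_one ρ s])]
    linarith [ramp_nonneg ρ s]
  rw [h1]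
  rcases le_or_gt (|y|) (2 * ρ) with hy | hy
  · exact h2 y hy
  rcases le_total 0 y with h0 | h0
  · rw [abs_of_nonneg h0] at hy
    have := pri_sub hB y (2 * ρ)
    rw [intervalIntegral.integral_zero_ae (ae_of_all _ fun x hx => ?_), sub_eq_zero] at this
    · rw [this]
      exact h2 _ (by rw [abs_of_pos (by positivity)])
    · rw [uIoc_of_le hy.le] at hx
      rw [ramp_eq_one hρ (hx.1.le.trans (le_abs_self x)), sub_self]
  · rw [abs_of_nonpos h0] at hy
    have := pri_sub hB y (-(2 * ρ))
    rw [intervalIntegral.integral_zero_ae (ae_of_all _ fun x hx => ?_), sub_eq_zero] at this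
    · rw [this]
      exact h2 _ (by rw [abs_neg, abs_of_pos (by positivity)])
    · rw [uIoc_of_ge (by linarith)] at hx
      rw [ramp_eq_one hρ (by linarith [neg_abs_le x, hx.2]), sub_self]

lemma abs_pri_ramp_sub_le {ρ : ℝ} (x y : ℝ) :
    |pri (ramp ρ) x - pri (ramp ρ) y| ≤ |x - y| := by
  rw [pri_sub (continuous_ramp ρ)]
  have := intervalIntegral.norm_integral_le_of_norm_le_const (a := y) (b := x) (f := ramp ρ)
    (C := 1) fun s _ => by
      rw [norm_eq_abs, abs_of_nonneg (ramp_nonneg ρ s)]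
      exact ramp_le_one ρ s
  simpa using this

end

namespace Cut

variable {α T l M κ : ℝ} {p q h f : ℝ → ℝ} {u c : ℝ → ℝ → ℝ}

lemma integral_sq_diff_u_le (H : Cut α T l M p q h f u c) {F η p0 a b : ℝ}
    (hF : ∀ t ∈ Icc 0 T, ∀ x ∈ Icc 0 l, |f t * h x| ≤ F) (hp0 : 0 ≤ p0)
    (hp : ∀ x ∈ Icc 0 l, p0 ≤ p x) (hη : 0 < η) (ha : 0 < a) (hab : a ≤ b) (hb : b + η < l) :
    p0 * ∫ t in (0:ℝ)..T, ∫ x in a..b, (u t (x + η) - u t x) ^ 2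
      ≤ η ^ 2 * ((M * F * T + 4 * M ^ 2 * kint α T) * l) := by
  set E := (M * F * T + 4 * M ^ 2 * kint α T) * l with hE
  have hu := H.hu
  have hM := H.M_nonneg
  have huc : Continuous fun t => ∫ x in a..b, (u t (x + η) - u t x) ^ 2 := by
    refine intervalIntegral.continuous_parametric_intervalIntegral_of_continuous' ?_ _ _
    simp only [Function.uncurry_def]
    fun_prop
  have key : ∀ ε ∈ Ioc 0 T, ∀ ρ > 0, p0 * ∫ t in ε..T, ∫ x in a..b, (u t (x + η) - u t x) ^ 2
      ≤ η ^ 2 * E + ρ * (p0 * (16 * M * (b - a) * (T - ε))) := by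
    intro ε hε ρ hρ
    have hr := continuous_ramp ρ
    have hγ := continuous_pri hr
    have hts : Icc ε T ⊆ Ioc 0 T := fun t ht => ⟨hε.1.trans_le ht.1, ht.2⟩
    have hxs : Icc a (b + η) ⊆ Ioo 0 l := fun x hx => ⟨ha.trans_le hx.1, hx.2.trans_lt hb⟩
    have hdu := H.continuousOn_deriv_u.mono (prod_mono hts hxs)
    have hpc := H.coef.pc
    have hG : ContinuousOn (fun z : ℝ × ℝ =>
        (fun t x => p x * (ramp ρ (u t x) ^ 2 * deriv (u t) x ^ 2)) z.1 z.2)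
        (Icc ε T ×ˢ Icc a (b + η)) := by fun_prop
    have slice : ∀ t ∈ Icc ε T, p0 * (∫ x in a..b, (u t (x + η) - u t x) ^ 2)
        ≤ η ^ 2 * (∫ x in a..(b + η), p x * (ramp ρ (u t x) ^ 2 * deriv (u t) x ^ 2))
          + ρ * (p0 * (16 * M * (b - a))) := by
      intro t ht
      have hdt : ContinuousOn (deriv (u t)) (Icc a (b + η)) :=
        hdu.comp (f := fun x : ℝ => (t, x)) (by fun_prop) fun x hx => ⟨ht, hx⟩
      have h1 := integral_sq_diff_le hab hη (V := fun x => pri (ramp ρ) (u t x))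
        (g := fun x => ramp ρ (u t x) * deriv (u t) x) (fun x hx =>
          (hasDerivAt_pri hr _).comp x ((H.ell t (hts ht)).hasDerivAt (hxs hx))) (by fun_prop)
      have h2 : ∫ x in a..b, (u t (x + η) - u t x) ^ 2
          ≤ (∫ x in a..b, (pri (ramp ρ) (u t (x + η)) - pri (ramp ρ) (u t x)) ^ 2)
            + ρ * (16 * M * (b - a)) := by
        have : ρ * (16 * M * (b - a)) = ∫ x in a..b, ρ * (16 * M) := by
          rw [intervalIntegral.integral_const, smul_eq_mul]
          ring
        rw [this, ← intervalIntegral.integral_add intervalIntegrable_cont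
          intervalIntegrable_const]
        refine integral_mono_on hab intervalIntegrable_cont intervalIntegrable_cont fun x _ => ?_
        set A := u t (x + η) with hA
        set B := u t x with hB
        have a1 := abs_sub_pri_ramp_le hρ A
        have a2 := abs_sub_pri_ramp_le hρ B
        have a3 := abs_pri_ramp_sub_le (ρ := ρ) A B
        have a4 : |A - B| ≤ 2 * M := (abs_sub _ _).trans (by linarith [H.bd t (x + η), H.bd t x])
        have a5 : |(A - pri (ramp ρ) A) - (B - pri (ramp ρ) B)| ≤ 4 * ρ :=
          (abs_sub _ _).trans (by linarith)
        have a6 : |(A - B) + (pri (ramp ρ) A - pri (ramp ρ) B)| ≤ 4 * M :=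
          (abs_add_le _ _).trans (by linarith)
        have a7 := mul_le_mul a5 a6 (abs_nonneg _) (by positivity)
        rw [← abs_mul] at a7
        have a8 := (le_abs_self _).trans a7
        nlinarith
      have h3 : p0 * ∫ x in a..(b + η), (ramp ρ (u t x) * deriv (u t) x) ^ 2
          ≤ ∫ x in a..(b + η), p x * (ramp ρ (u t x) ^ 2 * deriv (u t) x ^ 2) := by
        rw [← intervalIntegral.integral_const_mul]
        refine integral_mono_on (by linarith)
          (intervalIntegrable_of_cont (by linarith) (by fun_prop))
          (intervalIntegrable_of_cont (by linarith) (by fun_prop)) fun x hx => ?_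
        rw [← mul_pow]
        exact mul_le_mul_of_nonneg_right (hp x (Ioo_subset_Icc_self (hxs hx))) (sq_nonneg _)
      have h4 := mul_le_mul_of_nonneg_left h2 hp0
      have h5 := mul_le_mul_of_nonneg_left h1 hp0
      have h6 := mul_le_mul_of_nonneg_left h3 (sq_nonneg η)
      linarith
    have h1 := integral_mono_on hε.2
      intervalIntegrable_cont
      (((intervalIntegrable_of_cont hε.2 (continuousOn_inner
      (G := fun t x => p x * (ramp ρ (u t x) ^ 2 * deriv (u t) x ^ 2)) (by linarith) hG)).const_mul
        _).add (intervalIntegrable_const (c := ρ * (p0 * (16 * M * (b - a)))))) slice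
    rw [intervalIntegral.integral_add ((intervalIntegrable_of_cont hε.2 (continuousOn_inner
      (G := fun t x => p x * (ramp ρ (u t x) ^ 2 * deriv (u t) x ^ 2)) (by linarith) hG)).const_mul
        _) intervalIntegrable_const, intervalIntegral.integral_const_mul,
      intervalIntegral.integral_const_mul, intervalIntegral.integral_const, smul_eq_mul] at h1
    have h2 := H.energy hF (B := fun y => ramp ρ y ^ 2) (by fun_prop) (fun y => sq_nonneg _)
      (fun y => pow_le_one₀ (ramp_nonneg ρ y) (ramp_le_one ρ y)) hρ
      (fun y hy => by simp [ramp_eq_zero hρ hy]) hε.1 hε.2 ha (b := b + η) (by linarith) hb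
    have h3 := mul_le_mul_of_nonneg_left h2 (sq_nonneg η)
    linarith
  have key2 : ∀ ε ∈ Ioc 0 T, p0 * ∫ t in ε..T, ∫ x in a..b, (u t (x + η) - u t x) ^ 2
      ≤ η ^ 2 * E := by
    intro ε hε
    have : Tendsto (fun ρ => η ^ 2 * E + ρ * (p0 * (16 * M * (b - a) * (T - ε)))) (𝓝[>] 0)
        (𝓝 (η ^ 2 * E)) := by
      have : Continuous fun ρ : ℝ => η ^ 2 * E + ρ * (p0 * (16 * M * (b - a) * (T - ε))) := by
        fun_prop
      have := this.tendsto 0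
      simp only [zero_mul, add_zero] at this
      exact this.mono_left nhdsWithin_le_nhds
    refine ge_of_tendsto this ?_
    filter_upwards [self_mem_nhdsWithin] with ρ hρ
    exact key ε hε ρ hρ
  have hlim : Tendsto (fun ε => p0 * ∫ t in ε..T, ∫ x in a..b, (u t (x + η) - u t x) ^ 2) (𝓝[>] 0)
      (𝓝 (p0 * ∫ t in (0:ℝ)..T, ∫ x in a..b, (u t (x + η) - u t x) ^ 2)) := by
    have : Continuous fun ε => ∫ t in ε..T, ∫ x in a..b, (u t (x + η) - u t x) ^ 2 := by
      simp only [integral_symm T]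
      exact (intervalIntegral.continuous_primitive (fun _ _ => huc.intervalIntegrable _ _) T).neg
    exact (((this.const_mul p0).tendsto 0).mono_left nhdsWithin_le_nhds)
  refine le_of_tendsto hlim ?_
  filter_upwards [Ioc_mem_nhdsGT H.hT] with ε hε
  exact key2 ε hε

end Cut

lemma continuous_eav (κ : ℝ) {V : ℝ → ℝ → ℝ} (hV : Continuous fun z : ℝ × ℝ => V z.1 z.2) :
    Continuous fun z : ℝ × ℝ => eav κ V z.1 z.2 := by
  have h1 : Continuous fun z : ℝ × ℝ => ∫ s in (0:ℝ)..z.1, exp (κ * s) * V s z.2 := by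
    refine intervalIntegral.continuous_parametric_intervalIntegral_of_continuous
      (f := fun (z : ℝ × ℝ) s => exp (κ * s) * V s z.2) ?_ continuous_fst
    simp only [Function.uncurry_def]
    fun_prop
  have : (fun z : ℝ × ℝ => eav κ V z.1 z.2) = fun z : ℝ × ℝ => κ * exp (-κ * z.1) *
      ∫ s in (0:ℝ)..z.1, exp (κ * s) * V s z.2 := by
    funext z
    rw [eav_eq, ← intervalIntegral.integral_const_mul]
    congr 1
    funext s
    rw [expo, show -κ * (z.1 - s) = -κ * z.1 + κ * s by ring, Real.exp_add]
    ring
  rw [this]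
  fun_prop

lemma continuous_inner {a b : ℝ} {G : ℝ → ℝ → ℝ} (hG : Continuous fun z : ℝ × ℝ => G z.1 z.2) :
    Continuous fun t => ∫ x in a..b, G t x :=
  intervalIntegral.continuous_parametric_intervalIntegral_of_continuous'
    (by simpa only [Function.uncurry_def]) _ _

lemma integral_cv_expo_le {κ T : ℝ} (hκ : 0 ≤ κ) (hT : 0 ≤ T) {e : ℝ → ℝ} (he : Continuous e)
    (he0 : ∀ t, 0 ≤ e t) :
    ∫ t in (0:ℝ)..T, cv (expo κ) e t ≤ ∫ t in (0:ℝ)..T, e t := by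
  have hE := continuous_expo κ
  rw [(kc_expo κ).integral_cv (KC.of_cont he) hT, cv]
  have hint : Continuous fun t => ∫ s in (0:ℝ)..t, e s :=
    intervalIntegral.continuous_primitive (fun _ _ => he.intervalIntegrable _ _) 0
  have h1 : ∫ s in (0:ℝ)..T, expo κ s * ∫ r in (0:ℝ)..(T - s), e r
      ≤ ∫ s in (0:ℝ)..T, expo κ s * ∫ r in (0:ℝ)..T, e r := by
    refine integral_mono_on hT intervalIntegrable_cont
      intervalIntegrable_cont fun s hs => ?_
    refine mul_le_mul_of_nonneg_left ?_ (expo_nonneg hκ s)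
    exact integral_mono_interval le_rfl (by linarith [hs.2]) (by linarith [hs.1])
      (ae_of_all _ he0) (he.intervalIntegrable _ _)
  refine h1.trans ?_
  rw [intervalIntegral.integral_mul_const, integral_expo]
  have h2 : 0 ≤ ∫ r in (0:ℝ)..T, e r := intervalIntegral.integral_nonneg hT fun x _ => he0 x
  nlinarith [exp_pos (-κ * T)]

namespace Cut

variable {α T l M κ : ℝ} {p q h f : ℝ → ℝ} {u c : ℝ → ℝ → ℝ}

lemma integral_sq_diff_eav_le (hu : Continuous fun z : ℝ × ℝ => u z.1 z.2) (hκ : 0 ≤ κ)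
    (hT : 0 ≤ T) {a b η : ℝ} (hab : a ≤ b) :
    ∫ t in (0:ℝ)..T, ∫ x in a..b, (eav κ u t (x + η) - eav κ u t x) ^ 2
      ≤ ∫ t in (0:ℝ)..T, ∫ x in a..b, (u t (x + η) - u t x) ^ 2 := by
  have hv := continuous_eav κ hu
  have hE := continuous_expo κ
  have hec : Continuous fun t => ∫ x in a..b, (u t (x + η) - u t x) ^ 2 :=
    continuous_inner (G := fun t x => (u t (x + η) - u t x) ^ 2) (by fun_prop)
  refine le_trans ?_ (integral_cv_expo_le hκ hT hec fun t =>
    intervalIntegral.integral_nonneg hab fun _ _ => sq_nonneg _)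
  refine integral_mono_on hT
    ((continuous_inner (G := fun t x => (eav κ u t (x + η) - eav κ u t x) ^ 2)
      (by fun_prop)).intervalIntegrable _ _)
    ((continuous_cv_expo hec).intervalIntegrable _ _) fun t ht => ?_
  have h1 : ∀ x, (eav κ u t (x + η) - eav κ u t x) ^ 2
      ≤ ∫ s in (0:ℝ)..t, expo κ (t - s) * (u s (x + η) - u s x) ^ 2 := by
    intro x
    rw [eav_eq, eav_eq, ← intervalIntegral.integral_sub
      intervalIntegrable_cont
      intervalIntegrable_cont]
    simp only [← mul_sub]
    refine (sq_integral_le ht.1 (by fun_prop) (fun s _ => expo_nonneg hκ _) one_pos ?_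
      (by fun_prop)).trans (le_of_eq (one_mul _))
    rw [integral_comp_sub_left (fun s => expo κ s)]
    simp only [sub_self, sub_zero]
    rw [integral_expo]
    linarith [exp_pos (-κ * t)]
  have h2 := integral_mono_on hab
    (Continuous.intervalIntegrable (μ := volume) (by fun_prop) _ _)
    ((continuous_inner (G := fun x s => expo κ (t - s) * (u s (x + η) - u s x) ^ 2)
      (by fun_prop)).intervalIntegrable _ _) fun x _ => h1 x
  refine h2.trans (le_of_eq ?_)
  rw [integral_swap (G := fun x s => expo κ (t - s) * (u s (x + η) - u s x) ^ 2) hab ht.1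
    (Continuous.continuousOn (by fun_prop)), cv_comm, cv]
  congr 1
  funext s
  rw [intervalIntegral.integral_const_mul, mul_comm]

lemma integral_sq_deriv_eav_le (H : Cut α T l M p q h f u c) {F p0 ε a b : ℝ}
    (hF : ∀ t ∈ Icc 0 T, ∀ x ∈ Icc 0 l, |f t * h x| ≤ F) (hp0 : 0 ≤ p0)
    (hp : ∀ x ∈ Icc 0 l, p0 ≤ p x) (hκ : 0 ≤ κ) (hε : 0 < ε) (hεT : ε ≤ T)
    (ha : 0 < a) (hab : a ≤ b) (hb : b < l) :
    p0 * ∫ t in ε..T, ∫ x in a..b, deriv (eav κ u t) x ^ 2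
      ≤ (M * F * T + 4 * M ^ 2 * kint α T) * l := by
  set E := (M * F * T + 4 * M ^ 2 * kint α T) * l with hE
  obtain ⟨b', hb1, hb2⟩ := exists_between hb
  have hts : Icc ε T ⊆ Ioc 0 T := fun t ht => ⟨hε.trans_le ht.1, ht.2⟩
  have hxs : Icc a b' ⊆ Ioo 0 l := fun x hx => ⟨ha.trans_le hx.1, hx.2.trans_lt hb2⟩
  have hd := (H.continuousOn_deriv_eav (κ := κ)).mono (prod_mono hts hxs)
  obtain ⟨K, hK⟩ := (isCompact_Icc.prod isCompact_Icc).exists_bound_of_continuousOn hd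
  have hv := continuous_eav κ H.hu
  have hder : ∀ t ∈ Icc ε T, ∀ x ∈ Icc a b',
      HasDerivAt (eav κ u t) (deriv (eav κ u t) x) x :=
    fun t ht x hx => (H.ell_eav (hts ht)).hasDerivAt (hxs hx)
  set D : ℝ → ℝ → ℝ → ℝ := fun η t x => ((eav κ u t (x + η) - eav κ u t x) / η) ^ 2 with hD
  have hDc : ∀ η, Continuous fun z : ℝ × ℝ => D η z.1 z.2 := fun η => by
    simp only [hD]
    fun_prop
  have hDK : ∀ η ∈ Ioc 0 (b' - b), ∀ t ∈ Icc ε T, ∀ x ∈ Icc a b, D η t x ≤ K ^ 2 := by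
    intro η hη t ht x hx
    have hsub : Icc x (x + η) ⊆ Icc a b' :=
      Icc_subset_Icc hx.1 (by linarith [hx.2, hη.2])
    have := Convex.norm_image_sub_le_of_norm_deriv_le (f := eav κ u t) (s := Icc x (x + η))
      (C := K) (x := x) (y := x + η) (fun y hy => (hder t ht y (hsub hy)).differentiableAt)
      (fun y hy => hK (t, y) ⟨ht, hsub hy⟩) (convex_Icc _ _) ⟨le_rfl, by linarith [hη.1]⟩
      ⟨by linarith [hη.1], le_rfl⟩
    rw [add_sub_cancel_left, norm_eq_abs, norm_eq_abs, abs_of_pos hη.1] at this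
    simp only [hD]
    rw [← sq_abs]
    refine pow_le_pow_left₀ (abs_nonneg _) ?_ 2
    rw [abs_div, abs_of_pos hη.1, div_le_iff₀ hη.1]
    exact this
  have hη : ∀ᶠ η in 𝓝[>] (0:ℝ), η ∈ Ioc 0 (b' - b) := Ioc_mem_nhdsGT (by linarith)
  have hbd : ∀ η ∈ Ioc 0 (b' - b), p0 * ∫ t in ε..T, ∫ x in a..b, D η t x ≤ E := by
    intro η hη
    have h1 := H.integral_sq_diff_u_le hF hp0 hp hη.1 ha hab (by linarith [hη.2])
    have h2 := integral_sq_diff_eav_le H.hu hκ H.hT.le hab (η := η)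
    have h3 : ∫ t in ε..T, ∫ x in a..b, D η t x
        ≤ ∫ t in (0:ℝ)..T, ∫ x in a..b, D η t x :=
      integral_mono_interval hε.le hεT le_rfl (ae_of_all _ fun t =>
        intervalIntegral.integral_nonneg hab fun _ _ => sq_nonneg _)
        ((continuous_inner (hDc η)).intervalIntegrable _ _)
    have h4 : ∫ t in (0:ℝ)..T, ∫ x in a..b, D η t x
        = (∫ t in (0:ℝ)..T, ∫ x in a..b, (eav κ u t (x + η) - eav κ u t x) ^ 2) / η ^ 2 := by
      simp only [hD, div_pow, intervalIntegral.integral_div]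
    rw [h4] at h3
    have hη2 : 0 < η ^ 2 := by have := hη.1; positivity
    have h5 := mul_le_mul_of_nonneg_left (h3.trans (div_le_div_of_nonneg_right h2 hη2.le)) hp0
    refine h5.trans ?_
    rw [← mul_div_assoc, div_le_iff₀ hη2]
    linarith
  have hlim : Tendsto (fun η => ∫ t in ε..T, ∫ x in a..b, D η t x) (𝓝[>] 0)
      (𝓝 (∫ t in ε..T, ∫ x in a..b, deriv (eav κ u t) x ^ 2)) := by
    refine intervalIntegral.tendsto_integral_filter_of_dominated_convergence
      (fun _ => K ^ 2 * (b - a)) (Eventually.of_forall fun η =>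
        (continuous_inner (hDc η)).aestronglyMeasurable) ?_ intervalIntegrable_const ?_
    · filter_upwards [hη] with η hη
      refine ae_of_all _ fun t ht => ?_
      rw [uIoc_of_le hεT] at ht
      rw [norm_eq_abs, abs_of_nonneg (intervalIntegral.integral_nonneg hab
        fun _ _ => sq_nonneg _)]
      exact integral_le_const hab (by have := hDc η; fun_prop)
        fun x hx => hDK η hη t (Ioc_subset_Icc_self ht) x hx
    · refine ae_of_all _ fun t ht => ?_
      rw [uIoc_of_le hεT] at ht
      have ht' := Ioc_subset_Icc_self ht
      refine intervalIntegral.tendsto_integral_filter_of_dominated_convergence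
        (fun _ => K ^ 2) (Eventually.of_forall fun η =>
          (by have := hDc η; fun_prop : Continuous (D η t)).aestronglyMeasurable) ?_
          intervalIntegrable_const ?_
      · filter_upwards [hη] with η hη
        refine ae_of_all _ fun x hx => ?_
        rw [uIoc_of_le hab] at hx
        rw [norm_eq_abs, abs_of_nonneg (sq_nonneg _)]
        exact hDK η hη t ht' x (Ioc_subset_Icc_self hx)
      · refine ae_of_all _ fun x hx => ?_
        rw [uIoc_of_le hab] at hx
        have := (hder t ht' x ⟨hx.1.le, hx.2.trans hb1.le⟩).tendsto_slope_zero_right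
        refine (this.pow 2).congr fun η => ?_
        simp only [hD, smul_eq_mul]
        rw [div_eq_inv_mul]
  refine le_of_tendsto (hlim.const_mul p0) ?_
  filter_upwards [hη] with η hη
  exact hbd η hη

end Cut

/-- The pair of tents at `-2` and `2`. -/
noncomputable def tent (y : ℝ) : ℝ := max 0 (1 - |(|y| - 2)|)

lemma continuous_tent : Continuous tent := by
  unfold tent
  fun_prop

lemma tent_nonneg (y : ℝ) : 0 ≤ tent y := le_max_left _ _

lemma tent_le_one (y : ℝ) : tent y ≤ 1 := max_le zero_le_one (by linarith [abs_nonneg (|y| - 2)])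

lemma tent_neg (y : ℝ) : tent (-y) = tent y := by rw [tent, abs_neg, tent]

lemma tent_of_le_one {y : ℝ} (hy : |y| ≤ 1) : tent y = 0 := by
  rw [tent, max_eq_left]
  rw [abs_of_nonpos (by linarith)]
  linarith

lemma tent_of_mem_left {y : ℝ} (hy : y ∈ Icc (1:ℝ) 2) : tent y = y - 1 := by
  rw [tent, abs_of_nonneg (show 0 ≤ y by linarith [hy.1]),
    abs_of_nonpos (show y - 2 ≤ 0 by linarith [hy.2]), max_eq_right] <;> linarith [hy.1]

lemma tent_of_mem_right {y : ℝ} (hy : y ∈ Icc (2:ℝ) 3) : tent y = 3 - y := by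
  rw [tent, abs_of_nonneg (show 0 ≤ y by linarith [hy.1]),
    abs_of_nonneg (show 0 ≤ y - 2 by linarith [hy.1]), max_eq_right] <;> linarith [hy.2]

lemma tent_of_three_le {y : ℝ} (hy : 3 ≤ y) : tent y = 0 := by
  rw [tent, max_eq_left]
  rw [abs_of_nonneg (show 0 ≤ y by linarith), abs_of_nonneg (by linarith)]
  linarith

lemma pri_neg_of_even {B : ℝ → ℝ} (hB : ∀ y, B (-y) = B y) (y : ℝ) : pri B (-y) = -pri B y := by
  have := intervalIntegral.integral_comp_neg (a := 0) (b := y) B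
  simp only [hB, neg_zero] at this
  rw [pri, pri, this, integral_symm]

lemma pri_neg_of_odd {B : ℝ → ℝ} (hB : ∀ y, B (-y) = -B y) (y : ℝ) : pri B (-y) = pri B y := by
  have := intervalIntegral.integral_comp_neg (a := 0) (b := y) B
  simp only [hB, neg_zero, intervalIntegral.integral_neg] at this
  rw [pri, pri, integral_symm, ← this, neg_neg]

lemma pri_tent_of_three_le {y : ℝ} (hy : 3 ≤ y) : pri tent y = 1 := by
  have hi : ∀ a b, IntervalIntegrable tent volume a b := continuous_tent.intervalIntegrable
  have e0 : ∫ s in (0:ℝ)..1, tent s = 0 := by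
    refine intervalIntegral.integral_zero_ae (ae_of_all _ fun s hs => tent_of_le_one ?_)
    rw [uIoc_of_le zero_le_one] at hs
    rw [abs_of_pos hs.1]
    exact hs.2
  have e1 : ∫ s in (1:ℝ)..2, tent s = 1 / 2 := by
    rw [integral_congr (g := fun s => s - 1) fun s hs => tent_of_mem_left
      (by rwa [uIcc_of_le (by norm_num)] at hs),
      intervalIntegral.integral_sub intervalIntegral.intervalIntegrable_id intervalIntegrable_const]
    simp
    norm_num
  have e2 : ∫ s in (2:ℝ)..3, tent s = 1 / 2 := by
    rw [integral_congr (g := fun s => 3 - s) fun s hs => tent_of_mem_right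
      (by rwa [uIcc_of_le (by norm_num)] at hs),
      intervalIntegral.integral_sub intervalIntegrable_const intervalIntegral.intervalIntegrable_id]
    simp
    norm_num
  have e3 : ∫ s in (3:ℝ)..y, tent s = 0 := by
    refine intervalIntegral.integral_zero_ae (ae_of_all _ fun s hs => tent_of_three_le ?_)
    rw [uIoc_of_le hy] at hs
    exact hs.1.le
  rw [pri, ← integral_add_adjacent_intervals (hi 0 1) (hi 1 y),
    ← integral_add_adjacent_intervals (hi 1 2) (hi 2 y),
    ← integral_add_adjacent_intervals (hi 2 3) (hi 3 y), e0, e1, e2, e3]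
  norm_num

/-- A smooth truncated sign function. -/
noncomputable def sgn (y : ℝ) : ℝ := pri tent y

/-- A smooth convex approximation of the absolute value. -/
noncomputable def soft (y : ℝ) : ℝ := pri sgn y

lemma continuous_sgn : Continuous sgn := continuous_pri continuous_tent

lemma continuous_soft : Continuous soft := continuous_pri continuous_sgn

lemma hasDerivAt_sgn (y : ℝ) : HasDerivAt sgn (tent y) y := hasDerivAt_pri continuous_tent y

lemma hasDerivAt_soft (y : ℝ) : HasDerivAt soft (sgn y) y := hasDerivAt_pri continuous_sgn y

lemma monotone_sgn : Monotone sgn := monotone_pri continuous_tent tent_nonneg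

lemma sgn_neg (y : ℝ) : sgn (-y) = -sgn y := pri_neg_of_even tent_neg y

lemma soft_neg (y : ℝ) : soft (-y) = soft y := pri_neg_of_odd sgn_neg y

lemma sgn_nonneg {y : ℝ} (hy : 0 ≤ y) : 0 ≤ sgn y := by
  have := monotone_sgn hy
  rwa [sgn, pri_zero] at this

lemma soft_abs (y : ℝ) : soft |y| = soft y := by
  rcases abs_choice y with h | h <;> rw [h]
  exact soft_neg y

lemma abs_sgn_le_one (y : ℝ) : |sgn y| ≤ 1 := by
  have key : ∀ y, 0 ≤ y → |sgn y| ≤ 1 := fun y hy => by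
    rw [abs_of_nonneg (sgn_nonneg hy)]
    exact (monotone_sgn (le_max_left y 3)).trans (pri_tent_of_three_le (le_max_right _ _)).le
  rcases le_total 0 y with hy | hy
  · exact key y hy
  · rw [← abs_neg, ← sgn_neg]
    exact key _ (by linarith)

lemma soft_le_abs (y : ℝ) : soft y ≤ |y| :=
  (le_abs_self _).trans ((abs_pri_le (C := 1) fun s _ => abs_sgn_le_one s).trans_eq (one_mul _))

lemma soft_nonneg (y : ℝ) : 0 ≤ soft y := by
  rw [← soft_abs]
  exact intervalIntegral.integral_nonneg (abs_nonneg _) fun s hs => sgn_nonneg hs.1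

lemma abs_sub_three_le_soft (y : ℝ) : |y| - 3 ≤ soft y := by
  rcases le_total |y| 3 with h | h
  · linarith [soft_nonneg y]
  · have h1 := pri_sub continuous_sgn |y| 3
    rw [integral_congr (f := sgn) (g := fun _ => 1) fun s hs => pri_tent_of_three_le
      (by rw [uIcc_of_le h] at hs; exact hs.1)] at h1
    have h2 : pri sgn |y| = soft y := soft_abs y
    have h3 : 0 ≤ pri sgn 3 := soft_nonneg 3
    simp at h1
    linarith

lemma sgn_of_abs_le_one {y : ℝ} (hy : |y| ≤ 1) : sgn y = 0 :=
  pri_eq_zero (fun _ hs => tent_of_le_one hs) hy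

lemma soft_of_abs_le_one {y : ℝ} (hy : |y| ≤ 1) : soft y = 0 :=
  pri_eq_zero (fun _ hs => sgn_of_abs_le_one hs) hy

lemma sgn_mul_nonneg (y : ℝ) : 0 ≤ sgn y * y := pri_mul_nonneg continuous_tent tent_nonneg y

/-- The positive supersolution used as a weight. -/
noncomputable def psi (l : ℝ) (p : ℝ → ℝ) (x : ℝ) : ℝ := ∫ s in (0:ℝ)..x, (l - s) / p s

lemma hasDerivAt_psi {p q : ℝ → ℝ} (hc : Coef p q) (l x : ℝ) :
    HasDerivAt (psi l p) ((l - x) / p x) x := by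
  have hp := hc.pc
  have : Continuous fun s => (l - s) / p s :=
    Continuous.div (by fun_prop) hp fun s => (hc.p0 s).ne'
  exact integral_hasDerivAt_right (this.intervalIntegrable _ _)
    (this.stronglyMeasurableAtFilter _ _) this.continuousAt

lemma continuous_psi {p q : ℝ → ℝ} (hc : Coef p q) (l : ℝ) : Continuous (psi l p) :=
  continuous_iff_continuousAt.2 fun x => (hasDerivAt_psi hc l x).continuousAt

lemma psi_nonneg {p q : ℝ → ℝ} (hc : Coef p q) {l x : ℝ} (hx : x ∈ Icc 0 l) : 0 ≤ psi l p x :=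
  intervalIntegral.integral_nonneg hx.1 fun s hs =>
    div_nonneg (by linarith [hs.2, hx.2]) (hc.p0 s).le

lemma test_step_pointwise {S Z e ex R ψ Ψ px P qx Q hx0 N a b Zx α M l x : ℝ} (s1 : |S| ≤ 1)
    (s2 : 0 ≤ S * Z) (s3 : |e| ≤ M) (s4 : 0 ≤ R) (s5 : R ≤ 1) (s6 : 0 ≤ ψ) (s7 : ψ ≤ Ψ)
    (hp : 0 < px) (s8 : px ≤ P) (hq : 0 ≤ qx) (s9 : qx ≤ Q) (s10 : |hx0| ≤ N) (hα : 0 < α)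
    (hα1 : α < 1) (hx : x ∈ Icc 0 l) :
    ψ * (S * b) + soft Z + (ψ * S * (hx0 * a - b) - (qx * (ψ * S * (Z + α * e))
        + px * (Zx + α * ex) * ((l - x) / px * S + ψ * (R * Zx))))
      + ((l - x) * (S * Zx) - soft Z)
      ≤ (Ψ * N * |a| + (Q * Ψ * M + l)) + (P * Ψ + l) * ex ^ 2 := by
  have hΨ0 : 0 ≤ Ψ := s6.trans s7
  have hP0 : 0 ≤ P := hp.le.trans s8
  have hQ0 : 0 ≤ Q := hq.trans s9
  have hl : 0 ≤ l := hx.1.trans hx.2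
  have r1 : ψ * S * (hx0 * a) ≤ Ψ * N * |a| := by
    refine (le_abs_self _).trans ?_
    rw [abs_mul, abs_mul, abs_mul, abs_of_nonneg s6]
    have : ψ * |S| ≤ Ψ := (mul_le_of_le_one_right s6 s1).trans s7
    calc ψ * |S| * (|hx0| * |a|) ≤ Ψ * (N * |a|) :=
          mul_le_mul this (mul_le_mul_of_nonneg_right s10 (abs_nonneg a)) (by positivity) hΨ0
      _ = _ := by ring
  have r2 : -(qx * (ψ * S * (Z + α * e))) ≤ Q * Ψ * M := by
    have a1 : 0 ≤ qx * (ψ * (S * Z)) := by positivity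
    have a2 : -(qx * (ψ * (S * (α * e)))) ≤ Q * Ψ * M := by
      refine (neg_le_abs _).trans ?_
      rw [abs_mul, abs_mul, abs_mul, abs_mul, abs_of_nonneg s6, abs_of_nonneg hq,
        abs_of_nonneg hα.le]
      have b1 : α * |e| ≤ M := (mul_le_of_le_one_left (abs_nonneg _) hα1.le).trans s3
      have b2 : |S| * (α * |e|) ≤ 1 * M := mul_le_mul s1 b1 (by positivity) zero_le_one
      have b3 : ψ * (|S| * (α * |e|)) ≤ Ψ * (1 * M) := mul_le_mul s7 b2 (by positivity) hΨ0
      have b4 := mul_le_mul s9 b3 (by positivity) hQ0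
      linarith
    nlinarith
  have r3 : -(px * (Zx + α * ex) * ((l - x) / px * S + ψ * (R * Zx))) + (l - x) * (S * Zx)
      ≤ l + (P * Ψ + l) * ex ^ 2 := by
    have a1 : -(px * (Zx + α * ex) * ((l - x) / px * S + ψ * (R * Zx))) + (l - x) * (S * Zx)
        = -((l - x) * (α * ex * S)) - px * (ψ * (R * (Zx ^ 2 + α * ex * Zx))) := by
      field_simp
      ring
    have a2 : (α * ex) ^ 2 ≤ ex ^ 2 := by
      rw [mul_pow]
      exact mul_le_of_le_one_left (sq_nonneg _) (pow_le_one₀ hα.le hα1.le)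
    have a3 : -((l - x) * (α * ex * S)) ≤ l * (1 + ex ^ 2) := by
      refine (neg_le_abs _).trans ?_
      rw [abs_mul, abs_mul]
      have b1 : |α * ex| * |S| ≤ 1 + ex ^ 2 := by
        have := mul_le_of_le_one_right (abs_nonneg (α * ex)) s1
        have b3 := sq_abs (α * ex)
        nlinarith [sq_nonneg (|α * ex| - 1)]
      have b2 : |l - x| ≤ l := by rw [abs_of_nonneg] <;> linarith [hx.1, hx.2]
      exact mul_le_mul b2 b1 (by positivity) hl
    have a4 : -(px * (ψ * (R * (Zx ^ 2 + α * ex * Zx)))) ≤ P * Ψ * ex ^ 2 := by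
      have b1 : -(Zx ^ 2 + α * ex * Zx) ≤ ex ^ 2 := by
        nlinarith [sq_nonneg (2 * Zx + α * ex)]
      have b2 : px * ψ ≤ P * Ψ := mul_le_mul s8 s7 s6 hP0
      have b3 : px * ψ * R ≤ P * Ψ := by
        have : px * ψ * R ≤ px * ψ := mul_le_of_le_one_right (by positivity) s5
        linarith
      have b4 : px * ψ * R * -(Zx ^ 2 + α * ex * Zx) ≤ px * ψ * R * ex ^ 2 :=
        mul_le_mul_of_nonneg_left b1 (by positivity)
      have b5 := mul_le_mul_of_nonneg_right b3 (sq_nonneg ex)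
      linarith
    rw [a1]
    linarith
  linarith

namespace Cut

variable {α T l M κ : ℝ} {p q h f : ℝ → ℝ} {u c : ℝ → ℝ → ℝ}

lemma avg_slice (H : Cut α T l M p q h f u c) {t x : ℝ} (ht : 0 < t) (hx : x ∈ Ioo 0 l) :
    dif κ (src h f c) t x + α * eav κ (src h f c) t x
      = h x * avg κ α f t - avg κ α (fun s => c s x) t := by
  have hE := kc_expo κ
  have kf : KC f := KC.of_cont H.hf
  have kc := H.kc x hx
  have e1 : cv (expo κ) (fun s => src h f c s x) t
      = h x * cv (expo κ) f t - cv (expo κ) (fun s => c s x) t := by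
    rw [← cv_smul_right, ← cv_sub_right (hE.cvI (kf.smul (h x)) ht) (hE.cvI kc ht)]
    simp only [src, mul_comm]
  have e2 : cv (expo κ) (fun s => s * src h f c s x) t
      = h x * cv (expo κ) (fun s => s * f s) t - cv (expo κ) (fun s => s * c s x) t := by
    rw [← cv_smul_right, ← cv_sub_right (hE.cvI (kf.id_mul.smul (h x)) ht) (hE.cvI kc.id_mul ht)]
    refine cv_congr ht.le (fun _ _ => rfl) fun s _ => ?_
    rw [src]
    ring
  rw [dif, tdiff, eav, avg, avg, e1, e2, src]
  ring

lemma abs_eav_le (H : Cut α T l M p q h f u c) (hκ : 0 ≤ κ) {t : ℝ} (ht : 0 ≤ t) (x : ℝ) :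
    |eav κ u t x| ≤ M := by
  have h1 := abs_cv_le (f := expo κ) (g := fun s => u s x) ht ((kc_expo κ).int t)
    (fun s _ => H.bd s x)
  refine h1.trans (mul_le_of_le_one_left H.M_nonneg ?_)
  have : ∀ s, |expo κ s| = expo κ s := fun s => abs_of_nonneg (expo_nonneg hκ s)
  simp only [this]
  rw [← integral_of_le ht, integral_expo]
  linarith [exp_pos (-κ * t)]

lemma test_step (H : Cut α T l M p q h f u c) (hκ : 0 ≤ κ) {t x1 x2 Ψ P Q N : ℝ}
    (ht : t ∈ Ioc 0 T) (hx1 : 0 < x1) (h12 : x1 ≤ x2) (hx2 : x2 < l)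
    (hz1 : |dif κ u t x1| ≤ 1) (hz2 : |dif κ u t x2| ≤ 1)
    (hΨ : ∀ x ∈ Icc 0 l, psi l p x ≤ Ψ) (hP : ∀ x ∈ Icc 0 l, p x ≤ P) (hQ : ∀ x ∈ Icc 0 l, q x ≤ Q)
    (hN : ∀ x ∈ Icc 0 l, |h x| ≤ N) :
    (∫ x in x1..x2, psi l p x * (sgn (dif κ u t x) * avg κ α (fun s => c s x) t))
        + ∫ x in x1..x2, soft (dif κ u t x)
      ≤ Ψ * N * l * |avg κ α f t| + (Q * Ψ * M + l) * l
        + (P * Ψ + l) * ∫ x in x1..x2, deriv (eav κ u t) x ^ 2 := by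
  have hsub : Icc x1 x2 ⊆ Ioo 0 l := fun x hx => ⟨hx1.trans_le hx.1, hx.2.trans_lt hx2⟩
  have hsub' : Icc x1 x2 ⊆ Icc 0 l := hsub.trans Ioo_subset_Icc_self
  have hα := H.h0
  have hα1 := H.h1
  have hM := H.M_nonneg
  have hl := H.hl
  have hpc := H.coef.pc
  have hqc := H.coef.qc
  have hhc := H.hh
  have hψc := continuous_psi H.coef l
  have hβ := continuous_sgn
  have hj := continuous_soft
  have htent := continuous_tent
  have m0 : (0:ℝ) ∈ Icc 0 l := ⟨le_rfl, hl.le⟩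
  have hΨ0 : 0 ≤ Ψ := (psi_nonneg H.coef m0).trans (hΨ 0 m0)
  have hP0 : 0 ≤ P := (H.coef.p0 0).le.trans (hP 0 m0)
  have hQ0 : 0 ≤ Q := (H.coef.q0 0).trans (hQ 0 m0)
  have hN0 : 0 ≤ N := (abs_nonneg _).trans (hN 0 m0)
  have sl : ∀ {G : ℝ → ℝ → ℝ}, ContinuousOn (fun z : ℝ × ℝ => G z.1 z.2) (Ioc 0 T ×ˢ Ioo 0 l) →
      ContinuousOn (G t) (Ioo 0 l) := fun hG => Ell.continuousOn_left hG ht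
  have zc : ContinuousOn (dif κ u t) (Icc x1 x2) :=
    (sl (G := dif κ u) (continuousOn_dif H.hT.le H.prim_u)).mono hsub
  have ec : ContinuousOn (eav κ u t) (Icc x1 x2) := (sl (G := eav κ u) H.continuousOn_eav_u).mono hsub
  have zd : ContinuousOn (deriv (dif κ u t)) (Icc x1 x2) :=
    (sl (G := fun t x => deriv (dif κ u t) x) H.continuousOn_deriv_dif).mono hsub
  have ed : ContinuousOn (deriv (eav κ u t)) (Icc x1 x2) :=
    (sl (G := fun t x => deriv (eav κ u t) x) H.continuousOn_deriv_eav).mono hsub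
  have hE := (H.ell_dif (κ := κ) ht).add ((H.ell_eav (κ := κ) ht).smul α)
  have hzx := fun x (hx : x ∈ Icc x1 x2) => (H.ell_dif (κ := κ) ht).hasDerivAt (hsub hx)
  have hex := fun x (hx : x ∈ Icc x1 x2) => (H.ell_eav (κ := κ) ht).hasDerivAt (hsub hx)
  have hVx : ∀ x ∈ Icc x1 x2, deriv (fun x => dif κ u t x + α * eav κ u t x) x
      = deriv (dif κ u t) x + α * deriv (eav κ u t) x := fun x hx =>
    ((hzx x hx).add ((hex x hx).const_mul α)).deriv
  have sc : ContinuousOn (fun x => dif κ (src h f c) t x + α * eav κ (src h f c) t x)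
      (Ioo 0 l) :=
    (sl (G := dif κ (src h f c)) (continuousOn_dif H.hT.le H.prim_src)).add
      (continuousOn_const.mul (sl (G := eav κ (src h f c)) (H.prim_src.continuousOn_eav H.hT.le)))
  have ac : ContinuousOn (fun x => avg κ α (fun s => c s x) t) (Icc x1 x2) :=
    ((sl (G := dif κ c) (continuousOn_dif H.hT.le H.prim_c)).add (continuousOn_const.mul
      (sl (G := eav κ c) (H.prim_c.continuousOn_eav H.hT.le)))).mono hsub
  have hqc' : ∀ x ∈ Icc x1 x2, p x ≠ 0 := fun x _ => (H.coef.p0 x).ne'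
  have key := Ell.integral_test H.coef hE sc hx1 h12 hx2
    (w := fun x => psi l p x * sgn (dif κ u t x))
    (w' := fun x => (l - x) / p x * sgn (dif κ u t x)
      + psi l p x * (tent (dif κ u t x) * deriv (dif κ u t) x))
    (fun x hx => (hasDerivAt_psi H.coef l x).mul ((hasDerivAt_sgn _).comp x (hzx x hx)))
    (by fun_prop (disch := assumption)) ((zd.add (continuousOn_const.mul ed)).congr hVx)
    (by simp [sgn_of_abs_le_one hz1]) (by simp [sgn_of_abs_le_one hz2])
  have ibp : ∫ x in x1..x2, ((l - x) * (sgn (dif κ u t x) * deriv (dif κ u t) x)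
      - soft (dif κ u t x)) = 0 := by
    rw [integral_eq_sub_of_hasDerivAt
      (f := fun x => (l - x) * soft (dif κ u t x)) (fun x hx => ?_)
      (intervalIntegrable_of_cont h12 (by fun_prop))]
    · simp [soft_of_abs_le_one hz1, soft_of_abs_le_one hz2]
    · rw [uIcc_of_le h12] at hx
      refine (((hasDerivAt_id x).const_sub l).mul ((hasDerivAt_soft _).comp x
        (hzx x hx))).congr_deriv ?_
      simp
      ring
  have hi : ∀ {g : ℝ → ℝ}, ContinuousOn g (Icc x1 x2) → IntervalIntegrable g volume x1 x2 :=
    fun hg => intervalIntegrable_of_cont h12 hg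
  have hVc : ContinuousOn (deriv fun x => dif κ u t x + α * eav κ u t x) (Icc x1 x2) :=
    (zd.add (continuousOn_const.mul ed)).congr hVx
  have e1 : (∫ x in x1..x2, psi l p x * (sgn (dif κ u t x) * avg κ α (fun s => c s x) t))
        + (∫ x in x1..x2, soft (dif κ u t x))
      = (∫ x in x1..x2, psi l p x * (sgn (dif κ u t x) * avg κ α (fun s => c s x) t))
        + (∫ x in x1..x2, soft (dif κ u t x))
        + ((∫ x in x1..x2, psi l p x * sgn (dif κ u t x) *
            (dif κ (src h f c) t x + α * eav κ (src h f c) t x))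
          - ∫ x in x1..x2, (q x * (psi l p x * sgn (dif κ u t x) *
            (dif κ u t x + α * eav κ u t x))
            + p x * deriv (fun x => dif κ u t x + α * eav κ u t x) x *
              ((l - x) / p x * sgn (dif κ u t x)
                + psi l p x * (tent (dif κ u t x) * deriv (dif κ u t) x))))
        + ∫ x in x1..x2, ((l - x) * (sgn (dif κ u t x) * deriv (dif κ u t) x)
          - soft (dif κ u t x)) := by
    rw [key, ibp]
    ring
  rw [e1, ← intervalIntegral.integral_add (hi (by fun_prop)) (hi (by fun_prop)),
    ← intervalIntegral.integral_sub (hi (by have := sc.mono hsub; fun_prop))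
      (hi (by fun_prop (disch := assumption))),
    ← intervalIntegral.integral_add (hi (by fun_prop))
      (hi (by have := sc.mono hsub; fun_prop (disch := assumption))),
    ← intervalIntegral.integral_add
      (hi (by have := sc.mono hsub; fun_prop (disch := assumption))) (hi (by fun_prop))]
  set A := |avg κ α f t| with hA
  have hA0 : 0 ≤ A := abs_nonneg _
  have pw : ∀ x ∈ Icc x1 x2,
      psi l p x * (sgn (dif κ u t x) * avg κ α (fun s => c s x) t) + soft (dif κ u t x)
        + (psi l p x * sgn (dif κ u t x) *
            (dif κ (src h f c) t x + α * eav κ (src h f c) t x)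
          - (q x * (psi l p x * sgn (dif κ u t x) * (dif κ u t x + α * eav κ u t x))
            + p x * deriv (fun x => dif κ u t x + α * eav κ u t x) x *
              ((l - x) / p x * sgn (dif κ u t x)
                + psi l p x * (tent (dif κ u t x) * deriv (dif κ u t) x))))
        + ((l - x) * (sgn (dif κ u t x) * deriv (dif κ u t) x) - soft (dif κ u t x))
      ≤ (Ψ * N * A + (Q * Ψ * M + l)) + (P * Ψ + l) * deriv (eav κ u t) x ^ 2 := by
    intro x hx
    rw [H.avg_slice ht.1 (hsub hx), hVx x hx]
    have hx' := hsub' hx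
    have s1 := abs_sgn_le_one (dif κ u t x)
    have s2 := sgn_mul_nonneg (dif κ u t x)
    have s3 := H.abs_eav_le hκ ht.1.le x
    have s4 := tent_nonneg (dif κ u t x)
    have s5 := tent_le_one (dif κ u t x)
    have s6 := psi_nonneg H.coef hx'
    have s7 := hΨ x hx'
    have s8 := hP x hx'
    have s9 := hQ x hx'
    have s10 := hN x hx'
    exact test_step_pointwise s1 s2 s3 s4 s5 s6 s7 (H.coef.p0 x) s8 (H.coef.q0 x) s9 s10 hα hα1
      hx'
  have fin := integral_mono_on h12 (hi (by
    have := sc.mono hsub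
    fun_prop (disch := assumption))) (hi (by fun_prop)) pw
  rw [intervalIntegral.integral_add intervalIntegrable_const (hi (by fun_prop)),
    intervalIntegral.integral_const, intervalIntegral.integral_const_mul, smul_eq_mul] at fin
  have : (x2 - x1) * (Ψ * N * A + (Q * Ψ * M + l)) ≤ l * (Ψ * N * A + (Q * Ψ * M + l)) :=
    mul_le_mul_of_nonneg_right (by linarith) (by positivity)
  linarith

lemma continuous_dif (κ : ℝ) (hu : Continuous fun z : ℝ × ℝ => u z.1 z.2) :
    Continuous fun z : ℝ × ℝ => dif κ u z.1 z.2 := by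
  have := continuous_eav κ (V := fun s y => s * u s y) (by fun_prop)
  exact continuous_const.mul ((continuous_fst.mul hu).sub this)

lemma integral_soft_dif_le (H : Cut α T l M p q h f u c) (hκ : 0 < κ)
    {Ψ P Q N F p0 A B ε a b : ℝ}
    (hΨ : ∀ x ∈ Icc 0 l, psi l p x ≤ Ψ) (hP : ∀ x ∈ Icc 0 l, p x ≤ P) (hQ : ∀ x ∈ Icc 0 l, q x ≤ Q)
    (hN : ∀ x ∈ Icc 0 l, |h x| ≤ N) (hF : ∀ t ∈ Icc 0 T, ∀ x ∈ Icc 0 l, |f t * h x| ≤ F)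
    (hp0 : 0 < p0) (hp : ∀ x ∈ Icc 0 l, p0 ≤ p x) (hA : ∫ t in (0:ℝ)..T, |avg κ α f t| ≤ A)
    (hB : ∀ t ∈ Icc 0 T, ∀ x ∈ Icc 0 l, |dif κ u t x| ≤ B)
    (hε : 0 < ε) (hεT : ε ≤ T) (ha : 0 < a) (hab : a ≤ b) (hb : b < l) :
    ∫ t in ε..T, ∫ x in a..b, soft (dif κ u t x)
      ≤ Ψ * N * l * A + (Q * Ψ * M + l) * l * T
        + (P * Ψ + l) * ((M * F * T + 4 * M ^ 2 * kint α T) * l / p0)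
        + Ψ * ((3 + 4 * M) * kint α T + B * kint α ε) * l := by
  have hdc := continuous_dif κ H.hu
  obtain ⟨x1, x2, hx1, hx1a, hbx2, hx2, hsm⟩ := exists_small (T := T) (y := dif κ u) hdc
    (fun t => by simp [dif, tdiff, cv, H.left]) (fun t => by simp [dif, tdiff, cv, H.right])
    one_pos ha hb
  have h12 : x1 ≤ x2 := hx1a.trans (hab.trans hbx2)
  have hsub : Icc x1 x2 ⊆ Ioo 0 l := fun x hx => ⟨hx1.trans_le hx.1, hx.2.trans_lt hx2⟩
  have hts : Icc ε T ⊆ Ioc 0 T := fun t ht => ⟨hε.trans_le ht.1, ht.2⟩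
  have hR : Icc ε T ×ˢ Icc x1 x2 ⊆ Ioc 0 T ×ˢ Ioo 0 l := prod_mono hts hsub
  have hT := H.hT.le
  have hl := H.hl.le
  have hM := H.M_nonneg
  have hψc := continuous_psi H.coef l
  have hβ := continuous_sgn
  have hj := continuous_soft
  have m0 : (0:ℝ) ∈ Icc 0 l := ⟨le_rfl, hl⟩
  have hΨ0 : 0 ≤ Ψ := (psi_nonneg H.coef m0).trans (hΨ 0 m0)
  have hP0 : 0 ≤ P := (H.coef.p0 0).le.trans (hP 0 m0)
  have hQ0 : 0 ≤ Q := (H.coef.q0 0).trans (hQ 0 m0)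
  have hN0 : 0 ≤ N := (abs_nonneg _).trans (hN 0 m0)
  have hB0 : 0 ≤ B := (abs_nonneg _).trans (hB 0 ⟨le_rfl, hT⟩ 0 m0)
  have hk1 := kint_nonneg H.h1 hT
  have hk2 := kint_nonneg H.h1 hε.le
  have kf : KC (avg κ α f) := (KC.of_cont H.hf).avg
  have ac : ContinuousOn (fun z : ℝ × ℝ => avg κ α (fun s => c s z.2) z.1) (Icc ε T ×ˢ Icc x1 x2) :=
    ((continuousOn_dif hT H.prim_c).add (continuousOn_const.mul
      (H.prim_c.continuousOn_eav hT))).mono hR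
  have hW : ContinuousOn (fun z : ℝ × ℝ => (fun t x => psi l p x * (sgn (dif κ u t x) *
      avg κ α (fun s => c s x) t)) z.1 z.2) (Icc ε T ×ˢ Icc x1 x2) := by fun_prop
  have ed : ContinuousOn (fun z : ℝ × ℝ => (fun t x => deriv (eav κ u t) x ^ 2) z.1 z.2)
      (Icc ε T ×ˢ Icc x1 x2) := ((H.continuousOn_deriv_eav (κ := κ)).mono hR).pow 2
  have hsc : Continuous fun z : ℝ × ℝ => soft (dif κ u z.1 z.2) := by fun_prop
  have fc : ContinuousOn (fun t => |avg κ α f t|) (Icc ε T) :=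
    (kf.cont.mono fun t ht => (hts ht).1).abs
  have i1 := intervalIntegrable_of_cont hεT (continuousOn_inner (G := fun t x => psi l p x *
    (sgn (dif κ u t x) * avg κ α (fun s => c s x) t)) h12 hW)
  have i2 : IntervalIntegrable (fun t => ∫ x in x1..x2, soft (dif κ u t x)) volume ε T :=
    (continuous_inner hsc).intervalIntegrable _ _
  have i3 := intervalIntegrable_of_cont hεT fc
  have i4 := intervalIntegrable_of_cont hεT (continuousOn_inner (G := fun t x =>
    deriv (eav κ u t) x ^ 2) h12 ed)
  have main := integral_mono_on hεT (i1.add i2)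
    (((i3.const_mul (Ψ * N * l)).add (intervalIntegrable_const (c := (Q * Ψ * M + l) * l))).add
      (i4.const_mul (P * Ψ + l))) fun t ht =>
    H.test_step hκ.le (hts ht) hx1 h12 hx2 (hsm t (Ioc_subset_Icc_self (hts ht))).1
      (hsm t (Ioc_subset_Icc_self (hts ht))).2 hΨ hP hQ hN
  rw [intervalIntegral.integral_add i1 i2, intervalIntegral.integral_add
    ((i3.const_mul _).add intervalIntegrable_const) (i4.const_mul _),
    intervalIntegral.integral_add (i3.const_mul _) intervalIntegrable_const,
    intervalIntegral.integral_const_mul, intervalIntegral.integral_const_mul (P * Ψ + l),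
    intervalIntegral.integral_const, smul_eq_mul, integral_swap (G := fun t x => psi l p x *
    (sgn (dif κ u t x) * avg κ α (fun s => c s x) t)) hεT h12 hW] at main
  have e1 : ∫ t in ε..T, |avg κ α f t| ≤ A :=
    (integral_mono_interval hε.le hεT le_rfl (ae_of_all _ fun t => abs_nonneg _)
      (kf.intervalIntegrable hT).abs).trans hA
  have e2 : ∫ t in ε..T, ∫ x in x1..x2, deriv (eav κ u t) x ^ 2
      ≤ (M * F * T + 4 * M ^ 2 * kint α T) * l / p0 := by
    rw [le_div_iff₀ hp0, mul_comm]
    exact H.integral_sq_deriv_eav_le hF hp0.le hp hκ.le hε hεT hx1 h12 hx2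
  have e3 : ∫ t in ε..T, ∫ x in a..b, soft (dif κ u t x)
      ≤ ∫ t in ε..T, ∫ x in x1..x2, soft (dif κ u t x) := by
    refine integral_mono_on hεT ((continuous_inner hsc).intervalIntegrable _ _) i2
      fun t _ => integral_mono_interval hx1a hab hbx2
        (ae_of_all _ fun x => soft_nonneg _)
        intervalIntegrable_cont
  have e4 : -(Ψ * ((3 + 4 * M) * kint α T + B * kint α ε)) * (x2 - x1)
      ≤ ∫ x in x1..x2, ∫ t in ε..T, psi l p x *
        (sgn (dif κ u t x) * avg κ α (fun s => c s x) t) := by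
    have hcont := continuousOn_inner (G := fun x t => psi l p x *
      (sgn (dif κ u t x) * avg κ α (fun s => c s x) t)) hεT
      (ContinuousOn.swap_rect (G := fun t x => psi l p x *
      (sgn (dif κ u t x) * avg κ α (fun s => c s x) t)) hW)
    have := integral_le_const h12 hcont.neg
      (C := Ψ * ((3 + 4 * M) * kint α T + B * kint α ε)) fun x hx => ?_
    · simp only [Pi.neg_apply, intervalIntegral.integral_neg] at this
      linarith
    · have hx' := Ioo_subset_Icc_self (hsub hx)
      obtain ⟨τ, hτ, hcut, hz⟩ := H.cut x (hsub hx)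
      have := integral_mul_avg_ge H.h0 H.h1 hκ (H.cont_slice x) (H.kc x (hsub hx))
        (fun t => H.bd t x) hτ hcut hz hβ hj (pri_convex hβ monotone_sgn) (pri_zero _)
        abs_sgn_le_one soft_le_abs abs_sub_three_le_soft soft_nonneg
        (fun t ht => hB t ht x hx') hε hεT
      simp only [Pi.neg_apply]
      rw [intervalIntegral.integral_const_mul, ← mul_neg]
      refine (mul_le_mul_of_nonneg_left (neg_le.1 this) (psi_nonneg H.coef hx')).trans ?_
      exact mul_le_mul_of_nonneg_right (hΨ x hx') (by positivity)
  have e5 : Ψ * ((3 + 4 * M) * kint α T + B * kint α ε) * (x2 - x1)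
      ≤ Ψ * ((3 + 4 * M) * kint α T + B * kint α ε) * l :=
    mul_le_mul_of_nonneg_left (by linarith) (by positivity)
  have e6 : Ψ * N * l * ∫ t in ε..T, |avg κ α f t| ≤ Ψ * N * l * A :=
    mul_le_mul_of_nonneg_left e1 (by positivity)
  have e7 : (T - ε) * ((Q * Ψ * M + l) * l) ≤ T * ((Q * Ψ * M + l) * l) :=
    mul_le_mul_of_nonneg_right (by linarith) (by positivity)
  have e8 := mul_le_mul_of_nonneg_left e2 (show 0 ≤ P * Ψ + l by positivity)
  linarith

/-- The averaged time differences of `t u` are bounded in `L¹`. -/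
lemma exists_soft_bound (H : Cut α T l M p q h f u c) {A : ℝ}
    (hA : ∀ κ > 0, ∫ t in (0:ℝ)..T, |avg κ α f t| ≤ A) :
    ∃ C, ∀ κ > 0, ∀ ε ∈ Ioc 0 T, ∀ a b, 0 < a → a ≤ b → b < l →
      ∫ t in ε..T, ∫ x in a..b, soft (dif κ u t x) ≤ C := by
  have hT := H.hT.le
  have hl := H.hl.le
  obtain ⟨Ψ, hΨ⟩ := isCompact_Icc.exists_bound_of_continuousOn
    (s := Icc 0 l) (continuous_psi H.coef l).continuousOn
  obtain ⟨P, hP⟩ := isCompact_Icc.exists_bound_of_continuousOn (s := Icc 0 l) H.coef.pc.continuousOn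
  obtain ⟨Q, hQ⟩ := isCompact_Icc.exists_bound_of_continuousOn (s := Icc 0 l) H.coef.qc.continuousOn
  obtain ⟨N, hN⟩ := isCompact_Icc.exists_bound_of_continuousOn (s := Icc 0 l) H.hh.continuousOn
  have hfh : Continuous fun z : ℝ × ℝ => f z.1 * h z.2 := by
    have := H.hf
    have := H.hh
    fun_prop
  obtain ⟨F, hF⟩ := (isCompact_Icc.prod isCompact_Icc).exists_bound_of_continuousOn
    (s := Icc 0 T ×ˢ Icc 0 l) hfh.continuousOn
  obtain ⟨y, _, hy⟩ := isCompact_Icc.exists_isMinOn (s := Icc 0 l) ⟨0, le_rfl, hl⟩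
    H.coef.pc.continuousOn
  have hle : ∀ {g : ℝ → ℝ} {K : ℝ}, (∀ x ∈ Icc 0 l, ‖g x‖ ≤ K) → ∀ x ∈ Icc 0 l, g x ≤ K :=
    fun h x hx => (le_abs_self _).trans (h x hx)
  refine ⟨Ψ * N * l * A + (Q * Ψ * M + l) * l * T
        + (P * Ψ + l) * ((M * F * T + 4 * M ^ 2 * kint α T) * l / p y)
        + Ψ * ((3 + 4 * M) * kint α T) * l, fun κ hκ ε hε a b ha hab hb => ?_⟩
  have hdc := continuous_dif κ H.hu
  have hj := continuous_soft
  obtain ⟨B, hB⟩ := (isCompact_Icc.prod isCompact_Icc).exists_bound_of_continuousOn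
    (s := Icc 0 T ×ˢ Icc 0 l) hdc.continuousOn
  have key := fun δ (hδ : δ ∈ Ioc 0 ε) => H.integral_soft_dif_le hκ (hle hΨ) (hle hP) (hle hQ)
    hN (fun t ht x hx => hF (t, x) ⟨ht, hx⟩) (H.coef.p0 y) (fun x hx => hy hx) (hA κ hκ)
    (fun t ht x hx => hB (t, x) ⟨ht, hx⟩) hδ.1 (hδ.2.trans hε.2) ha hab hb
  have hsc : Continuous fun z : ℝ × ℝ => soft (dif κ u z.1 z.2) := by fun_prop
  have hlim : Tendsto (fun δ => Ψ * N * l * A + (Q * Ψ * M + l) * l * T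
        + (P * Ψ + l) * ((M * F * T + 4 * M ^ 2 * kint α T) * l / p y)
        + Ψ * ((3 + 4 * M) * kint α T + B * kint α δ) * l) (𝓝[>] 0)
      (𝓝 (Ψ * N * l * A + (Q * Ψ * M + l) * l * T
        + (P * Ψ + l) * ((M * F * T + 4 * M ^ 2 * kint α T) * l / p y)
        + Ψ * ((3 + 4 * M) * kint α T + B * 0) * l)) :=
    ((((tendsto_kint H.h1).const_mul B).const_add _).const_mul Ψ |>.mul_const l).const_add _
  rw [mul_zero, add_zero] at hlim
  refine ge_of_tendsto hlim ?_
  filter_upwards [Ioc_mem_nhdsGT hε.1] with δ hδ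
  refine le_trans ?_ (key δ hδ)
  exact integral_mono_interval hδ.2 hε.2 le_rfl (ae_of_all _ fun t =>
    intervalIntegral.integral_nonneg hab fun x _ => soft_nonneg _)
    ((continuous_inner hsc).intervalIntegrable _ _)

end Cut

lemma LI.expo_sub {κ t : ℝ} {g : ℝ → ℝ} (hg : LI g) (ht : 0 ≤ t) :
    κ * ((∫ s in (0:ℝ)..t, g s) - InvSource.cv (expo κ) (fun r => ∫ s in (0:ℝ)..r, g s) t)
      = InvSource.cv (expo κ) g t := by
  have hE : BC (expo κ) := (continuous_expo κ).continuousOn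
  have he : BC fun s => exp (-κ * s) := Continuous.continuousOn (by fun_prop)
  have e1 : (fun r => ∫ s in (0:ℝ)..r, g s) = InvSource.cv g fun _ => 1 := by
    funext r
    rw [cv_one_right]
  have e2 : InvSource.cv (fun _ => 1) (expo κ) = fun s => 1 - exp (-κ * s) := by
    funext r
    rw [cv_one_left, integral_expo]
  rw [e1, cv_comm (expo κ), hg.assoc kc_one.li hE ht, e2,
    cv_sub_right (hg.cvI (bc_const 1) ht) (hg.cvI he ht), cv_one_right, sub_sub_cancel,
    ← cv_smul_right, cv_comm]
  rfl

lemma LI.id_mul {g : ℝ → ℝ} (hg : LI g) : LI fun t => t * g t := fun T => by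
  rcases le_or_gt T 0 with h | h
  · simp [Ioc_eq_empty (not_lt.2 h)]
  · exact (intervalIntegrable_iff_integrableOn_Ioc_of_le h.le).1
      ((hg.intervalIntegrable h.le).continuousOn_mul continuousOn_id)

lemma bc_prim {f0 : ℝ} {fp : ℝ → ℝ} (hf : LI fp) : BC (prim f0 fp) :=
  continuousOn_const.add hf.bc_integral

lemma mul_prim_eq {f0 t : ℝ} {fp : ℝ → ℝ} (hf : LI fp) (ht : 0 ≤ t) :
    t * prim f0 fp t = ∫ s in (0:ℝ)..t, (prim f0 fp s + s * fp s) := by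
  have hb : BC fun t => t := continuousOn_id
  rw [intervalIntegral.integral_add ((bc_prim hf).kc.intervalIntegrable ht)
    (hf.id_mul.intervalIntegrable ht), ← cv_one_left fun s => s * fp s,
    cv_id_mul (hf.cvI (bc_const 1) ht).symm (by simpa using (hf.cvI hb ht).symm), cv_one_left]
  have e : cv (fun s => s * 1) fp t = ∫ s in (0:ℝ)..t, ∫ r in (0:ℝ)..s, fp r := by
    have e1 : (fun s : ℝ => s * 1) = cv (fun _ => 1) (fun _ => 1) := by
      funext s; rw [cv_one_one, mul_one]
    rw [e1, cv_comm, ← hf.assoc kc_one.li (bc_const 1) ht, cv_one_right]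
    simp only [cv_one_right]
  have e2 : ∫ s in (0:ℝ)..t, prim f0 fp s = t * f0 + ∫ s in (0:ℝ)..t, ∫ r in (0:ℝ)..s, fp r := by
    simp only [prim]
    rw [intervalIntegral.integral_add (by simp) (hf.bc_integral.kc.intervalIntegrable ht)]
    simp
  rw [e, e2, prim]
  ring

/-- For absolutely continuous data, the averaged differences are bounded in `L¹`. -/
lemma exists_avg_bound {f : ℝ → ℝ} {f0 : ℝ} {fp : ℝ → ℝ} (hf : LI fp)
    (h : ∀ t ≥ 0, f t = prim f0 fp t) (α : ℝ) {T : ℝ} (hT : 0 ≤ T) :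
    ∃ A, ∀ κ > 0, ∫ t in (0:ℝ)..T, |avg κ α f t| ≤ A := by
  set w : ℝ → ℝ := fun s => prim f0 fp s + s * fp s with hw
  have hp := (bc_prim (f0 := f0) hf).kc
  have hwL : LI w := hp.li.add hf.id_mul
  have hv : LI fun s => w s + α * prim f0 fp s := hwL.add (hp.li.smul α)
  refine ⟨∫ t in Ioc 0 T, |w t + α * prim f0 fp t|, fun κ hκ => ?_⟩
  have hE : BC (expo κ) := (continuous_expo κ).continuousOn
  have e : ∀ t ∈ Ioc 0 T, |avg κ α f t| = |cv (expo κ) (fun s => w s + α * prim f0 fp s) t| := by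
    intro t ht
    have h0 := ht.1.le
    have e1 : cv (expo κ) (fun s => s * f s) t
        = cv (expo κ) (fun r => ∫ s in (0:ℝ)..r, w s) t :=
      cv_congr h0 (fun _ _ => rfl) fun s hs => by rw [h s hs.1.le, mul_prim_eq hf hs.1.le]
    have e2 : cv (expo κ) f t = cv (expo κ) (prim f0 fp) t :=
      cv_congr h0 (fun _ _ => rfl) fun s hs => h s hs.1.le
    rw [cv_add_right (hwL.cvI hE h0).symm ((hp.li.smul α).cvI hE h0).symm, cv_smul_right, avg,
      ← hwL.expo_sub h0, ← mul_prim_eq hf h0, h t h0, e1, e2]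
  rw [integral_of_le hT, setIntegral_congr_fun measurableSet_Ioc e]
  refine (young ((kc_expo κ).int T) (hv T)).trans ?_
  have e2 : ∫ t in Ioc 0 T, |expo κ t| = 1 - exp (-κ * T) := by
    rw [← integral_expo, integral_of_le hT]
    exact setIntegral_congr_fun measurableSet_Ioc fun t _ => abs_of_nonneg (expo_nonneg hκ.le t)
  rw [e2]
  refine mul_le_of_le_one_left (integral_nonneg fun _ => abs_nonneg _) ?_
  linarith [exp_pos (-κ * T)]

lemma tendsto_integral_gamma {ψ : ℝ → ℝ} (hψ : Continuous ψ) {t : ℝ} (ht : 0 < t) :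
    Tendsto (fun n : ℕ => ∫ s in (0:ℝ)..t, n * expo n s * (s * ψ s)) atTop (𝓝 (ψ 0)) := by
  obtain ⟨K, hK⟩ := isCompact_Icc.exists_bound_of_continuousOn (s := Icc 0 t) hψ.continuousOn
  have hΓ := Real.GammaIntegral_convergent (show (0:ℝ) < 2 by norm_num)
  have key : Tendsto (fun n : ℕ => ∫ s in Ioi (0:ℝ), (Ioc 0 ((n:ℝ) * t)).indicator
      (fun s => exp (-s) * s ^ ((2:ℝ) - 1) * ψ (s / n)) s) atTop
      (𝓝 (∫ s in Ioi (0:ℝ), exp (-s) * s ^ ((2:ℝ) - 1) * ψ 0)) := by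
    refine tendsto_integral_of_dominated_convergence
      (fun s => exp (-s) * s ^ ((2:ℝ) - 1) * K) (fun n => ?_) (hΓ.mul_const K)
      (fun n => ?_) ?_
    · refine (hΓ.aestronglyMeasurable.mul ?_).indicator measurableSet_Ioc
      exact (Continuous.aestronglyMeasurable (by fun_prop))
    · filter_upwards [ae_restrict_mem measurableSet_Ioi] with s (hs : 0 < s)
      have h0 : 0 ≤ exp (-s) * s ^ ((2:ℝ) - 1) := by positivity
      have hK0 : 0 ≤ K := (norm_nonneg _).trans (hK 0 ⟨le_rfl, ht.le⟩)
      by_cases h : s ∈ Ioc 0 ((n:ℝ) * t)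
      · have hn : (0:ℝ) < n := by
          by_contra hn
          nlinarith [h.1, h.2]
        rw [indicator_of_mem h, norm_mul, Real.norm_of_nonneg h0]
        exact mul_le_mul_of_nonneg_left (hK _ ⟨by positivity, (div_le_iff₀' hn).2 h.2⟩) h0
      · rw [indicator_of_notMem h, norm_zero]
        positivity
    · filter_upwards [ae_restrict_mem measurableSet_Ioi] with s (hs : 0 < s)
      have h1 : Tendsto (fun n : ℕ => exp (-s) * s ^ ((2:ℝ) - 1) * ψ (s / n)) atTop
          (𝓝 (exp (-s) * s ^ ((2:ℝ) - 1) * ψ 0)) :=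
        ((hψ.tendsto 0).comp (tendsto_const_div_atTop_nhds_zero_nat s)).const_mul _
      refine h1.congr' ?_
      have h2 : Tendsto (fun n : ℕ => (n:ℝ) * t) atTop atTop :=
        tendsto_natCast_atTop_atTop.atTop_mul_const ht
      filter_upwards [h2.eventually_ge_atTop s] with n hn
      have hm : s ∈ Ioc 0 ((n:ℝ) * t) := ⟨hs, hn⟩
      rw [indicator_of_mem hm]
  have e : ∫ s in Ioi (0:ℝ), exp (-s) * s ^ ((2:ℝ) - 1) * ψ 0 = ψ 0 := by
    rw [integral_mul_const, ← Real.Gamma_eq_integral (by norm_num), Real.Gamma_two, one_mul]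
  rw [e] at key
  refine key.congr' ?_
  filter_upwards [eventually_gt_atTop 0] with n hn
  have hn' : (0:ℝ) < n := by exact_mod_cast hn
  rw [setIntegral_indicator measurableSet_Ioc, inter_eq_self_of_subset_right
    Ioc_subset_Ioi_self, ← integral_of_le (by positivity)]
  have := intervalIntegral.mul_integral_comp_mul_left (a := 0) (b := t) (c := (n:ℝ))
    (f := fun s => exp (-s) * s ^ ((2:ℝ) - 1) * ψ (s / n))
  rw [mul_zero] at this
  rw [← this, ← intervalIntegral.integral_const_mul]
  congr 1
  funext s
  rw [mul_div_cancel_left₀ s hn'.ne', show (2:ℝ) - 1 = 1 by norm_num, Real.rpow_one, expo, neg_mul]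
  ring

/-- The averaged differences of `t v` converge to its derivative. -/
lemma tendsto_tdiff {v : ℝ → ℝ} (hv : Continuous v) {t : ℝ} (ht : 0 < t)
    (hd : DifferentiableAt ℝ v t) :
    Tendsto (fun n : ℕ => tdiff n v t) atTop (𝓝 (deriv (fun s => s * v s) t)) := by
  set w : ℝ → ℝ := fun s => s * v s with hw
  have hwc : Continuous w := by fun_prop
  have hwd : DifferentiableAt ℝ w t := differentiableAt_fun_id.mul hd
  have hψ : Continuous fun s => dslope w t (t - s) := by
    have : Continuous (dslope w t) := by
      rw [← continuousOn_univ, continuousOn_dslope univ_mem]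
      exact ⟨hwc.continuousOn, hwd⟩
    fun_prop
  have h1 := tendsto_integral_gamma hψ ht
  simp only [sub_zero, dslope_same] at h1
  have h2 : Tendsto (fun n : ℕ => (n:ℝ) * exp (-(n:ℝ) * t) * w t) atTop (𝓝 0) := by
    have := (Real.tendsto_pow_mul_exp_neg_atTop_nhds_zero 1).comp
      (tendsto_natCast_atTop_atTop (R := ℝ).atTop_mul_const ht)
    have := this.mul_const (w t / t)
    rw [zero_mul] at this
    refine this.congr fun n => ?_
    simp only [Function.comp_apply, pow_one, neg_mul]
    field_simp
  have h3 := h1.add h2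
  rw [add_zero] at h3
  refine h3.congr fun n => ?_
  have e : cv (expo n) w t = w t * (1 - exp (-(n:ℝ) * t))
      - ∫ s in (0:ℝ)..t, expo n s * (s * dslope w t (t - s)) := by
    have hE := continuous_expo n
    rw [cv, ← integral_expo, ← intervalIntegral.integral_const_mul,
      ← intervalIntegral.integral_sub intervalIntegrable_cont
      intervalIntegrable_cont]
    congr 1
    funext s
    have := sub_smul_dslope w t (t - s)
    rw [smul_eq_mul] at this
    linear_combination -expo n s * this
  rw [tdiff, e]
  simp only [mul_assoc]
  rw [intervalIntegral.integral_const_mul]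
  ring

/-- A solution of the cut equation whose Caputo derivative is computed from its pointwise
derivative, with absolutely continuous source. -/
structure Reg (α T l M : ℝ) (p q h f : ℝ → ℝ) (u c : ℝ → ℝ → ℝ) : Prop
    extends Cut α T l M p q h f u c where
  dif : ∀ x ∈ Ioo 0 l, ∀ t ∈ Ioo 0 T, DifferentiableAt ℝ (fun s => u s x) t
  cap : ∀ x ∈ Ioo 0 l, ∀ t ∈ Ioc 0 T, c t x = cv (rl (1 - α)) (deriv fun s => u s x) t
  ac : ∃ fp, LI fp ∧ ∀ t ≥ 0, f t = prim (f 0) fp t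

lemma lintegral_lintegral_eq {G : ℝ → ℝ → ℝ} (hG : Continuous fun z : ℝ × ℝ => G z.1 z.2)
    (h0 : ∀ t x, 0 ≤ G t x) {a b T : ℝ} (hab : a ≤ b) (hT : 0 ≤ T) :
    ∫⁻ x in Ioc a b, ∫⁻ t in Ioc 0 T, ENNReal.ofReal (G t x)
      = ENNReal.ofReal (∫ t in (0:ℝ)..T, ∫ x in a..b, G t x) := by
  have e : ∀ x, ∫⁻ t in Ioc 0 T, ENNReal.ofReal (G t x)
      = ENNReal.ofReal (∫ t in (0:ℝ)..T, G t x) := fun x => by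
    rw [integral_of_le hT, ofReal_integral_eq_lintegral_ofReal]
    · exact (Continuous.integrableOn_Ioc (by fun_prop))
    · exact ae_of_all _ fun t => h0 t x
  simp only [e]
  rw [integral_swap hT hab hG.continuousOn, integral_of_le hab,
    ofReal_integral_eq_lintegral_ofReal]
  · have : Continuous fun x => ∫ t in (0:ℝ)..T, G t x :=
      continuous_inner (G := fun x t => G t x) (by fun_prop)
    exact this.integrableOn_Ioc
  · exact ae_of_all _ fun x => intervalIntegral.integral_nonneg hT fun t _ => h0 t x

namespace Reg

variable {α T l M : ℝ} {p q h f : ℝ → ℝ} {u c : ℝ → ℝ → ℝ}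

/-- Nearby any point, the time derivative of `t u` is integrable at some point. -/
lemma exists_integrableOn (H : Reg α T l M p q h f u c) {a b : ℝ} (ha : 0 < a) (hab : a < b)
    (hb : b < l) : ∃ x ∈ Ioo a b, IntegrableOn (deriv fun s => s * u s x) (Ioc 0 T) := by
  have hT := H.hT.le
  obtain ⟨fp, hfp, hf⟩ := H.ac
  obtain ⟨A, hA⟩ := exists_avg_bound hfp hf α hT
  obtain ⟨C, hC⟩ := H.toCut.exists_soft_bound hA
  have hj := continuous_soft
  have hdc := fun κ => Cut.continuous_dif κ H.hu
  have hsc : ∀ κ, Continuous fun z : ℝ × ℝ => soft (Cut.dif κ u z.1 z.2) := fun κ =>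
    hj.comp (hdc κ)
  have hC' : ∀ κ > 0, ∫ t in (0:ℝ)..T, ∫ x in a..b, soft (Cut.dif κ u t x) ≤ C := by
    intro κ hκ
    have hi : Continuous fun t => ∫ x in a..b, soft (Cut.dif κ u t x) := continuous_inner (hsc κ)
    have hc : Continuous fun ε => ∫ t in ε..T, ∫ x in a..b, soft (Cut.dif κ u t x) := by
      simp only [integral_symm T]
      exact (intervalIntegral.continuous_primitive (fun _ _ => hi.intervalIntegrable _ _) T).neg
    refine le_of_tendsto ((hc.tendsto 0).mono_left (nhdsWithin_le_nhds (s := Ioi 0))) ?_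
    filter_upwards [Ioc_mem_nhdsGT H.hT] with ε hε
    exact hC κ hκ ε hε a b ha hab.le hb
  have hmeas : ∀ n : ℕ, Measurable fun z : ℝ × ℝ => ENNReal.ofReal (soft (Cut.dif n u z.2 z.1)) :=
    fun n => ((hsc n).comp continuous_swap).measurable.ennreal_ofReal
  have hF := lintegral_liminf_le (μ := volume.restrict (Ioc a b)) (u := atTop) (f := fun (n : ℕ) x =>
    ∫⁻ t in Ioc 0 T, ENNReal.ofReal (soft (Cut.dif n u t x)))
    fun n => (hmeas n).lintegral_prod_right'
  have hF2 : liminf (fun n : ℕ => ∫⁻ x in Ioc a b, ∫⁻ t in Ioc 0 T,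
      ENNReal.ofReal (soft (Cut.dif n u t x))) atTop ≤ ENNReal.ofReal C := by
    refine liminf_le_of_frequently_le' (Eventually.frequently ?_)
    filter_upwards [eventually_gt_atTop 0] with n hn
    rw [lintegral_lintegral_eq (hsc n) (fun _ _ => soft_nonneg _) hab.le hT]
    exact ENNReal.ofReal_le_ofReal (hC' n (by exact_mod_cast hn))
  have hml : Measurable fun x => liminf (fun n : ℕ => ∫⁻ t in Ioc 0 T,
      ENNReal.ofReal (soft (Cut.dif n u t x))) atTop :=
    .liminf fun n => (hmeas n).lintegral_prod_right'
  have hae := ae_lt_top hml ((hF.trans hF2).trans_lt ENNReal.ofReal_lt_top).ne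
  have hne : (ae (volume.restrict (Ioo a b))).NeBot := by
    rw [ae_neBot, Ne, Measure.restrict_eq_zero, Real.volume_Ioo]
    simpa using hab
  have hae' := ae_restrict_of_ae_restrict_of_subset Ioo_subset_Ioc_self hae
  obtain ⟨x, hx, hxm⟩ := (hae'.and (ae_restrict_mem measurableSet_Ioo)).exists
  refine ⟨x, hxm, ?_⟩
  have hx0 : x ∈ Ioo 0 l := ⟨ha.trans hxm.1, hxm.2.trans hb⟩
  set w : ℝ → ℝ := deriv fun s => s * u s x with hw
  have hwm : Measurable w := measurable_deriv _
  have hlim : ∀ t ∈ Ioo 0 T, liminf (fun n : ℕ => ENNReal.ofReal (soft (Cut.dif n u t x))) atTop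
      = ENNReal.ofReal (soft (w t)) := fun t ht =>
    ((ENNReal.continuous_ofReal.comp hj).tendsto _ |>.comp
      (tendsto_tdiff (H.cont_slice x) ht.1 (H.dif x hx0 t ht))).liminf_eq
  have hmx : ∀ n : ℕ, Measurable fun t => ENNReal.ofReal (soft (Cut.dif n u t x)) := fun n => by
    have : Continuous fun t => soft (Cut.dif n u t x) := (hsc n).comp (Continuous.prodMk_left x)
    exact this.measurable.ennreal_ofReal
  have hfin : ∫⁻ t in Ioo 0 T, ENNReal.ofReal (soft (w t)) < ⊤ := by
    rw [← setLIntegral_congr_fun measurableSet_Ioo hlim]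
    refine (lintegral_mono_set Ioo_subset_Ioc_self).trans_lt ?_
    exact (lintegral_liminf_le (u := atTop) (f := fun (n : ℕ) t => ENNReal.ofReal
      (soft (Cut.dif n u t x))) hmx).trans_lt hx
  have hint : IntegrableOn (fun t => soft (w t)) (Ioo 0 T) :=
    ⟨(hj.measurable.comp hwm).aestronglyMeasurable,
      (hasFiniteIntegral_iff_ofReal (ae_of_all _ fun _ => soft_nonneg _)).2 hfin⟩
  rw [integrableOn_Ioc_iff_integrableOn_Ioo]
  refine Integrable.mono' (hint.add (integrableOn_const (C := (3:ℝ)) measure_Ioo_lt_top.ne))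
    hwm.aestronglyMeasurable (ae_of_all _ fun t => ?_)
  have := abs_sub_three_le_soft (y := w t)
  simp only [Pi.add_apply, norm_eq_abs]
  linarith

/-- The fractional equation holds in integrated form at the point `x`. -/
def Legit (α T : ℝ) (u c : ℝ → ℝ → ℝ) (x : ℝ) : Prop :=
  ∀ t ∈ Icc 0 T, cv (rl (1 - α)) (fun s => u s x - u 0 x) t = ∫ s in (0:ℝ)..t, c s x

lemma legit_of_integrableOn (H : Reg α T l M p q h f u c) {x : ℝ} (hx : x ∈ Ioo 0 l)
    (hi : IntegrableOn (deriv fun s => u s x) (Ioc 0 T)) : Legit α T u c x := fun t ht =>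
  ((caputo_of_integrable H.h1 (H.cont_slice x).continuousOn (H.dif x hx) (H.cap x hx)
    le_rfl hi).2 t ht).2

lemma exists_legit_or (H : Reg α T l M p q h f u c) {a b : ℝ} (ha : 0 < a) (hab : a < b)
    (hb : b < l) : ∃ x ∈ Ioo a b, Legit α T u c x ∨ ∀ t ∈ Ioc 0 T, c t x = 0 := by
  obtain ⟨x, hx, hi⟩ := H.exists_integrableOn ha hab hb
  have hx0 : x ∈ Ioo 0 l := ⟨ha.trans hx.1, hx.2.trans hb⟩
  refine ⟨x, hx, ?_⟩
  by_cases hz : ∀ t ∈ Ioc 0 T, c t x = 0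
  · exact .inr hz
  left
  push Not at hz
  obtain ⟨s, hs, hcs⟩ := hz
  rw [H.cap x hx0 s hs] at hcs
  have h1 := integrableOn_of_cv_ne_zero H.h1 hs.1 hcs H.h0
  refine H.legit_of_integrableOn hx0 ?_
  rw [← Ioc_union_Ioc_eq_Ioc hs.1.le hs.2]
  refine h1.union ?_
  have h2 : IntegrableOn (fun t => t⁻¹ * (deriv (fun s => s * u s x) t - u t x)) (Icc s T) := by
    have hsub : IntegrableOn (fun t => deriv (fun s => s * u s x) t - u t x) (Icc s T) := by
      rw [integrableOn_Icc_iff_integrableOn_Ioc]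
      exact (hi.mono_set (Ioc_subset_Ioc_left hs.1.le)).sub (H.cont_slice x).integrableOn_Ioc
    refine hsub.continuousOn_mul (fun t ht => ?_) isCompact_Icc
    exact (continuousAt_inv₀ (hs.1.trans_le ht.1).ne').continuousWithinAt
  rw [integrableOn_Ioc_iff_integrableOn_Ioo]
  refine (h2.mono_set Ioo_subset_Icc_self).congr_fun (fun t ht => ?_) measurableSet_Ioo
  have ht0 : t ∈ Ioo 0 T := ⟨hs.1.trans ht.1, ht.2⟩
  have hd := ((hasDerivAt_id t).mul (H.dif x hx0 t ht0).hasDerivAt).deriv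
  have : deriv (fun s => s * u s x) t = 1 * u t x + t * deriv (fun s => u s x) t := hd
  have h0 := ht0.1.ne'
  simp only [this]
  field_simp
  ring

end Reg

lemma eq_zero_of_integral_eq_zero {T : ℝ} {W : ℝ → ℝ} (hT : 0 < T) (hW : Continuous W)
    (h : ∀ t ∈ Ioo 0 T, ∫ s in (0:ℝ)..t, W s = 0) : ∀ t ∈ Icc 0 T, W t = 0 := by
  have ho : Ioo 0 T ⊆ {t | W t = 0} := fun t ht => by
    refine ((KC.of_cont hW).hasDerivAt_integral ht.1).unique
      ((hasDerivAt_const t (0:ℝ)).congr_of_eventuallyEq ?_)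
    filter_upwards [Ioo_mem_nhds ht.1 ht.2] with s hs using h s hs
  have hcl := closure_minimal ho (isClosed_eq hW continuous_const)
  rwa [closure_Ioo hT.ne] at hcl

/-- The fractional integral of order `α` inverts the one of order `1 - α` up to integration. -/
lemma cv_rl_cv_rl_compl {α t : ℝ} (h0 : 0 < α) (h1 : α < 1) {W : ℝ → ℝ} (hW : KC W) (ht : 0 < t) :
    cv (rl α) (cv (rl (1 - α)) W) t = ∫ s in (0:ℝ)..t, W s := by
  rw [← (kc_rl h0).assoc (kc_rl (by linarith)) hW ht, ← cv_one_left]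
  exact cv_congr ht.le (fun s hs => by rw [cv_comm, cv_rl_compl h0 h1 hs.1]) fun _ _ => rfl

/-- A continuous function whose fractional integral vanishes is zero. -/
lemma eq_zero_of_cv_rl_eq_zero {α T : ℝ} (h0 : 0 < α) (h1 : α < 1) {W : ℝ → ℝ} (hW : Continuous W)
    (h : ∀ t ∈ Icc 0 T, cv (rl (1 - α)) W t = 0) : ∀ t ∈ Ioc 0 T, W t = 0 := fun t ht => by
  refine eq_zero_of_integral_eq_zero (ht.1.trans_le ht.2) hW (fun s hs => ?_) t ⟨ht.1.le, ht.2⟩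
  rw [← cv_rl_cv_rl_compl h0 h1 (KC.of_cont hW) hs.1, cv_congr (f' := rl α) (g' := fun _ => 0)
    hs.1.le (fun _ _ => rfl) fun r hr => h r ⟨hr.1.le, hr.2.le.trans hs.2.le⟩]
  simp [cv]

namespace Reg

variable {α T l M : ℝ} {p q h f : ℝ → ℝ} {u c : ℝ → ℝ → ℝ}

lemma continuous_cv_rl (H : Reg α T l M p q h f u c) {t : ℝ} (ht : 0 ≤ t) :
    Continuous fun x => cv (rl (1 - α)) (fun s => u s x - u 0 x) t := by
  have hk := kc_rl (show 0 < 1 - α by linarith [H.h1])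
  have hu := H.hu
  have hki := hk.intervalIntegrable ht
  refine intervalIntegral.continuous_of_dominated_interval
    (bound := fun s => |rl (1 - α) s| * (M + M)) (fun x => ?_) (fun x => ae_of_all _ fun s _ => ?_)
    (hki.abs.mul_const _) (ae_of_all _ fun s _ => by fun_prop)
  · rw [uIoc_of_le ht]
    exact (hk.int t).aestronglyMeasurable.mul (Continuous.aestronglyMeasurable (by fun_prop))
  · rw [norm_mul, norm_eq_abs, norm_eq_abs]
    refine mul_le_mul_of_nonneg_left ?_ (abs_nonneg _)
    exact (abs_sub _ _).trans (add_le_add (H.bd _ _) (H.bd _ _))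

/-- The points where the equation holds in integrated form, boundary included, are closed. -/
lemma isClosed_legit (H : Reg α T l M p q h f u c) :
    IsClosed {x ∈ Icc 0 l | x ∈ Ioo 0 l → Legit α T u c x} := by
  refine isClosed_of_closure_subset fun x hx => ?_
  have hxl : x ∈ Icc 0 l := closure_minimal (fun _ h => h.1) isClosed_Icc hx
  refine ⟨hxl, fun hx0 t ht => ?_⟩
  have hcont : ContinuousAt (fun y => cv (rl (1 - α)) (fun s => u s y - u 0 y) t
      - ∫ s in (0:ℝ)..t, c s y) x := by
    refine (H.continuous_cv_rl ht.1).continuousAt.sub ?_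
    refine ContinuousOn.continuousAt ?_ (Ioo_mem_nhds hx0.1 hx0.2)
    exact H.prim_c.prim.comp (f := fun y => (t, y)) (by fun_prop) fun y hy => ⟨ht, hy⟩
  by_contra hne
  have hev := (hcont.eventually_ne (sub_ne_zero.2 hne)).and (Ioo_mem_nhds hx0.1 hx0.2)
  obtain ⟨y, ⟨hy1, hy2⟩, hy3⟩ := mem_closure_iff_nhds.1 hx _ hev
  exact hy1 (sub_eq_zero.2 (hy3.2 hy2 t ht))

lemma continuousAt_c (H : Reg α T l M p q h f u c) {t x : ℝ} (ht : 0 < t) (hx : x ∈ Ioo 0 l) :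
    ContinuousAt (fun y => c t y) x := by
  refine ContinuousOn.continuousAt ?_ (Ioo_mem_nhds hx.1 hx.2)
  exact H.hc.comp (f := fun y => (t, y)) (by fun_prop) fun y hy => ⟨ht, hy⟩

lemma legit_or (H : Reg α T l M p q h f u c) {x : ℝ} (hx : x ∈ Ioo 0 l) :
    Legit α T u c x ∨ ∀ t ∈ Ioc 0 T, c t x = 0 := by
  by_contra! hcon
  obtain ⟨hL, t, ht, hc⟩ := hcon
  have h1 := (H.continuousAt_c ht.1 hx).eventually_ne hc
  have h2 := H.isClosed_legit.isOpen_compl.mem_nhds fun hm => hL (hm.2 hx)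
  obtain ⟨a, b, hab, hsub⟩ := mem_nhds_iff_exists_Ioo_subset.1
    (inter_mem (inter_mem h1 h2) (Ioo_mem_nhds hx.1 hx.2))
  obtain ⟨a', ha'⟩ := exists_between hab.1
  obtain ⟨b', hb'⟩ := exists_between hab.2
  have ha0 := (hsub ⟨ha'.1, ha'.2.trans hab.2⟩).2.1
  have hbl := (hsub ⟨hab.1.trans hb'.1, hb'.2⟩).2.2
  obtain ⟨y, hy, hor⟩ := H.exists_legit_or ha0 (ha'.2.trans hb'.1) hbl
  obtain ⟨⟨m1, m2⟩, m3⟩ := hsub ⟨ha'.1.trans hy.1, hy.2.trans hb'.2⟩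
  rcases hor with hy' | hy'
  · exact m2 ⟨Ioo_subset_Icc_self m3, fun _ => hy'⟩
  · exact m1 (hy' t ht)

/-- At a boundary point of a component of the degenerate set, the solution is constant in time. -/
lemma const_of_boundary (H : Reg α T l M p q h f u c) {y : ℝ} (hy : y ∈ Icc 0 l)
    (hL : y ∈ Ioo 0 l → Legit α T u c y) {S : Set ℝ} (hyS : y ∈ closure S)
    (hN : ∀ x ∈ S, ∀ t ∈ Ioc 0 T, c t x = 0) : ∀ t ∈ Ioc 0 T, u t y = u 0 y := by
  by_cases hy0 : y ∈ Ioo 0 l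
  · have hc : ∀ t ∈ Ioc 0 T, c t y = 0 := fun t ht => by
      by_contra hne
      obtain ⟨x, hx1, hx2⟩ := mem_closure_iff_nhds.1 hyS _
        ((H.continuousAt_c ht.1 hy0).eventually_ne hne)
      exact hx1 (hN x hx2 t ht)
    have hu := H.cont_slice y
    have := eq_zero_of_cv_rl_eq_zero H.h0 H.h1 (W := fun s => u s y - u 0 y) (T := T)
      (by fun_prop) fun t ht => by
        rw [hL hy0 t ht, intervalIntegral.integral_congr_ae (g := fun _ => 0) (ae_of_all _ ?_)]
        · simp
        · intro s hs
          rw [uIoc_of_le ht.1] at hs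
          exact hc s ⟨hs.1, hs.2.trans ht.2⟩
    exact fun t ht => sub_eq_zero.1 (this t ht)
  · intro t _
    rcases hy.1.eq_or_lt with h | h
    · rw [← h, H.left, H.left]
    · have : y = l := by
        by_contra hne
        exact hy0 ⟨h, lt_of_le_of_ne hy.2 hne⟩
      rw [this, H.right, H.right]

/-- Between two points where it is constant in time, a solution of the equation without
fractional derivative depends affinely on the source. -/
lemma exists_affine (H : Reg α T l M p q h f u c) {a b : ℝ} (hab : Ioo a b ⊆ Ioo 0 l)
    (hN : ∀ x ∈ Ioo a b, ∀ t ∈ Ioc 0 T, c t x = 0) (ha : ∀ t ∈ Ioc 0 T, u t a = u 0 a)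
    (hb : ∀ t ∈ Ioc 0 T, u t b = u 0 b) {x : ℝ} (hx : x ∈ Ioo a b) :
    ∃ m, ∀ t ∈ Ioc 0 T, u t x = u T x + (f t - f T) * m := by
  have hT : T ∈ Ioc 0 T := ⟨H.hT, le_rfl⟩
  have hu := H.hu
  have key : ∀ t ∈ Ioc 0 T, ∀ s ∈ Ioc 0 T, ∀ r, f t - f T = r * (f s - f T) →
      u t x - u T x - r * (u s x - u T x) = 0 := by
    intro t ht s hs r hr
    obtain ⟨D, hD⟩ := ((H.ell t ht).sub (H.ell T hT)).sub (((H.ell s hs).sub (H.ell T hT)).smul r)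
    refine eq_zero_of_ell H.coef (w := fun x => u t x - u T x - r * (u s x - u T x)) (a := a)
      (b := b) (D := D) (Continuous.continuousOn (by fun_prop)) ?_ ?_ (fun y hy => ?_) x
      (Ioo_subset_Icc_self hx)
    · simp only [ha t ht, ha T hT, ha s hs]; ring
    · simp only [hb t ht, hb T hT, hb s hs]; ring
    · refine ⟨(hD y (hab hy)).1, (hD y (hab hy)).2.congr_deriv ?_⟩
      simp only [hN y hy t ht, hN y hy s hs, hN y hy T hT]
      linear_combination -h y * hr
  by_cases hcon : ∃ s ∈ Ioc 0 T, f s ≠ f T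
  · obtain ⟨s, hs, hne⟩ := hcon
    have hne' := sub_ne_zero.2 hne
    refine ⟨(u s x - u T x) / (f s - f T), fun t ht => ?_⟩
    have := key t ht s hs ((f t - f T) / (f s - f T)) (by field_simp)
    field_simp at this ⊢
    linear_combination this
  · push Not at hcon
    refine ⟨0, fun t ht => ?_⟩
    have := key t ht T hT 0 (by rw [hcon t ht]; ring)
    linear_combination this

lemma integrableOn_of_affine (H : Reg α T l M p q h f u c) {x m : ℝ}
    (h : ∀ t ∈ Ioc 0 T, u t x = u T x + (f t - f T) * m) :
    IntegrableOn (deriv fun s => u s x) (Ioc 0 T) := by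
  obtain ⟨fp, hfp, hf⟩ := H.ac
  rw [integrableOn_Ioc_iff_integrableOn_Ioo]
  refine (((hfp T).mono_set Ioo_subset_Ioc_self).mul_const m).congr ?_
  have hae := (hfp.intervalIntegrable H.hT.le).ae_hasDerivAt_integral
  filter_upwards [ae_restrict_of_ae hae, ae_restrict_mem measurableSet_Ioo] with t h1 h2
  have h3 := h1 (by rw [uIcc_of_le H.hT.le]; exact Ioo_subset_Icc_self h2) 0 (by simp [H.hT.le])
  refine (HasDerivAt.deriv ?_).symm
  refine (((((h3.const_add (f 0)).sub_const (f T)).mul_const m).const_add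
    (u T x))).congr_of_eventuallyEq ?_
  filter_upwards [Ioo_mem_nhds h2.1 h2.2] with s hs
  rw [h s ⟨hs.1, hs.2.le⟩]
  congr 3
  exact hf s hs.1.le

/-- The equation holds in integrated form at every point. -/
theorem legit (H : Reg α T l M p q h f u c) {x : ℝ} (hx : x ∈ Ioo 0 l) : Legit α T u c x := by
  by_contra hL
  set A := {x ∈ Icc 0 l | x ∈ Ioo 0 l → Legit α T u c x} with hA
  have hcl := H.isClosed_legit
  have h0A : (0:ℝ) ∈ A := ⟨⟨le_rfl, H.hl.le⟩, fun h => absurd h.1 (lt_irrefl _)⟩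
  have hlA : l ∈ A := ⟨⟨H.hl.le, le_rfl⟩, fun h => absurd h.2 (lt_irrefl _)⟩
  have hxA : x ∉ A := fun h => hL (h.2 hx)
  have ha := (isCompact_Icc (a := 0) (b := x)).inter_right hcl |>.sSup_mem
    ⟨0, ⟨le_rfl, hx.1.le⟩, h0A⟩
  have hb := (isCompact_Icc (a := x) (b := l)).inter_right hcl |>.sInf_mem
    ⟨l, ⟨hx.2.le, le_rfl⟩, hlA⟩
  set a := sSup (Icc 0 x ∩ A)
  set b := sInf (Icc x l ∩ A)
  have hax : a < x := lt_of_le_of_ne ha.1.2 fun h => hxA (h ▸ ha.2)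
  have hxb : x < b := lt_of_le_of_ne hb.1.1 fun h => hxA (h ▸ hb.2)
  have hsub : Ioo a b ⊆ Ioo 0 l := Ioo_subset_Ioo ha.1.1 hb.1.2
  have hno : ∀ y ∈ Ioo a b, y ∉ A := by
    intro y hy hyA
    rcases le_total y x with h | h
    · exact hy.1.not_ge (le_csSup (bddAbove_Icc.mono inter_subset_left) ⟨⟨hyA.1.1, h⟩, hyA⟩)
    · exact hy.2.not_ge (csInf_le (bddBelow_Icc.mono inter_subset_left) ⟨⟨h, hyA.1.2⟩, hyA⟩)
  have hN : ∀ y ∈ Ioo a b, ∀ t ∈ Ioc 0 T, c t y = 0 := fun y hy =>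
    (H.legit_or (hsub hy)).resolve_left fun h => hno y hy ⟨Ioo_subset_Icc_self (hsub hy), fun _ => h⟩
  have hclo : closure (Ioo a b) = Icc a b := closure_Ioo (hax.trans hxb).ne
  have hab := (hax.trans hxb).le
  obtain ⟨m, hm⟩ := H.exists_affine hsub hN
    (H.const_of_boundary ha.2.1 ha.2.2 (hclo ▸ left_mem_Icc.2 hab) hN)
    (H.const_of_boundary hb.2.1 hb.2.2 (hclo ▸ right_mem_Icc.2 hab) hN) ⟨hax, hxb⟩
  exact hL (H.legit_of_integrableOn hx (H.integrableOn_of_affine hm))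

end Reg

/-- Symmetry of the elliptic operator with Dirichlet conditions. -/
lemma Ell.green {p q U V ζ ξ : ℝ → ℝ} {l : ℝ} (hc : Coef p q) (hl : 0 < l) (hU : Ell p q l U ζ)
    (hV : Ell p q l V ξ) (cU : Continuous U) (cV : Continuous V) (cζ : Continuous ζ)
    (cξ : Continuous ξ) (hU0 : U 0 = 0) (hUl : U l = 0) (hV0 : V 0 = 0) (hVl : V l = 0) :
    ∫ x in (0:ℝ)..l, U x * ξ x = ∫ x in (0:ℝ)..l, V x * ζ x := by
  obtain ⟨D, hD⟩ := hU
  obtain ⟨E, hE⟩ := hV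
  have hqc := hc.qc
  have hbd : ∀ {D W ζ : ℝ → ℝ}, Continuous W → Continuous ζ →
      (∀ x ∈ Ioo 0 l, HasDerivAt D (q x * W x - ζ x) x) → ∃ C, ∀ x ∈ Ioo 0 l, |D x| ≤ C := by
    intro D W ζ cW cζ h
    obtain ⟨K, hK⟩ := (isCompact_Icc (a := 0) (b := l)).exists_bound_of_continuousOn
      (f := fun x => q x * W x - ζ x) (by fun_prop)
    have hm : l / 2 ∈ Ioo 0 l := ⟨half_pos hl, half_lt_self hl⟩
    refine ⟨|D (l / 2)| + K * l, fun x hx => ?_⟩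
    have h1 := (convex_Ioo 0 l).norm_image_sub_le_of_norm_hasDerivWithin_le
      (fun y hy => (h y hy).hasDerivWithinAt) (fun y hy => hK y (Ioo_subset_Icc_self hy)) hm hx
    have h2 : ‖x - l / 2‖ ≤ l := by
      rw [norm_eq_abs, abs_le]; constructor <;> linarith [hx.1, hx.2]
    have h3 := mul_le_mul_of_nonneg_left h2 ((norm_nonneg _).trans (hK 0 ⟨le_rfl, hl.le⟩))
    have h4 := abs_add_le (D x - D (l / 2)) (D (l / 2))
    rw [sub_add_cancel] at h4
    rw [norm_eq_abs] at h1
    linarith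
  obtain ⟨C, hC⟩ := hbd cU cζ fun x hx => (hD x hx).2
  obtain ⟨K, hK⟩ := hbd cV cξ fun x hx => (hE x hx).2
  have hlim : ∀ {W D : ℝ → ℝ} {C : ℝ} {a : ℝ} {F : Filter ℝ}, Continuous W → W a = 0 → F ≤ 𝓝 a →
      Ioo 0 l ∈ F → (∀ x ∈ Ioo 0 l, |D x| ≤ C) → Tendsto (fun x => W x * D x) F (𝓝 0) := by
    intro W D C a F cW h0 hF hm hb
    have h1 := (cW.tendsto a).mono_left hF
    rw [h0] at h1
    exact h1.zero_mul_isBoundedUnder_le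
      ⟨C, eventually_map.2 (by filter_upwards [hm] with x hx using hb x hx)⟩
  have h0 := Ioo_mem_nhdsGT hl
  have h1 := Ioo_mem_nhdsLT hl
  have key := intervalIntegral.integral_eq_sub_of_hasDerivAt_of_tendsto hl
    (f := fun x => V x * D x - U x * E x) (f' := fun x => U x * ξ x - V x * ζ x) (fa := 0 - 0)
    (fb := 0 - 0) (fun x hx => by
      refine (((hE x hx).1.mul (hD x hx).2).sub ((hD x hx).1.mul (hE x hx).2)).congr_deriv ?_
      ring) intervalIntegrable_cont
    ((hlim cV hV0 nhdsWithin_le_nhds h0 hC).sub (hlim cU hU0 nhdsWithin_le_nhds h0 hK))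
    ((hlim cV hVl nhdsWithin_le_nhds h1 hC).sub (hlim cU hUl nhdsWithin_le_nhds h1 hK))
  rw [intervalIntegral.integral_sub intervalIntegrable_cont
    intervalIntegrable_cont, sub_self] at key
  exact sub_eq_zero.1 key

lemma integral_cv_swap {k : ℝ → ℝ} (hk : KC k) {G : ℝ → ℝ → ℝ}
    (hG : Continuous fun z : ℝ × ℝ => G z.1 z.2) {l t : ℝ} (hl : 0 ≤ l) (ht : 0 ≤ t) :
    ∫ x in (0:ℝ)..l, cv k (fun s => G s x) t = cv k (fun s => ∫ x in (0:ℝ)..l, G s x) t := by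
  simp only [cv, integral_of_le hl,
    integral_of_le ht, ← integral_const_mul]
  refine integral_integral_swap ?_
  obtain ⟨C, hC⟩ := (isCompact_Icc.prod isCompact_Icc).exists_bound_of_continuousOn
    (s := Icc 0 t ×ˢ Icc 0 l) hG.continuousOn
  have h1 := ((integrable_const (μ := volume.restrict (Ioc 0 l)) (1:ℝ)).mul_prod (hk.int t))
  refine (h1.bdd_mul (c := C) (f := fun z : ℝ × ℝ => G (t - z.2) z.1)
    (Continuous.aestronglyMeasurable (by fun_prop)) ?_).congr
    (ae_of_all _ fun z => by simp [mul_comm, Function.uncurry])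
  rw [Measure.prod_restrict]
  filter_upwards [ae_restrict_mem (measurableSet_Ioc.prod measurableSet_Ioc)] with z hz
  exact hC (t - z.2, z.1) ⟨⟨by linarith [hz.2.2], by linarith [hz.2.1]⟩, Ioc_subset_Icc_self hz.1⟩

namespace Reg

variable {α T l M : ℝ} {p q h f : ℝ → ℝ} {u c : ℝ → ℝ → ℝ}

/-- The time-integrated equation tested against an eigenfunction. -/
lemma mode (H : Reg α T l M p q h f u c) {X : ℝ → ℝ} {μ : ℝ} (cX : Continuous X)
    (hX : Ell p q l (fun x => μ * X x) X) (hX0 : X 0 = 0) (hXl : X l = 0) {t : ℝ}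
    (ht : t ∈ Icc 0 T) :
    μ * ((∫ s in (0:ℝ)..t, f s) * (∫ x in (0:ℝ)..l, X x * h x)
      - cv (rl (1 - α)) (fun s => (∫ x in (0:ℝ)..l, X x * u s x) - ∫ x in (0:ℝ)..l, X x * u 0 x) t)
      = ∫ s in (0:ℝ)..t, ∫ x in (0:ℝ)..l, X x * u s x := by
  have hu := H.hu
  have hh := H.hh
  have hk := kc_rl (show 0 < 1 - α by linarith [H.h1])
  have cw := H.continuous_cv_rl ht.1
  have hE : Ell p q l (pav u t) fun x => (∫ s in (0:ℝ)..t, f s) * h x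
      - cv (rl (1 - α)) (fun s => u s x - u 0 x) t := by
    refine (H.toCut.ell_pav ht).congr (fun _ _ => rfl) fun x hx => ?_
    rw [H.legit hx t ht, ← intervalIntegral.integral_mul_const]
    exact (intervalIntegral.integral_sub ((H.hf.mul_const _).intervalIntegrable _ _)
      ((H.kc x hx).intervalIntegrable ht.1)).symm
  have cP : Continuous (pav u t) := continuous_inner (G := fun x s => u s x) (by fun_prop)
  have key := hE.green H.coef H.hl hX cP (by fun_prop) (by fun_prop) cX (by simp [pav, H.left])
    (by simp [pav, H.right]) (by simp [hX0]) (by simp [hXl])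
  have e1 : ∫ x in (0:ℝ)..l, pav u t x * X x = ∫ s in (0:ℝ)..t, ∫ x in (0:ℝ)..l, X x * u s x := by
    rw [integral_swap (G := fun s x => X x * u s x) ht.1 H.hl.le (by fun_prop)]
    simp only [intervalIntegral.integral_const_mul, mul_comm (pav u t _)]
    rfl
  have e2 : ∀ s, (∫ x in (0:ℝ)..l, X x * u s x) - (∫ x in (0:ℝ)..l, X x * u 0 x)
      = ∫ x in (0:ℝ)..l, X x * (u s x - u 0 x) := fun s => by
    rw [← intervalIntegral.integral_sub intervalIntegrable_cont
      intervalIntegrable_cont]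
    simp only [mul_sub]
  simp only [e2]
  rw [← e1, key, ← integral_cv_swap (G := fun s x => X x * (u s x - u 0 x)) hk (by fun_prop)
    H.hl.le ht.1]
  simp only [cv_smul_right]
  rw [← intervalIntegral.integral_const_mul,
    ← intervalIntegral.integral_sub intervalIntegrable_cont
      intervalIntegrable_cont, ← intervalIntegral.integral_const_mul]
  congr 1
  funext x
  ring

end Reg

lemma Relax.integral_eq_zero {ι : Type} [Countable ι] {α : ℝ} {lam : ι → ℝ} {P : ι → ℝ → ℝ}
    (hP : Relax α lam P) {a : ι → ℝ} (ha : Summable fun i => |a i|)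
    (hla : Summable fun i => |lam i * a i|) (hN : ∑' i, a i ≠ 0) {Z : ℝ → ℝ} (hZ : Continuous Z)
    {T : ℝ} (hz : ∀ t ∈ Ioc 0 T, ∑' i, a i * cv (P i) Z t = 0) :
    ∀ t ∈ Ioc 0 T, ∫ s in (0:ℝ)..t, Z s = 0 := by
  set N := ∑' i, a i
  set Pd : ℝ → ℝ := fun t => ∑' i, lam i * a i * P i t
  have kZ := KC.of_cont hZ
  have bZ : BC Z := hZ.continuousOn
  have kP := hP.famP.kc_tsum ha
  have kd : KC Pd := hP.famP.kc_tsum hla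
  have hk := kc_rl (show 0 < 1 - α by linarith [hP.h1])
  have key : ∀ t ∈ Ioc 0 T, ∫ s in (0:ℝ)..t, Z s
      = cv (fun s => N⁻¹ * Pd s) (fun s => ∫ r in (0:ℝ)..s, Z r) t := fun t ht => by
    have h0 : cv (rl (1 - α)) (cv (fun s => ∑' i, a i * P i s) Z) t = 0 := by
      rw [cv_congr (f' := rl (1 - α)) (g' := fun _ => 0) ht.1.le (fun _ _ => rfl) fun s hs => ?_]
      · simp [cv]
      · rw [cv_comm, hP.famP.cv_tsum ha kZ hs.1]
        simp only [cv_comm Z]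
        exact hz s ⟨hs.1, hs.2.le.trans ht.2⟩
    rw [← hk.assoc kP kZ ht.1, cv_congr (g' := Z) (f' := fun s => N - ∫ r in (0:ℝ)..s, Pd r)
      ht.1.le (fun s hs => ?_) fun _ _ => rfl, cv_sub_left (kc_one.smul N |>.cvI kZ ht.1 |> fun h => by
        simpa using h) (kd.li.bc_integral.kc.cvI kZ ht.1), cv_comm _ Z, cv_comm _ Z,
      ← kZ.li.integral_cv kd.li ht.1.le] at h0
    · rw [cv_smul_left, ← kd.li.integral_cv kZ.li ht.1.le, eq_inv_mul_iff_mul_eq₀ hN]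
      have e : cv Z (fun _ => N) t = N * ∫ s in (0:ℝ)..t, Z s := by
        simp [cv, mul_comm]
      have e' : ∀ s, cv Pd Z s = cv Z Pd s := fun s => cv_comm _ _ _
      simp only [e']
      linarith
    · rw [hP.cv_k_tsum_P ha hs.1]
      have := hP.integral_tsum_N ha hs.1.le
      simp only [Pd, mul_assoc, mul_left_comm (lam _)]
      linarith
  have h1 := volterra_unique ((kd.smul N⁻¹).int T) (kZ.li.bc_integral.kc.int T) (ae_of_all _ key)
  exact eq_of_ae_of_cont (kZ.li.bc_integral.kc.cont.mono Ioc_subset_Ioi_self) continuousOn_const h1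

namespace Reg

variable {α T l M₁ M₂ : ℝ} {p q h f₁ f₂ : ℝ → ℝ} {u₁ u₂ c₁ c₂ : ℝ → ℝ → ℝ}

lemma mode_sub (H₁ : Reg α T l M₁ p q h f₁ u₁ c₁) (H₂ : Reg α T l M₂ p q h f₂ u₂ c₂)
    (h0 : ∀ x, u₁ 0 x = u₂ 0 x) {X P : ℝ → ℝ} {μ : ℝ} (hμ : 0 < μ) (hP : IsRelax α μ⁻¹ P)
    (cX : Continuous X) (hX : Ell p q l (fun x => μ * X x) X) (hX0 : X 0 = 0) (hXl : X l = 0) :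
    ∀ t ∈ Ioc 0 T, ∫ s in (0:ℝ)..t, ∫ x in (0:ℝ)..l, X x * (u₁ s x - u₂ s x)
      = (∫ x in (0:ℝ)..l, X x * h x) * cv P (fun t => ∫ s in (0:ℝ)..t, (f₁ s - f₂ s)) t := by
  have hu₁ := H₁.hu
  have hu₂ := H₂.hu
  have hk := kc_rl (show 0 < 1 - α by linarith [H₁.h1])
  set ĥ := ∫ x in (0:ℝ)..l, X x * h x
  set Z : ℝ → ℝ := fun t => ∫ s in (0:ℝ)..t, (f₁ s - f₂ s)
  set V : ℝ → ℝ := fun s => ∫ x in (0:ℝ)..l, X x * (u₁ s x - u₂ s x)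
  have cV : Continuous V := continuous_inner (G := fun s x => X x * (u₁ s x - u₂ s x)) (by fun_prop)
  have cZ : Continuous Z := intervalIntegral.continuous_primitive
    (fun _ _ => (H₁.hf.sub H₂.hf).intervalIntegrable _ _) 0
  have cU₁ : Continuous fun s => ∫ x in (0:ℝ)..l, X x * u₁ s x := continuous_inner (by fun_prop)
  have cU₂ : Continuous fun s => ∫ x in (0:ℝ)..l, X x * u₂ s x := continuous_inner (by fun_prop)
  have eV : ∀ s, V s = (∫ x in (0:ℝ)..l, X x * u₁ s x) - ∫ x in (0:ℝ)..l, X x * u₂ s x :=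
    fun s => by
      rw [← intervalIntegral.integral_sub intervalIntegrable_cont
        intervalIntegrable_cont]
      simp only [V, mul_sub]
  have hmode : ∀ t ∈ Ioc 0 T, cv (rl (1 - α)) V t = ĥ * Z t - μ⁻¹ * ∫ s in (0:ℝ)..t, V s := by
    intro t ht
    have e1 := H₁.mode cX hX hX0 hXl (Ioc_subset_Icc_self ht)
    have e2 := H₂.mode cX hX hX0 hXl (Ioc_subset_Icc_self ht)
    have e3 : (∫ s in (0:ℝ)..t, V s) = (∫ s in (0:ℝ)..t, ∫ x in (0:ℝ)..l, X x * u₁ s x)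
        - ∫ s in (0:ℝ)..t, ∫ x in (0:ℝ)..l, X x * u₂ s x := by
      simp only [eV]
      exact intervalIntegral.integral_sub (cU₁.intervalIntegrable _ _) (cU₂.intervalIntegrable _ _)
    have e4 : Z t = (∫ s in (0:ℝ)..t, f₁ s) - ∫ s in (0:ℝ)..t, f₂ s :=
      intervalIntegral.integral_sub (H₁.hf.intervalIntegrable _ _) (H₂.hf.intervalIntegrable _ _)
    have k₁ : KC fun s => (∫ x in (0:ℝ)..l, X x * u₁ s x) - ∫ x in (0:ℝ)..l, X x * u₁ 0 x :=
      KC.of_cont (cU₁.sub continuous_const)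
    have k₂ : KC fun s => (∫ x in (0:ℝ)..l, X x * u₂ s x) - ∫ x in (0:ℝ)..l, X x * u₂ 0 x :=
      KC.of_cont (cU₂.sub continuous_const)
    have e5 := cv_sub_right (hk.cvI k₁ ht.1) (hk.cvI k₂ ht.1)
    have e6 : V = fun s => ((∫ x in (0:ℝ)..l, X x * u₁ s x) - ∫ x in (0:ℝ)..l, X x * u₁ 0 x)
        - ((∫ x in (0:ℝ)..l, X x * u₂ s x) - ∫ x in (0:ℝ)..l, X x * u₂ 0 x) := by
      funext s
      simp only [eV, h0]
      ring
    rw [← e6] at e5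
    rw [e5, e3, e4, ← e1, ← e2]
    field_simp
    ring
  have kY : KC fun t => ∫ s in (0:ℝ)..t, V s := (KC.of_cont cV).li.bc_integral.kc
  have hs := hP.solve H₁.h0 (kY.int T) (((KC.of_cont cZ).smul ĥ).int T) (ae_of_all _ fun t ht => by
    rw [← sub_eq_zero, ← cv_smul_right, add_sub_assoc, ← neg_sub, ← cv_sub_right, ← sub_eq_add_neg,
      sub_eq_zero, ← cv_rl_cv_rl_compl H₁.h0 H₁.h1 (KC.of_cont cV) ht.1]
    · exact cv_congr ht.1.le (fun _ _ => rfl) fun s hs => hmode s ⟨hs.1, hs.2.le.trans ht.2⟩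
    · exact (kc_rl H₁.h0).cvI ((KC.of_cont cZ).smul ĥ) ht.1
    · exact (kc_rl H₁.h0).cvI (kY.smul μ⁻¹) ht.1)
  intro t ht
  rw [← cv_smul_right]
  exact eq_of_ae_of_cont (kY.cont.mono Ioc_subset_Ioi_self)
    ((hP.kc.cv ((KC.of_cont cZ).smul ĥ)).cont.mono Ioc_subset_Ioi_self) hs t ht

variable {E ι : Type} [NormedAddCommGroup E] [InnerProductSpace ℝ E] [CompleteSpace E]
  {e : ℝ → E} {B : E →L[ℝ] E} {w : HilbertBasis ι ℝ E} {mu : ι → ℝ}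

/-- The source factor is determined by the initial value and the overdetermination. -/
lemma source_unique (H₁ : Reg α T l M₁ p q h f₁ u₁ c₁) (H₂ : Reg α T l M₂ p q h f₂ u₂ c₂)
    (S : Spec p q l e B w mu) {m : E} (hm : ∀ x ∈ Icc 0 l, ⟪e x, m⟫ = h x) (hN : ⟪B m, m⟫ ≠ 0)
    (h0 : ∀ x, u₁ 0 x = u₂ 0 x)
    (hover : ∀ t ∈ Icc 0 T, (∫ x in (0:ℝ)..l, h x * u₁ t x) = ∫ x in (0:ℝ)..l, h x * u₂ t x) :
    ∀ t ∈ Icc 0 T, f₁ t = f₂ t := by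
  have := S.countable
  obtain ⟨P, hP⟩ := S.exists_relax H₁.h0 H₁.h1
  have he := S.cont
  have hu₁ := H₁.hu
  have hu₂ := H₂.hu
  have hh := H₁.hh
  have hf := H₁.hf.sub H₂.hf
  have cZ : Continuous fun t => ∫ s in (0:ℝ)..t, (f₁ s - f₂ s) :=
    intervalIntegral.continuous_primitive (fun _ _ => hf.intervalIntegrable _ _) 0
  have hmode := fun i => mode_sub H₁ H₂ h0 (S.mu_pos i) (hP.relax i) (X := fun x => ⟪e x, w i⟫)
    (by fun_prop) (by simpa only [S.B_w, inner_smul_right] using S.ell (w i)) (by simp [S.left])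
    (by simp [S.right])
  have hmi : ∀ i, ∫ x in (0:ℝ)..l, ⟪e x, w i⟫ * h x = mu i * ⟪w i, m⟫ := fun i => by
    rw [← S.inner_B_basis, real_inner_comm, S.inner_B]
    refine integral_congr fun x hx => ?_
    rw [uIcc_of_le H₁.hl.le] at hx
    simp only [hm x hx, mul_comm]
  have hz : ∀ t ∈ Ioc 0 T, ∑' i, mu i * ⟪w i, m⟫ * ⟪w i, m⟫
      * cv (P i) (fun t => ∫ s in (0:ℝ)..t, (f₁ s - f₂ s)) t = 0 := fun t ht => by
    set v : ℝ → ℝ → ℝ := fun s x => u₁ s x - u₂ s x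
    set R : E := ∫ x in (0:ℝ)..l, pav v t x • e x
    have cv' : Continuous (pav v t) := continuous_inner (G := fun x s => v s x) (by fun_prop)
    have hR : ∀ n, ⟪R, n⟫ = ∫ s in (0:ℝ)..t, ∫ x in (0:ℝ)..l, ⟪e x, n⟫ * v s x := fun n => by
      rw [integral_swap (G := fun s x => ⟪e x, n⟫ * v s x) ht.1.le H₁.hl.le
        (Continuous.continuousOn (by fun_prop)), real_inner_comm]
      simp only [R, integral_of_le H₁.hl.le]
      rw [← integral_inner (Continuous.integrableOn_Ioc (by fun_prop))]
      congr 1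
      funext x
      rw [inner_smul_right, real_inner_comm, intervalIntegral.integral_const_mul]
      exact mul_comm _ _
    have hR0 : ⟪R, m⟫ = 0 := by
      rw [hR]
      refine (integral_congr (g := fun _ => 0) fun s hs => ?_).trans
        intervalIntegral.integral_zero
      rw [uIcc_of_le ht.1.le] at hs
      have h1 := hover s ⟨hs.1, hs.2.trans ht.2⟩
      rw [← sub_eq_zero, ← intervalIntegral.integral_sub
        intervalIntegrable_cont
        intervalIntegrable_cont] at h1
      refine (integral_congr fun x hx => ?_).trans h1
      rw [uIcc_of_le H₁.hl.le] at hx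
      simp only [hm x hx, v, mul_sub]
    refine (tsum_congr fun i => ?_).trans ((tsum_inner w R m).trans hR0)
    rw [real_inner_comm R (w i), hR, hmode i t ht, hmi]
    ring
  have hZ := hP.integral_eq_zero (a := fun i => mu i * ⟪w i, m⟫ * ⟪w i, m⟫)
    ((summable_abs_inner w (B m) m).congr fun i => by rw [S.inner_B_basis])
    ((summable_abs_inner w m m).congr fun i => by
      rw [← mul_assoc, ← mul_assoc, inv_mul_cancel₀ (S.mu_pos i).ne', one_mul])
    (by
      rw [← tsum_inner w] at hN
      simpa only [S.inner_B_basis] using hN) cZ hz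
  have hZ0 := eq_zero_of_integral_eq_zero H₁.hT cZ fun t ht => hZ t (Ioo_subset_Ioc_self ht)
  exact fun t ht => sub_eq_zero.1
    (eq_zero_of_integral_eq_zero H₁.hT hf (fun s hs => hZ0 s (Ioo_subset_Icc_self hs)) t ht)

end Reg

lemma clamp_mem_Ioc {T t : ℝ} (hT : 0 < T) (ht : 0 < t) : clamp T t ∈ Ioc 0 T :=
  ⟨lt_max_of_lt_right (lt_min ht hT), (clamp_mem hT.le t).2⟩

lemma exists_prim_clamp {f : ℝ → ℝ} {T : ℝ} (hT : 0 < T) (hf : AbsContOn f 0 T) :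
    Continuous (fun t => f (clamp T t)) ∧
      ∃ fp, LI fp ∧ ∀ t ≥ 0, f (clamp T t) = prim (f (clamp T 0)) fp t := by
  obtain ⟨f', hf', h⟩ := hf
  have hi : Integrable ((Ioc 0 T).indicator f') :=
    (hf'.mono_set Ioc_subset_Icc_self).integrable_indicator measurableSet_Ioc
  have e0 : clamp T 0 = 0 := clamp_eq ⟨le_rfl, hT.le⟩
  have e : ∀ t ≥ 0, f (clamp T t) = prim (f (clamp T 0)) ((Ioc 0 T).indicator f') t :=
    fun t ht => by
      have h1 := clamp_mem hT.le t
      have h2 : clamp T t = min t T := max_eq_right (le_min ht hT.le)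
      rw [e0, h _ h1, prim, integral_of_le h1.1, integral_of_le ht,
        setIntegral_indicator measurableSet_Ioc, Ioc_inter_Ioc, h2, max_self]
  refine ⟨?_, _, fun _ => hi.integrableOn, e⟩
  have hc : ContinuousOn f (Icc 0 T) := by
    have : ContinuousOn (prim (f 0) ((Ioc 0 T).indicator f')) (Icc 0 T) :=
      (continuous_const.add (intervalIntegral.continuous_primitive
        (fun _ _ => hi.intervalIntegrable) 0)).continuousOn
    refine this.congr fun t ht => ?_
    have := e t ht.1
    rwa [clamp_eq ht, e0] at this
  exact hc.comp_continuous (continuous_clamp T) (clamp_mem hT.le)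

/-- A solution of the direct problem, extended by freezing it outside `[0,T] × [0,l]`. -/
lemma exists_reg {α T l : ℝ} {p q h f φ : ℝ → ℝ} {u : ℝ → ℝ → ℝ} (hα0 : 0 < α) (hα1 : α < 1)
    (hT : 0 < T) (hl : 0 < l) (hp_diff : ∀ x ∈ Icc 0 l, DifferentiableAt ℝ p x)
    (hp_pos : ∀ x ∈ Icc 0 l, 0 < p x) (hq_cont : ContinuousOn q (Icc 0 l))
    (hq_nonneg : ∀ x ∈ Icc 0 l, 0 ≤ q x) (hhc : ContinuousOn h (Icc 0 l))
    (hf : AbsContOn f 0 T) (H : IsDirectSolution α T l p q (fun t x => f t * h x) φ u) :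
    ∃ M c, Reg α T l M (fun x => p (clamp l x)) (fun x => q (clamp l x))
      (fun x => h (clamp l x)) (fun t => f (clamp T t))
      (fun t x => u (clamp T t) (clamp l x)) c := by
  obtain ⟨hu, hdif, hcap, hd, -, heq, -, hbd⟩ := H
  have hpc : ContinuousOn p (Icc 0 l) := fun x hx => (hp_diff x hx).continuousAt.continuousWithinAt
  obtain ⟨M, hM⟩ := (isCompact_Icc.prod isCompact_Icc).exists_bound_of_continuousOn hu
  obtain ⟨hfc, hfp⟩ := exists_prim_clamp hT hf
  set c : ℝ → ℝ → ℝ := fun t x => caputoDeriv α (fun τ => u τ x) (clamp T t)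
  have hc : ContinuousOn (fun z : ℝ × ℝ => c z.1 z.2) (Ioi 0 ×ˢ Ioo 0 l) :=
    hcap.comp (f := fun z : ℝ × ℝ => (clamp T z.1, z.2))
      (((continuous_clamp T).comp continuous_fst).prodMk continuous_snd).continuousOn
      fun z hz => ⟨clamp_mem_Ioc hT hz.1, hz.2⟩
  have cx : ∀ x ∈ Ioo 0 l, ContinuousOn (fun t => c t x) (Ioi 0) := fun x hx =>
    hc.comp (f := fun t : ℝ => (t, x)) (by fun_prop) fun t ht => ⟨ht, hx⟩
  have hev : ∀ x ∈ Ioo 0 l, ∀ t ∈ Ioo 0 T,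
      (fun s => u (clamp T s) (clamp l x)) =ᶠ[𝓝 t] fun s => u s x := fun x hx t ht => by
    rw [clamp_eq (Ioo_subset_Icc_self hx)]
    exact clamp_eventuallyEq (fun s => u s x) ht
  have dif : ∀ x ∈ Ioo 0 l, ∀ t ∈ Ioo 0 T,
      DifferentiableAt ℝ (fun s => u (clamp T s) (clamp l x)) t := fun x hx t ht =>
    (hdif t (Ioo_subset_Ioc_self ht) x hx).congr_of_eventuallyEq (hev x hx t ht)
  have cap : ∀ x ∈ Ioo 0 l, ∀ t ∈ Ioc 0 T,
      c t x = cv (rl (1 - α)) (deriv fun s => u (clamp T s) (clamp l x)) t := fun x hx t ht => by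
    simp only [c, clamp_eq (Ioc_subset_Icc_self ht)]
    exact caputoDeriv_eq_cv ht.1.le fun s hs =>
      ((hev x hx s ⟨hs.1, hs.2.trans_le ht.2⟩).deriv_eq).symm
  have cu : Continuous fun z : ℝ × ℝ => u (clamp T z.1) (clamp l z.2) :=
    hu.comp_continuous (f := fun z : ℝ × ℝ => (clamp T z.1, clamp l z.2))
      (((continuous_clamp T).comp continuous_fst).prodMk ((continuous_clamp l).comp continuous_snd))
      fun z => ⟨clamp_mem hT.le _, clamp_mem hl.le _⟩
  have hcut := fun x hx => exists_cut hα0 hα1 hT (v := fun s => u (clamp T s) (clamp l x))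
    (c := fun t => c t x) (Continuous.continuousOn (cu.comp (by fun_prop : Continuous
      fun s : ℝ => (s, x)))) (dif x hx) ((cx x hx).mono Ioc_subset_Ioi_self) (cap x hx)
  refine ⟨M, c, ⟨hα0, hα1, hT, hl, coef_clamp hl.le hpc hp_pos hq_cont hq_nonneg,
    hhc.comp_continuous (continuous_clamp l) (clamp_mem hl.le), hfc, cu,
    fun t x => hM (clamp T t, clamp l x) ⟨clamp_mem hT.le _, clamp_mem hl.le _⟩,
    fun t => ?_, fun t => ?_, hc, fun x hx => ?_, fun t ht => ?_, fun x hx => (hcut x hx).2⟩,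
    dif, cap, hfp⟩
  · rw [clamp_eq ⟨le_rfl, hl.le⟩]
    exact (hbd _ (clamp_mem hT.le t)).1
  · rw [clamp_eq ⟨hl.le, le_rfl⟩]
    exact (hbd _ (clamp_mem hT.le t)).2
  · exact KC.of_bound (cx x hx) hT (b := fun t => |c t x|) (hcut x hx).1.abs fun _ _ => le_rfl
  · have h1 := ell_clamp_of_deriv (q := q) (U := u t) (ζ := fun x => f t * h x - c t x) hp_pos
      hp_diff (hd t ht) fun x hx => by
        have := heq t ht x hx
        simp only [c, clamp_eq (Ioc_subset_Icc_self ht)]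
        linarith
    refine h1.congr (fun x hx => ?_) fun x hx => ?_ <;>
      simp only [clamp_eq (Ioc_subset_Icc_self ht), clamp_eq (Ioo_subset_Icc_self hx)]

end InvSource

/-- Well-posedness of the inverse problem: under the assumptions of Theorem 1, if
moreover `h ≢ 0`, `g` and `g′` are absolutely continuous on `[0,T]` and the
compatibility condition `∫_0^l φ h = g(0)` holds, then there is a unique absolutely
continuous `f` on `[0,T]` such that the solution `u` of the direct problem with
right-hand side `f(t) h(x)` satisfies the overdetermination condition
`∫_0^l h(x) u(t,x) dx = g(t)` on `[0,T]`. -/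
theorem inverse_problem_wellposed (α T l : ℝ)
    (hα0 : 0 < α) (hα1 : α < 1) (hT : 0 < T) (hl : 0 < l)
    (p q φ h : ℝ → ℝ) (g : ℝ → ℝ)
    (hp_diff : ∀ x ∈ Icc 0 l, DifferentiableAt ℝ p x)
    (hp_cont : ContinuousOn (deriv p) (Icc 0 l))
    (hp_pos : ∀ x ∈ Icc 0 l, 0 < p x)
    (hq_cont : ContinuousOn q (Icc 0 l))
    (hq_nonneg : ∀ x ∈ Icc 0 l, 0 ≤ q x)
    (hφ_diff : ∀ x ∈ Icc 0 l, DifferentiableAt ℝ φ x)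
    (hφ_cont : ContinuousOn (deriv φ) (Icc 0 l))
    (hφ0 : φ 0 = 0) (hφl : φ l = 0)
    (hh_diff : ∀ x ∈ Icc 0 l, DifferentiableAt ℝ h x)
    (hh_cont : ContinuousOn (deriv h) (Icc 0 l))
    (hh0 : h 0 = 0) (hhl : h l = 0)
    (hh_ne : ∃ x ∈ Icc 0 l, h x ≠ 0)
    (hg : ∃ g₁ : ℝ → ℝ, (∀ x ∈ Icc 0 T, g x = g 0 + ∫ t in (0:ℝ)..x, g₁ t) ∧
      AbsContOn g₁ 0 T)
    (hcompat : ∫ x in (0:ℝ)..l, φ x * h x = g 0) :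
    ∃ f : ℝ → ℝ, AbsContOn f 0 T ∧
      (∃ u : ℝ → ℝ → ℝ, IsDirectSolution α T l p q (fun t x => f t * h x) φ u ∧
        ∀ t ∈ Icc 0 T, (∫ x in (0:ℝ)..l, h x * u t x) = g t) ∧
      ∀ f₂ : ℝ → ℝ, AbsContOn f₂ 0 T →
        (∃ u : ℝ → ℝ → ℝ, IsDirectSolution α T l p q (fun t x => f₂ t * h x) φ u ∧
          ∀ t ∈ Icc 0 T, (∫ x in (0:ℝ)..l, h x * u t x) = g t) →
        ∀ t ∈ Icc 0 T, f₂ t = f t := by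
  have hpc : ContinuousOn p (Icc 0 l) := fun x hx => (hp_diff x hx).continuousAt.continuousWithinAt
  have hhc : ContinuousOn h (Icc 0 l) := fun x hx => (hh_diff x hx).continuousAt.continuousWithinAt
  have hC := InvSource.coef_clamp hl.le hpc hp_pos hq_cont hq_nonneg
  obtain ⟨ι, w, mu, S⟩ := InvSource.exists_spec hC hl
  obtain ⟨m, hm⟩ := InvSource.exists_energy_rep hC hl.le hh_diff hh_cont hh0 hhl
  obtain ⟨φ', hφ'⟩ := InvSource.exists_energy_rep hC hl.le hφ_diff hφ_cont hφ0 hφl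
  have hN := S.inner_B_pos hl hhc hh_ne hm
  obtain ⟨f, hf, u, hu, hover⟩ := S.exists_inverse_solution hα0 hα1 hl hC hp_diff hp_cont hp_pos hpc
    hq_cont hhc hφ' hm hN hg hcompat
  refine ⟨f, hf, ⟨u, hu, hover⟩, ?_⟩
  rintro f₂ hf₂ ⟨u₂, hu₂, hover₂⟩
  obtain ⟨M₁, c₁, H₁⟩ := InvSource.exists_reg hα0 hα1 hT hl hp_diff hp_pos hq_cont hq_nonneg hhc hf hu
  obtain ⟨M₂, c₂, H₂⟩ :=
    InvSource.exists_reg hα0 hα1 hT hl hp_diff hp_pos hq_cont hq_nonneg hhc hf₂ hu₂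
  have hclamp : ∀ x ∈ Icc 0 l, InvSource.clamp l x = x := fun x hx => InvSource.clamp_eq hx
  have hint : ∀ v : ℝ → ℝ → ℝ, (∀ t ∈ Icc 0 T, (∫ x in (0:ℝ)..l, h x * v t x) = g t) →
      ∀ t ∈ Icc 0 T, (∫ x in (0:ℝ)..l, h (InvSource.clamp l x) *
        v (InvSource.clamp T t) (InvSource.clamp l x)) = g t := fun v hv t ht => by
    rw [← hv t ht, InvSource.clamp_eq ht]
    refine intervalIntegral.integral_congr fun x hx => ?_
    rw [uIcc_of_le hl.le] at hx
    simp only [hclamp x hx]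
  have key := H₂.source_unique H₁ S (m := m) (fun x hx => by rw [hm x hx, hclamp x hx])
    hN.ne' (fun x => by
      have h0 := InvSource.clamp_mem hl.le x
      rw [InvSource.clamp_eq ⟨le_rfl, hT.le⟩, hu.2.2.2.2.2.2.1 _ h0, hu₂.2.2.2.2.2.2.1 _ h0])
    fun t ht => by rw [hint u hover t ht, hint u₂ hover₂ t ht]
  intro t ht
  simpa only [InvSource.clamp_eq ht] using key t ht
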